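/- For every m, n ≥ 1 there are commuting actions of the locally unital superalgebras U̇(p̃(m)) and U̇(p(n)) on A = S(V_n)^{⊗m}, where U̇(p(n)) acts through the natural p(n)-action; the induced superalgebra homomorphisms ρ̃: U̇(p̃(m)) → End^fin_k(A) and ρ: U̇(p(n)) → End^fin_k(A) have mutually centralizing images: the image of each map equals the centralizer, in the graded sense, of the image of the other inside End^fin_k(A). -/

import Mathlib

/-!
Core: a concrete model of the supersymmetric algebra
`S(U) = S(Y_F ⊗ V_L)` (with `F` purely even "tensor slots" and `V_L = k^{L|L}`)
via its monomial basis.  A basis monomial is a pair `(d, ε)` where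
`d : Fin F × Fin L → ℕ` records the exponents of the even variables
`z_{i,ℓ}` (`ℓ > 0`) and `ε : Fin F × Fin L → Bool` records the occurrences of
the odd variables `z_{i,-ℓ}`, the odd variables being ordered
lexicographically by position `(i, ℓ)`.  The multiplication and derivation
operators `z_{i,±ℓ}` and `∂_{i,±ℓ}` are defined on this basis with the signs
dictated by supercommutativity.  The same space also models
`S(U') = S(W_F ⊗ Y_L)` (with `W_F = k^{F|F}`), via the variables
`z'_{±i,ℓ}`, the odd variable `z'_{-i,ℓ}` occupying the position `(i,ℓ)`.
-/

/-- The index set `I_{L|L}` (`inl` = positive/even, `inr` = negative/odd). -/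
abbrev Ix (L : ℕ) := Fin L ⊕ Fin L

/-- Negation `r ↦ -r` on `I_{L|L}`. -/
def nIx {L : ℕ} : Ix L → Ix L := Sum.elim Sum.inr Sum.inl

/-- `(-1)^{|r|}` for `r ∈ I_{L|L}`. -/
def sgn (k : Type) [Field k] {L : ℕ} : Ix L → k :=
  Sum.elim (fun _ => (1:k)) (fun _ => (-1:k))

/-- Basis monomials: even exponents and odd occurrence flags. -/
abbrev MonB (F L : ℕ) := (Fin F × Fin L → ℕ) × (Fin F × Fin L → Bool)

variable (k : Type) [Field k]

/-- The model of `S(Y_F ⊗ V_L)` (equivalently of `S(W_F ⊗ Y_L)`). -/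
abbrev SM (F L : ℕ) := MonB F L →₀ k

noncomputable def bvec (F L : ℕ) (b : MonB F L) : SM k F L := Finsupp.single b 1

/-- The vacuum monomial `1`. -/
noncomputable def vac (F L : ℕ) : SM k F L := bvec k F L (fun _ => 0, fun _ => false)

/-- Extend a map defined on basis monomials to a linear endomorphism. -/
noncomputable def opOf (F L : ℕ) (f : MonB F L → SM k F L) :
    Module.End k (SM k F L) := Finsupp.linearCombination k f

/-- Position code of `(i,ℓ)` (lexicographic). -/
def posIdx {F L : ℕ} (p : Fin F × Fin L) : ℕ := p.1.val * L + p.2.val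

/-- The number of odd variables occurring strictly before position `p`. -/
noncomputable def oddBefore {F L : ℕ} (ε : Fin F × Fin L → Bool)
    (p : Fin F × Fin L) : ℕ :=
  (Finset.univ.filter fun q : Fin F × Fin L => posIdx q < posIdx p ∧ ε q = true).card

/-- Multiplication by the even variable at position `(i,ℓ)`. -/
noncomputable def zE (F L : ℕ) (i : Fin F) (j : Fin L) : Module.End k (SM k F L) :=
  opOf k F L fun b =>
    bvec k F L (Function.update b.1 (i, j) (b.1 (i, j) + 1), b.2)

/-- Derivation with respect to the even variable at position `(i,ℓ)`. -/
noncomputable def dE (F L : ℕ) (i : Fin F) (j : Fin L) : Module.End k (SM k F L) :=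
  opOf k F L fun b =>
    (b.1 (i, j) : k) • bvec k F L (Function.update b.1 (i, j) (b.1 (i, j) - 1), b.2)

/-- (Left) multiplication by the odd variable at position `(i,ℓ)`. -/
noncomputable def zO (F L : ℕ) (i : Fin F) (j : Fin L) : Module.End k (SM k F L) :=
  opOf k F L fun b =>
    if b.2 (i, j) then 0
    else ((-1:k) ^ oddBefore b.2 (i, j)) •
      bvec k F L (b.1, Function.update b.2 (i, j) true)

/-- (Left) derivation with respect to the odd variable at position `(i,ℓ)`. -/
noncomputable def dO (F L : ℕ) (i : Fin F) (j : Fin L) : Module.End k (SM k F L) :=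
  opOf k F L fun b =>
    if b.2 (i, j) then
      ((-1:k) ^ oddBefore b.2 (i, j)) •
        bvec k F L (b.1, Function.update b.2 (i, j) false)
    else 0

/-- Multiplication by the variable `z_{i,r}`, `r ∈ I_{L|L}`. -/
noncomputable def zop (F L : ℕ) (i : Fin F) (r : Ix L) : Module.End k (SM k F L) :=
  Sum.elim (zE k F L i) (zO k F L i) r

/-- The derivation `∂_{i,r}`, `r ∈ I_{L|L}`. -/
noncomputable def dop (F L : ℕ) (i : Fin F) (r : Ix L) : Module.End k (SM k F L) :=
  Sum.elim (dE k F L i) (dO k F L i) r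

/-- `𝙴_{a,b} = Σ_{p=1}^F z_{p,a} ∂_{p,b}` for `a, b ∈ I_{L|L}`: the operator by
which the matrix unit `E_{a,b} ∈ gl(L|L)` acts naturally on `S(Y_F ⊗ V_L)`. -/
noncomputable def EEop (F L : ℕ) (a b : Ix L) : Module.End k (SM k F L) :=
  ∑ p : Fin F, zop k F L p a * dop k F L p b

/-- `𝙰_{i,j} = 𝙴_{i,j} - 𝙴_{-j,-i}`: the natural action of `a_{i,j} ∈ p(L)`. -/
noncomputable def opA (F L : ℕ) (i j : Fin L) : Module.End k (SM k F L) :=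
  EEop k F L (Sum.inl i) (Sum.inl j) - EEop k F L (Sum.inr j) (Sum.inr i)

/-- `𝙱_{i,j} = 𝙴_{i,-j} + 𝙴_{j,-i}` (`i < j`), `𝙱_{i,i} = 𝙴_{i,-i}`: the
natural action of `b_{i,j} ∈ p(L)`. -/
noncomputable def opB (F L : ℕ) (i j : Fin L) : Module.End k (SM k F L) :=
  if i = j then EEop k F L (Sum.inl i) (Sum.inr i)
  else EEop k F L (Sum.inl i) (Sum.inr j) + EEop k F L (Sum.inl j) (Sum.inr i)

/-- `𝙲_{i,j} = 𝙴_{-i,j} - 𝙴_{-j,i}` (`i < j`): the natural action of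
`c_{i,j} ∈ p(L)`. -/
noncomputable def opC (F L : ℕ) (i j : Fin L) : Module.End k (SM k F L) :=
  EEop k F L (Sum.inr i) (Sum.inl j) - EEop k F L (Sum.inr j) (Sum.inl i)

/-- `Ã_{i,j} = Σ_{r ∈ I_{L|L}} z_{i,r} ∂_{j,r} - L·δ_{i,j}` (`1 ≤ i,j ≤ F`). -/
noncomputable def tA (F L : ℕ) (i j : Fin F) : Module.End k (SM k F L) :=
  (∑ r : Ix L, zop k F L i r * dop k F L j r) - (if i = j then (L : k) • 1 else 0)

/-- `B̃_{i,j} = Σ_{r ∈ I_{L|L}} ∂_{i,r} ∂_{j,-r}` (`i ≠ j`), and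
`B̃_{i,i} = Σ_{r=1}^{L} ∂_{i,r} ∂_{i,-r}`. -/
noncomputable def tB (F L : ℕ) (i j : Fin F) : Module.End k (SM k F L) :=
  if i = j then ∑ q : Fin L, dE k F L i q * dO k F L i q
  else ∑ r : Ix L, dop k F L i r * dop k F L j (nIx r)

/-- `C̃_{i,j} = Σ_{r ∈ I_{L|L}} (-1)^{|r|} z_{i,r} z_{j,-r}` (`i < j`). -/
noncomputable def tC (F L : ℕ) (i j : Fin F) : Module.End k (SM k F L) :=
  ∑ r : Ix L, sgn k r • (zop k F L i r * zop k F L j (nIx r))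

/-- Multiplication by the variable `z'_{a,ℓ}`, `a ∈ I_{F|F}`, of
`S(W_F ⊗ Y_L)` in the same model. -/
noncomputable def zop2 (F L : ℕ) (a : Ix F) (j : Fin L) : Module.End k (SM k F L) :=
  Sum.elim (fun i => zE k F L i j) (fun i => zO k F L i j) a

/-- The derivation `∂'_{a,ℓ}`, `a ∈ I_{F|F}`. -/
noncomputable def dop2 (F L : ℕ) (a : Ix F) (j : Fin L) : Module.End k (SM k F L) :=
  Sum.elim (fun i => dE k F L i j) (fun i => dO k F L i j) a

/-- `𝙴'_{a,b} = Σ_{p=1}^L z'_{a,p} ∂'_{b,p}` for `a, b ∈ I_{F|F}`: the natural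
action of the matrix unit `E_{a,b} ∈ gl(F|F)` on `S(W_F ⊗ Y_L)`. -/
noncomputable def EE2op (F L : ℕ) (a b : Ix F) : Module.End k (SM k F L) :=
  ∑ p : Fin L, zop2 k F L a p * dop2 k F L b p

/-- `Ã'_{i,j} = 𝙴'_{i,j} - 𝙴'_{-j,-i}`: the natural action of
`ã_{i,j} ∈ p̃(F)`. -/
noncomputable def opA2 (F L : ℕ) (i j : Fin F) : Module.End k (SM k F L) :=
  EE2op k F L (Sum.inl i) (Sum.inl j) - EE2op k F L (Sum.inr j) (Sum.inr i)

/-- `B̃'_{i,j} = 𝙴'_{-i,j} + 𝙴'_{-j,i}` (`i < j`), `B̃'_{i,i} = 𝙴'_{-i,i}`: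
the natural action of `b̃_{i,j} ∈ p̃(F)`. -/
noncomputable def opB2 (F L : ℕ) (i j : Fin F) : Module.End k (SM k F L) :=
  if i = j then EE2op k F L (Sum.inr i) (Sum.inl i)
  else EE2op k F L (Sum.inr i) (Sum.inl j) + EE2op k F L (Sum.inr j) (Sum.inl i)

/-- `C̃'_{i,j} = 𝙴'_{i,-j} - 𝙴'_{j,-i}` (`i < j`): the natural action of
`c̃_{i,j} ∈ p̃(F)`. -/
noncomputable def opC2 (F L : ℕ) (i j : Fin F) : Module.End k (SM k F L) :=
  EE2op k F L (Sum.inl i) (Sum.inr j) - EE2op k F L (Sum.inl j) (Sum.inr i)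

/-- `θ'(a_{i,j}) = Σ_{r ∈ I_{F|F}} z'_{r,i} ∂'_{r,j} - F·δ_{i,j}`. -/
noncomputable def pA2 (F L : ℕ) (i j : Fin L) : Module.End k (SM k F L) :=
  (∑ r : Ix F, zop2 k F L r i * dop2 k F L r j) - (if i = j then (F : k) • 1 else 0)

/-- `θ'(b_{i,j}) = Σ_{r ∈ I_{F|F}} z'_{r,i} z'_{-r,j}` (`i ≠ j`), and
`θ'(b_{i,i}) = Σ_{r=1}^{F} z'_{r,i} z'_{-r,i}`. -/
noncomputable def pB2 (F L : ℕ) (i j : Fin L) : Module.End k (SM k F L) :=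
  if i = j then ∑ s : Fin F, zop2 k F L (Sum.inl s) i * zop2 k F L (Sum.inr s) i
  else ∑ r : Ix F, zop2 k F L r i * zop2 k F L (nIx r) j

/-- `θ'(c_{i,j}) = Σ_{r ∈ I_{F|F}} (-1)^{|r|} ∂'_{-r,i} ∂'_{r,j}` (`i < j`). -/
noncomputable def pC2 (F L : ℕ) (i j : Fin L) : Module.End k (SM k F L) :=
  ∑ r : Ix F, sgn k r • (dop2 k F L (nIx r) i * dop2 k F L r j)

/-- A monomial is even if it contains an even number of odd variables. -/
def evenMon {F L : ℕ} (b : MonB F L) : Prop :=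
  (Finset.univ.filter fun p : Fin F × Fin L => b.2 p = true).card % 2 = 0

noncomputable instance {F L : ℕ} (b : MonB F L) : Decidable (evenMon b) := by
  unfold evenMon; infer_instance

/-- The even part of the model of `S(U)`. -/
noncomputable def SMev (F L : ℕ) : Submodule k (SM k F L) where
  carrier := {s | ∀ b, ¬ evenMon b → s b = 0}
  add_mem' := by
    intro a b ha hb b' hb'
    simp [Finsupp.add_apply, ha b' hb', hb b' hb']
  zero_mem' := by intro b _; simp
  smul_mem' := by
    intro c a ha b hb
    simp [Finsupp.smul_apply, ha b hb]

/-- The odd part of the model of `S(U)`. -/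
noncomputable def SMod (F L : ℕ) : Submodule k (SM k F L) where
  carrier := {s | ∀ b, evenMon b → s b = 0}
  add_mem' := by
    intro a b ha hb b' hb'
    simp [Finsupp.add_apply, ha b' hb', hb b' hb']
  zero_mem' := by intro b _; simp
  smul_mem' := by
    intro c a ha b hb
    simp [Finsupp.smul_apply, ha b hb]

/-- Projection onto the even part. -/
noncomputable def Pe (F L : ℕ) : Module.End k (SM k F L) :=
  opOf k F L fun b => if evenMon b then bvec k F L b else 0

/-- Projection onto the odd part. -/
noncomputable def Po (F L : ℕ) : Module.End k (SM k F L) :=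
  opOf k F L fun b => if evenMon b then 0 else bvec k F L b

/-- The even component of an operator. -/
noncomputable def evPart (F L : ℕ) (f : Module.End k (SM k F L)) :
    Module.End k (SM k F L) :=
  Pe k F L * f * Pe k F L + Po k F L * f * Po k F L

/-- The odd component of an operator. -/
noncomputable def odPart (F L : ℕ) (f : Module.End k (SM k F L)) :
    Module.End k (SM k F L) :=
  Pe k F L * f * Po k F L + Po k F L * f * Pe k F L

/-- An operator is even if its odd component vanishes. -/
def IsEvenOp (F L : ℕ) (f : Module.End k (SM k F L)) : Prop := odPart k F L f = 0
/-- An operator is odd if its even component vanishes. -/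
def IsOddOp (F L : ℕ) (f : Module.End k (SM k F L)) : Prop := evPart k F L f = 0

/-- The supercommutator `[g, f]`, extended bilinearly from homogeneous
components: `[g,f] = g∘f - f∘g + 2·(odd part of f)∘(odd part of g)`. -/
noncomputable def sbrk (F L : ℕ) (g f : Module.End k (SM k F L)) :
    Module.End k (SM k F L) :=
  g * f - f * g + (2:k) • (odPart k F L f * odPart k F L g)

/-- The supercommutator `[g, f]` for an *even* `g`. -/
noncomputable def evComm (F L : ℕ) (g f : Module.End k (SM k F L)) :
    Module.End k (SM k F L) := g * f - f * g

/-- The supercommutator `[g, f]` for an *odd* (homogeneous) `g`: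
`[g,f] = g∘f - (even part of f)∘g + (odd part of f)∘g`. -/
noncomputable def odComm (F L : ℕ) (g f : Module.End k (SM k F L)) :
    Module.End k (SM k F L) :=
  g * f - evPart k F L f * g + odPart k F L f * g

/-- The Weyl–Clifford superalgebra `WC(U)`: the subalgebra of `End(S(U))`
generated by the multiplication operators and the superderivations. -/
noncomputable def WCsub (F L : ℕ) : Subalgebra k (Module.End k (SM k F L)) :=
  Algebra.adjoin k
    ({f | ∃ p r, f = zop k F L p r} ∪ {f | ∃ p r, f = dop k F L p r})

/-!
Core: the idempotented (Lusztig) forms `U̇(p(n))` and `U̇(p̃(m))`, presented as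
(unital hulls of) locally unital algebras: the generators are the morphisms
`X 1_λ` of the supercategories `Udot(p(n))` resp. `Udot(p̃(m))`, where
`λ ∈ X(T) = ⊕ ℤε_i` runs over the weight lattice, together with the weight
idempotents `1_λ`, subject to the idempotented forms (U1)–(U11) resp.
(Ũ1)–(Ũ11) of the defining relations.
-/

/-- Generators: `1_λ`, `E_i 1_λ`, `F_i 1_λ`, `B_{1,1} 1_λ`, `B_i 1_λ`,
`C_i 1_λ` (1-based `i`). -/
inductive DGen (m : ℕ) : Type
  | idem (l : Fin m → ℤ)
  | ge (i : ℕ) (l : Fin m → ℤ)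
  | gf (i : ℕ) (l : Fin m → ℤ)
  | gb11 (l : Fin m → ℤ)
  | gb (i : ℕ) (l : Fin m → ℤ)
  | gc (i : ℕ) (l : Fin m → ℤ)

/-- `ε_i ∈ X(T_m)` (1-based). -/
def epsw (m i : ℕ) : Fin m → ℤ := fun t => if t.val + 1 = i then 1 else 0
/-- `α_i = ε_i - ε_{i+1}`. -/
def alw (m i : ℕ) : Fin m → ℤ := epsw m i - epsw m (i+1)
/-- `β_i = ε_i + ε_{i+1}`. -/
def btw (m i : ℕ) : Fin m → ℤ := epsw m i + epsw m (i+1)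
/-- `2 ε_1`. -/
def b11w (m : ℕ) : Fin m → ℤ := (2:ℤ) • epsw m 1

/-- `λ_i` (the coefficient of `ε_i` in `λ`; 1-based, `0` out of range). -/
def cf (m : ℕ) (l : Fin m → ℤ) (i : ℕ) : ℤ :=
  if h : 1 ≤ i ∧ i ≤ m then l ⟨i-1, by omega⟩ else 0

/-- `(α_i, λ) = λ_i - λ_{i+1}`. -/
def alpair (m : ℕ) (l : Fin m → ℤ) (i : ℕ) : ℤ := cf m l i - cf m l (i+1)

/-- A "weighted operator": a natural transformation `λ ↦ (morphism λ → λ+wt)`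
in the free algebra on the generators; used to write the relations
uniformly. -/
structure WOp (k : Type) [Field k] (m : ℕ) where
  wt : Fin m → ℤ
  op : (Fin m → ℤ) → FreeAlgebra k (DGen m)

variable {k} in
/-- Composition of weighted operators. -/
noncomputable def WOp.comp {m : ℕ} (x y : WOp k m) : WOp k m :=
  ⟨x.wt + y.wt, fun l => x.op (l + y.wt) * y.op l⟩

variable {k} in
/-- Commutator of weighted operators. -/
noncomputable def WOp.cmm {m : ℕ} (x y : WOp k m) : WOp k m :=
  ⟨x.wt + y.wt, fun l => (x.comp y).op l - (y.comp x).op l⟩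

variable {k} in
/-- Anticommutator of weighted operators. -/
noncomputable def WOp.acm {m : ℕ} (x y : WOp k m) : WOp k m :=
  ⟨x.wt + y.wt, fun l => (x.comp y).op l + (y.comp x).op l⟩

noncomputable def wE (m i : ℕ) : WOp k m :=
  ⟨alw m i, fun l => FreeAlgebra.ι k (DGen.ge i l)⟩
noncomputable def wF (m i : ℕ) : WOp k m :=
  ⟨-(alw m i), fun l => FreeAlgebra.ι k (DGen.gf i l)⟩
/-- `B_i` for `U̇(p(n))`: weight `+β_i`. -/
noncomputable def wB (m i : ℕ) : WOp k m :=
  ⟨btw m i, fun l => FreeAlgebra.ι k (DGen.gb i l)⟩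
/-- `C_i` for `U̇(p(n))`: weight `-β_i`. -/
noncomputable def wC (m i : ℕ) : WOp k m :=
  ⟨-(btw m i), fun l => FreeAlgebra.ι k (DGen.gc i l)⟩
/-- `B_{1,1}` for `U̇(p(n))`: weight `2ε_1`. -/
noncomputable def wB11 (m : ℕ) : WOp k m :=
  ⟨b11w m, fun l => FreeAlgebra.ι k (DGen.gb11 l)⟩
/-- `B̃_i` for `U̇(p̃(m))`: weight `-β̃_i = -(ε_i + ε_{i+1})`. -/
noncomputable def wBt (m i : ℕ) : WOp k m :=
  ⟨-(btw m i), fun l => FreeAlgebra.ι k (DGen.gb i l)⟩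
/-- `C̃_i` for `U̇(p̃(m))`: weight `+(ε_i + ε_{i+1})`. -/
noncomputable def wCt (m i : ℕ) : WOp k m :=
  ⟨btw m i, fun l => FreeAlgebra.ι k (DGen.gc i l)⟩
/-- `B̃_{1,1}` for `U̇(p̃(m))`: weight `-2ε_1`. -/
noncomputable def wB11t (m : ℕ) : WOp k m :=
  ⟨-(b11w m), fun l => FreeAlgebra.ι k (DGen.gb11 l)⟩

noncomputable def iId (m : ℕ) (l : Fin m → ℤ) : FreeAlgebra k (DGen m) :=
  FreeAlgebra.ι k (DGen.idem l)

/-- Admissible index: `1 ≤ i ≤ m - 1`. -/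
def okEd (m i : ℕ) : Prop := 1 ≤ i ∧ i + 1 ≤ m

/-- The defining relations of the idempotented form `U̇(p(n))`
((U1)–(U11) of Davidson–Kujawa–Muth, Definition `Udot(p(n))`), together with
the idempotent relations and relations killing out-of-range generators. -/
inductive DRelU (n : ℕ) :
    FreeAlgebra k (DGen n) → FreeAlgebra k (DGen n) → Prop
  -- idempotents
  | idem2 (l l' : Fin n → ℤ) :
      DRelU n (iId k n l * iId k n l') (if l = l' then iId k n l else 0)
  -- sources and targets of the generators
  | srcE (i : ℕ) (l l' : Fin n → ℤ) :
      DRelU n ((wE k n i).op l * iId k n l') (if l' = l then (wE k n i).op l else 0)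
  | tgtE (i : ℕ) (l l' : Fin n → ℤ) :
      DRelU n (iId k n l' * (wE k n i).op l)
        (if l' = l + (wE k n i).wt then (wE k n i).op l else 0)
  | srcF (i : ℕ) (l l' : Fin n → ℤ) :
      DRelU n ((wF k n i).op l * iId k n l') (if l' = l then (wF k n i).op l else 0)
  | tgtF (i : ℕ) (l l' : Fin n → ℤ) :
      DRelU n (iId k n l' * (wF k n i).op l)
        (if l' = l + (wF k n i).wt then (wF k n i).op l else 0)
  | srcB (i : ℕ) (l l' : Fin n → ℤ) :
      DRelU n ((wB k n i).op l * iId k n l') (if l' = l then (wB k n i).op l else 0)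
  | tgtB (i : ℕ) (l l' : Fin n → ℤ) :
      DRelU n (iId k n l' * (wB k n i).op l)
        (if l' = l + (wB k n i).wt then (wB k n i).op l else 0)
  | srcC (i : ℕ) (l l' : Fin n → ℤ) :
      DRelU n ((wC k n i).op l * iId k n l') (if l' = l then (wC k n i).op l else 0)
  | tgtC (i : ℕ) (l l' : Fin n → ℤ) :
      DRelU n (iId k n l' * (wC k n i).op l)
        (if l' = l + (wC k n i).wt then (wC k n i).op l else 0)
  | srcB11 (l l' : Fin n → ℤ) :
      DRelU n ((wB11 k n).op l * iId k n l') (if l' = l then (wB11 k n).op l else 0)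
  | tgtB11 (l l' : Fin n → ℤ) :
      DRelU n (iId k n l' * (wB11 k n).op l)
        (if l' = l + (wB11 k n).wt then (wB11 k n).op l else 0)
  -- out-of-range generators vanish
  | killE (i : ℕ) (l : Fin n → ℤ) (h : ¬ okEd n i) : DRelU n ((wE k n i).op l) 0
  | killF (i : ℕ) (l : Fin n → ℤ) (h : ¬ okEd n i) : DRelU n ((wF k n i).op l) 0
  | killB (i : ℕ) (l : Fin n → ℤ) (h : ¬ okEd n i) : DRelU n ((wB k n i).op l) 0
  | killC (i : ℕ) (l : Fin n → ℤ) (h : ¬ okEd n i) : DRelU n ((wC k n i).op l) 0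
  -- (U1)
  | u1 (i j : ℕ) (l : Fin n → ℤ) (hi : okEd n i) (hj : okEd n j) :
      DRelU n (((wE k n i).cmm (wF k n j)).op l)
        (if i = j then ((alpair n l i : ℤ) : k) • iId k n l else 0)
  -- (U2)
  | u2a (i j : ℕ) (l : Fin n → ℤ) (hi : okEd n i) (hj : okEd n j)
      (h : j ≠ i + 1 ∧ i ≠ j + 1) : DRelU n (((wE k n i).cmm (wE k n j)).op l) 0
  | u2b (i j : ℕ) (l : Fin n → ℤ) (hi : okEd n i) (hj : okEd n j)
      (h : j = i + 1 ∨ i = j + 1) :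
      DRelU n (((wE k n i).cmm ((wE k n i).cmm (wE k n j))).op l) 0
  -- (U3)
  | u3a (i j : ℕ) (l : Fin n → ℤ) (hi : okEd n i) (hj : okEd n j)
      (h : j ≠ i + 1 ∧ i ≠ j + 1) : DRelU n (((wF k n i).cmm (wF k n j)).op l) 0
  | u3b (i j : ℕ) (l : Fin n → ℤ) (hi : okEd n i) (hj : okEd n j)
      (h : j = i + 1 ∨ i = j + 1) :
      DRelU n (((wF k n i).cmm ((wF k n i).cmm (wF k n j))).op l) 0
  -- (U4)
  | u4b (i j : ℕ) (l : Fin n → ℤ) (hi : okEd n i) (hj : okEd n j) :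
      DRelU n (((wB k n i).acm (wB k n j)).op l) 0
  | u4c (i j : ℕ) (l : Fin n → ℤ) (hi : okEd n i) (hj : okEd n j) :
      DRelU n (((wC k n i).acm (wC k n j)).op l) 0
  -- (U5)
  | u5i (i : ℕ) (l : Fin n → ℤ) (hi : okEd n i) :
      DRelU n (((wB k n i).acm (wC k n i)).op l)
        ((-((alpair n l i : ℤ) : k)) • iId k n l)
  | u5m (i : ℕ) (l : Fin n → ℤ) (hi : okEd n i) (hi1 : okEd n (i+1)) :
      DRelU n (((wB k n (i+1)).acm (wC k n i)).op l)
        (((wF k n i).cmm (wF k n (i+1))).op l)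
  | u5p (i : ℕ) (l : Fin n → ℤ) (hi : okEd n i) (hi1 : okEd n (i+1)) :
      DRelU n (((wB k n i).acm (wC k n (i+1))).op l)
        (((wE k n i).cmm (wE k n (i+1))).op l)
  | u5z (i j : ℕ) (l : Fin n → ℤ) (hi : okEd n i) (hj : okEd n j)
      (h : i ≠ j ∧ i ≠ j + 1 ∧ j ≠ i + 1) :
      DRelU n (((wB k n i).acm (wC k n j)).op l) 0
  -- (U6)
  | u6f (i j : ℕ) (l : Fin n → ℤ) (hi : okEd n i) (hj : okEd n j)
      (h : j ≠ i ∧ j ≠ i + 1) : DRelU n (((wB k n i).cmm (wF k n j)).op l) 0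
  | u6e (i j : ℕ) (l : Fin n → ℤ) (hi : okEd n i) (hj : okEd n j)
      (h : j ≠ i ∧ i ≠ j + 1) : DRelU n (((wB k n i).cmm (wE k n j)).op l) 0
  | u6c1 (i : ℕ) (l : Fin n → ℤ) (hi : okEd n i) (hi1 : okEd n (i+1)) :
      DRelU n (((wB k n i).cmm (wF k n i)).op l)
        (((wB k n (i+1)).cmm (wE k n (i+1))).op l)
  | u6c2 (i : ℕ) (l : Fin n → ℤ) (hi : okEd n i) (hi1 : okEd n (i+1)) :
      DRelU n (((wB k n i).cmm (wF k n (i+1))).op l)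
        (((wB k n (i+1)).cmm (wE k n i)).op l)
  -- (U7)
  | u7f (i j : ℕ) (l : Fin n → ℤ) (hi : okEd n i) (hj : okEd n j)
      (h : i ≠ j + 1) : DRelU n (((wF k n j).cmm (wC k n i)).op l) 0
  | u7e (i j : ℕ) (l : Fin n → ℤ) (hi : okEd n i) (hj : okEd n j)
      (h : j ≠ i + 1) : DRelU n (((wE k n j).cmm (wC k n i)).op l) 0
  | u7x (i : ℕ) (l : Fin n → ℤ) (hi : okEd n i) (hi1 : okEd n (i+1)) :
      DRelU n (((wF k n i).cmm (wC k n (i+1))).op l)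
        (((wE k n (i+1)).cmm (wC k n i)).op l)
  -- (U8)
  | u8a (i : ℕ) (l : Fin n → ℤ) (hi : okEd n i) (hi1 : okEd n (i+1)) :
      DRelU n ((((wB k n i).cmm (wF k n i)).cmm (wF k n (i+1))).op l)
        ((2:k) • FreeAlgebra.ι k (DGen.gb (i+1) l))
  | u8z (i j : ℕ) (l : Fin n → ℤ) (hi : okEd n i) (hj : okEd n j)
      (h : j ≠ i + 1) :
      DRelU n ((((wB k n i).cmm (wF k n i)).cmm (wF k n j)).op l) 0
  | u8e (l : Fin n → ℤ) (h1 : okEd n 1) :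
      DRelU n ((((wB k n 1).cmm (wF k n 1)).cmm (wE k n 1)).op l)
        ((2:k) • FreeAlgebra.ι k (DGen.gb 1 l))
  | u8be (j : ℕ) (l : Fin n → ℤ) (h1 : okEd n 1) (hj : okEd n j) :
      DRelU n ((((wB k n 1).cmm (wE k n 1)).cmm (wE k n j)).op l) 0
  -- (U9)
  | u9a (i : ℕ) (l : Fin n → ℤ) (hi : okEd n i) (hi1 : okEd n (i+1)) :
      DRelU n ((((wC k n (i+1)).cmm (wF k n i)).cmm (wF k n (i+1))).op l)
        (FreeAlgebra.ι k (DGen.gc i l))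
  | u9z (i j : ℕ) (l : Fin n → ℤ) (hi : okEd n i) (hi1 : okEd n (i+1))
      (hj : okEd n j) (h : j ≠ i + 1 ∧ i ≠ j + 1) :
      DRelU n ((((wC k n (i+1)).cmm (wF k n i)).cmm (wF k n j)).op l) 0
  -- (U10)
  | u10 (l : Fin n → ℤ) (h1 : okEd n 1) :
      DRelU n ((2:k) • FreeAlgebra.ι k (DGen.gb11 l))
        (((wE k n 1).cmm (wB k n 1)).op l)
  -- (U11)
  | u11 (l : Fin n → ℤ) :
      DRelU n (((wB11 k n).comp (wB11 k n)).op l) 0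

/-- The idempotented form `U̇(p(n))` (with a unit formally adjoined). -/
abbrev Udu (n : ℕ) := RingQuot (DRelU k n)

noncomputable def mkDu (n : ℕ) : FreeAlgebra k (DGen n) →ₐ[k] Udu k n :=
  RingQuot.mkAlgHom k (DRelU k n)

/-- The defining relations of the idempotented form `U̇(p̃(m))`
((Ũ1)–(Ũ11) of Davidson–Kujawa–Muth, Definition `Udot(p̃(m))`). -/
inductive DRelT (m : ℕ) :
    FreeAlgebra k (DGen m) → FreeAlgebra k (DGen m) → Prop
  -- idempotents
  | idem2 (l l' : Fin m → ℤ) :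
      DRelT m (iId k m l * iId k m l') (if l = l' then iId k m l else 0)
  -- sources and targets of the generators
  | srcE (i : ℕ) (l l' : Fin m → ℤ) :
      DRelT m ((wE k m i).op l * iId k m l') (if l' = l then (wE k m i).op l else 0)
  | tgtE (i : ℕ) (l l' : Fin m → ℤ) :
      DRelT m (iId k m l' * (wE k m i).op l)
        (if l' = l + (wE k m i).wt then (wE k m i).op l else 0)
  | srcF (i : ℕ) (l l' : Fin m → ℤ) :
      DRelT m ((wF k m i).op l * iId k m l') (if l' = l then (wF k m i).op l else 0)
  | tgtF (i : ℕ) (l l' : Fin m → ℤ) :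
      DRelT m (iId k m l' * (wF k m i).op l)
        (if l' = l + (wF k m i).wt then (wF k m i).op l else 0)
  | srcB (i : ℕ) (l l' : Fin m → ℤ) :
      DRelT m ((wBt k m i).op l * iId k m l') (if l' = l then (wBt k m i).op l else 0)
  | tgtB (i : ℕ) (l l' : Fin m → ℤ) :
      DRelT m (iId k m l' * (wBt k m i).op l)
        (if l' = l + (wBt k m i).wt then (wBt k m i).op l else 0)
  | srcC (i : ℕ) (l l' : Fin m → ℤ) :
      DRelT m ((wCt k m i).op l * iId k m l') (if l' = l then (wCt k m i).op l else 0)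
  | tgtC (i : ℕ) (l l' : Fin m → ℤ) :
      DRelT m (iId k m l' * (wCt k m i).op l)
        (if l' = l + (wCt k m i).wt then (wCt k m i).op l else 0)
  | srcB11 (l l' : Fin m → ℤ) :
      DRelT m ((wB11t k m).op l * iId k m l') (if l' = l then (wB11t k m).op l else 0)
  | tgtB11 (l l' : Fin m → ℤ) :
      DRelT m (iId k m l' * (wB11t k m).op l)
        (if l' = l + (wB11t k m).wt then (wB11t k m).op l else 0)
  -- out-of-range generators vanish
  | killE (i : ℕ) (l : Fin m → ℤ) (h : ¬ okEd m i) : DRelT m ((wE k m i).op l) 0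
  | killF (i : ℕ) (l : Fin m → ℤ) (h : ¬ okEd m i) : DRelT m ((wF k m i).op l) 0
  | killB (i : ℕ) (l : Fin m → ℤ) (h : ¬ okEd m i) : DRelT m ((wBt k m i).op l) 0
  | killC (i : ℕ) (l : Fin m → ℤ) (h : ¬ okEd m i) : DRelT m ((wCt k m i).op l) 0
  -- (Ũ1)
  | u1 (i j : ℕ) (l : Fin m → ℤ) (hi : okEd m i) (hj : okEd m j) :
      DRelT m (((wE k m i).cmm (wF k m j)).op l)
        (if i = j then ((alpair m l i : ℤ) : k) • iId k m l else 0)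
  -- (Ũ2)
  | u2a (i j : ℕ) (l : Fin m → ℤ) (hi : okEd m i) (hj : okEd m j)
      (h : j ≠ i + 1 ∧ i ≠ j + 1) : DRelT m (((wE k m i).cmm (wE k m j)).op l) 0
  | u2b (i j : ℕ) (l : Fin m → ℤ) (hi : okEd m i) (hj : okEd m j)
      (h : j = i + 1 ∨ i = j + 1) :
      DRelT m (((wE k m i).cmm ((wE k m i).cmm (wE k m j))).op l) 0
  -- (Ũ3)
  | u3a (i j : ℕ) (l : Fin m → ℤ) (hi : okEd m i) (hj : okEd m j)
      (h : j ≠ i + 1 ∧ i ≠ j + 1) : DRelT m (((wF k m i).cmm (wF k m j)).op l) 0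
  | u3b (i j : ℕ) (l : Fin m → ℤ) (hi : okEd m i) (hj : okEd m j)
      (h : j = i + 1 ∨ i = j + 1) :
      DRelT m (((wF k m i).cmm ((wF k m i).cmm (wF k m j))).op l) 0
  -- (Ũ4)
  | u4b (i j : ℕ) (l : Fin m → ℤ) (hi : okEd m i) (hj : okEd m j) :
      DRelT m (((wBt k m i).acm (wBt k m j)).op l) 0
  | u4c (i j : ℕ) (l : Fin m → ℤ) (hi : okEd m i) (hj : okEd m j) :
      DRelT m (((wCt k m i).acm (wCt k m j)).op l) 0
  -- (Ũ5)
  | u5i (i : ℕ) (l : Fin m → ℤ) (hi : okEd m i) :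
      DRelT m (((wBt k m i).acm (wCt k m i)).op l)
        (((alpair m l i : ℤ) : k) • iId k m l)
  | u5m (i : ℕ) (l : Fin m → ℤ) (hi : okEd m i) (hi1 : okEd m (i+1)) :
      DRelT m (((wBt k m (i+1)).acm (wCt k m i)).op l)
        (((wE k m i).cmm (wE k m (i+1))).op l)
  | u5p (i : ℕ) (l : Fin m → ℤ) (hi : okEd m i) (hi1 : okEd m (i+1)) :
      DRelT m (((wBt k m i).acm (wCt k m (i+1))).op l)
        (((wF k m i).cmm (wF k m (i+1))).op l)
  | u5z (i j : ℕ) (l : Fin m → ℤ) (hi : okEd m i) (hj : okEd m j)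
      (h : i ≠ j ∧ i ≠ j + 1 ∧ j ≠ i + 1) :
      DRelT m (((wBt k m i).acm (wCt k m j)).op l) 0
  -- (Ũ6)
  | u6e (i j : ℕ) (l : Fin m → ℤ) (hi : okEd m i) (hj : okEd m j)
      (h : j ≠ i ∧ j ≠ i + 1) : DRelT m (((wBt k m i).cmm (wE k m j)).op l) 0
  | u6f (i j : ℕ) (l : Fin m → ℤ) (hi : okEd m i) (hj : okEd m j)
      (h : j ≠ i ∧ i ≠ j + 1) : DRelT m (((wBt k m i).cmm (wF k m j)).op l) 0
  | u6c1 (i : ℕ) (l : Fin m → ℤ) (hi : okEd m i) (hi1 : okEd m (i+1)) :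
      DRelT m (((wBt k m i).cmm (wE k m i)).op l)
        (((wBt k m (i+1)).cmm (wF k m (i+1))).op l)
  | u6c2 (i : ℕ) (l : Fin m → ℤ) (hi : okEd m i) (hi1 : okEd m (i+1)) :
      DRelT m (((wBt k m i).cmm (wE k m (i+1))).op l)
        (((wBt k m (i+1)).cmm (wF k m i)).op l)
  -- (Ũ7)
  | u7e (i j : ℕ) (l : Fin m → ℤ) (hi : okEd m i) (hj : okEd m j)
      (h : i ≠ j + 1) : DRelT m (((wE k m j).cmm (wCt k m i)).op l) 0
  | u7f (i j : ℕ) (l : Fin m → ℤ) (hi : okEd m i) (hj : okEd m j)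
      (h : j ≠ i + 1) : DRelT m (((wF k m j).cmm (wCt k m i)).op l) 0
  | u7x (i : ℕ) (l : Fin m → ℤ) (hi : okEd m i) (hi1 : okEd m (i+1)) :
      DRelT m (((wE k m i).cmm (wCt k m (i+1))).op l)
        (((wF k m (i+1)).cmm (wCt k m i)).op l)
  -- (Ũ8)
  | u8a (i : ℕ) (l : Fin m → ℤ) (hi : okEd m i) (hi1 : okEd m (i+1)) :
      DRelT m ((((wBt k m i).cmm (wE k m i)).cmm (wE k m (i+1))).op l)
        ((2:k) • FreeAlgebra.ι k (DGen.gb (i+1) l))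
  | u8z (i j : ℕ) (l : Fin m → ℤ) (hi : okEd m i) (hj : okEd m j)
      (h : j ≠ i + 1) :
      DRelT m ((((wBt k m i).cmm (wE k m i)).cmm (wE k m j)).op l) 0
  | u8e (l : Fin m → ℤ) (h1 : okEd m 1) :
      DRelT m ((((wBt k m 1).cmm (wE k m 1)).cmm (wF k m 1)).op l)
        ((2:k) • FreeAlgebra.ι k (DGen.gb 1 l))
  | u8bf (j : ℕ) (l : Fin m → ℤ) (h1 : okEd m 1) (hj : okEd m j) :
      DRelT m ((((wBt k m 1).cmm (wF k m 1)).cmm (wF k m j)).op l) 0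
  -- (Ũ9)
  | u9a (i : ℕ) (l : Fin m → ℤ) (hi : okEd m i) (hi1 : okEd m (i+1)) :
      DRelT m ((((wCt k m (i+1)).cmm (wE k m i)).cmm (wE k m (i+1))).op l)
        (FreeAlgebra.ι k (DGen.gc i l))
  | u9z (i j : ℕ) (l : Fin m → ℤ) (hi : okEd m i) (hi1 : okEd m (i+1))
      (hj : okEd m j) (h : j ≠ i + 1 ∧ i ≠ j + 1) :
      DRelT m ((((wCt k m (i+1)).cmm (wE k m i)).cmm (wE k m j)).op l) 0
  -- (Ũ10)
  | u10 (l : Fin m → ℤ) (h1 : okEd m 1) :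
      DRelT m ((2:k) • FreeAlgebra.ι k (DGen.gb11 l))
        (((wBt k m 1).cmm (wF k m 1)).op l)
  -- (Ũ11)
  | u11 (l : Fin m → ℤ) :
      DRelT m (((wB11t k m).comp (wB11t k m)).op l) 0

/-- The idempotented form `U̇(p̃(m))` (with a unit formally adjoined). -/
abbrev Udt (m : ℕ) := RingQuot (DRelT k m)

noncomputable def mkDt (m : ℕ) : FreeAlgebra k (DGen m) →ₐ[k] Udt k m :=
  RingQuot.mkAlgHom k (DRelT k m)

/-!
Model-side definitions on `A = S(V_n)^{⊗ m}` (the model `SM k m n`): weight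
and tensor-degree projections and the operators of the natural `p(n)`-action,
in 1-based indexing.
-/

/-- The tensor-degree profile of a monomial: its multidegree in the `m`
tensor slots, i.e. the weight for `U̇(p̃(m))`. -/
noncomputable def prof {m n : ℕ} (b : MonB m n) : Fin m → ℤ :=
  fun i => (∑ l : Fin n, (b.1 (i, l) : ℤ))
    + ((Finset.univ.filter fun l : Fin n => b.2 (i, l) = true).card : ℤ)

/-- Projection of `A` onto the summand `S^λ(V_n) = S^{λ_1}(V_n) ⊗ ⋯ ⊗
S^{λ_m}(V_n)` (zero if `λ ∉ X(T_m)_{≥0}`). -/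
noncomputable def projP (m n : ℕ) (lam : Fin m → ℤ) : Module.End k (SM k m n) :=
  opOf k m n fun b => if prof b = lam then bvec k m n b else 0

/-- The `p(n)`-weight of a monomial. -/
noncomputable def pwt {m n : ℕ} (b : MonB m n) : Fin n → ℤ :=
  fun l => (∑ i : Fin m, (b.1 (i, l) : ℤ))
    - ((Finset.univ.filter fun i : Fin m => b.2 (i, l) = true).card : ℤ)

/-- Projection of `A` onto its `p(n)`-weight space of weight `ν`. -/
noncomputable def projW (m n : ℕ) (nu : Fin n → ℤ) : Module.End k (SM k m n) :=
  opOf k m n fun b => if pwt b = nu then bvec k m n b else 0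

/-- The operator of the natural action of `a_{i,i+1} ∈ p(n)` (1-based `i`). -/
noncomputable def pnE (m n i : ℕ) : Module.End k (SM k m n) :=
  if h : 1 ≤ i ∧ i + 1 ≤ n then opA k m n ⟨i-1, by omega⟩ ⟨i, by omega⟩ else 0
/-- The operator of the natural action of `a_{i+1,i} ∈ p(n)`. -/
noncomputable def pnF (m n i : ℕ) : Module.End k (SM k m n) :=
  if h : 1 ≤ i ∧ i + 1 ≤ n then opA k m n ⟨i, by omega⟩ ⟨i-1, by omega⟩ else 0
/-- The operator of the natural action of `b_{1,1} ∈ p(n)`. -/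
noncomputable def pnB11 (m n : ℕ) : Module.End k (SM k m n) :=
  if h : 0 < n then opB k m n ⟨0, h⟩ ⟨0, h⟩ else 0
/-- The operator of the natural action of `b_{i,i+1} ∈ p(n)`. -/
noncomputable def pnB (m n i : ℕ) : Module.End k (SM k m n) :=
  if h : 1 ≤ i ∧ i + 1 ≤ n then opB k m n ⟨i-1, by omega⟩ ⟨i, by omega⟩ else 0
/-- The operator of the natural action of `c_{i,i+1} ∈ p(n)`. -/
noncomputable def pnC (m n i : ℕ) : Module.End k (SM k m n) :=
  if h : 1 ≤ i ∧ i + 1 ≤ n then opC k m n ⟨i-1, by omega⟩ ⟨i, by omega⟩ else 0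

/-- `f` is a homomorphism of `p(n)`-supermodules `A → A` (in the graded sense:
its even and odd components intertwine the natural action operators with the
appropriate signs). -/
def IsPnHom (m n : ℕ) (f : Module.End k (SM k m n)) : Prop :=
  (∀ i j : Fin n, evComm k m n (opA k m n i j) f = 0) ∧
  (∀ i j : Fin n, i ≤ j → odComm k m n (opB k m n i j) f = 0) ∧
  (∀ i j : Fin n, i < j → odComm k m n (opC k m n i j) f = 0)

/-- The natural action of `U̇(p(n))` on `A = S(V_n)^{⊗m}`: weight idempotents
act by the weight projections and the generating morphisms act through the
natural `p(n)`-action on `V_n`. -/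
def NatPnAction (m n : ℕ) (Ψ : Udu k n →ₐ[k] Module.End k (SM k m n)) : Prop :=
  (∀ nu : Fin n → ℤ, Ψ (mkDu k n (iId k n nu)) = projW k m n nu) ∧
  (∀ i (nu : Fin n → ℤ),
    Ψ (mkDu k n (FreeAlgebra.ι k (DGen.ge i nu))) = pnE k m n i * projW k m n nu) ∧
  (∀ i (nu : Fin n → ℤ),
    Ψ (mkDu k n (FreeAlgebra.ι k (DGen.gf i nu))) = pnF k m n i * projW k m n nu) ∧
  (∀ nu : Fin n → ℤ,
    Ψ (mkDu k n (FreeAlgebra.ι k (DGen.gb11 nu))) = pnB11 k m n * projW k m n nu) ∧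
  (∀ i (nu : Fin n → ℤ),
    Ψ (mkDu k n (FreeAlgebra.ι k (DGen.gb i nu))) = pnB k m n i * projW k m n nu) ∧
  (∀ i (nu : Fin n → ℤ),
    Ψ (mkDu k n (FreeAlgebra.ι k (DGen.gc i nu))) = pnC k m n i * projW k m n nu)

/-- The "locally unital part" of the presented algebra: the span of the
elements factoring through a weight idempotent.  Its image is the image of the
locally unital algebra `U̇` proper (without the formally adjoined unit). -/
noncomputable def locT (m : ℕ) : Submodule k (Udt k m) :=
  Submodule.span k {x : Udt k m | ∃ (l : Fin m → ℤ) (a b : Udt k m), x = a * mkDt k m (iId k m l) * b}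

noncomputable def locU (n : ℕ) : Submodule k (Udu k n) :=
  Submodule.span k {x : Udu k n | ∃ (l : Fin n → ℤ) (a b : Udu k n), x = a * mkDu k n (iId k n l) * b}

/-- Endomorphisms with finite-dimensional image. -/
def EndFin (m n : ℕ) : Set (Module.End k (SM k m n)) :=
  {f | Module.Finite k ↥(LinearMap.range f)}

section MonomialOperators

variable {k : Type} [Field k] {F L : ℕ}

theorem opOf_bvec (f : MonB F L → SM k F L) (b : MonB F L) :
    opOf k F L f (bvec k F L b) = f b := by
  simp [opOf, bvec, Finsupp.linearCombination_single]

theorem end_ext_bvec {M : Type*} [AddCommGroup M] [Module k M] {f g : SM k F L →ₗ[k] M}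
    (h : ∀ b, f (bvec k F L b) = g (bvec k F L b)) : f = g := by
  refine Finsupp.lhom_ext fun b c => ?_
  have h1 : (Finsupp.single b c : SM k F L) = c • bvec k F L b := by
    simp [bvec]
  rw [h1, map_smul, map_smul, h b]

theorem posIdx_injective : Function.Injective (posIdx : Fin F × Fin L → ℕ) := by
  have h : ∀ p : Fin F × Fin L, posIdx p = (finProdFinEquiv p).val := by
    intro p
    simp [posIdx, finProdFinEquiv]
    ring
  intro p q hpq
  rw [h, h] at hpq
  exact finProdFinEquiv.injective (Fin.ext hpq)

/-- The sign picked up when moving a variable to position `p`. -/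
noncomputable def osgn (k : Type) [Field k] {F L : ℕ} (e : Fin F × Fin L → Bool)
    (p : Fin F × Fin L) : k := (-1 : k) ^ oddBefore e p

theorem osgn_mul_self (e : Fin F × Fin L → Bool) (p : Fin F × Fin L) :
    osgn k e p * osgn k e p = 1 := by
  rw [osgn, ← pow_add, ← two_mul, pow_mul]; simp

theorem osgn_update (e : Fin F × Fin L → Bool) (p q : Fin F × Fin L) (v : Bool) :
    osgn k (Function.update e p v) q =
      (if posIdx p < posIdx q ∧ e p ≠ v then -1 else 1) * osgn k e q := by
  have hc : ∀ e : Fin F × Fin L → Bool, osgn k e q =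
      ∏ r : Fin F × Fin L, if posIdx r < posIdx q ∧ e r = true then (-1 : k) else 1 := by
    intro e
    rw [osgn, oddBefore, Finset.prod_ite]
    simp
  rw [hc, hc, ← Finset.mul_prod_erase Finset.univ _ (Finset.mem_univ p),
    ← Finset.mul_prod_erase Finset.univ (fun r => if posIdx r < posIdx q ∧ e r = true
      then (-1 : k) else 1) (Finset.mem_univ p), ← mul_assoc]
  congr 1
  · simp only [Function.update_self]
    by_cases h : posIdx p < posIdx q <;> cases e p <;> cases v <;> simp [h]
  · refine Finset.prod_congr rfl fun r hr => ?_
    rw [Function.update_of_ne (Finset.ne_of_mem_erase hr)]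

theorem zE_bvec (i : Fin F) (j : Fin L) (b : MonB F L) :
    zE k F L i j (bvec k F L b) =
      bvec k F L (Function.update b.1 (i, j) (b.1 (i, j) + 1), b.2) := opOf_bvec _ _

theorem dE_bvec (i : Fin F) (j : Fin L) (b : MonB F L) :
    dE k F L i j (bvec k F L b) = (b.1 (i, j) : k) •
      bvec k F L (Function.update b.1 (i, j) (b.1 (i, j) - 1), b.2) := opOf_bvec _ _

theorem zO_bvec (i : Fin F) (j : Fin L) (b : MonB F L) :
    zO k F L i j (bvec k F L b) = if b.2 (i, j) then 0 else osgn k b.2 (i, j) •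
      bvec k F L (b.1, Function.update b.2 (i, j) true) := opOf_bvec _ _

theorem dO_bvec (i : Fin F) (j : Fin L) (b : MonB F L) :
    dO k F L i j (bvec k F L b) = if b.2 (i, j) then osgn k b.2 (i, j) •
      bvec k F L (b.1, Function.update b.2 (i, j) false) else 0 := opOf_bvec _ _

theorem zE_zE (i i' : Fin F) (j j' : Fin L) :
    zE k F L i j * zE k F L i' j' = zE k F L i' j' * zE k F L i j := by
  refine end_ext_bvec fun b => ?_
  simp only [Module.End.mul_apply, zE_bvec]
  by_cases h : ((i, j) : Fin F × Fin L) = (i', j')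
  · rw [h]
  · rw [Function.update_of_ne h, Function.update_of_ne (Ne.symm h), Function.update_comm h]

theorem dE_dE (i i' : Fin F) (j j' : Fin L) :
    dE k F L i j * dE k F L i' j' = dE k F L i' j' * dE k F L i j := by
  refine end_ext_bvec fun b => ?_
  simp only [Module.End.mul_apply, dE_bvec, map_smul]
  by_cases h : ((i, j) : Fin F × Fin L) = (i', j')
  · rw [h]
  · rw [Function.update_of_ne h, Function.update_of_ne (Ne.symm h), Function.update_comm h,
      smul_smul, smul_smul, mul_comm]

theorem dE_zE (i i' : Fin F) (j j' : Fin L) :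
    dE k F L i j * zE k F L i' j' = zE k F L i' j' * dE k F L i j +
      if i = i' ∧ j = j' then 1 else 0 := by
  refine end_ext_bvec fun b => ?_
  simp only [Module.End.mul_apply, dE_bvec, zE_bvec, map_smul, LinearMap.add_apply]
  by_cases h : i = i' ∧ j = j'
  · obtain ⟨rfl, rfl⟩ := h
    simp only [Function.update_self, Function.update_idem, and_self, if_true,
      Module.End.one_apply, Nat.add_sub_cancel, Function.update_eq_self]
    rcases Nat.eq_zero_or_pos (b.1 (i, j)) with h0 | h0
    · simp [h0]
    · rw [Nat.sub_add_cancel h0, Function.update_eq_self]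
      push_cast
      rw [add_smul, one_smul]
  · have h' : ((i, j) : Fin F × Fin L) ≠ (i', j') := by simpa [Prod.ext_iff] using h
    rw [Function.update_of_ne h', Function.update_of_ne (Ne.symm h'), Function.update_comm h']
    simp [h]

theorem zO_zE (i i' : Fin F) (j j' : Fin L) :
    zO k F L i j * zE k F L i' j' = zE k F L i' j' * zO k F L i j := by
  refine end_ext_bvec fun b => ?_
  simp only [Module.End.mul_apply, zE_bvec, zO_bvec]
  split_ifs <;> simp [zE_bvec]

theorem zO_dE (i i' : Fin F) (j j' : Fin L) :
    zO k F L i j * dE k F L i' j' = dE k F L i' j' * zO k F L i j := by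
  refine end_ext_bvec fun b => ?_
  simp only [Module.End.mul_apply, dE_bvec, zO_bvec, map_smul]
  split_ifs <;> simp [dE_bvec, smul_smul, mul_comm]

theorem dO_zE (i i' : Fin F) (j j' : Fin L) :
    dO k F L i j * zE k F L i' j' = zE k F L i' j' * dO k F L i j := by
  refine end_ext_bvec fun b => ?_
  simp only [Module.End.mul_apply, zE_bvec, dO_bvec]
  split_ifs <;> simp [zE_bvec]

theorem dO_dE (i i' : Fin F) (j j' : Fin L) :
    dO k F L i j * dE k F L i' j' = dE k F L i' j' * dO k F L i j := by
  refine end_ext_bvec fun b => ?_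
  simp only [Module.End.mul_apply, dE_bvec, dO_bvec, map_smul]
  split_ifs <;> simp [dE_bvec, smul_smul, mul_comm]

theorem posIdx_lt_or {p q : Fin F × Fin L} (h : p ≠ q) :
    (posIdx p < posIdx q ∧ ¬ posIdx q < posIdx p) ∨
      (posIdx q < posIdx p ∧ ¬ posIdx p < posIdx q) := by
  have := posIdx_injective.ne h
  omega

theorem zO_zO (i i' : Fin F) (j j' : Fin L) :
    zO k F L i j * zO k F L i' j' = -(zO k F L i' j' * zO k F L i j) := by
  refine end_ext_bvec fun b => ?_
  simp only [Module.End.mul_apply, zO_bvec, LinearMap.neg_apply]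
  by_cases h : ((i, j) : Fin F × Fin L) = (i', j')
  · obtain ⟨rfl, rfl⟩ := Prod.ext_iff.1 h
    split_ifs <;> simp [zO_bvec]
  · rcases posIdx_lt_or h with ⟨h1, h2⟩ | ⟨h1, h2⟩ <;>
    cases hb : b.2 (i, j) <;> cases hb' : b.2 (i', j') <;>
    simp [zO_bvec, osgn_update, Function.update_of_ne h, Function.update_of_ne (Ne.symm h),
      hb, hb', h1, h2, smul_smul, mul_comm, Function.update_comm h]

theorem dO_dO (i i' : Fin F) (j j' : Fin L) :
    dO k F L i j * dO k F L i' j' = -(dO k F L i' j' * dO k F L i j) := by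
  refine end_ext_bvec fun b => ?_
  simp only [Module.End.mul_apply, dO_bvec, LinearMap.neg_apply]
  by_cases h : ((i, j) : Fin F × Fin L) = (i', j')
  · obtain ⟨rfl, rfl⟩ := Prod.ext_iff.1 h
    split_ifs <;> simp [dO_bvec]
  · rcases posIdx_lt_or h with ⟨h1, h2⟩ | ⟨h1, h2⟩ <;>
    cases hb : b.2 (i, j) <;> cases hb' : b.2 (i', j') <;>
    simp [dO_bvec, osgn_update, Function.update_of_ne h, Function.update_of_ne (Ne.symm h),
      hb, hb', h1, h2, smul_smul, mul_comm, Function.update_comm h]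

theorem dO_zO (i i' : Fin F) (j j' : Fin L) :
    dO k F L i j * zO k F L i' j' = -(zO k F L i' j' * dO k F L i j) +
      if i = i' ∧ j = j' then 1 else 0 := by
  refine end_ext_bvec fun b => ?_
  simp only [Module.End.mul_apply, zO_bvec, dO_bvec, LinearMap.neg_apply, LinearMap.add_apply]
  by_cases h : ((i, j) : Fin F × Fin L) = (i', j')
  · obtain ⟨rfl, rfl⟩ := Prod.ext_iff.1 h
    have hs := osgn_mul_self (k := k) b.2 (i, j)
    cases hb : b.2 (i, j)
    · have : Function.update b.2 (i, j) false = b.2 := by rw [← hb, Function.update_eq_self]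
      simp [dO_bvec, osgn_update, smul_smul, hs, this]
    · have : Function.update b.2 (i, j) true = b.2 := by rw [← hb, Function.update_eq_self]
      simp [zO_bvec, osgn_update, smul_smul, hs, this]
  · have h' : ¬ (i = i' ∧ j = j') := by simpa [Prod.ext_iff] using h
    rcases posIdx_lt_or h with ⟨h1, h2⟩ | ⟨h1, h2⟩ <;>
    cases hb : b.2 (i, j) <;> cases hb' : b.2 (i', j') <;>
    simp [dO_bvec, zO_bvec, osgn_update, Function.update_of_ne h,
      Function.update_of_ne (Ne.symm h),
      hb, hb', h1, h2, h', smul_smul, mul_comm, Function.update_comm h]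

theorem dE_vac (i : Fin F) (j : Fin L) : dE k F L i j (vac k F L) = 0 := by
  simp [vac, dE_bvec]

theorem dO_vac (i : Fin F) (j : Fin L) : dO k F L i j (vac k F L) = 0 := by
  simp [vac, dO_bvec]

theorem zE_dE_bvec (i : Fin F) (j : Fin L) (b : MonB F L) :
    zE k F L i j (dE k F L i j (bvec k F L b)) = (b.1 (i, j) : k) • bvec k F L b := by
  rw [dE_bvec, map_smul, zE_bvec]
  rcases Nat.eq_zero_or_pos (b.1 (i, j)) with h0 | h0
  · simp [h0]
  · simp [Nat.sub_add_cancel h0]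

theorem zO_dO_bvec (i : Fin F) (j : Fin L) (b : MonB F L) :
    zO k F L i j (dO k F L i j (bvec k F L b)) =
      (if b.2 (i, j) then (1 : k) else 0) • bvec k F L b := by
  rw [dO_bvec]
  cases hb : b.2 (i, j)
  · simp
  · have : Function.update b.2 (i, j) true = b.2 := by rw [← hb, Function.update_eq_self]
    simp [zO_bvec, osgn_update, smul_smul, osgn_mul_self, this]

end MonomialOperators

section UniversalProperty

/-- Negate `x` when both parities are odd. -/
def sgm {A : Type*} [Neg A] (p q : Bool) (x : A) : A := if p && q then -x else x

@[simp] theorem sgm_false_left {A : Type*} [Neg A] (q : Bool) (x : A) : sgm false q x = x := rfl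
@[simp] theorem sgm_false_right {A : Type*} [Neg A] (q : Bool) (x : A) : sgm q false x = x := by
  cases q <;> rfl
@[simp] theorem sgm_true_true {A : Type*} [Neg A] (x : A) : sgm true true x = -x := rfl

variable {k : Type} [Field k] {F L : ℕ}

/-- The creation operator of given parity. -/
noncomputable def zv (k : Type) [Field k] {F L : ℕ} (p : Bool) (i : Fin F) (j : Fin L) :
    Module.End k (SM k F L) := if p then zO k F L i j else zE k F L i j

/-- The annihilation operator of given parity. -/
noncomputable def dv (k : Type) [Field k] {F L : ℕ} (p : Bool) (i : Fin F) (j : Fin L) :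
    Module.End k (SM k F L) := if p then dO k F L i j else dE k F L i j

@[simp] theorem zv_false (i : Fin F) (j : Fin L) : zv k false i j = zE k F L i j := rfl
@[simp] theorem zv_true (i : Fin F) (j : Fin L) : zv k true i j = zO k F L i j := rfl
@[simp] theorem dv_false (i : Fin F) (j : Fin L) : dv k false i j = dE k F L i j := rfl
@[simp] theorem dv_true (i : Fin F) (j : Fin L) : dv k true i j = dO k F L i j := rfl

theorem zv_zv (p q : Bool) (i i' : Fin F) (j j' : Fin L) :
    zv k p i j * zv k q i' j' = sgm p q (zv k q i' j' * zv k p i j) := by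
  cases p <;> cases q <;> simp [zE_zE i i', zO_zO i i', zO_zE]

theorem dv_dv (p q : Bool) (i i' : Fin F) (j j' : Fin L) :
    dv k p i j * dv k q i' j' = sgm p q (dv k q i' j' * dv k p i j) := by
  cases p <;> cases q <;> simp [dE_dE i i', dO_dO i i', dO_dE]

theorem dv_zv (p q : Bool) (i i' : Fin F) (j j' : Fin L) :
    dv k p i j * zv k q i' j' = sgm p q (zv k q i' j' * dv k p i j) +
      if p = q ∧ i = i' ∧ j = j' then 1 else 0 := by
  cases p <;> cases q <;> simp [dE_zE i i', dO_zO i i', dO_zE, zO_dE]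

theorem dv_vac (p : Bool) (i : Fin F) (j : Fin L) : dv k p i j (vac k F L) = 0 := by
  cases p <;> simp [dE_vac, dO_vac]

theorem sm_submodule_eq_top (K : Submodule k (SM k F L)) (h0 : vac k F L ∈ K)
    (hz : ∀ p i j, ∀ u ∈ K, zv k p i j u ∈ K) : K = ⊤ := by
  have key : ∀ N : ℕ, ∀ b : MonB F L,
      (∑ p, b.1 p) + (∑ p, if b.2 p then 1 else 0) = N → bvec k F L b ∈ K := by
    intro N
    induction N with
    | zero =>
      intro b hb
      have h1 : b = (fun _ => 0, fun _ => false) := by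
        simp only [Nat.add_eq_zero_iff, Finset.sum_eq_zero_iff, Finset.mem_univ,
          true_implies] at hb
        refine Prod.ext (funext hb.1) (funext fun p => ?_)
        have := hb.2 p
        simpa using this
      rw [h1]; exact h0
    | succ N ih =>
      intro b hb
      by_cases h : ∃ p, b.1 p ≠ 0
      · obtain ⟨⟨i, j⟩, hp⟩ := h
        have h2 : bvec k F L b = zE k F L i j
            (bvec k F L (Function.update b.1 (i, j) (b.1 (i, j) - 1), b.2)) := by
          rw [zE_bvec]
          simp [Nat.sub_add_cancel (Nat.one_le_iff_ne_zero.2 hp)]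
        rw [h2]
        refine hz false i j _ (ih _ ?_)
        rw [Finset.sum_update_of_mem (Finset.mem_univ _)]
        rw [← Finset.add_sum_erase Finset.univ b.1 (Finset.mem_univ (i, j))] at hb
        simp only [Finset.sdiff_singleton_eq_erase]
        omega
      · by_cases h' : ∃ p, b.2 p = true
        · obtain ⟨⟨i, j⟩, hp⟩ := h'
          have h2 : bvec k F L b = osgn k b.2 (i, j) • zO k F L i j
              (bvec k F L (b.1, Function.update b.2 (i, j) false)) := by
            have : Function.update b.2 (i, j) true = b.2 := by
              rw [← hp, Function.update_eq_self]
            simp [zO_bvec, osgn_update, smul_smul, osgn_mul_self, this]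
          rw [h2]
          refine K.smul_mem _ (hz true i j _ (ih _ ?_))
          rw [← Finset.add_sum_erase Finset.univ (fun p => if b.2 p then 1 else 0)
            (Finset.mem_univ (i, j))] at hb
          have h3 : ∑ x ∈ Finset.univ.erase (i, j),
              (if Function.update b.2 (i, j) false x then 1 else 0) =
              ∑ x ∈ Finset.univ.erase (i, j), if b.2 x then 1 else 0 :=
            Finset.sum_congr rfl fun x hx => by
              rw [Function.update_of_ne (Finset.ne_of_mem_erase hx)]
          have h4 := Finset.add_sum_erase Finset.univ
            (fun p => if Function.update b.2 (i, j) false p = true then 1 else 0)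
            (Finset.mem_univ (i, j))
          rw [h3] at h4
          simp only [Function.update_self, hp, if_true, Bool.false_eq_true, if_false] at hb h4
          dsimp only
          omega
        · push Not at h h'
          simp [h, h'] at hb
  refine eq_top_iff.2 fun u _ => ?_
  induction u using Finsupp.induction_linear with
  | zero => exact K.zero_mem
  | add f g hf hg => exact K.add_mem (hf trivial) (hg trivial)
  | single b c =>
    have h1 : (Finsupp.single b c : SM k F L) = c • bvec k F L b := by simp [bvec]
    rw [h1]
    exact K.smul_mem _ (key _ b rfl)

theorem sm_induction {C : SM k F L → Prop} (h0 : C (vac k F L)) (hadd : ∀ u v, C u → C v → C (u + v))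
    (hsmul : ∀ (c : k) u, C u → C (c • u)) (hz : ∀ p i j u, C u → C (zv k p i j u))
    (u : SM k F L) : C u := by
  have := sm_submodule_eq_top (k := k)
    { carrier := {u | C u}
      add_mem' := fun {a b} ha hb => hadd a b ha hb
      zero_mem' := by simpa using hsmul 0 _ h0
      smul_mem' := fun c u hu => hsmul c u hu } h0 hz
  have h : u ∈ (⊤ : Submodule k (SM k F L)) := trivial
  rw [← this] at h
  exact h

theorem list_prod_update_mul {A P : Type*} [Ring A] [DecidableEq P] (l : List P) (hl : l.Nodup)
    (g : P → A) (p : P) (hp : p ∈ l) (x : A) (hx : ∀ q, x * g q = g q * x) :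
    (l.map (Function.update g p (x * g p))).prod = x * (l.map g).prod := by
  induction l with
  | nil => simp at hp
  | cons q l ih =>
    rw [List.nodup_cons] at hl
    rw [List.map_cons, List.prod_cons, List.map_cons, List.prod_cons]
    by_cases h : q = p
    · subst h
      rw [Function.update_self, mul_assoc]
      congr 3
      refine List.map_congr_left fun r hr => ?_
      rw [Function.update_of_ne]
      rintro rfl
      exact hl.1 hr
    · rw [Function.update_of_ne h, ih hl.2 (by simpa [Ne.symm h] using hp), ← mul_assoc,
        ← mul_assoc, hx]

theorem list_prod_odd {A P : Type*} [Ring A] [DecidableEq P] (l : List P) (hl : l.Nodup)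
    (o : P → A) (hsq : ∀ p, o p * o p = 0) (hanti : ∀ p q, o p * o q = -(o q * o p))
    (r : P → P → Bool) (hr : l.Pairwise fun a b => r a b = true ∧ r b a = false)
    (hrr : ∀ p, r p p = false) (e : P → Bool) (p : P) (hp : p ∈ l) :
    o p * (l.map fun q => if e q then o q else 1).prod =
      if e p then 0 else (-1) ^ (l.countP fun q => r q p && e q) *
        (l.map fun q => if Function.update e p true q then o q else 1).prod := by
  induction l with
  | nil => simp at hp
  | cons q l ih =>
    rw [List.nodup_cons] at hl
    rw [List.pairwise_cons] at hr
    simp only [List.map_cons, List.prod_cons]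
    by_cases h : q = p
    · subst h
      cases he : e q
      · have h1 : (l.countP fun q' => r q' q && e q') = 0 := by
          rw [List.countP_eq_zero]
          intro a ha
          simp [(hr.1 a ha).2]
        rw [List.countP_cons, h1]
        simp only [hrr, Function.update_self]
        simp only [Bool.false_eq_true, if_false, one_mul, Bool.false_and, if_true, add_zero,
          pow_zero]
        congr 2
        refine List.map_congr_left fun a ha => ?_
        rw [Function.update_of_ne]
        rintro rfl
        exact hl.1 ha
      · simp only [if_true]
        rw [← mul_assoc, hsq, zero_mul]
    · have hpl : p ∈ l := by simpa [Ne.symm h] using hp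
      have hih := ih hl.2 hr.2 hpl
      rw [List.countP_cons, Function.update_of_ne h, (hr.1 p hpl).1]
      cases he : e q
      · simp [hih]
      · simp only [if_true]
        rw [← mul_assoc, hanti, neg_mul, mul_assoc, hih]
        by_cases hep : e p = true
        · simp [hep]
        · simp [hep, pow_succ, ← mul_assoc, ((Commute.neg_one_right (o q)).pow_right _).eq]

/-- All positions, in increasing order. -/
def posList (F L : ℕ) : List (Fin F × Fin L) := (List.finRange (F * L)).map finProdFinEquiv.symm

theorem posIdx_finProdFinEquiv_symm (a : Fin (F * L)) :
    posIdx (finProdFinEquiv.symm a : Fin F × Fin L) = a.val := by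
  have h : ∀ p : Fin F × Fin L, posIdx p = (finProdFinEquiv p).val := by
    intro p
    simp [posIdx, finProdFinEquiv]
    ring
  rw [h, Equiv.apply_symm_apply]

theorem posList_nodup : (posList F L).Nodup :=
  (List.nodup_finRange _).map (Equiv.injective _)

theorem mem_posList (p : Fin F × Fin L) : p ∈ posList F L := by
  simp only [posList, List.mem_map, List.mem_finRange, true_and]
  exact ⟨finProdFinEquiv p, by simp⟩

theorem posList_pairwise : (posList F L).Pairwise
    fun a b => decide (posIdx a < posIdx b) = true ∧ decide (posIdx b < posIdx a) = false := by
  rw [posList, List.pairwise_map]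
  refine (List.pairwise_lt_finRange _).imp fun {a b} hab => ?_
  simp only [posIdx_finProdFinEquiv_symm]
  have : a.val < b.val := hab
  simp [this, Nat.le_of_lt this, Fin.le_def]

theorem countP_posList (e : Fin F × Fin L → Bool) (p : Fin F × Fin L) :
    (posList F L).countP (fun q => decide (posIdx q < posIdx p) && e q) = oddBefore e p := by
  rw [List.countP_eq_length_filter, oddBefore, ← List.toFinset_card_of_nodup
    (posList_nodup.filter _)]
  congr 1
  ext q
  simp [mem_posList]

theorem exists_sm_lift [CharZero k] {M : Type*} [AddCommGroup M] [Module k M]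
    (Z : Bool → Fin F → Fin L → Module.End k M)
    (hZ : ∀ p q i j i' j', Z p i j * Z q i' j' = sgm p q (Z q i' j' * Z p i j)) (v0 : M) :
    ∃ Θ : SM k F L →ₗ[k] M, Θ (vac k F L) = v0 ∧ ∀ p i j u, Θ (zv k p i j u) = Z p i j (Θ u) := by
  set E : (Fin F × Fin L → ℕ) → Module.End k M := fun d =>
    ((posList F L).map fun p => Z false p.1 p.2 ^ d p).prod with hE
  set O : (Fin F × Fin L → Bool) → Module.End k M := fun e =>
    ((posList F L).map fun p => if e p then Z true p.1 p.2 else 1).prod with hO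
  have hsq : ∀ p : Fin F × Fin L, Z true p.1 p.2 * Z true p.1 p.2 = 0 := by
    intro p
    have h := hZ true true p.1 p.2 p.1 p.2
    rw [sgm_true_true, eq_neg_iff_add_eq_zero, ← two_smul k] at h
    exact (smul_eq_zero.1 h).resolve_left two_ne_zero
  refine ⟨Finsupp.linearCombination k fun b => E b.1 (O b.2 v0), ?_, ?_⟩
  · simp [vac, bvec, Finsupp.linearCombination_single, hE, hO]
  · intro p i j u
    have hlin : (Finsupp.linearCombination k fun b => E b.1 (O b.2 v0)) ∘ₗ zv k p i j =
        Z p i j ∘ₗ (Finsupp.linearCombination k fun b : MonB F L => E b.1 (O b.2 v0)) := by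
      refine end_ext_bvec fun b => ?_
      have hb : ∀ b : MonB F L, (Finsupp.linearCombination k fun b => E b.1 (O b.2 v0))
          (bvec k F L b) = E b.1 (O b.2 v0) := by
        intro b; simp [bvec, Finsupp.linearCombination_single]
      rw [LinearMap.comp_apply, LinearMap.comp_apply, hb]
      cases p
      · rw [zv_false, zE_bvec, hb, ← Module.End.mul_apply (Z false i j)]
        congr 1
        simp only [hE]
        rw [← list_prod_update_mul _ posList_nodup _ (i, j) (mem_posList _) (Z false i j)]
        · congr 2
          ext1 q
          by_cases h : q = (i, j)
          · subst h; simp [pow_succ']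
          · rw [Function.update_of_ne h, Function.update_of_ne h]
        · intro q
          exact ((show Commute (Z false i j) (Z false q.1 q.2) from hZ _ _ _ _ _ _).pow_right _).eq
      · have hcomm : Z true i j * E b.1 = E b.1 * Z true i j := by
          refine (Commute.list_prod_right _ _ fun x hx => ?_ : Commute (Z true i j) (E b.1)).eq
          obtain ⟨q, -, rfl⟩ := List.mem_map.1 hx
          exact (show Commute (Z true i j) (Z false q.1 q.2) from
            hZ true false i j q.1 q.2).pow_right _
        rw [zv_true, zO_bvec, ← Module.End.mul_apply (Z true i j), hcomm, Module.End.mul_apply,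
          ← Module.End.mul_apply (Z true i j)]
        have h := list_prod_odd (posList F L) posList_nodup (fun p => Z true p.1 p.2) hsq
          (fun p q => hZ true true _ _ _ _) (fun a b => decide (posIdx a < posIdx b))
          posList_pairwise (by simp) b.2 (i, j) (mem_posList _)
        simp only [hO] at h ⊢
        rw [h]
        split_ifs
        · simp
        · rw [map_smul, hb, countP_posList, osgn]
          simp only [hO]
          rcases neg_one_pow_eq_or (Module.End k M) (oddBefore b.2 (i, j)) with h1 | h1 <;>
          rcases neg_one_pow_eq_or k (oddBefore b.2 (i, j)) with h2 | h2
          · simp [h1, h2]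
          · rcases Nat.even_or_odd (oddBefore b.2 (i, j)) with h3 | h3
            · simp [h3]
            · simp [h3]
          · rcases Nat.even_or_odd (oddBefore b.2 (i, j)) with h3 | h3
            · simp [h3]
            · simp [h3]
          · simp [h1, h2]
    exact LinearMap.congr_fun hlin u

end UniversalProperty

section FockCalculus

section Signs

variable {A : Type*} [Ring A]

theorem sgm_zero (p q : Bool) : sgm p q (0 : A) = 0 := by cases p <;> cases q <;> simp
theorem sgm_add (p q : Bool) (x y : A) : sgm p q (x + y) = sgm p q x + sgm p q y := by
  cases p <;> cases q <;> simp [add_comm]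
theorem sgm_sub (p q : Bool) (x y : A) : sgm p q (x - y) = sgm p q x - sgm p q y := by
  cases p <;> cases q <;> simp [neg_add_eq_sub]
theorem sgm_neg (p q : Bool) (x : A) : sgm p q (-x) = -sgm p q x := by
  cases p <;> cases q <;> simp
theorem sgm_mul (p q : Bool) (x y : A) : sgm p q x * y = sgm p q (x * y) := by
  cases p <;> cases q <;> simp
theorem mul_sgm (p q : Bool) (x y : A) : x * sgm p q y = sgm p q (x * y) := by
  cases p <;> cases q <;> simp
theorem sgm_sum {ι : Type*} (s : Finset ι) (p q : Bool) (f : ι → A) :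
    sgm p q (∑ i ∈ s, f i) = ∑ i ∈ s, sgm p q (f i) := by
  cases p <;> cases q <;> simp
theorem sgm_sgm_left (p p' q : Bool) (x : A) : sgm p q (sgm p' q x) = sgm (xor p p') q x := by
  cases p <;> cases p' <;> cases q <;> simp
theorem sgm_sgm_right (p q q' : Bool) (x : A) : sgm p q (sgm p q' x) = sgm p (xor q q') x := by
  cases p <;> cases q <;> cases q' <;> simp
theorem sgm_sgm_self (p q : Bool) (x : A) : sgm p q (sgm p q x) = x := by
  cases p <;> cases q <;> simp
theorem sgm_swap (p q : Bool) (x : A) : sgm p q x = sgm q p x := by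
  cases p <;> cases q <;> simp

end Signs

/-- Creation operators `z` and annihilation operators `d`, indexed by a sign (`true` for negative
rows), a row and a column, satisfying the canonical supercommutation relations. -/
structure Fock (A : Type*) [Ring A] {C : Type*} [DecidableEq C] (pc : C → Bool)
    (R : Type*) [DecidableEq R] where
  z : Bool → R → C → A
  d : Bool → R → C → A
  zz : ∀ β γ i j c c', z β i c * z γ j c' =
    sgm (xor β (pc c)) (xor γ (pc c')) (z γ j c' * z β i c)
  dd : ∀ β γ i j c c', d β i c * d γ j c' =
    sgm (xor β (pc c)) (xor γ (pc c')) (d γ j c' * d β i c)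
  dz : ∀ β γ i j c c', d β i c * z γ j c' =
    sgm (xor β (pc c)) (xor γ (pc c')) (z γ j c' * d β i c) +
      if β = γ ∧ i = j ∧ c = c' then 1 else 0

namespace Fock

variable {A : Type*} [Ring A] {C R : Type*} [DecidableEq C] [DecidableEq R]
  {pc : C → Bool} (X : Fock A pc R)

theorem zd (β γ : Bool) (i j : R) (c c' : C) : X.z β i c * X.d γ j c' =
    sgm (xor β (pc c)) (xor γ (pc c')) (X.d γ j c' * X.z β i c) -
      sgm (xor β (pc c)) (xor γ (pc c')) (if β = γ ∧ i = j ∧ c = c' then 1 else 0) := by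
  have h : (γ = β ∧ j = i ∧ c' = c) ↔ (β = γ ∧ i = j ∧ c = c') := by
    simp only [eq_comm]
  rw [X.dz, sgm_add, sgm_swap (xor γ _), sgm_sgm_self]
  simp only [h]
  rw [add_sub_cancel_right]

/-- A single summand of the action of a matrix unit. -/
theorem zd_z (β β' γ : Bool) (i j l : R) (a b c : C) :
    X.z β i a * X.d β' j b * X.z γ l c =
      sgm (xor (xor β β') (xor (pc a) (pc b))) (xor γ (pc c))
        (X.z γ l c * (X.z β i a * X.d β' j b)) +
        if β' = γ ∧ j = l ∧ b = c then X.z β i a else 0 := by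
  rw [mul_assoc, X.dz, mul_add, mul_sgm, ← mul_assoc, X.zz, sgm_mul, mul_assoc, sgm_sgm_left]
  congr 2
  · cases β <;> cases β' <;> cases pc a <;> cases pc b <;> rfl
  · split_ifs <;> simp

theorem zd_d (β β' γ : Bool) (i j l : R) (a b c : C) :
    X.z β i a * X.d β' j b * X.d γ l c =
      sgm (xor (xor β β') (xor (pc a) (pc b))) (xor γ (pc c))
        (X.d γ l c * (X.z β i a * X.d β' j b)) -
        sgm (xor (xor β β') (xor (pc a) (pc b))) (xor γ (pc c))
          (if β = γ ∧ i = l ∧ a = c then X.d β' j b else 0) := by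
  rw [mul_assoc, X.dd, mul_sgm, ← mul_assoc, X.zd, sub_mul, sgm_sub, sgm_mul, sgm_mul, mul_assoc,
    sgm_sgm_left, sgm_sgm_left]
  have h : xor (xor β' (pc b)) (xor β (pc a)) = xor (xor β β') (xor (pc a) (pc b)) := by
    cases β <;> cases β' <;> cases pc a <;> cases pc b <;> rfl
  rw [h]
  congr 2
  split_ifs <;> simp

section Rows

variable [Fintype C]

/-- The action of the matrix unit of `gl(n|n)` at position `((β, i), (β', j))`. -/
def eop (β β' : Bool) (i j : R) : A := ∑ c, X.z β i c * X.d β' j c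

theorem eop_z (β β' γ : Bool) (i j l : R) (c : C) :
    X.eop β β' i j * X.z γ l c = sgm (xor β β') (xor γ (pc c)) (X.z γ l c * X.eop β β' i j) +
      if β' = γ ∧ j = l then X.z β i c else 0 := by
  simp only [eop, Finset.sum_mul, zd_z, Bool.xor_self, Bool.xor_false, Finset.sum_add_distrib, Finset.mul_sum, sgm_sum]
  congr 1
  by_cases h : β' = γ ∧ j = l
  · simp [h]
  · simp only [if_neg h]
    refine Finset.sum_eq_zero fun c' _ => if_neg fun h' => h ⟨h'.1, h'.2.1⟩

theorem eop_d (β β' γ : Bool) (i j l : R) (c : C) :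
    X.eop β β' i j * X.d γ l c = sgm (xor β β') (xor γ (pc c)) (X.d γ l c * X.eop β β' i j) -
      sgm (xor β β') (xor γ (pc c)) (if β = γ ∧ i = l then X.d β' j c else 0) := by
  simp only [eop, Finset.sum_mul, zd_d, Bool.xor_self, Bool.xor_false, Finset.sum_sub_distrib, Finset.mul_sum, sgm_sum]
  congr 1
  by_cases h : β = γ ∧ i = l
  · simp only [h, true_and]
    rw [Finset.sum_eq_single c (fun b _ hb => by simp [hb, sgm_zero]) (by simp)]
    simp
  · simp only [if_neg h, sgm_zero]
    refine Finset.sum_eq_zero fun c' _ => ?_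
    rw [if_neg fun h' => h ⟨h'.1, h'.2.1⟩, sgm_zero]

theorem eop_eop (β β' γ γ' : Bool) (i j k l : R) :
    X.eop β β' i j * X.eop γ γ' k l =
      sgm (xor β β') (xor γ γ') (X.eop γ γ' k l * X.eop β β' i j) +
        (if β' = γ ∧ j = k then X.eop β γ' i l else 0) -
        sgm (xor β β') (xor γ γ') (if β = γ' ∧ i = l then X.eop γ β' k j else 0) := by
  have h : ∀ c, X.eop β β' i j * (X.z γ k c * X.d γ' l c) =
      sgm (xor β β') (xor γ γ') (X.z γ k c * X.d γ' l c * X.eop β β' i j) +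
      (if β' = γ ∧ j = k then X.z β i c * X.d γ' l c else 0) -
      sgm (xor β β') (xor γ γ') (if β = γ' ∧ i = l then X.z γ k c * X.d β' j c else 0) := by
    intro c
    have hx : xor (xor γ (pc c)) (xor γ' (pc c)) = xor γ γ' := by
      cases γ <;> cases γ' <;> cases pc c <;> rfl
    rw [← mul_assoc, eop_z, add_mul, sgm_mul, mul_assoc, eop_d, mul_sub, mul_sgm, mul_sgm,
      sgm_sub, sgm_sgm_right, sgm_sgm_right, hx, ← mul_assoc]
    split_ifs <;> (try simp only [mul_zero, zero_mul, sgm_zero, add_zero, sub_zero]) <;> abel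
  rw [show X.eop γ γ' k l = ∑ c, X.z γ k c * X.d γ' l c from rfl, Finset.mul_sum]
  simp only [h, Finset.sum_sub_distrib, Finset.sum_add_distrib, ← sgm_sum, ← Finset.sum_mul]
  congr 2
  · split_ifs <;> simp [eop]
  · split_ifs <;> simp [eop]

/-- The action of `a_{i,j}`. -/
def ra (i j : R) : A := X.eop false false i j - X.eop true true j i
/-- The action of `b_{i,j}` (twice it, on the diagonal). -/
def rb (i j : R) : A := X.eop false true i j + X.eop false true j i
/-- The action of `c_{i,j}`. -/
def rc (i j : R) : A := X.eop true false i j - X.eop true false j i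

theorem rb_symm (i j : R) : X.rb i j = X.rb j i := add_comm _ _
theorem rc_symm (i j : R) : X.rc i j = -X.rc j i := (neg_sub _ _).symm

theorem ra_ra (i j k l : R) : X.ra i j * X.ra k l = X.ra k l * X.ra i j +
    (if j = k then X.ra i l else 0) - (if i = l then X.ra k j else 0) := by
  simp only [ra, sub_mul, mul_sub, eop_eop (i := i) (j := j), eop_eop (i := j) (j := i)]
  simp only [Bool.xor_false, Bool.xor_true, sgm_false_left, Bool.not_true, Bool.not_false,
    true_and, false_and, reduceCtorEq, if_false, eq_comm]
  split_ifs <;> abel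

theorem ra_rb (i j k l : R) : X.ra i j * X.rb k l = X.rb k l * X.ra i j +
    (if j = k then X.rb i l else 0) + (if j = l then X.rb i k else 0) := by
  simp only [ra, rb, sub_mul, mul_sub, mul_add, add_mul, eop_eop (γ := false) (i := i),
    eop_eop (γ := false) (i := j)]
  simp only [Bool.xor_false, Bool.xor_true, sgm_false_left, Bool.not_true, Bool.not_false,
    true_and, false_and, reduceCtorEq, if_false, eq_comm]
  split_ifs <;> abel

theorem ra_rc (i j k l : R) : X.ra i j * X.rc k l = X.rc k l * X.ra i j -
    (if i = k then X.rc j l else 0) - (if i = l then X.rc k j else 0) := by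
  simp only [ra, rc, sub_mul, mul_sub, eop_eop (γ := true) (γ' := false) (i := i),
    eop_eop (γ := true) (γ' := false) (i := j)]
  simp only [Bool.xor_false, Bool.xor_true, sgm_false_left, Bool.not_true, Bool.not_false,
    true_and, false_and, reduceCtorEq, if_false, eq_comm]
  split_ifs <;> abel

theorem rb_rb (i j k l : R) : X.rb i j * X.rb k l = -(X.rb k l * X.rb i j) := by
  simp only [rb, mul_add, add_mul, eop_eop (k := k), eop_eop (k := l)]
  simp only [Bool.xor_false, Bool.xor_true, Bool.not_true, Bool.not_false, sgm_true_true,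
    false_and, reduceCtorEq, if_false]
  abel

theorem rc_rc (i j k l : R) : X.rc i j * X.rc k l = -(X.rc k l * X.rc i j) := by
  simp only [rc, mul_sub, sub_mul, eop_eop (k := k), eop_eop (k := l)]
  simp only [Bool.xor_false, Bool.xor_true, Bool.not_true, Bool.not_false, sgm_true_true,
    false_and, reduceCtorEq, if_false]
  abel

theorem rb_rc (i j k l : R) : X.rb i j * X.rc k l = -(X.rc k l * X.rb i j) +
    (if j = k then X.ra i l else 0) - (if j = l then X.ra i k else 0) +
    (if i = k then X.ra j l else 0) - (if i = l then X.ra j k else 0) := by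
  simp only [rb, rc, ra, mul_sub, sub_mul, add_mul, mul_add, eop_eop (γ := true) (γ' := false)
    (i := i), eop_eop (γ := true) (γ' := false) (i := j)]
  simp only [Bool.xor_false, Bool.xor_true, Bool.not_true, Bool.not_false, sgm_true_true,
    true_and]
  split_ifs <;> abel

end Rows

section Columns

variable [Fintype R]

/-- The action of the matrix unit `(c, c')` of the general linear superalgebra of columns. -/
def cE (c c' : C) : A := ∑ p : Bool × R,
  sgm p.1 (xor (pc c) (pc c')) (X.z p.1 p.2 c * X.d p.1 p.2 c')
/-- The quadratic invariant creation operator. -/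
def cq (c c' : C) : A := ∑ p : Bool × R, sgm p.1 (!pc c) (X.z p.1 p.2 c * X.z (!p.1) p.2 c')
/-- The quadratic invariant annihilation operator. -/
def ck (c c' : C) : A := ∑ p : Bool × R, sgm p.1 (pc c') (X.d p.1 p.2 c * X.d (!p.1) p.2 c')

theorem cE_z (γ : Bool) (l : R) (a b c : C) :
    X.cE a b * X.z γ l c = sgm (xor (pc a) (pc b)) (xor γ (pc c)) (X.z γ l c * X.cE a b) +
      if b = c then sgm γ (xor (pc a) (pc b)) (X.z γ l a) else 0 := by
  simp only [cE, Finset.sum_mul, sgm_mul, zd_z, Bool.xor_self, Bool.false_xor, sgm_add,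
    Finset.sum_add_distrib, Finset.mul_sum, sgm_sum, mul_sgm]
  congr 1
  · refine Finset.sum_congr rfl fun p _ => ?_
    cases p.1 <;> cases γ <;> cases pc a <;> cases pc b <;> cases pc c <;> simp
  · rw [Finset.sum_eq_single (γ, l)]
    · simp only [true_and]
      split_ifs <;> simp [sgm_zero]
    · intro p _ hp
      rw [if_neg, sgm_zero]
      exact fun h => hp (Prod.ext h.1 h.2.1)
    · simp

theorem cE_d (γ : Bool) (l : R) (a b c : C) :
    X.cE a b * X.d γ l c = sgm (xor (pc a) (pc b)) (xor γ (pc c)) (X.d γ l c * X.cE a b) -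
      if a = c then sgm (xor (pc a) (pc b)) (pc a) (X.d γ l b) else 0 := by
  simp only [cE, Finset.sum_mul, sgm_mul, zd_d, Bool.xor_self, Bool.false_xor, sgm_sub,
    Finset.sum_sub_distrib, Finset.mul_sum, sgm_sum, mul_sgm]
  congr 1
  · refine Finset.sum_congr rfl fun p _ => ?_
    cases p.1 <;> cases γ <;> cases pc a <;> cases pc b <;> cases pc c <;> simp
  · rw [Finset.sum_eq_single (γ, l)]
    · simp only [true_and]
      split_ifs with h
      · subst h
        cases γ <;> cases pc a <;> cases pc b <;> simp
      · simp [sgm_zero]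
    · intro p _ hp
      rw [if_neg, sgm_zero, sgm_zero]
      exact fun h => hp (Prod.ext h.1 h.2.1)
    · simp

theorem cE_cE (a b c d : C) :
    X.cE a b * X.cE c d = sgm (xor (pc a) (pc b)) (xor (pc c) (pc d)) (X.cE c d * X.cE a b) +
      (if b = c then X.cE a d else 0) -
      (if a = d then sgm (xor (pc a) (pc b)) (xor (pc c) (pc d)) (X.cE c b) else 0) := by
  have h : ∀ p : Bool × R, X.cE a b * sgm p.1 (xor (pc c) (pc d)) (X.z p.1 p.2 c * X.d p.1 p.2 d) =
      sgm (xor (pc a) (pc b)) (xor (pc c) (pc d))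
        (sgm p.1 (xor (pc c) (pc d)) (X.z p.1 p.2 c * X.d p.1 p.2 d) * X.cE a b) +
      (if b = c then sgm p.1 (xor (pc a) (pc d)) (X.z p.1 p.2 a * X.d p.1 p.2 d) else 0) -
      (if a = d then sgm (xor (pc a) (pc b)) (xor (pc c) (pc d))
        (sgm p.1 (xor (pc c) (pc b)) (X.z p.1 p.2 c * X.d p.1 p.2 b)) else 0) := by
    rintro ⟨γ, l⟩
    rw [mul_sgm, ← mul_assoc, cE_z, add_mul, sgm_mul, mul_assoc, cE_d, mul_sub, mul_sgm]
    dsimp only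
    by_cases h1 : b = c
    · subst h1
      by_cases h2 : a = d
      · subst h2
        cases γ <;> cases pc a <;> cases pc b <;> simp [mul_assoc] <;> abel
      · cases γ <;> cases pc a <;> cases pc b <;> cases pc d <;> simp [mul_assoc, h2, add_comm]
    · by_cases h2 : a = d
      · subst h2
        cases γ <;> cases pc a <;> cases pc b <;> cases pc c <;> simp [mul_assoc, h1] <;> abel
      · cases γ <;> cases pc a <;> cases pc b <;> cases pc c <;> cases pc d <;>
          simp [mul_assoc, h1, h2, add_comm]
  rw [show X.cE c d = ∑ p : Bool × R, sgm p.1 (xor (pc c) (pc d)) (X.z p.1 p.2 c * X.d p.1 p.2 d)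
    from rfl, Finset.mul_sum]
  simp only [h, Finset.sum_sub_distrib, Finset.sum_add_distrib, ← sgm_sum, ← Finset.sum_mul]
  congr 2
  · split_ifs <;> simp [cE]
  · split_ifs <;> simp [cE, sgm_sum]

theorem cq_symm (a b : C) : X.cq b a =
    sgm (!xor (pc a) (pc b)) (!pc a) (X.cq a b) := by
  rw [cq, cq, sgm_sum, Fintype.sum_prod_type, Fintype.sum_prod_type, Fintype.sum_bool,
    Fintype.sum_bool, add_comm]
  congr 1 <;> refine Finset.sum_congr rfl fun l _ => ?_
  all_goals
    dsimp only
    rw [X.zz]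
    cases pc a <;> cases pc b <;> simp

theorem cq_z (γ : Bool) (l : R) (a b c : C) :
    X.cq a b * X.z γ l c =
      sgm (!xor (pc a) (pc b)) (xor γ (pc c)) (X.z γ l c * X.cq a b) := by
  simp only [cq, Finset.sum_mul, Finset.mul_sum, sgm_sum]
  refine Finset.sum_congr rfl fun p _ => ?_
  rw [sgm_mul, mul_assoc, X.zz, mul_sgm, ← mul_assoc, X.zz, sgm_mul, mul_sgm, mul_assoc]
  cases p.1 <;> cases γ <;> cases pc a <;> cases pc b <;> cases pc c <;> simp

theorem cE_cq (c d a b : C) :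
    X.cE c d * X.cq a b =
      sgm (xor (pc c) (pc d)) (!xor (pc a) (pc b)) (X.cq a b * X.cE c d) +
      (if d = a then X.cq c b else 0) +
      (if d = b then sgm (xor (pc c) (pc d)) (!pc a) (X.cq a c) else 0) := by
  have h : ∀ p : Bool × R, X.cE c d * sgm p.1 (!pc a) (X.z p.1 p.2 a * X.z (!p.1) p.2 b) =
      sgm (xor (pc c) (pc d)) (!xor (pc a) (pc b))
        (sgm p.1 (!pc a) (X.z p.1 p.2 a * X.z (!p.1) p.2 b) * X.cE c d) +
      (if d = a then sgm p.1 (!pc c) (X.z p.1 p.2 c * X.z (!p.1) p.2 b) else 0) +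
      (if d = b then sgm (xor (pc c) (pc d)) (!pc a)
        (sgm p.1 (!pc a) (X.z p.1 p.2 a * X.z (!p.1) p.2 c)) else 0) := by
    rintro ⟨γ, l⟩
    rw [mul_sgm, ← mul_assoc, cE_z, add_mul, sgm_mul, mul_assoc, cE_z, mul_add, mul_sgm]
    dsimp only
    by_cases h1 : d = a
    · subst h1
      by_cases h2 : d = b
      · subst h2
        cases γ <;> cases pc c <;> cases pc d <;> simp [mul_assoc] <;> abel
      · cases γ <;> cases pc c <;> cases pc b <;> cases pc d <;>
          simp [mul_assoc, h2, add_comm]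
    · by_cases h2 : d = b
      · subst h2
        cases γ <;> cases pc a <;> cases pc d <;> cases pc c <;> simp [mul_assoc, h1, add_comm]
      · cases γ <;> cases pc a <;> cases pc b <;> cases pc c <;> cases pc d <;>
          simp [mul_assoc, h1, h2, add_comm]
  rw [show X.cq a b = ∑ p : Bool × R, sgm p.1 (!pc a) (X.z p.1 p.2 a * X.z (!p.1) p.2 b)
    from rfl, Finset.mul_sum]
  simp only [h, Finset.sum_add_distrib, ← sgm_sum, ← Finset.sum_mul]
  congr 2
  · split_ifs <;> simp [cq]
  · split_ifs <;> simp [cq, sgm_sum]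

theorem cE_ck_diag (c a b : C) :
    X.cE c c * X.ck a b = X.ck a b * X.cE c c - (if c = a then X.ck a b else 0) -
      (if c = b then X.ck a b else 0) := by
  simp only [ck, Finset.sum_mul, Finset.mul_sum, sgm_mul, mul_sgm]
  have h : ∀ p : Bool × R, X.cE c c * (X.d p.1 p.2 a * X.d (!p.1) p.2 b) =
      X.d p.1 p.2 a * X.d (!p.1) p.2 b * X.cE c c -
      (if c = a then X.d p.1 p.2 a * X.d (!p.1) p.2 b else 0) -
      (if c = b then X.d p.1 p.2 a * X.d (!p.1) p.2 b else 0) := by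
    intro p
    rw [← mul_assoc, cE_d, sub_mul, Bool.xor_self, sgm_false_left, mul_assoc, cE_d, mul_sub]
    simp only [Bool.xor_self, sgm_false_left]
    split_ifs with h1 h2 <;> simp [mul_assoc] <;> (try subst h1) <;> (try subst h2) <;>
      simp_all <;> abel
  simp only [h, sgm_sub, Finset.sum_sub_distrib]
  split_ifs <;> simp [sgm_zero]

variable [Fintype C]

theorem eop_cE (β β' : Bool) (i j : R) (c c' : C) :
    X.eop β β' i j * X.cE c c' =
      sgm (xor β β') (xor (pc c) (pc c')) (X.cE c c' * X.eop β β' i j) := by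
  have h : ∀ p : Bool × R, X.eop β β' i j * sgm p.1 (xor (pc c) (pc c'))
      (X.z p.1 p.2 c * X.d p.1 p.2 c') =
      sgm (xor β β') (xor (pc c) (pc c'))
        (sgm p.1 (xor (pc c) (pc c')) (X.z p.1 p.2 c * X.d p.1 p.2 c') * X.eop β β' i j) +
      (if p = (β', j) then sgm p.1 (xor (pc c) (pc c')) (X.z β i c * X.d β' j c') else 0) -
      (if p = (β, i) then
        sgm β' (xor (pc c) (pc c')) (X.z β i c * X.d β' j c') else 0) := by
    rintro ⟨γ, l⟩
    rw [mul_sgm, ← mul_assoc, eop_z, add_mul, sgm_mul, mul_assoc, eop_d, mul_sub, mul_sgm]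
    dsimp only
    simp only [Prod.mk.injEq, @eq_comm _ γ, @eq_comm _ l]
    by_cases h1 : β' = γ ∧ j = l
    · obtain ⟨rfl, rfl⟩ := h1
      by_cases h2 : β = β' ∧ i = j
      · obtain ⟨rfl, rfl⟩ := h2
        cases β <;> cases pc c <;> cases pc c' <;> simp [mul_assoc]
      · rw [if_neg h2, if_neg h2]
        cases β <;> cases β' <;> cases pc c <;> cases pc c' <;> simp [mul_assoc, add_comm]
    · rw [if_neg h1, if_neg h1]
      by_cases h2 : β = γ ∧ i = l
      · obtain ⟨rfl, rfl⟩ := h2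
        cases β <;> cases β' <;> cases pc c <;> cases pc c' <;> simp [mul_assoc] <;> abel
      · rw [if_neg h2, if_neg h2]
        cases β <;> cases β' <;> cases γ <;> cases pc c <;> cases pc c' <;> simp [mul_assoc]
  rw [cE, Finset.mul_sum]
  simp only [h, Finset.sum_sub_distrib, Finset.sum_add_distrib, Finset.sum_ite_eq',
    Finset.mem_univ, if_true, add_sub_cancel_right, ← sgm_sum, ← Finset.sum_mul]

theorem eop_cq (β β' : Bool) (i j : R) (c c' : C) :
    X.eop β β' i j * X.cq c c' =
      sgm (xor β β') (!xor (pc c) (pc c')) (X.cq c c' * X.eop β β' i j) +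
      (sgm β' (!pc c) (X.z β i c * X.z (!β') j c') +
       sgm (!β') (!pc c) (sgm (xor β β') (xor (!β') (pc c)) (X.z (!β') j c * X.z β i c'))) := by
  have h : ∀ p : Bool × R, X.eop β β' i j * sgm p.1 (!pc c)
      (X.z p.1 p.2 c * X.z (!p.1) p.2 c') =
      sgm (xor β β') (!xor (pc c) (pc c'))
        (sgm p.1 (!pc c) (X.z p.1 p.2 c * X.z (!p.1) p.2 c') * X.eop β β' i j) +
      ((if p = (β', j) then sgm β' (!pc c) (X.z β i c * X.z (!β') j c') else 0) +
       (if p = (!β', j) then sgm (!β') (!pc c) (sgm (xor β β') (xor (!β') (pc c))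
          (X.z (!β') j c * X.z β i c')) else 0)) := by
    rintro ⟨γ, l⟩
    rw [mul_sgm, ← mul_assoc, eop_z, add_mul, sgm_mul, mul_assoc, eop_z, mul_add, mul_sgm]
    dsimp only
    simp only [Prod.mk.injEq, @eq_comm _ γ, @eq_comm _ l]
    by_cases h1 : j = l
    · subst h1
      cases β <;> cases β' <;> cases γ <;> cases pc c <;> cases pc c' <;> simp [mul_assoc] <;> abel
    · cases β <;> cases β' <;> cases γ <;> cases pc c <;> cases pc c' <;> simp [mul_assoc, h1, add_comm]
  rw [cq, Finset.mul_sum]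
  simp only [h, Finset.sum_add_distrib, Finset.sum_ite_eq',
    Finset.mem_univ, if_true, ← sgm_sum, ← Finset.sum_mul]

theorem eop_ck (β β' : Bool) (i j : R) (c c' : C) :
    X.eop β β' i j * X.ck c c' =
      sgm (xor β β') (!xor (pc c) (pc c')) (X.ck c c' * X.eop β β' i j) -
      (sgm β (pc c') (sgm (xor β β') (xor β (pc c)) (X.d β' j c * X.d (!β) i c')) +
       sgm (!β) (pc c') (sgm (xor β β') (!xor (pc c) (pc c')) (X.d (!β) i c * X.d β' j c'))) := by
  have h : ∀ p : Bool × R, X.eop β β' i j * sgm p.1 (pc c')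
      (X.d p.1 p.2 c * X.d (!p.1) p.2 c') =
      sgm (xor β β') (!xor (pc c) (pc c'))
        (sgm p.1 (pc c') (X.d p.1 p.2 c * X.d (!p.1) p.2 c') * X.eop β β' i j) -
      ((if p = (β, i) then sgm β (pc c') (sgm (xor β β') (xor β (pc c))
          (X.d β' j c * X.d (!β) i c')) else 0) +
       (if p = (!β, i) then sgm (!β) (pc c') (sgm (xor β β') (!xor (pc c) (pc c'))
          (X.d (!β) i c * X.d β' j c')) else 0)) := by
    rintro ⟨γ, l⟩
    rw [mul_sgm, ← mul_assoc, eop_d, sub_mul, sgm_mul, mul_assoc, eop_d, mul_sub, mul_sgm]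
    dsimp only
    simp only [Prod.mk.injEq, @eq_comm _ γ, @eq_comm _ l]
    by_cases h1 : i = l
    · subst h1
      cases β <;> cases β' <;> cases γ <;> cases pc c <;> cases pc c' <;> simp [mul_assoc] <;> abel
    · cases β <;> cases β' <;> cases γ <;> cases pc c <;> cases pc c' <;> simp [mul_assoc, h1, add_comm]
  rw [ck, Finset.mul_sum]
  simp only [h, Finset.sum_sub_distrib, Finset.sum_add_distrib, Finset.sum_ite_eq',
    Finset.mem_univ, if_true, ← sgm_sum, ← Finset.sum_mul]

theorem ra_cE (i j : R) (c c' : C) : X.ra i j * X.cE c c' = X.cE c c' * X.ra i j := by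
  simp [ra, sub_mul, mul_sub, eop_cE]
theorem rb_cE (i j : R) (c c' : C) :
    X.rb i j * X.cE c c' = sgm true (xor (pc c) (pc c')) (X.cE c c' * X.rb i j) := by
  simp [rb, add_mul, mul_add, eop_cE, sgm_add]
theorem rc_cE (i j : R) (c c' : C) :
    X.rc i j * X.cE c c' = sgm true (xor (pc c) (pc c')) (X.cE c c' * X.rc i j) := by
  simp [rc, sub_mul, mul_sub, eop_cE, sgm_sub]

theorem ra_cq (i j : R) (c c' : C) : X.ra i j * X.cq c c' = X.cq c c' * X.ra i j := by
  simp only [ra, sub_mul, mul_sub, eop_cq]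
  cases pc c <;> cases pc c' <;> simp <;> abel
theorem rb_cq (i j : R) (c c' : C) :
    X.rb i j * X.cq c c' = sgm true (!xor (pc c) (pc c')) (X.cq c c' * X.rb i j) := by
  simp only [rb, add_mul, mul_add, eop_cq, sgm_add]
  cases pc c <;> cases pc c' <;> simp <;> abel
theorem rc_cq (i j : R) (c c' : C) :
    X.rc i j * X.cq c c' = sgm true (!xor (pc c) (pc c')) (X.cq c c' * X.rc i j) := by
  simp only [rc, sub_mul, mul_sub, eop_cq, sgm_sub]
  cases pc c <;> cases pc c' <;> simp <;> abel

theorem ra_ck (i j : R) (c c' : C) : X.ra i j * X.ck c c' = X.ck c c' * X.ra i j := by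
  simp only [ra, sub_mul, mul_sub, eop_ck]
  cases pc c <;> cases pc c' <;> simp <;> abel
theorem rb_ck (i j : R) (c c' : C) :
    X.rb i j * X.ck c c' = sgm true (!xor (pc c) (pc c')) (X.ck c c' * X.rb i j) := by
  simp only [rb, add_mul, mul_add, eop_ck, sgm_add]
  cases pc c <;> cases pc c' <;> simp <;> abel
theorem rc_ck (i j : R) (c c' : C) :
    X.rc i j * X.ck c c' = sgm true (!xor (pc c) (pc c')) (X.ck c c' * X.rc i j) := by
  simp only [rc, sub_mul, mul_sub, eop_ck, sgm_sub]
  cases pc c <;> cases pc c' <;> simp <;> abel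

end Columns

end Fock

end FockCalculus

section Derivatives

variable {k : Type} [Field k] {F L : ℕ}

/-- The operator acting on the monomial `b` by the scalar `w b`. -/
noncomputable def diagOp (w : MonB F L → k) : Module.End k (SM k F L) :=
  opOf k F L fun b => w b • bvec k F L b

theorem diagOp_bvec (w : MonB F L → k) (b : MonB F L) :
    diagOp w (bvec k F L b) = w b • bvec k F L b := opOf_bvec _ _

theorem diagOp_apply (w : MonB F L → k) (u : SM k F L) (b : MonB F L) :
    diagOp w u b = w b * u b := by
  induction u using Finsupp.induction_linear with
  | zero => simp
  | add f g hf hg => rw [map_add, Finsupp.add_apply, Finsupp.add_apply, hf, hg, mul_add]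
  | single a c =>
    have h1 : (Finsupp.single a c : SM k F L) = c • bvec k F L a := by simp [bvec]
    rw [h1, map_smul, diagOp_bvec]
    by_cases h : a = b
    · subst h; simp [bvec]; ring
    · simp [bvec, Finsupp.single_eq_of_ne (Ne.symm h)]

theorem eq_diagOp {D : Module.End k (SM k F L)} {w : MonB F L → k}
    (h : ∀ b, D (bvec k F L b) = w b • bvec k F L b) : D = diagOp w :=
  end_ext_bvec fun b => by rw [h, diagOp_bvec]

/-- An element annihilated by all derivatives is a constant. -/
theorem exists_smul_vac [CharZero k] {u : SM k F L} (h : ∀ p i j, dv k p i j u = 0) :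
    ∃ c : k, u = c • vac k F L := by
  have hD : (∑ p : Fin F × Fin L, (zE k F L p.1 p.2 * dE k F L p.1 p.2 +
      zO k F L p.1 p.2 * dO k F L p.1 p.2)) =
      diagOp fun b => ((∑ p, (b.1 p + if b.2 p then 1 else 0) : ℕ) : k) := by
    refine eq_diagOp fun b => ?_
    rw [LinearMap.sum_apply, Nat.cast_sum, Finset.sum_smul]
    refine Finset.sum_congr rfl fun p _ => ?_
    rw [LinearMap.add_apply, Module.End.mul_apply, Module.End.mul_apply, zE_dE_bvec, zO_dO_bvec]
    simp [add_smul, ite_smul]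
  have h0 : (∑ p : Fin F × Fin L, (zE k F L p.1 p.2 * dE k F L p.1 p.2 +
      zO k F L p.1 p.2 * dO k F L p.1 p.2)) u = 0 := by
    rw [LinearMap.sum_apply]
    refine Finset.sum_eq_zero fun p _ => ?_
    have h1 := h false p.1 p.2
    have h2 := h true p.1 p.2
    rw [dv_false] at h1
    rw [dv_true] at h2
    simp [h1, h2]
  refine ⟨u (fun _ => 0, fun _ => false), ?_⟩
  ext b
  have hb := DFunLike.congr_fun h0 b
  rw [hD, diagOp_apply] at hb
  by_cases hb0 : b = (fun _ => 0, fun _ => false)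
  · subst hb0
    simp [vac, bvec]
  · have h1 : u b = 0 := by
      refine (mul_eq_zero.1 hb).resolve_left fun h2 => hb0 ?_
      rw [Nat.cast_eq_zero, Finset.sum_eq_zero_iff] at h2
      refine Prod.ext (funext fun p => ?_) (funext fun p => ?_)
      · exact (Nat.add_eq_zero_iff.1 (h2 p (Finset.mem_univ _))).1
      · have := h2 p (Finset.mem_univ _)
        by_contra h3
        simp [Bool.eq_true_of_not_eq_false h3] at this
    rw [h1]
    simp [vac, bvec, Finsupp.single_eq_of_ne hb0]

/-- The subspace of elements whose iterated derivatives of order `N` vanish. -/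
noncomputable def derivFilt (k : Type) [Field k] (F L : ℕ) : ℕ → Submodule k (SM k F L)
  | 0 => ⊥
  | N + 1 => ⨅ p, ⨅ i, ⨅ j, (derivFilt k F L N).comap (dv k p i j)

theorem mem_derivFilt_succ {N : ℕ} {u : SM k F L} :
    u ∈ derivFilt k F L (N + 1) ↔ ∀ p i j, dv k p i j u ∈ derivFilt k F L N := by
  simp [derivFilt, Submodule.mem_iInf]

theorem zv_mem_derivFilt {N : ℕ} {u : SM k F L} (hu : u ∈ derivFilt k F L N) (q : Bool) (i' : Fin F)
    (j' : Fin L) : zv k q i' j' u ∈ derivFilt k F L (N + 1) := by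
  induction N generalizing u with
  | zero =>
    rw [derivFilt, Submodule.mem_bot] at hu
    rw [hu, map_zero]; exact Submodule.zero_mem _
  | succ N ih =>
    rw [mem_derivFilt_succ]
    intro p i j
    have h1 := LinearMap.congr_fun (dv_zv (k := k) p q i i' j j') u
    have h2 := ih (mem_derivFilt_succ.1 hu p i j)
    rw [Module.End.mul_apply] at h1
    rw [h1, LinearMap.add_apply]
    refine Submodule.add_mem _ ?_ ?_
    · cases p <;> cases q <;> simpa using h2
    · split_ifs
      · exact hu
      · exact Submodule.zero_mem _

theorem derivFilt_mono : Monotone (derivFilt k F L) := by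
  refine monotone_nat_of_le_succ fun N => ?_
  induction N with
  | zero => exact bot_le
  | succ N ih =>
    intro u hu
    rw [mem_derivFilt_succ] at hu ⊢
    exact fun p i j => ih (hu p i j)

theorem exists_mem_derivFilt (u : SM k F L) : ∃ N, u ∈ derivFilt k F L N := by
  refine sm_induction (C := fun u => ∃ N, u ∈ derivFilt k F L N) ⟨1, ?_⟩ ?_ ?_ ?_ u
  · rw [mem_derivFilt_succ]
    intro p i j
    rw [dv_vac]; exact Submodule.zero_mem _
  · rintro u v ⟨N, hu⟩ ⟨N', hv⟩
    exact ⟨max N N', Submodule.add_mem _ (derivFilt_mono (le_max_left _ _) hu)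
      (derivFilt_mono (le_max_right _ _) hv)⟩
  · rintro c u ⟨N, hu⟩
    exact ⟨N, Submodule.smul_mem _ _ hu⟩
  · rintro p i j u ⟨N, hu⟩
    exact ⟨N + 1, zv_mem_derivFilt hu _ _ _⟩

theorem dv_nilpotent (u : SM k F L) (C : SM k F L → Prop) (h0 : C 0)
    (hC : ∀ u, (∀ p i j, C (dv k p i j u)) → C u) : C u := by
  obtain ⟨N, hN⟩ := exists_mem_derivFilt u
  induction N generalizing u with
  | zero =>
    rw [derivFilt, Submodule.mem_bot] at hN
    rwa [hN]
  | succ N ih => exact hC u fun p i j => ih _ (mem_derivFilt_succ.1 hN p i j)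

/-- A subspace closed under derivatives and containing no nonzero constant vanishes. -/
theorem eq_zero_of_dv_stable [CharZero k] (J : Submodule k (SM k F L))
    (hJ : ∀ p i j, ∀ u ∈ J, dv k p i j u ∈ J) (hc : ∀ c : k, c • vac k F L ∈ J → c • vac k F L = 0)
    {u : SM k F L} (hu : u ∈ J) : u = 0 := by
  refine dv_nilpotent u (fun u => u ∈ J → u = 0) (fun _ => rfl) (fun u ih hu => ?_) hu
  obtain ⟨c, rfl⟩ := exists_smul_vac fun p i j => ih p i j (hJ p i j u hu)
  exact hc c hu

/-- Derivatives of a lift computed from its generators. -/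
theorem lift_dv {M : Type*} [AddCommGroup M] [Module k M] {Z : Bool → Fin F → Fin L → Module.End k M}
    {Θ : SM k F L →ₗ[k] M} (hΘ : ∀ p i j u, Θ (zv k p i j u) = Z p i j (Θ u))
    (p : Bool) (i : Fin F) (j : Fin L) (D : Module.End k M) (h0 : D (Θ (vac k F L)) = 0)
    (hD : ∀ q i' j', D * Z q i' j' = sgm p q (Z q i' j' * D) +
      if p = q ∧ i = i' ∧ j = j' then 1 else 0) (u : SM k F L) :
    Θ (dv k p i j u) = D (Θ u) := by
  refine sm_induction (C := fun u => Θ (dv k p i j u) = D (Θ u)) ?_ ?_ ?_ ?_ u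
  · rw [dv_vac, map_zero, h0]
  · intro u v hu hv
    rw [map_add, map_add, hu, hv, map_add, map_add]
  · intro c u hu
    rw [map_smul, map_smul, hu, map_smul, map_smul]
  · intro q i' j' u hu
    have h1 := LinearMap.congr_fun (dv_zv (k := k) p q i i' j j') u
    have h2 := LinearMap.congr_fun (hD q i' j') (Θ u)
    rw [Module.End.mul_apply] at h1 h2
    rw [h1, hΘ, h2, LinearMap.add_apply, LinearMap.add_apply, map_add]
    congr 1
    · have h3 : Θ ((zv k q i' j' * dv k p i j) u) = (Z q i' j' * D) (Θ u) := by
        rw [Module.End.mul_apply, hΘ, hu, Module.End.mul_apply]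
      cases p <;> cases q <;> simp only [sgm_false_left, sgm_false_right, sgm_true_true,
        LinearMap.neg_apply, map_neg, h3]
    · split_ifs <;> simp

/-- The Fock structure on a polynomial superalgebra whose column `c` is parity shifted when
`pc c` is `true`. -/
noncomputable def polyFock (k : Type) [Field k] {F n : ℕ} (pc : Fin F → Bool) :
    Fock (Module.End k (SM k F n)) pc (Fin n) where
  z β i c := zv k (xor β (pc c)) c i
  d β i c := dv k (xor β (pc c)) c i
  zz β γ i j c c' := zv_zv _ _ _ _ _ _
  dd β γ i j c c' := dv_dv _ _ _ _ _ _
  dz β γ i j c c' := by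
    rw [dv_zv]
    congr 1
    refine if_congr ?_ rfl rfl
    constructor
    · rintro ⟨h, rfl, rfl⟩
      exact ⟨by simpa using h, rfl, rfl⟩
    · rintro ⟨rfl, rfl, rfl⟩
      exact ⟨rfl, rfl, rfl⟩

variable {n : ℕ} {pc : Fin F → Bool}

theorem polyFock_cE_self (c : Fin F) : (polyFock k (n := n) pc).cE c c =
    diagOp fun b => ((∑ i, (b.1 (c, i) + if b.2 (c, i) then 1 else 0) : ℕ) : k) := by
  refine eq_diagOp fun b => ?_
  rw [Fock.cE, Fintype.sum_prod_type, Fintype.sum_bool, LinearMap.add_apply, LinearMap.sum_apply,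
    LinearMap.sum_apply, ← Finset.sum_add_distrib, Nat.cast_sum, Finset.sum_smul]
  refine Finset.sum_congr rfl fun i _ => ?_
  simp only [polyFock, Bool.xor_self, sgm_false_right]
  cases pc c
  · simp [zE_dE_bvec, zO_dO_bvec, add_smul, ite_smul, add_comm]
  · simp [zE_dE_bvec, zO_dO_bvec, add_smul, ite_smul]

theorem polyFock_eq_zero_of_cE [CharZero k] {c : Fin F} {u : SM k F n} {x : k}
    (hu : (polyFock k pc).cE c c u = x • u) (hx : ∀ m : ℕ, x ≠ m) : u = 0 := by
  ext b
  have h := DFunLike.congr_fun hu b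
  rw [polyFock_cE_self, diagOp_apply, Finsupp.smul_apply, smul_eq_mul] at h
  by_contra hb
  exact hx _ (mul_right_cancel₀ hb h).symm

theorem polyFock_d_eq_zero [CharZero k] {c : Fin F} {u : SM k F n}
    (hu : (polyFock k pc).cE c c u = 0) (β : Bool) (i : Fin n) : (polyFock k pc).d β i c u = 0 := by
  refine polyFock_eq_zero_of_cE (pc := pc) (c := c) (x := -1) ?_ ?_
  · have h := LinearMap.congr_fun ((polyFock k pc).cE_d β i c c c) u
    simpa [hu] using h
  · intro m h
    have : ((m + 1 : ℕ) : k) = 0 := by push_cast; rw [← h]; ring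
    exact absurd (Nat.cast_eq_zero.1 this) (by omega)

theorem polyFock_d_vac (β : Bool) (i : Fin n) (c : Fin F) :
    (polyFock k pc).d β i c (vac k F n) = 0 := dv_vac _ _ _

end Derivatives

section Casimir

variable {k : Type} [Field k] {M : Type*} [AddCommGroup M] [Module k M]
  {C R : Type*} [DecidableEq C] [DecidableEq R] [Fintype C] [Fintype R] {pc : C → Bool}

theorem Fock.eop_apply_of_support (X : Fock (Module.End k M) pc R) {T : Finset C} {g : M}
    (hg : ∀ γ l a, a ∉ T → X.d γ l a g = 0) (β β' : Bool) (i j : R) :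
    X.eop β β' i j g = ∑ e ∈ T, X.z β i e (X.d β' j e g) := by
  rw [Fock.eop, LinearMap.sum_apply]
  refine (Finset.sum_subset (Finset.subset_univ _) fun e _ he => ?_).symm
  rw [Module.End.mul_apply, hg _ _ _ he, map_zero]

/-- Comparing two quadratic Casimir elements on a vector which is invariant under row operators. -/
theorem Fock.casimir (X : Fock (Module.End k M) pc R) {T : Finset C} (hT : ∀ e ∈ T, pc e = true)
    {f : M} (hf : ∀ γ l a, a ∉ T → X.d γ l a f = 0) (ha : ∀ i j, X.ra i j f = 0)
    (hb : ∀ i j, X.rb i j f = 0) (hc : ∀ i j, X.rc i j f = 0) {c : C} (hcT : c ∈ T) :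
    ∑ e ∈ T, X.cE c e (X.cE e c f) - ∑ e ∈ T, X.cq c e (X.ck e c f) =
      ((T.card : k) + 1) • X.cE c c f := by
  have hg : ∀ γ l γ' l' a, a ∉ T → X.d γ' l' a (X.d γ l c f) = 0 := by
    intro γ l γ' l' a haT
    have := LinearMap.congr_fun (X.dd γ' γ l' l a c) f
    rw [Module.End.mul_apply] at this
    rw [this]
    generalize (xor γ' (pc a)) = s
    generalize (xor γ (pc c)) = t
    cases s <;> cases t <;> simp [hf _ _ _ haT]
  have hE : ∀ e ∈ T, X.cE c e (X.cE e c f) = (∑ p : Bool × R, ∑ r : Bool × R,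
      sgm (!p.1) (!r.1) (X.z p.1 p.2 c (X.z r.1 r.2 e (X.d p.1 p.2 e (X.d r.1 r.2 c f))))) +
      X.cE c c f := by
    intro e he
    rw [Fock.cE, Fock.cE, Fock.cE, LinearMap.sum_apply, LinearMap.sum_apply, LinearMap.sum_apply,
      ← Finset.sum_add_distrib]
    refine Finset.sum_congr rfl fun p _ => ?_
    simp only [hT e he, hT c hcT, Bool.xor_self, sgm_false_right, Module.End.mul_apply, map_sum]
    have : ∀ r : Bool × R, X.d p.1 p.2 e (X.z r.1 r.2 e (X.d r.1 r.2 c f)) =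
        sgm (!p.1) (!r.1) (X.z r.1 r.2 e (X.d p.1 p.2 e (X.d r.1 r.2 c f))) +
          if p = r then X.d r.1 r.2 c f else 0 := by
      intro r
      have := LinearMap.congr_fun (X.dz p.1 r.1 p.2 r.2 e e) (X.d r.1 r.2 c f)
      rw [Module.End.mul_apply] at this
      rw [this, hT e he]
      simp only [Bool.xor_true, LinearMap.add_apply, and_true, ← Prod.ext_iff]
      congr 1
      · cases p.1 <;> cases r.1 <;> simp
      · split_ifs <;> simp
    simp only [this, map_add, Finset.sum_add_distrib]
    congr 1
    · refine Finset.sum_congr rfl fun r _ => ?_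
      cases p.1 <;> cases r.1 <;> simp
    · simp [apply_ite (X.z p.1 p.2 c)]
  have hQ : ∀ e ∈ T, X.cq c e (X.ck e c f) = ∑ p : Bool × R, ∑ r : Bool × R,
      sgm true (!r.1) (X.z p.1 p.2 c (X.z (!p.1) p.2 e (X.d (!r.1) r.2 e (X.d r.1 r.2 c f)))) := by
    intro e he
    have hk : X.ck e c f = ∑ r : Bool × R, sgm true (!r.1) (X.d (!r.1) r.2 e (X.d r.1 r.2 c f)) := by
      rw [Fock.ck, LinearMap.sum_apply, Fintype.sum_prod_type, Fintype.sum_prod_type,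
        Fintype.sum_bool, Fintype.sum_bool, add_comm]
      simp [hT c hcT]
    rw [hk, Fock.cq, LinearMap.sum_apply]
    refine Finset.sum_congr rfl fun p _ => ?_
    simp only [hT c hcT, Bool.not_true, sgm_false_right, Module.End.mul_apply, map_sum]
    refine Finset.sum_congr rfl fun r _ => ?_
    cases r.1 <;> simp
  rw [Finset.sum_congr rfl hE, Finset.sum_congr rfl hQ, Finset.sum_add_distrib, Finset.sum_const]
  have hE' : ∑ e ∈ T, ∑ p : Bool × R, ∑ r : Bool × R,
      sgm (!p.1) (!r.1) (X.z p.1 p.2 c (X.z r.1 r.2 e (X.d p.1 p.2 e (X.d r.1 r.2 c f)))) =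
      ∑ p : Bool × R, ∑ r : Bool × R, (sgm true (!r.1) (X.z p.1 p.2 c
        (X.d r.1 r.2 c (X.eop r.1 p.1 r.2 p.2 f))) -
        sgm true (!r.1) (X.z p.1 p.2 c (X.d p.1 p.2 c f))) := by
    rw [Finset.sum_comm]
    refine Finset.sum_congr rfl fun p _ => ?_
    rw [Finset.sum_comm]
    refine Finset.sum_congr rfl fun r _ => ?_
    have h1 : ∑ e ∈ T, sgm (!p.1) (!r.1)
        (X.z p.1 p.2 c (X.z r.1 r.2 e (X.d p.1 p.2 e (X.d r.1 r.2 c f)))) =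
        sgm (!p.1) (!r.1) (X.z p.1 p.2 c (X.eop r.1 p.1 r.2 p.2 (X.d r.1 r.2 c f))) := by
      rw [X.eop_apply_of_support (hg _ _), map_sum]
      cases p.1 <;> cases r.1 <;> simp
    rw [h1, ← Module.End.mul_apply (X.eop _ _ _ _), Fock.eop_d, hT c hcT]
    cases p.1 <;> cases r.1 <;> simp <;> abel
  have hQ' : ∑ e ∈ T, ∑ p : Bool × R, ∑ r : Bool × R,
      sgm true (!r.1) (X.z p.1 p.2 c (X.z (!p.1) p.2 e (X.d (!r.1) r.2 e (X.d r.1 r.2 c f)))) =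
      ∑ p : Bool × R, ∑ r : Bool × R, (sgm true (!r.1) (X.z p.1 p.2 c
        (X.d r.1 r.2 c (sgm (xor p.1 r.1) (!r.1) (X.eop (!p.1) (!r.1) p.2 r.2 f)))) -
        if r = (!p.1, p.2) then X.z p.1 p.2 c (X.d p.1 p.2 c f) else 0) := by
    rw [Finset.sum_comm]
    refine Finset.sum_congr rfl fun p _ => ?_
    rw [Finset.sum_comm]
    refine Finset.sum_congr rfl fun r _ => ?_
    have h1 : ∑ e ∈ T, sgm true (!r.1)
        (X.z p.1 p.2 c (X.z (!p.1) p.2 e (X.d (!r.1) r.2 e (X.d r.1 r.2 c f)))) =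
        sgm true (!r.1) (X.z p.1 p.2 c (X.eop (!p.1) (!r.1) p.2 r.2 (X.d r.1 r.2 c f))) := by
      rw [X.eop_apply_of_support (hg _ _), map_sum]
      cases r.1 <;> simp
    rw [h1, ← Module.End.mul_apply (X.eop _ _ _ _), Fock.eop_d, hT c hcT]
    obtain ⟨β, i⟩ := p
    obtain ⟨γ, j⟩ := r
    dsimp only
    simp only [Prod.mk.injEq, @eq_comm _ j]
    by_cases hij : i = j
    · subst hij
      cases β <;> cases γ <;> simp <;> abel
    · cases β <;> cases γ <;> simp [hij]
  rw [hE', hQ']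
  have hz : ∑ p : Bool × R, ∑ r : Bool × R,
      sgm true (!r.1) (X.z p.1 p.2 c (X.d p.1 p.2 c f)) = 0 := by
    refine Finset.sum_eq_zero fun p _ => ?_
    rw [Fintype.sum_prod_type, Fintype.sum_bool]
    simp
  have hcc : ∑ p : Bool × R, ∑ r : Bool × R,
      (if r = (!p.1, p.2) then X.z p.1 p.2 c (X.d p.1 p.2 c f) else 0) = X.cE c c f := by
    simp [Fock.cE]
  have hm : ∀ p r : Bool × R, X.eop r.1 p.1 r.2 p.2 f =
      sgm (xor p.1 r.1) (!r.1) (X.eop (!p.1) (!r.1) p.2 r.2 f) := by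
    rintro ⟨β, i⟩ ⟨γ, j⟩
    have h1 := ha i j
    have h2 := ha j i
    have h3 := hb i j
    have h4 := hc i j
    simp only [Fock.ra, Fock.rb, Fock.rc, LinearMap.sub_apply, LinearMap.add_apply, sub_eq_zero,
      add_eq_zero_iff_eq_neg] at h1 h2 h3 h4
    cases β <;> cases γ <;> simp [h1, h2, h3, h4]
  simp only [Finset.sum_sub_distrib, hz, hcc, ← hm]
  rw [add_smul, one_smul, Nat.cast_smul_eq_nsmul]
  abel

end Casimir

section Invariants

variable {k : Type} [Field k]

namespace Fock

section General

variable {M : Type*} [AddCommGroup M] [Module k M]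
  {C R : Type*} [DecidableEq C] [DecidableEq R] {pc : C → Bool}
  (X : Fock (Module.End k M) pc R)

/-- Vectors killed by all row operators. -/
structure IsInv [Fintype C] (f : M) : Prop where
  ra : ∀ i j, X.ra i j f = 0
  rb : ∀ i j, X.rb i j f = 0
  rc : ∀ i j, X.rc i j f = 0

/-- Weight vectors for the column torus. -/
def IsWt [Fintype R] (μ : C → ℤ) (f : M) : Prop := ∀ c, X.cE c c f = (μ c : k) • f

/-- The subspace generated from `v` by the quadratic invariants. -/
def qSub [Fintype R] (v : M) : Submodule k M :=
  sInf {K | v ∈ K ∧ ∀ c c', ∀ u ∈ K, X.cq c c' u ∈ K}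

variable {X}

theorem mem_qSub_self [Fintype R] (v : M) : v ∈ X.qSub v :=
  Submodule.mem_sInf.2 fun _ hK => hK.1

theorem cq_mem_qSub [Fintype R] {v u : M} (hu : u ∈ X.qSub v) (c c' : C) :
    X.cq c c' u ∈ X.qSub v :=
  Submodule.mem_sInf.2 fun K hK => hK.2 c c' u (Submodule.mem_sInf.1 hu K hK)

theorem qSub_le [Fintype R] {v : M} {K : Submodule k M} (hv : v ∈ K)
    (hK : ∀ c c', ∀ u ∈ K, u ∈ X.qSub v → X.cq c c' u ∈ K) : X.qSub v ≤ K := by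
  intro u hu
  have h : X.qSub v ≤ K ⊓ X.qSub v := sInf_le
    ⟨⟨hv, mem_qSub_self v⟩, fun c c' u hu => ⟨hK c c' u hu.1 hu.2, cq_mem_qSub hu.2 c c'⟩⟩
  exact (h hu).1

theorem cE_mem_qSub [Fintype R] {v u : M} (hu : u ∈ X.qSub v) (c d : C) (hv : X.cE c d v = 0) :
    X.cE c d u ∈ X.qSub v := by
  refine qSub_le (K := (X.qSub v).comap (X.cE c d)) ?_ ?_ hu
  · rw [Submodule.mem_comap, hv]; exact Submodule.zero_mem _
  · intro a b u hu hu'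
    have h := LinearMap.congr_fun (X.cE_cq c d a b) u
    rw [Module.End.mul_apply] at h
    rw [Submodule.mem_comap] at hu ⊢
    rw [h, LinearMap.add_apply, LinearMap.add_apply]
    refine Submodule.add_mem _ (Submodule.add_mem _ ?_ ?_) ?_
    · have := cq_mem_qSub hu a b
      generalize (xor (pc c) (pc d)) = s
      generalize (!xor (pc a) (pc b)) = t
      cases s <;> cases t <;> simpa using this
    · split_ifs
      · exact cq_mem_qSub hu' _ _
      · exact Submodule.zero_mem _
    · split_ifs
      · have := cq_mem_qSub hu' a c
        cases (xor (pc c) (pc d)) <;> cases pc a <;> simpa using this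
      · exact Submodule.zero_mem _

theorem sgm_apply_eq_zero {A : Module.End k M} {f : M} (s t : Bool) (h : A f = 0) :
    sgm s t A f = 0 := by cases s <;> cases t <;> simpa using h

variable [Fintype C] [Fintype R]

theorem IsInv.cE {f : M} (hf : X.IsInv f) (c c' : C) : X.IsInv (X.cE c c' f) where
  ra i j := by
    have h := LinearMap.congr_fun (X.ra_cE i j c c') f
    rw [Module.End.mul_apply, Module.End.mul_apply, hf.ra, map_zero] at h
    exact h
  rb i j := by
    have h := LinearMap.congr_fun (X.rb_cE i j c c') f
    rw [sgm_apply_eq_zero _ _ (by rw [Module.End.mul_apply, hf.rb, map_zero])] at h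
    exact h
  rc i j := by
    have h := LinearMap.congr_fun (X.rc_cE i j c c') f
    rw [sgm_apply_eq_zero _ _ (by rw [Module.End.mul_apply, hf.rc, map_zero])] at h
    exact h

theorem IsInv.ck {f : M} (hf : X.IsInv f) (c c' : C) : X.IsInv (X.ck c c' f) where
  ra i j := by
    have h := LinearMap.congr_fun (X.ra_ck i j c c') f
    rw [Module.End.mul_apply, Module.End.mul_apply, hf.ra, map_zero] at h
    exact h
  rb i j := by
    have h := LinearMap.congr_fun (X.rb_ck i j c c') f
    rw [sgm_apply_eq_zero _ _ (by rw [Module.End.mul_apply, hf.rb, map_zero])] at h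
    exact h
  rc i j := by
    have h := LinearMap.congr_fun (X.rc_ck i j c c') f
    rw [sgm_apply_eq_zero _ _ (by rw [Module.End.mul_apply, hf.rc, map_zero])] at h
    exact h

omit [Fintype C] in
theorem IsWt.cE {μ : C → ℤ} {f : M} (hf : X.IsWt μ f) (a b : C) :
    X.IsWt (fun c => μ c + (if c = a then 1 else 0) - if c = b then 1 else 0) (X.cE a b f) := by
  intro c
  have h := LinearMap.congr_fun (X.cE_cE c c a b) f
  simp only [Bool.xor_self, sgm_false_left, Module.End.mul_apply, LinearMap.sub_apply,
    LinearMap.add_apply, hf c, map_smul] at h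
  rw [h]
  by_cases h1 : c = a
  · subst h1
    by_cases h2 : c = b
    · simp [h2]
    · simp [h2, add_smul]
  · by_cases h2 : c = b
    · subst h2; simp [h1, sub_smul]
    · simp [h1, h2]

omit [Fintype C] in
theorem IsWt.ck {μ : C → ℤ} {f : M} (hf : X.IsWt μ f) (a b : C) :
    X.IsWt (fun c => μ c - (if c = a then 1 else 0) - if c = b then 1 else 0) (X.ck a b f) := by
  intro c
  have h := LinearMap.congr_fun (X.cE_ck_diag c a b) f
  simp only [Module.End.mul_apply, LinearMap.sub_apply, hf c, map_smul] at h
  rw [h]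
  by_cases h1 : c = a
  · by_cases h2 : c = b
    · simp only [if_pos h1, if_pos h2]; simp [sub_smul]
    · simp only [if_pos h1, if_neg h2]; simp [sub_smul]
  · by_cases h2 : c = b
    · simp only [if_neg h1, if_pos h2]; simp [sub_smul]
    · simp only [if_neg h1, if_neg h2]; simp

end General

end Fock

variable {F n : ℕ} {pc : Fin F → Bool}

theorem polyFock_cE_apply_eq_zero [CharZero k] {c : Fin F} {u : SM k F n}
    (hu : (polyFock k pc).cE c c u = 0) (a : Fin F) : (polyFock k pc).cE a c u = 0 := by
  rw [Fock.cE, LinearMap.sum_apply]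
  exact Finset.sum_eq_zero fun p _ => Fock.sgm_apply_eq_zero _ _ (by
    rw [Module.End.mul_apply, polyFock_d_eq_zero hu, map_zero])

theorem polyFock_cE_vac (a c : Fin F) : (polyFock k (n := n) pc).cE a c (vac k F n) = 0 := by
  rw [Fock.cE, LinearMap.sum_apply]
  exact Finset.sum_eq_zero fun p _ => Fock.sgm_apply_eq_zero _ _ (by
    rw [Module.End.mul_apply, polyFock_d_vac, map_zero])

theorem polyFock_wt [CharZero k] {μ : Fin F → ℤ} {f : SM k F n}
    (hf : (polyFock k pc).IsWt μ f) : f = 0 ∨ ∃ lam : Fin F → ℕ, ∀ c, (lam c : ℤ) = μ c := by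
  by_cases h : ∀ c, 0 ≤ μ c
  · exact Or.inr ⟨fun c => (μ c).toNat, fun c => Int.toNat_of_nonneg (h c)⟩
  · push Not at h
    obtain ⟨c, hc⟩ := h
    refine Or.inl (polyFock_eq_zero_of_cE (hf c) fun m hm => ?_)
    have : μ c = (m : ℤ) := by exact_mod_cast hm
    omega

theorem staircase (g : ℕ → ℕ) (N : ℕ) (h0 : ∀ i, N ≤ i → g i = 0)
    (h : ∀ c < N, g c * g c = (c + 2) * g c + ∑ e ∈ Finset.Ico (c + 1) N, g e) :
    ∃ l ≤ N, ∀ i, g i = if i < l then l + 1 else 0 := by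
  classical
  have hex : ∃ l, ∀ i, l ≤ i → g i = 0 := ⟨N, h0⟩
  obtain ⟨l, hl, hmin⟩ : ∃ l, (∀ i, l ≤ i → g i = 0) ∧ ∀ l' < l, ¬ ∀ i, l' ≤ i → g i = 0 :=
    ⟨Nat.find hex, Nat.find_spec hex, fun l' hl' => Nat.find_min hex hl'⟩
  have hlN : l ≤ N := by
    by_contra hlt
    exact hmin N (by omega) h0
  refine ⟨l, hlN, ?_⟩
  cases l with
  | zero => intro i; simp [hl i (Nat.zero_le i)]
  | succ m =>
    have hm : g m ≠ 0 := fun h1 => hmin m (by omega) fun i hi => by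
      rcases Nat.eq_or_lt_of_le hi with h2 | h2
      · rw [← h2, h1]
      · exact hl i h2
    have key : ∀ j, ∀ c, c + j = m → g c = m + 2 := by
      intro j
      induction j using Nat.strong_induction_on with
      | _ j ih =>
        intro c hc
        have h1 := h c (by omega)
        have h2 : ∑ e ∈ Finset.Ico (c + 1) N, g e = j * (m + 2) := by
          rw [← Finset.sum_subset (s₁ := Finset.Ico (c + 1) (m + 1))]
          · rw [Finset.sum_congr rfl fun e he => ih (m - e) (by
              rw [Finset.mem_Ico] at he; omega) e (by rw [Finset.mem_Ico] at he; omega)]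
            rw [Finset.sum_const, Nat.card_Ico, smul_eq_mul]
            congr 1; omega
          · exact Finset.Ico_subset_Ico_right hlN
          · intro e he he'
            rw [Finset.mem_Ico] at he he'
            exact hl e (by omega)
        rw [h2] at h1
        rcases Nat.eq_zero_or_pos j with hj | hj
        · subst hj
          simp only [zero_mul, add_zero] at h1 hc
          subst hc
          exact Nat.eq_of_mul_eq_mul_right (Nat.pos_of_ne_zero hm) h1
        · have h3 : ((g c : ℤ) - (m + 2)) * (g c + j) = 0 := by
            have h4 : (g c : ℤ) * g c = (c + 2) * g c + j * (m + 2) := by exact_mod_cast h1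
            have h5 : (m : ℤ) = c + j := by exact_mod_cast hc.symm
            rw [h5] at h4 ⊢
            linear_combination h4
          rcases mul_eq_zero.1 h3 with h4 | h4 <;> omega
    intro i
    split_ifs with hi
    · exact key (m - i) i (by omega)
    · exact hl i (by omega)

theorem sum_filter_val_lt {A : Type*} [AddCommMonoid A] {N : ℕ} (hN : N ≤ F) (a : ℕ) (g : ℕ → A) :
    ∑ e : Fin F with a ≤ e.val ∧ e.val < N, g e.val = ∑ i ∈ Finset.Ico a N, g i := by
  refine Finset.sum_nbij (fun e => e.val) ?_ ?_ ?_ ?_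
  · intro e he
    simpa using he
  · exact fun x _ y _ h => Fin.ext h
  · intro i hi
    rw [Finset.mem_coe, Finset.mem_Ico] at hi
    exact ⟨⟨i, by omega⟩, by simpa using hi, rfl⟩
  · intros; rfl

/-- Invariants of degree less than the number `N` of odd columns are generated by the quadratic
invariants, provided this holds for the staircase weights. -/
theorem inv_mem_qSub_of_staircase [CharZero k] {N : ℕ} (hN : N ≤ F)
    (hst : ∀ (l : ℕ) (f : SM k F n), 1 ≤ l → l * (l + 1) < N →
      (polyFock k (fun c : Fin F => decide (c.val < N))).IsInv f →
      (polyFock k (fun c : Fin F => decide (c.val < N))).IsWt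
        (fun c => if c.val < l then (l : ℤ) + 1 else 0) f →
      f ∈ (polyFock k (fun c : Fin F => decide (c.val < N))).qSub (vac k F n)) :
    ∀ d < N, ∀ (w : ℕ) (lam : Fin F → ℕ) (f : SM k F n), ∑ c, lam c = d → ∑ c, c.val * lam c = w →
      (polyFock k (fun c : Fin F => decide (c.val < N))).IsInv f →
      (polyFock k (fun c : Fin F => decide (c.val < N))).IsWt (fun c => lam c) f →
      f ∈ (polyFock k (fun c : Fin F => decide (c.val < N))).qSub (vac k F n) := by
  set X := polyFock k (n := n) (fun c : Fin F => decide (c.val < N)) with hX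
  intro d
  induction d using Nat.strong_induction_on with
  | _ d ihd =>
  intro hd w
  induction w using Nat.strong_induction_on with
  | _ w ihw =>
  intro lam f hlam hw hf hwt
  have hwt' : ∀ c, X.cE c c f = ((lam c : ℤ) : k) • f := hwt
  have hE : ∀ c e : Fin F, c < e → X.cE c e f ∈ X.qSub (vac k F n) := by
    intro c e hce
    rcases polyFock_wt (hwt.cE c e) with h0 | ⟨lam', hlam'⟩
    · rw [h0]; exact Submodule.zero_mem _
    · have h1 : ∑ a, lam' a = d := by
        zify
        rw [Finset.sum_congr rfl fun a _ => hlam' a, ← hlam]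
        simp [Finset.sum_sub_distrib, Finset.sum_add_distrib]
      have h2 : ((∑ a : Fin F, a.val * lam' a : ℕ) : ℤ) = w + c.val - e.val := by
        push_cast
        rw [Finset.sum_congr rfl fun a _ => by rw [hlam' a], ← hw]
        simp [Finset.sum_sub_distrib, Finset.sum_add_distrib, mul_sub, mul_add]
      refine ihw _ ?_ lam' _ h1 rfl (hf.cE c e) ?_
      · have : c.val < e.val := hce
        omega
      · have := hwt.cE c e
        intro a
        have h3 := this a
        dsimp only at h3 ⊢
        rw [h3, ← hlam' a]
  have hK : ∀ a b : Fin F, X.ck a b f ∈ X.qSub (vac k F n) := by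
    intro a b
    rcases polyFock_wt (hwt.ck a b) with h0 | ⟨lam', hlam'⟩
    · rw [h0]; exact Submodule.zero_mem _
    · have h1 : ((∑ a, lam' a : ℕ) : ℤ) = d - 2 := by
        push_cast
        rw [Finset.sum_congr rfl fun a _ => hlam' a, ← hlam]
        simp [Finset.sum_sub_distrib]
        ring
      refine ihd (∑ a, lam' a) (by omega) (by omega) _ lam' _ rfl rfl (hf.ck a b) ?_
      have := hwt.ck a b
      intro c
      have h3 := this c
      dsimp only at h3 ⊢
      rw [h3, ← hlam' c]
  by_cases hev : ∃ a : Fin F, N ≤ a.val ∧ lam a ≠ 0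
  · obtain ⟨a, haN, ha⟩ := hev
    obtain ⟨c, hcN, hc⟩ : ∃ c : Fin F, c.val < N ∧ lam c = 0 := by
      by_contra hcon
      push Not at hcon
      have h1 : ∑ e : Fin F with 0 ≤ e.val ∧ e.val < N, 1 ≤ ∑ e, lam e := by
        refine le_trans (Finset.sum_le_sum fun e he => ?_)
          (Finset.sum_le_sum_of_subset (Finset.filter_subset _ _))
        exact Nat.one_le_iff_ne_zero.2 (hcon e (by simpa using he))
      rw [sum_filter_val_lt hN 0 (fun _ => 1)] at h1
      simp at h1
      omega
    have hcf : X.cE c c f = 0 := by rw [hwt' c, hc]; simp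
    have h0 := polyFock_cE_apply_eq_zero hcf a
    have h1 := LinearMap.congr_fun (X.cE_cE a c c a) f
    have ha' : decide (a.val < N) = false := by simpa using haN
    have hc' : decide (c.val < N) = true := by simpa using hcN
    simp only [ha', hc', Bool.xor_true, Bool.xor_false, Bool.not_false, sgm_true_true, if_true,
      Module.End.mul_apply, LinearMap.sub_apply, LinearMap.add_apply, LinearMap.neg_apply] at h1
    have h2 := hwt' a
    rw [← hX] at h0
    rw [h0, hcf, h2, map_zero] at h1
    have h3 : f = (lam a : k)⁻¹ • X.cE a c (X.cE c a f) := by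
      rw [h1]
      simp [smul_smul, ha]
    rw [h3]
    exact Submodule.smul_mem _ _ (Fock.cE_mem_qSub
      (hE c a (show c.val < a.val by omega)) _ _ (polyFock_cE_vac _ _))
  push Not at hev
  set T : Finset (Fin F) := {e | 0 ≤ e.val ∧ e.val < N} with hT
  have hTmem : ∀ e, e ∈ T ↔ e.val < N := by intro e; simp [hT]
  have hTcard : T.card = N := by
    rw [Finset.card_eq_sum_ones, hT, sum_filter_val_lt hN 0 (fun _ => 1)]
    simp
  by_contra hcon
  have hcoef : ∀ c ∈ T, (∑ e ∈ T, (if e < c then 0 else if e = c then (lam c : ℤ) * lam c else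
      lam c - lam e)) = (N + 1) * lam c := by
    intro c hc
    by_contra hne
    apply hcon
    have hcas := X.casimir (T := T) (fun e he => by simpa using (hTmem e).1 he) (f := f)
      (fun γ l a ha => polyFock_d_eq_zero (by
        have h1 : N ≤ a.val := by
          by_contra h; exact ha ((hTmem a).2 (by omega))
        have h2 := hwt' a
        rw [hev a h1] at h2
        rw [← hX, h2]; simp) γ l) hf.ra hf.rb hf.rc hc
    have h1 : ∀ e ∈ T, X.cE c e (X.cE e c f) - ((if e < c then 0 else if e = c then
        (lam c : ℤ) * lam c else lam c - lam e : ℤ) : k) • f ∈ X.qSub (vac k F n) := by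
      intro e he
      split_ifs with h1 h2
      · simpa using Fock.cE_mem_qSub (hE e c h1) c e (polyFock_cE_vac _ _)
      · subst h2
        have h3 := hwt' e
        rw [h3, map_smul, h3, smul_smul]
        simp
      · have hce : c < e := lt_of_le_of_ne (not_lt.1 h1) (Ne.symm h2)
        have h3 := LinearMap.congr_fun (X.cE_cE c e e c) f
        have h4 : decide (c.val < N) = true := by simpa using (hTmem c).1 hc
        have h5 : decide (e.val < N) = true := by simpa using (hTmem e).1 he
        simp only [h4, h5, Bool.xor_self, sgm_false_left, if_true, Module.End.mul_apply,
          LinearMap.sub_apply, LinearMap.add_apply] at h3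
        rw [h3, hwt' c, hwt' e]
        have h6 := Fock.cE_mem_qSub (hE c e hce) e c (polyFock_cE_vac _ _)
        convert h6 using 1
        push_cast
        rw [sub_smul]
        abel
    have h2 := Submodule.sum_mem _ h1
    rw [Finset.sum_sub_distrib, ← Finset.sum_smul] at h2
    have h3 : ∑ e ∈ T, X.cq c e (X.ck e c f) ∈ X.qSub (vac k F n) :=
      Submodule.sum_mem _ fun e _ => Fock.cq_mem_qSub (hK e c) _ _
    rw [sub_eq_iff_eq_add] at hcas
    rw [hcas, hwt' c, hTcard] at h2
    have h4 := Submodule.sub_mem _ h2 h3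
    have h5 : (((N + 1) * lam c - ∑ e ∈ T, (if e < c then 0 else if e = c then
        (lam c : ℤ) * lam c else lam c - lam e) : ℤ) : k) • f ∈ X.qSub (vac k F n) := by
      convert h4 using 1
      rw [smul_smul, Int.cast_sub, sub_smul, Int.cast_sum]
      push_cast
      abel
    have h6 : (((N + 1) * lam c - ∑ e ∈ T, (if e < c then 0 else if e = c then
        (lam c : ℤ) * lam c else lam c - lam e) : ℤ) : k) ≠ 0 := by
      rw [Int.cast_ne_zero]
      intro h
      exact hne (by omega)
    exact (Submodule.smul_mem_iff _ h6).1 h5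
  obtain ⟨l, hlN, hl⟩ := staircase (fun i => if h : i < F then lam ⟨i, h⟩ else 0) N
    (fun i hi => by
      split_ifs with h
      · exact hev _ hi
      · rfl)
    (fun c hcN => by
      set g : ℕ → ℕ := fun i => if h : i < F then lam ⟨i, h⟩ else 0 with hg
      have hlg : ∀ e : Fin F, lam e = g e.val := fun e => by simp [hg]
      have hcF : c < F := by omega
      have h1 := hcoef ⟨c, hcF⟩ ((hTmem _).2 hcN)
      have h2 : ∀ e : Fin F, e ∈ T → (if e < ⟨c, hcF⟩ then 0 else if e = ⟨c, hcF⟩ then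
          (lam ⟨c, hcF⟩ : ℤ) * lam ⟨c, hcF⟩ else lam ⟨c, hcF⟩ - lam e) =
          (fun i : ℕ => if i < c then 0 else if i = c then (g c : ℤ) * g c else g c - g i) e.val := by
        intro e _
        simp only [hlg, Fin.lt_def, Fin.ext_iff]
      rw [Finset.sum_congr rfl h2, hT, sum_filter_val_lt hN 0 (fun i : ℕ => if i < c then 0 else
          if i = c then (g c : ℤ) * g c else g c - g i),
        ← Finset.sum_Ico_consecutive _ (Nat.zero_le c) hcN.le,
        Finset.sum_eq_sum_Ico_succ_bot hcN] at h1
      rw [Finset.sum_eq_zero (fun i hi => by rw [Finset.mem_Ico] at hi; simp [hi.2])] at h1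
      have h3 : ∑ i ∈ Finset.Ico (c + 1) N, (if i < c then (0 : ℤ) else
          if i = c then (g c : ℤ) * g c else g c - g i) =
          ∑ i ∈ Finset.Ico (c + 1) N, ((g c : ℤ) - g i) :=
        Finset.sum_congr rfl fun i hi => by
          rw [Finset.mem_Ico] at hi
          rw [if_neg (by omega), if_neg (by omega)]
      rw [h3, Finset.sum_sub_distrib, Finset.sum_const, Nat.card_Ico] at h1
      simp only [lt_irrefl, if_false, if_true, hlg, nsmul_eq_mul, zero_add] at h1
      rw [Nat.cast_sub (by omega)] at h1
      change g c * g c = (c + 2) * g c + ∑ e ∈ Finset.Ico (c + 1) N, g e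
      clear_value g
      zify
      push_cast at h1
      linear_combination h1)
  have hlam' : ∀ c : Fin F, lam c = if c.val < l then l + 1 else 0 := by
    intro c
    have := hl c.val
    simpa using this
  rcases Nat.eq_zero_or_pos l with h0 | h0
  · subst h0
    obtain ⟨c, rfl⟩ := exists_smul_vac (u := f) fun p i j => by
      have h1 := hwt' i
      rw [hlam' i] at h1
      have h2 := polyFock_d_eq_zero (u := f) (by rw [← hX, h1]; simp) (xor p (decide (i.val < N))) j
      simpa [polyFock] using h2
    exact hcon (Submodule.smul_mem _ _ (Fock.mem_qSub_self _))
  · refine hcon (hst l f h0 ?_ hf ?_)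
    · have h1 : ∑ e : Fin F with 0 ≤ e.val ∧ e.val < l, (l + 1) ≤ ∑ e, lam e := by
        refine le_trans (Finset.sum_le_sum fun e he => ?_)
          (Finset.sum_le_sum_of_subset (Finset.filter_subset _ _))
        rw [hlam' e, if_pos (by simpa using he)]
      rw [sum_filter_val_lt (hlN.trans hN) 0 (fun _ => l + 1)] at h1
      simp at h1
      omega
    · intro c
      have := hwt' c
      dsimp only
      rw [this, hlam' c]
      split_ifs <;> simp

end Invariants

section RowDegree

namespace Fock

section

variable {A : Type*} [Ring A] {C R : Type*} [DecidableEq C] [DecidableEq R] [Fintype C] [Fintype R]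
  {pc : C → Bool} (X : Fock A pc R)

theorem sum_eop_z (β γ : Bool) (l : R) (c : C) : (∑ i, X.eop β β i i) * X.z γ l c =
      X.z γ l c * ∑ i, X.eop β β i i + if β = γ then X.z γ l c else 0 := by
  simp only [Finset.sum_mul, X.eop_z, Bool.xor_self, sgm_false_left, Finset.sum_add_distrib,
    Finset.mul_sum]
  congr 1
  by_cases h : β = γ
  · subst h; simp
  · simp [h]

theorem sum_eop_d (β γ : Bool) (l : R) (c : C) : (∑ i, X.eop β β i i) * X.d γ l c =
      X.d γ l c * ∑ i, X.eop β β i i - if β = γ then X.d γ l c else 0 := by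
  simp only [Finset.sum_mul, X.eop_d, Bool.xor_self, sgm_false_left, Finset.sum_sub_distrib,
    Finset.mul_sum]
  congr 1
  by_cases h : β = γ
  · subst h; simp
  · simp [h]

theorem sum_eop_d_of_ne {β γ : Bool} (h : β ≠ γ) (l : R) (c : C) :
    (∑ i, X.eop β β i i) * X.d γ l c = X.d γ l c * ∑ i, X.eop β β i i := by
  rw [sum_eop_d, if_neg h, sub_zero]

theorem sum_eop_zd (β γ : Bool) (i j : R) (c c' : C) :
    (∑ i, X.eop β β i i) * (X.z γ i c * X.d γ j c') =
      X.z γ i c * X.d γ j c' * ∑ i, X.eop β β i i := by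
  rw [← mul_assoc, sum_eop_z, add_mul, mul_assoc, sum_eop_d]
  split_ifs
  · rw [mul_sub, mul_assoc, sub_add_cancel]
  · rw [sub_zero, zero_mul, add_zero, mul_assoc]

end

end Fock


variable {k : Type} [Field k] {F n : ℕ} {pc : Fin F → Bool}

/-- The number of variables of a monomial lying in rows of type `β`. -/
def rowDeg (pc : Fin F → Bool) (β : Bool) (b : MonB F n) : ℕ :=
  ∑ c, ∑ i, if xor β (pc c) then (if b.2 (c, i) then 1 else 0) else b.1 (c, i)

theorem polyFock_sum_eop (β : Bool) :
    ∑ i, (polyFock k (n := n) pc).eop β β i i = diagOp fun b => (rowDeg pc β b : k) := by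
  refine eq_diagOp fun b => ?_
  simp only [Fock.eop, LinearMap.sum_apply, rowDeg]
  rw [Finset.sum_comm]
  push_cast
  simp only [Finset.sum_smul]
  refine Finset.sum_congr rfl fun c _ => Finset.sum_congr rfl fun i _ => ?_
  simp only [polyFock, Module.End.mul_apply]
  cases xor β (pc c)
  · simp [zE_dE_bvec]
  · simp [zO_dO_bvec]

/-- The projection to the part of degree `s` in the rows of the second kind. -/
noncomputable def rowComp (k : Type) [Field k] {F n : ℕ} (pc : Fin F → Bool) (s : ℕ) :
    Module.End k (SM k F n) := diagOp fun b => if rowDeg pc true b = s then 1 else 0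

theorem rowComp_of_eigen [CharZero k] {v : SM k F n} {m : ℤ}
    (h : (∑ i, (polyFock k (n := n) pc).eop true true i i) v = (m : k) • v) (s : ℕ) :
    rowComp k pc s v = if (s : ℤ) = m then v else 0 := by
  ext b
  have hb := DFunLike.congr_fun h b
  rw [polyFock_sum_eop, diagOp_apply, Finsupp.smul_apply, smul_eq_mul] at hb
  rw [rowComp, diagOp_apply]
  by_cases hv : v b = 0
  · split_ifs <;> simp [hv]
  · have h1 : (rowDeg pc true b : ℤ) = m := by
      have := mul_right_cancel₀ hv hb
      exact_mod_cast this
    rw [← h1]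
    simp only [Nat.cast_inj, eq_comm (a := s)]
    split_ifs <;> simp

theorem sum_eop_bvec (b : MonB F n) :
    (∑ i, (polyFock k (n := n) pc).eop true true i i) (bvec k F n b) =
      (rowDeg pc true b : k) • bvec k F n b := by
  rw [polyFock_sum_eop, diagOp_bvec]

theorem rowComp_bvec (s : ℕ) (b : MonB F n) :
    rowComp k pc s (bvec k F n b) = if s = rowDeg pc true b then bvec k F n b else 0 := by
  rw [rowComp, diagOp_bvec]
  simp only [eq_comm (a := s)]
  split_ifs <;> simp

section

variable [CharZero k] (s : ℕ)

theorem rowComp_comm {A : Module.End k (SM k F n)}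
    (h : (∑ i, (polyFock k (n := n) pc).eop true true i i) * A =
      A * ∑ i, (polyFock k (n := n) pc).eop true true i i) :
    rowComp k pc s * A = A * rowComp k pc s := by
  refine end_ext_bvec fun b => ?_
  have h1 := LinearMap.congr_fun h (bvec k F n b)
  rw [Module.End.mul_apply, Module.End.mul_apply, sum_eop_bvec, map_smul] at h1
  rw [Module.End.mul_apply, Module.End.mul_apply, rowComp_bvec,
    rowComp_of_eigen (m := rowDeg pc true b) (by rw [h1]; simp)]
  simp only [Nat.cast_inj]
  split_ifs <;> simp

theorem rowComp_z_false (i : Fin n) (c : Fin F) : rowComp k pc s * (polyFock k pc).z false i c =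
    (polyFock k pc).z false i c * rowComp k pc s :=
  rowComp_comm s (by rw [Fock.sum_eop_z]; simp)

theorem rowComp_d_false (i : Fin n) (c : Fin F) : rowComp k pc s * (polyFock k pc).d false i c =
    (polyFock k pc).d false i c * rowComp k pc s :=
  rowComp_comm s (Fock.sum_eop_d_of_ne _ (by simp) _ _)

theorem rowComp_zero_z_true (i : Fin n) (c : Fin F) :
    rowComp k pc 0 * (polyFock k pc).z true i c = 0 := by
  refine end_ext_bvec fun b => ?_
  have h := LinearMap.congr_fun (Fock.sum_eop_z (polyFock k pc) true true i c) (bvec k F n b)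
  rw [Module.End.mul_apply, LinearMap.add_apply, Module.End.mul_apply, sum_eop_bvec, map_smul] at h
  rw [Module.End.mul_apply,
    rowComp_of_eigen (m := rowDeg pc true b + 1) (by rw [h]; simp [add_smul]), if_neg (by omega)]
  rfl

theorem rowComp_d_true (i : Fin n) (c : Fin F) : rowComp k pc s * (polyFock k pc).d true i c =
    (polyFock k pc).d true i c * rowComp k pc (s + 1) := by
  refine end_ext_bvec fun b => ?_
  have h := LinearMap.congr_fun (Fock.sum_eop_d (polyFock k pc) true true i c) (bvec k F n b)
  rw [Module.End.mul_apply, LinearMap.sub_apply, Module.End.mul_apply, sum_eop_bvec, map_smul] at h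
  rw [Module.End.mul_apply, Module.End.mul_apply, rowComp_bvec,
    rowComp_of_eigen (m := rowDeg pc true b - 1) (by rw [h]; simp [sub_smul])]
  have : (s : ℤ) = rowDeg pc true b - 1 ↔ s + 1 = rowDeg pc true b := by omega
  simp only [this]
  split_ifs <;> simp

theorem rowComp_eop (β : Bool) (i j : Fin n) : rowComp k pc s * (polyFock k pc).eop β β i j =
    (polyFock k pc).eop β β i j * rowComp k pc s :=
  rowComp_comm s (by
    rw [Fock.eop, Finset.mul_sum, Finset.sum_mul]
    exact Finset.sum_congr rfl fun c _ => Fock.sum_eop_zd _ _ _ _ _ _ _)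

theorem rowComp_cE (c c' : Fin F) : rowComp k pc s * (polyFock k (n := n) pc).cE c c' =
    (polyFock k pc).cE c c' * rowComp k pc s :=
  rowComp_comm s (by
    rw [Fock.cE, Finset.mul_sum, Finset.sum_mul]
    refine Finset.sum_congr rfl fun p _ => ?_
    rw [mul_sgm, Fock.sum_eop_zd, sgm_mul])

/-- A family of vectors whose derivatives along the rows of the second kind are controlled by
degree preserving operators vanishes as soon as all its degree zero parts vanish. -/
theorem eq_zero_of_rowComp_zero (J : Set (SM k F n))
    (hJ : ∀ h ∈ J, ∀ i c, ∃ h' ∈ J, ∃ A : Module.End k (SM k F n),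
      (∀ s, rowComp k pc s * A = A * rowComp k pc s) ∧
      (polyFock k pc).d true i c h = h' + A h)
    (h0 : ∀ h ∈ J, rowComp k pc 0 h = 0) {h : SM k F n} (hh : h ∈ J) : h = 0 := by
  have key : ∀ s, ∀ h ∈ J, rowComp k pc s h = 0 := by
    intro s
    induction s with
    | zero => exact h0
    | succ s ih =>
      intro h hh
      have h1 : ∀ i c, (polyFock k pc).d true i c (rowComp k pc (s + 1) h) = 0 := by
        intro i c
        obtain ⟨h', hh', A, hA, he⟩ := hJ h hh i c
        rw [← Module.End.mul_apply, ← rowComp_d_true, Module.End.mul_apply, he, map_add, ih h' hh',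
          ← Module.End.mul_apply, hA, Module.End.mul_apply, ih h hh, map_zero, add_zero]
      have h2 : (∑ i, (polyFock k (n := n) pc).eop true true i i) (rowComp k pc (s + 1) h) = 0 := by
        rw [LinearMap.sum_apply]
        refine Finset.sum_eq_zero fun i _ => ?_
        rw [Fock.eop, LinearMap.sum_apply]
        exact Finset.sum_eq_zero fun c _ => by rw [Module.End.mul_apply, h1, map_zero]
      ext b
      have h3 := DFunLike.congr_fun h2 b
      rw [polyFock_sum_eop, diagOp_apply, rowComp, diagOp_apply] at h3
      rw [rowComp, diagOp_apply]
      split_ifs at h3 ⊢ with h4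
      · rw [h4, one_mul] at h3
        rw [one_mul]
        exact (mul_eq_zero.1 h3).resolve_left (Nat.cast_ne_zero.2 (Nat.succ_ne_zero _))
      · simp
  ext b
  have h1 := DFunLike.congr_fun (key (rowDeg pc true b) h hh) b
  rw [rowComp, diagOp_apply, if_pos rfl, one_mul] at h1
  exact h1

end

end RowDegree

section Translation

variable {k : Type} [Field k] [CharZero k] {F n : ℕ} {pc : Fin F → Bool}

theorem sgm_add_central {A : Type*} [Ring A] [Algebra k A] (p q : Bool) {x y : A} (r t : k)
    (h : x * y = sgm p q (y * x)) : (x + if p then 0 else algebraMap k A r) *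
      (y + if q then 0 else algebraMap k A t) = sgm p q ((y + if q then 0 else algebraMap k A t) *
      (x + if p then 0 else algebraMap k A r)) := by
  have h1 := Algebra.commutes r y
  have h2 := Algebra.commutes t x
  have h3 := Algebra.commutes r (algebraMap k A t)
  cases p <;> cases q <;> simp_all [add_mul, mul_add]
  abel

theorem sgm_comm_central {A : Type*} [Ring A] [Algebra k A] (p q : Bool) {x y e : A} (t : k)
    (h : x * y = sgm p q (y * x) + e) : x * (y + if q then 0 else algebraMap k A t) =
      sgm p q ((y + if q then 0 else algebraMap k A t) * x) + e := by
  have h2 := Algebra.commutes t x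
  cases p <;> cases q <;> simp_all [add_mul, mul_add] <;> abel

/-- Translation of the even variables in the odd columns. -/
structure IsTranslation (pc : Fin F → Bool) (s : Fin F → Fin n → k) (τ : Module.End k (SM k F n)) :
    Prop where
  inj : ∀ u, τ u = 0 → u = 0
  vac : τ (vac k F n) = vac k F n
  z_false : ∀ i c u, τ ((polyFock k pc).z false i c u) = (polyFock k pc).z false i c (τ u)
  z_true : ∀ i c u, τ ((polyFock k pc).z true i c u) =
    (polyFock k pc).z true i c (τ u) + s c i • τ u
  d : ∀ β i c u, τ ((polyFock k pc).d β i c u) = (polyFock k pc).d β i c (τ u)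

theorem exists_translation (s : Fin F → Fin n → k) (hs : ∀ c, pc c = false → ∀ i, s c i = 0) :
    ∃ τ : Module.End k (SM k F n), IsTranslation pc s τ := by
  obtain ⟨τ, h0, hz⟩ := exists_sm_lift (k := k) (F := F) (L := n) (M := SM k F n)
    (fun p c i => zv k p c i + if p then 0 else algebraMap k _ (s c i))
    (fun p q i j i' j' => sgm_add_central p q _ _ (zv_zv p q i i' j j')) (vac k F n)
  have hd : ∀ p i j u, τ (dv k p i j u) = dv k p i j (τ u) := by
    intro p i j u
    refine lift_dv hz p i j (dv k p i j) (by rw [h0, dv_vac]) (fun q i' j' => ?_) u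
    exact sgm_comm_central (A := Module.End k (SM k F n)) p q (s i' j') (dv_zv p q i i' j j')
  refine ⟨τ, fun u hu => ?_, h0, ?_, ?_, fun β i c u => hd _ _ _ _⟩
  · rw [← LinearMap.mem_ker] at hu
    refine eq_zero_of_dv_stable (LinearMap.ker τ) (fun p i j u hu => ?_) (fun c hc => ?_) hu
    · rw [LinearMap.mem_ker] at hu ⊢
      rw [hd, hu, map_zero]
    · rw [LinearMap.mem_ker, map_smul, h0] at hc
      exact hc
  · intro i c u
    change τ (zv k _ c i u) = zv k _ c i (τ u)
    rw [hz]
    cases hc : pc c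
    · simp [hs c hc]
    · simp
  · intro i c u
    change τ (zv k _ c i u) = zv k _ c i (τ u) + _
    rw [hz]
    cases hc : pc c
    · simp [hs c hc]
    · simp [Module.algebraMap_end_apply]

namespace IsTranslation

omit [CharZero k] in
theorem eop_false {s : Fin F → Fin n → k} {τ : Module.End k (SM k F n)}
    (h : IsTranslation pc s τ) (β : Bool) (i j : Fin n) (u : SM k F n) :
    τ ((polyFock k pc).eop false β i j u) = (polyFock k pc).eop false β i j (τ u) := by
  simp only [Fock.eop, LinearMap.sum_apply, map_sum, Module.End.mul_apply, h.z_false, h.d]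

omit [CharZero k] in
theorem eop_true {s : Fin F → Fin n → k} {τ : Module.End k (SM k F n)}
    (h : IsTranslation pc s τ) (β : Bool) (i j : Fin n) (u : SM k F n) :
    τ ((polyFock k pc).eop true β i j u) = (polyFock k pc).eop true β i j (τ u) +
      ∑ c, s c i • (polyFock k pc).d β j c (τ u) := by
  simp only [Fock.eop, LinearMap.sum_apply, map_sum, Module.End.mul_apply, h.z_true, h.d,
    Finset.sum_add_distrib]

omit [CharZero k] in
theorem ra {s : Fin F → Fin n → k} {τ : Module.End k (SM k F n)}
    (h : IsTranslation pc s τ) (i j : Fin n) (u : SM k F n) :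
    τ ((polyFock k pc).ra i j u) = (polyFock k pc).ra i j (τ u) -
      ∑ c, s c j • (polyFock k pc).d true i c (τ u) := by
  rw [Fock.ra, LinearMap.sub_apply, LinearMap.sub_apply, map_sub, h.eop_false, h.eop_true]
  abel

omit [CharZero k] in
theorem rc {s : Fin F → Fin n → k} {τ : Module.End k (SM k F n)}
    (h : IsTranslation pc s τ) (i j : Fin n) (u : SM k F n) :
    τ ((polyFock k pc).rc i j u) = (polyFock k pc).rc i j (τ u) +
      ∑ c, s c i • (polyFock k pc).d false j c (τ u) -
      ∑ c, s c j • (polyFock k pc).d false i c (τ u) := by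
  rw [Fock.rc, LinearMap.sub_apply, LinearMap.sub_apply, map_sub, h.eop_true, h.eop_true]
  abel

omit [CharZero k] in
theorem cE {s : Fin F → Fin n → k} {τ : Module.End k (SM k F n)}
    (h : IsTranslation pc s τ) {c c' : Fin F} (hc : pc c = pc c') (u : SM k F n) :
    τ ((polyFock k pc).cE c c' u) = (polyFock k pc).cE c c' (τ u) +
      ∑ i, s c i • (polyFock k pc).d true i c' (τ u) := by
  simp only [Fock.cE, hc, Bool.xor_self, sgm_false_right, Fintype.sum_prod_type, Fintype.sum_bool,
    LinearMap.add_apply, LinearMap.sum_apply, map_add, map_sum, Module.End.mul_apply, h.z_true,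
    h.z_false, h.d, Finset.sum_add_distrib]
  abel

omit [CharZero k] in
theorem cq {s : Fin F → Fin n → k} {τ : Module.End k (SM k F n)}
    (h : IsTranslation pc s τ) {c c' : Fin F} (hc : pc c = true) (hc' : pc c' = true)
    (u : SM k F n) : τ ((polyFock k pc).cq c c' u) = (polyFock k pc).cq c c' (τ u) +
      (∑ i, s c i • (polyFock k pc).z false i c' (τ u) +
       ∑ i, s c' i • (polyFock k pc).z false i c (τ u)) := by
  simp only [Fock.cq, hc, Bool.not_true, sgm_false_right, Fintype.sum_prod_type, Fintype.sum_bool,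
    LinearMap.add_apply, LinearMap.sum_apply, map_add, map_sum, Module.End.mul_apply, h.z_true,
    h.z_false, Bool.not_false, Finset.sum_add_distrib, map_smul]
  abel

end IsTranslation

end Translation

section Staircase

variable {k : Type} [Field k]

section General

variable {M : Type*} [AddCommGroup M] [Module k M] {C R : Type*} [DecidableEq C] [DecidableEq R]
  {pc : C → Bool} (X : Fock (Module.End k M) pc R)

theorem Fock.d_d_eq_zero {β γ : Bool} {i j : R} {c e : C} {u : M} (h : X.d β i c u = 0) :
    X.d β i c (X.d γ j e u) = 0 := by
  rw [← Module.End.mul_apply, X.dd]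
  exact Fock.sgm_apply_eq_zero _ _ (by rw [Module.End.mul_apply, h, map_zero])

theorem Fock.d_z_eq_zero {β γ : Bool} {i j : R} {c e : C} {u : M} (h : X.d β i c u = 0)
    (hne : ¬(β = γ ∧ i = j ∧ c = e)) : X.d β i c (X.z γ j e u) = 0 := by
  rw [← Module.End.mul_apply, X.dz, if_neg hne, LinearMap.add_apply, LinearMap.zero_apply, add_zero]
  exact Fock.sgm_apply_eq_zero _ _ (by rw [Module.End.mul_apply, h, map_zero])

theorem Fock.d_cq_eq_zero [Fintype R] {β : Bool} {i : R} {c a b : C} {u : M} (h : X.d β i c u = 0)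
    (ha : c ≠ a) (hb : c ≠ b) : X.d β i c (X.cq a b u) = 0 := by
  rw [Fock.cq, LinearMap.sum_apply, map_sum]
  refine Finset.sum_eq_zero fun p _ => ?_
  rw [← Module.End.mul_apply, mul_sgm]
  refine Fock.sgm_apply_eq_zero _ _ ?_
  rw [Module.End.mul_apply, Module.End.mul_apply]
  exact X.d_z_eq_zero (X.d_z_eq_zero h (by simp [hb])) (by simp [ha])

theorem Fock.d_cE_eq_zero [Fintype R] {β : Bool} {i : R} {c a b : C} {u : M} (h : X.d β i c u = 0)
    (ha : c ≠ a) : X.d β i c (X.cE a b u) = 0 := by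
  rw [Fock.cE, LinearMap.sum_apply, map_sum]
  refine Finset.sum_eq_zero fun p _ => ?_
  rw [← Module.End.mul_apply, mul_sgm]
  refine Fock.sgm_apply_eq_zero _ _ ?_
  rw [Module.End.mul_apply, Module.End.mul_apply]
  exact X.d_z_eq_zero (X.d_d_eq_zero h) (by simp [ha])

theorem Fock.sum_cE_self [Fintype C] [Fintype R] : ∑ c, X.cE c c =
    ∑ i, X.eop true true i i + ∑ i, X.eop false false i i := by
  simp only [Fock.cE, Fock.eop, Bool.xor_self, sgm_false_right, Fintype.sum_prod_type,
    Fintype.sum_bool, Finset.sum_add_distrib]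
  rw [Finset.sum_comm, Finset.sum_comm (γ := C)]

theorem Fock.sum_eop_cE [Fintype C] [Fintype R] (β : Bool) (a b : C) :
    (∑ i, X.eop β β i i) * X.cE a b = X.cE a b * ∑ i, X.eop β β i i := by
  rw [Finset.sum_mul, Finset.mul_sum]
  refine Finset.sum_congr rfl fun i _ => ?_
  rw [X.eop_cE]; simp

end General

variable [CharZero k] {F n : ℕ}

theorem sum_castLE {A : Type*} [AddCommMonoid A] {l n : ℕ} (h : l ≤ n) {g : Fin n → A}
    (hg : ∀ i, l ≤ i.val → g i = 0) : ∑ i, g i = ∑ a : Fin l, g (Fin.castLE h a) := by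
  refine (Finset.sum_of_injOn (Fin.castLE h) (fun a _ b _ hab => Fin.castLE_injective h hab)
    (fun _ _ => Finset.mem_coe.2 (Finset.mem_univ _)) (fun i _ hi => ?_) (fun _ _ => rfl)).symm
  refine hg i ?_
  by_contra hlt
  exact hi ⟨⟨i.val, by omega⟩, by simp, rfl⟩

/-- The amount by which variables are shifted. -/
def diagShift (k : Type) [Field k] {F n : ℕ} (l : ℕ) (c : Fin F) (i : Fin n) : k :=
  if i.val = c.val ∧ c.val < l then 1 else 0

omit [CharZero k] in
theorem sum_diagShift_col {M : Type*} [AddCommGroup M] [Module k M] {l : ℕ} (i : Fin n)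
    (c : Fin F) (hc : c.val < l) (hic : i.val = c.val) (g : Fin F → M) :
    ∑ e, diagShift k l e i • g e = g c := by
  rw [Finset.sum_eq_single c (fun e _ he => ?_) (by simp), diagShift, if_pos ⟨hic, hc⟩, one_smul]
  rw [diagShift, if_neg (fun h => he (Fin.ext (by omega))), zero_smul]

omit [CharZero k] in
theorem sum_diagShift_row {M : Type*} [AddCommGroup M] [Module k M] {l : ℕ} (i : Fin n)
    (c : Fin F) (hc : c.val < l) (hic : i.val = c.val) (g : Fin n → M) :
    ∑ j, diagShift k l c j • g j = g i := by
  rw [Finset.sum_eq_single i (fun e _ he => ?_) (by simp), diagShift, if_pos ⟨hic, hc⟩, one_smul]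
  rw [diagShift, if_neg (fun h => he (Fin.ext (by omega))), zero_smul]

omit [CharZero k] in
theorem sum_diagShift_eq_zero {M : Type*} [AddCommGroup M] [Module k M] {l : ℕ} (i : Fin n)
    (hi : l ≤ i.val) (g : Fin F → M) : ∑ e, diagShift k l e i • g e = 0 := by
  refine Finset.sum_eq_zero fun e _ => ?_
  rw [diagShift, if_neg (fun h => by omega), zero_smul]

variable {pc : Fin F → Bool}

theorem rowComp_zero_eop_true (β : Bool) (i j : Fin n) (u : SM k F n) :
    rowComp k pc 0 ((polyFock k pc).eop true β i j u) = 0 := by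
  rw [Fock.eop, LinearMap.sum_apply, map_sum]
  refine Finset.sum_eq_zero fun c _ => ?_
  rw [Module.End.mul_apply, ← Module.End.mul_apply, rowComp_zero_z_true]
  rfl

theorem rowComp_zero_rc (i j : Fin n) (u : SM k F n) :
    rowComp k pc 0 ((polyFock k pc).rc i j u) = 0 := by
  rw [Fock.rc, LinearMap.sub_apply, map_sub, rowComp_zero_eop_true, rowComp_zero_eop_true, sub_zero]

theorem rowComp_zero_cq (c c' : Fin F) (u : SM k F n) :
    rowComp k pc 0 ((polyFock k pc).cq c c' u) = 0 := by
  rw [Fock.cq, LinearMap.sum_apply, map_sum]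
  refine Finset.sum_eq_zero fun p _ => ?_
  rw [← Module.End.mul_apply, mul_sgm]
  refine Fock.sgm_apply_eq_zero _ _ ?_
  obtain ⟨p, i⟩ := p
  cases p
  · rw [(polyFock k pc).zz, mul_sgm]
    refine Fock.sgm_apply_eq_zero _ _ ?_
    rw [← mul_assoc, Bool.not_false, rowComp_zero_z_true, zero_mul]; rfl
  · rw [← mul_assoc, rowComp_zero_z_true, zero_mul]; rfl

theorem rowComp_ra (s : ℕ) (i j : Fin n) : rowComp k pc s * (polyFock k pc).ra i j =
    (polyFock k pc).ra i j * rowComp k pc s := by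
  refine LinearMap.ext fun u => ?_
  have h1 := LinearMap.congr_fun (rowComp_eop (k := k) (pc := pc) s false i j) u
  have h2 := LinearMap.congr_fun (rowComp_eop (k := k) (pc := pc) s true j i) u
  rw [Module.End.mul_apply, Module.End.mul_apply] at h1 h2 ⊢
  rw [Fock.ra, LinearMap.sub_apply, LinearMap.sub_apply, map_sub, h1, h2]

theorem rowComp_d_false_apply (s : ℕ) (i : Fin n) (c : Fin F) (u : SM k F n) :
    rowComp k pc s ((polyFock k pc).d false i c u) =
      (polyFock k pc).d false i c (rowComp k pc s u) := by
  have h := LinearMap.congr_fun (rowComp_d_false (k := k) (pc := pc) s i c) u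
  rwa [Module.End.mul_apply, Module.End.mul_apply] at h

theorem d_true_rowComp_zero (i : Fin n) (c : Fin F) (u : SM k F n) :
    (polyFock k pc).d true i c (rowComp k pc 0 u) = 0 := by
  suffices h : (polyFock k pc).d true i c * rowComp k pc 0 = 0 from LinearMap.congr_fun h u
  refine end_ext_bvec fun b => ?_
  rw [Module.End.mul_apply, rowComp_bvec]
  split_ifs with hb
  · have h := LinearMap.congr_fun (Fock.sum_eop_d (polyFock k pc) true true i c) (bvec k F n b)
    rw [Module.End.mul_apply, LinearMap.sub_apply, Module.End.mul_apply, sum_eop_bvec, ← hb] at h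
    ext e
    have h1 := rowComp_of_eigen (pc := pc) (v := (polyFock k pc).d true i c (bvec k F n b))
      (m := -1) (by rw [h]; simp) (rowDeg pc true e)
    rw [if_neg (by omega)] at h1
    have h2 := DFunLike.congr_fun h1 e
    rw [rowComp, diagOp_apply, if_pos rfl, one_mul] at h2
    exact h2
  · rw [map_zero]; rfl

/-- Invariants with few columns are polynomials in the quadratic invariants. -/
theorem inv_mem_qSub_of_le {l : ℕ} (hF : l ≤ F) (hn : l ≤ n) (hpc : ∀ c : Fin F, c.val < l → pc c = true)
    {r : ℕ} {f : SM k F n} (hf : (polyFock k pc).IsInv f)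
    (hr : (∑ i, (polyFock k pc).eop false false i i) f = (r : k) • f)
    (hs : ∀ β i (c : Fin F), l ≤ c.val → (polyFock k pc).d β i c f = 0) :
    f ∈ (polyFock k pc).qSub (vac k F n) := by
  set X := polyFock k (n := n) pc with hX
  obtain ⟨τ, hτ⟩ := exists_translation (pc := pc) (n := n) (diagShift k l) (fun c hc i => by
    rw [diagShift, if_neg]
    rintro ⟨-, h⟩
    rw [hpc c h] at hc
    exact Bool.noConfusion hc)
  set K : Submodule k (SM k F n) :=
    { carrier := {g | g ∈ X.qSub (vac k F n) ∧ (∀ i j, X.ra i j g = 0) ∧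
        ∀ β i (c : Fin F), l ≤ c.val → X.d β i c g = 0}
      add_mem' := fun {a b} ha hb => ⟨Submodule.add_mem _ ha.1 hb.1,
        fun i j => by rw [map_add, ha.2.1, hb.2.1, add_zero],
        fun β i c hc => by rw [map_add, ha.2.2 β i c hc, hb.2.2 β i c hc, add_zero]⟩
      zero_mem' := ⟨Submodule.zero_mem _, fun i j => map_zero _, fun β i c _ => map_zero _⟩
      smul_mem' := fun x a ha => ⟨Submodule.smul_mem _ _ ha.1,
        fun i j => by rw [map_smul, ha.2.1, smul_zero],
        fun β i c hc => by rw [map_smul, ha.2.2 β i c hc, smul_zero]⟩ } with hK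
  have hKv : vac k F n ∈ K := by
    refine ⟨Fock.mem_qSub_self _, fun i j => ?_, fun β i c _ => polyFock_d_vac _ _ _⟩
    rw [Fock.ra, LinearMap.sub_apply, Fock.eop, Fock.eop, LinearMap.sum_apply, LinearMap.sum_apply,
      Finset.sum_eq_zero, Finset.sum_eq_zero, sub_zero] <;> intro c _ <;>
    rw [Module.End.mul_apply, polyFock_d_vac, map_zero]
  have hKq : ∀ a b : Fin l, ∀ g ∈ K, X.cq (Fin.castLE hF a) (Fin.castLE hF b) g ∈ K := by
    intro a b g hg
    refine ⟨Fock.cq_mem_qSub hg.1 _ _, fun i j => ?_, fun β i c hc => ?_⟩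
    · rw [← Module.End.mul_apply, X.ra_cq, Module.End.mul_apply, hg.2.1, map_zero]
    · refine X.d_cq_eq_zero (hg.2.2 β i c hc) ?_ ?_ <;>
      · rintro rfl
        simp at hc
        omega
  have key : ∀ (r : ℕ) (u : SM k F n), (∀ i c, X.d true i c u = 0) →
      (∀ (i : Fin n) (c : Fin F), l ≤ i.val ∨ l ≤ c.val → X.d false i c u = 0) →
      (∀ a b : Fin l, X.d false (Fin.castLE hn a) (Fin.castLE hF b) u =
        X.d false (Fin.castLE hn b) (Fin.castLE hF a) u) →
      (∑ i, X.eop false false i i) u = (r : k) • u → u ∈ K.map (rowComp k pc 0 * τ) := by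
    intro r
    induction r with
    | zero =>
      intro u h1 h2 h3 h4
      have h5 : ∀ i c, X.d false i c u = 0 := by
        intro i c
        have h6 := LinearMap.congr_fun (X.sum_eop_d false false i c) u
        rw [Module.End.mul_apply, LinearMap.sub_apply, Module.End.mul_apply, h4] at h6
        simp only [CharP.cast_eq_zero, zero_smul, map_zero, if_true, zero_sub] at h6
        rw [hX, polyFock_sum_eop] at h6
        ext b
        have h7 := DFunLike.congr_fun h6 b
        rw [diagOp_apply, Finsupp.neg_apply] at h7
        have h8 : ((rowDeg pc false b + 1 : ℕ) : k) * (polyFock k pc).d false i c u b = 0 := by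
          push_cast; rw [add_mul, h7]; simp
        exact (mul_eq_zero.1 h8).resolve_left (Nat.cast_ne_zero.2 (Nat.succ_ne_zero _))
      obtain ⟨x, rfl⟩ := exists_smul_vac (u := u) fun p i j => by
        have h6 : ∀ β, X.d β j i u = 0 := fun β => by cases β <;> [exact h5 j i; exact h1 j i]
        simpa [hX, polyFock] using h6 (xor p (pc i))
      refine Submodule.smul_mem _ _ ⟨vac k F n, hKv, ?_⟩
      rw [Module.End.mul_apply, hτ.vac]
      have h6 := rowComp_of_eigen (pc := pc) (v := vac k F n) (m := 0) (by
        rw [LinearMap.sum_apply, Finset.sum_eq_zero]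
        · simp
        · intro i _
          rw [Fock.eop, LinearMap.sum_apply]
          exact Finset.sum_eq_zero fun c _ => by rw [Module.End.mul_apply, polyFock_d_vac, map_zero]) 0
      simpa using h6
    | succ r ih =>
      intro u h1 h2 h3 h4
      have h5 : ∀ a b : Fin l, X.d false (Fin.castLE hn a) (Fin.castLE hF b) u ∈
          K.map (rowComp k pc 0 * τ) := by
        intro a b
        refine ih _ (fun i c => X.d_d_eq_zero (h1 i c)) (fun i c h => X.d_d_eq_zero (h2 i c h))
          (fun a' b' => ?_) ?_
        · have h6 := LinearMap.congr_fun (X.dd false false (Fin.castLE hn a') (Fin.castLE hn a)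
            (Fin.castLE hF b') (Fin.castLE hF b)) u
          have h7 := LinearMap.congr_fun (X.dd false false (Fin.castLE hn b') (Fin.castLE hn a)
            (Fin.castLE hF a') (Fin.castLE hF b)) u
          rw [hpc _ (by simp), hpc _ (by simp)] at h6 h7
          simp only [Bool.xor_true, Bool.not_false, sgm_true_true, LinearMap.neg_apply,
            Module.End.mul_apply] at h6 h7
          rw [h6, h7, h3]
        · have h6 := LinearMap.congr_fun (X.sum_eop_d false false (Fin.castLE hn a)
            (Fin.castLE hF b)) u
          rw [Module.End.mul_apply, LinearMap.sub_apply, Module.End.mul_apply, h4] at h6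
          rw [h6]
          simp [add_smul]
      have h6 : ∀ a b : Fin l, ∀ v ∈ K.map (rowComp k pc 0 * τ),
          X.z false (Fin.castLE hn a) (Fin.castLE hF b) v +
          X.z false (Fin.castLE hn b) (Fin.castLE hF a) v ∈ K.map (rowComp k pc 0 * τ) := by
        rintro a b _ ⟨g, hg, rfl⟩
        refine ⟨_, hKq a b g hg, ?_⟩
        rw [Module.End.mul_apply, Module.End.mul_apply, hτ.cq (hpc _ (by simp)) (hpc _ (by simp)),
          map_add, rowComp_zero_cq, zero_add,
          sum_diagShift_row (Fin.castLE hn a) _ (by simp) (by simp),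
          sum_diagShift_row (Fin.castLE hn b) _ (by simp) (by simp), map_add,
          ← Module.End.mul_apply, ← Module.End.mul_apply (rowComp k pc 0), rowComp_z_false,
          rowComp_z_false]
        rfl
      have h7 : (∑ i, X.eop false false i i) u = ∑ a : Fin l, ∑ b : Fin l,
          X.z false (Fin.castLE hn a) (Fin.castLE hF b)
            (X.d false (Fin.castLE hn a) (Fin.castLE hF b) u) := by
        rw [LinearMap.sum_apply, sum_castLE hn]
        · refine Finset.sum_congr rfl fun a _ => ?_
          rw [Fock.eop, LinearMap.sum_apply, sum_castLE hF]
          · rfl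
          · intro c hc
            rw [Module.End.mul_apply, h2 _ _ (Or.inr hc), map_zero]
        · intro i hi
          rw [Fock.eop, LinearMap.sum_apply]
          exact Finset.sum_eq_zero fun c _ => by
            rw [Module.End.mul_apply, h2 _ _ (Or.inl hi), map_zero]
      have h8 : (2 : k) • ((r + 1 : ℕ) : k) • u ∈ K.map (rowComp k pc 0 * τ) := by
        rw [← h4, two_smul]
        nth_rewrite 2 [h7]
        rw [Finset.sum_comm, h7, ← Finset.sum_add_distrib]
        refine Submodule.sum_mem _ fun a _ => ?_
        rw [← Finset.sum_add_distrib]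
        refine Submodule.sum_mem _ fun b _ => ?_
        rw [h3 b a]
        exact h6 a b _ (h5 a b)
      rw [smul_smul] at h8
      exact (Submodule.smul_mem_iff _ (mul_ne_zero two_ne_zero
        (Nat.cast_ne_zero.2 (Nat.succ_ne_zero _)))).1 h8
  have hrc : ∀ i j, ∑ c, diagShift k l c i • X.d false j c (rowComp k pc 0 (τ f)) =
      ∑ c, diagShift k l c j • X.d false i c (rowComp k pc 0 (τ f)) := by
    intro i j
    have h := hτ.rc i j f
    rw [← hX, hf.rc, map_zero] at h
    have h' := congrArg (rowComp k pc 0) h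
    rw [map_sub, map_add, rowComp_zero_rc, map_zero, zero_add, map_sum, map_sum] at h'
    rw [eq_comm, sub_eq_zero] at h'
    simpa only [map_smul, hX, rowComp_d_false_apply] using h'
  have hcomp : ∀ i (c : Fin F), X.d false i c (rowComp k pc 0 (τ f)) =
      rowComp k pc 0 (τ (X.d false i c f)) := by
    intro i c
    rw [hτ.d, ← Module.End.mul_apply, ← rowComp_d_false]; rfl
  obtain ⟨g, hg, hgf⟩ : rowComp k pc 0 (τ f) ∈ K.map (rowComp k pc 0 * τ) := by
    refine key r _ (fun i c => d_true_rowComp_zero _ _ _) (fun i c hic => ?_) (fun a b => ?_) ?_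
    · rcases hic with hi | hc
      · by_cases hc : c.val < l
        · have h1 := hrc ⟨c.val, by omega⟩ i
          rw [sum_diagShift_col (⟨c.val, by omega⟩ : Fin n) c hc rfl,
            sum_diagShift_eq_zero _ hi] at h1
          exact h1
        · rw [hcomp, hs _ _ _ (not_lt.1 hc), map_zero, map_zero]
      · rw [hcomp, hs _ _ _ hc, map_zero, map_zero]
    · have h1 := hrc (Fin.castLE hn b) (Fin.castLE hn a)
      rw [sum_diagShift_col _ (Fin.castLE hF b) (by simp) (by simp),
        sum_diagShift_col _ (Fin.castLE hF a) (by simp) (by simp)] at h1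
      exact h1
    · have h1 : rowComp k pc 0 * (∑ i, X.eop false false i i) =
          (∑ i, X.eop false false i i) * rowComp k pc 0 := by
        rw [Finset.mul_sum, Finset.sum_mul]
        exact Finset.sum_congr rfl fun i _ => rowComp_eop _ _ _ _
      rw [← Module.End.mul_apply, ← h1, Module.End.mul_apply, LinearMap.sum_apply]
      simp only [hX, ← hτ.eop_false]
      rw [← map_sum, ← LinearMap.sum_apply, ← hX, hr, map_smul, map_smul]
  suffices h : τ (f - g) = 0 by
    have h1 := hτ.inj _ h
    rw [sub_eq_zero] at h1
    rw [h1]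
    exact hg.1
  refine eq_zero_of_rowComp_zero (pc := pc) {v | v = τ (f - g) ∨ v = 0} ?_ ?_ (Or.inl rfl)
  · rintro h (rfl | rfl) i c
    · refine ⟨0, Or.inr rfl, ?_⟩
      by_cases hc : c.val < l
      · refine ⟨X.ra i ⟨c.val, by omega⟩, fun s => rowComp_ra _ _ _, ?_⟩
        have h1 := hτ.ra i ⟨c.val, by omega⟩ (f - g)
        rw [← hX, map_sub, hf.ra, hg.2.1, sub_zero, map_zero,
          sum_diagShift_col (⟨c.val, by omega⟩ : Fin n) c hc rfl, eq_comm, sub_eq_zero] at h1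
        rw [zero_add, h1]
      · refine ⟨0, fun s => by rw [mul_zero, zero_mul], ?_⟩
        rw [← hτ.d, ← hX, map_sub, hs _ _ _ (not_lt.1 hc), hg.2.2 _ _ _ (not_lt.1 hc), sub_zero,
          map_zero]
        simp
    · exact ⟨0, Or.inr rfl, 0, fun s => by rw [mul_zero, zero_mul], by simp⟩
  · rintro h (rfl | rfl)
    · rw [map_sub, map_sub, ← hgf, Module.End.mul_apply, sub_self]
    · exact map_zero _

/-- An upper bound for the degree in rows of the first kind. -/
theorem eq_zero_of_rowDeg_false {l R : ℕ} (hF : l ≤ F) (hpc : ∀ c : Fin F, c.val < l → pc c = true)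
    {v : SM k F n} (hs : ∀ β i (c : Fin F), l ≤ c.val → (polyFock k pc).d β i c v = 0)
    (hv : (∑ i, (polyFock k pc).eop false false i i) v = (R : k) • v) (hR : l * n < R) : v = 0 := by
  ext b
  by_contra hb
  have h0 : v b ≠ 0 := hb
  have h1 := DFunLike.congr_fun hv b
  rw [polyFock_sum_eop, diagOp_apply, Finsupp.smul_apply, smul_eq_mul] at h1
  have h2 : rowDeg pc false b = R := Nat.cast_injective (mul_right_cancel₀ h0 h1)
  have h3 : rowDeg pc false b ≤ ∑ c : Fin F, if c.val < l then n else 0 := by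
    refine Finset.sum_le_sum fun c _ => ?_
    by_cases hc : c.val < l
    · rw [if_pos hc]
      calc _ ≤ ∑ _i : Fin n, 1 := Finset.sum_le_sum fun i _ => by
            rw [hpc c hc]; simp only [Bool.xor_true, Bool.not_false, if_true]; split_ifs <;> simp
        _ = n := by simp
    · rw [if_neg hc]
      refine (Finset.sum_eq_zero fun i _ => ?_).le
      have h4 : ∀ β, (polyFock k pc).z β i c ((polyFock k pc).d β i c v) b = 0 := fun β => by
        rw [hs β i c (not_lt.1 hc), map_zero]; rfl
      have h5 := h4 false
      simp only [polyFock] at h5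
      cases h6 : xor false (pc c) <;> rw [h6] at h5
      · have h7 : zE k F n c i * dE k F n c i = diagOp fun b => (b.1 (c, i) : k) :=
          eq_diagOp fun b => zE_dE_bvec _ _ _
        have h8 := DFunLike.congr_fun (LinearMap.congr_fun h7 v) b
        rw [diagOp_apply, Module.End.mul_apply] at h8
        have h9 := h8.symm.trans h5
        have := Nat.cast_eq_zero.1 ((mul_eq_zero.1 h9).resolve_right h0)
        simpa using this
      · have h7 : zO k F n c i * dO k F n c i = diagOp fun b => if b.2 (c, i) then (1 : k) else 0 :=
          eq_diagOp fun b => zO_dO_bvec _ _ _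
        have h8 := DFunLike.congr_fun (LinearMap.congr_fun h7 v) b
        rw [diagOp_apply, Module.End.mul_apply] at h8
        have h9 := (mul_eq_zero.1 (h8.symm.trans h5)).resolve_right h0
        simpa using h9
  rw [← Finset.sum_filter, Finset.sum_const, Fin.card_filter_val_lt, min_eq_right hF,
    smul_eq_mul] at h3
  omega

theorem two_mul_card_filter_lt (n : ℕ) :
    2 * (Finset.univ.filter fun p : Fin n × Fin n => p.1 < p.2).card + n = n * n := by
  have h1 : (Finset.univ.filter fun p : Fin n × Fin n => p.1 < p.2).card = ∑ i : Fin n, i.val := by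
    rw [Finset.card_filter, Fintype.sum_prod_type_right]
    refine Finset.sum_congr rfl fun j _ => ?_
    rw [← Finset.card_filter]
    have := Fin.card_filter_val_lt (n := n) (m := j.val)
    rw [min_eq_right j.isLt.le] at this
    exact this
  rw [h1, Fin.sum_univ_eq_sum_range (fun i => i) n, mul_comm, Finset.sum_range_id_mul_two]
  cases n with
  | zero => rfl
  | succ n => simp; ring

/-- Symmetric systems of derivatives in too many columns. -/
theorem eq_zero_of_symm_derivative {l r : ℕ} (hF : l ≤ F) (hn : n < l)
    (hpc : ∀ c : Fin F, c.val < l → pc c = true) (cR : Fin n → Fin F)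
    (hcR : ∀ i, (cR i).val = i.val) {u : SM k F n}
    (hs : ∀ β i (c : Fin F), l ≤ c.val → (polyFock k pc).d β i c u = 0)
    (hsym : ∀ i j, (polyFock k pc).d false i (cR j) u = (polyFock k pc).d false j (cR i) u)
    (hu : (∑ i, (polyFock k pc).eop false false i i) u = (r : k) • u) (hr : 2 * r = l * (l + 1)) :
    u = 0 := by
  set X := polyFock k (n := n) pc with hX
  have hlt : ∀ i, (cR i).val < l := fun i => by rw [hcR]; omega
  have hinj : ∀ {i j}, cR i = cR j ↔ i = j := fun {i j} =>
    ⟨fun h => Fin.ext (by rw [← hcR i, ← hcR j, h]), fun h => by rw [h]⟩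
  have hdz : ∀ (a b : Fin n) (p : Fin n × Fin n) (v : SM k F n),
      X.d false a (cR b) (X.z false p.1 (cR p.2) v) = -X.z false p.1 (cR p.2) (X.d false a (cR b) v) +
        if a = p.1 ∧ b = p.2 then v else 0 := by
    intro a b p v
    have h := LinearMap.congr_fun (X.dz false false a p.1 (cR b) (cR p.2)) v
    rw [hpc _ (hlt _), hpc _ (hlt _)] at h
    simp only [Bool.xor_true, Bool.not_false, sgm_true_true, Module.End.mul_apply,
      LinearMap.add_apply, LinearMap.neg_apply, true_and, hinj] at h
    rw [h]
    split_ifs <;> rfl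
  set w : List (Fin n × Fin n) → SM k F n :=
    fun L => L.foldr (fun p v => X.z false p.1 (cR p.2) v) u with hw
  have hwc : ∀ p L, w (p :: L) = X.z false p.1 (cR p.2) (w L) := fun p L => rfl
  have h1 : ∀ L : List (Fin n × Fin n), (∀ p ∈ L, p.1 < p.2) → ∀ q : Fin n × Fin n, q.1 < q.2 →
      q ∉ L → X.d false q.1 (cR q.2) (w L) = X.d false q.2 (cR q.1) (w L) := by
    intro L
    induction L with
    | nil => intro _ q _ _; exact hsym _ _
    | cons p L ih =>
      intro hL q hq hqL
      have hp : p.1 < p.2 := hL p (by simp)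
      rw [hwc, hdz, hdz, ih (fun p hp => hL p (by simp [hp])) q hq (fun h => hqL (by simp [h])),
        if_neg, if_neg]
      · rintro ⟨h2, h3⟩; rw [h2, h3] at hq; exact absurd hq (not_lt.2 hp.le)
      · rintro ⟨h2, h3⟩; exact hqL (by simp [Prod.ext h2 h3])
  have h2 : ∀ L : List (Fin n × Fin n), L.Nodup → (∀ p ∈ L, p.1 < p.2) → w L = 0 → u = 0 := by
    intro L
    induction L with
    | nil => intro _ _ h; exact h
    | cons p L ih =>
      intro hnd hL h
      have hp : p.1 < p.2 := hL p (by simp)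
      have hL' : ∀ p ∈ L, p.1 < p.2 := fun p hp => hL p (by simp [hp])
      refine ih hnd.of_cons hL' ?_
      have h3 : X.d false p.1 (cR p.2) (w (p :: L)) - X.d false p.2 (cR p.1) (w (p :: L)) = w L := by
        rw [hwc, hdz, hdz, h1 L hL' p hp (List.nodup_cons.1 hnd).1, if_pos ⟨rfl, rfl⟩, if_neg]
        · abel
        · rintro ⟨h4, -⟩; exact absurd h4 hp.ne'
      rw [← h3, h, map_zero, map_zero, sub_zero]
  have h3 : ∀ L : List (Fin n × Fin n), ∀ β i (c : Fin F), l ≤ c.val → X.d β i c (w L) = 0 := by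
    intro L
    induction L with
    | nil => exact hs
    | cons p L ih =>
      intro β i c hc
      refine X.d_z_eq_zero (ih β i c hc) ?_
      rintro ⟨-, -, rfl⟩
      exact absurd (hlt p.2) (not_lt.2 hc)
  have h4 : ∀ L : List (Fin n × Fin n), (∑ i, X.eop false false i i) (w L) =
      ((r + L.length : ℕ) : k) • w L := by
    intro L
    induction L with
    | nil => rw [List.length_nil, add_zero]; exact hu
    | cons p L ih =>
      have h5 := LinearMap.congr_fun (X.sum_eop_z false false p.1 (cR p.2)) (w L)
      rw [Module.End.mul_apply, LinearMap.add_apply, Module.End.mul_apply, ih] at h5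
      rw [hwc, h5]
      simp [add_smul, ← add_assoc]
  refine h2 (Finset.univ.filter fun p : Fin n × Fin n => p.1 < p.2).toList (Finset.nodup_toList _)
    (fun p hp => by simpa using hp) (eq_zero_of_rowDeg_false hF hpc (h3 _) (h4 _) ?_)
  have h5 := two_mul_card_filter_lt n
  rw [Finset.length_toList]
  nlinarith

/-- There are no invariants with too many columns. -/
theorem inv_eq_zero_of_lt {l : ℕ} (hF : l ≤ F) (hn : n < l) (hpc : ∀ c : Fin F, c.val < l → pc c = true)
    {r : ℕ} (hrl : 2 * r = l * (l + 1)) {f : SM k F n} (hf : (polyFock k pc).IsInv f)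
    (hr : (∑ i, (polyFock k pc).eop false false i i) f = (r : k) • f)
    (hs : ∀ β i (c : Fin F), l ≤ c.val → (polyFock k pc).d β i c f = 0) : f = 0 := by
  set X := polyFock k (n := n) pc with hX
  obtain ⟨τ, hτ⟩ := exists_translation (pc := pc) (n := n) (diagShift k l) (fun c hc i => by
    rw [diagShift, if_neg]
    rintro ⟨-, h⟩
    rw [hpc c h] at hc
    exact Bool.noConfusion hc)
  set cR : Fin n → Fin F := fun i => ⟨i.val, by omega⟩ with hcR
  have hlt : ∀ i, (cR i).val < l := fun i => i.isLt.trans hn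
  have hcE : ∀ (i : Fin n) (c : Fin F), c.val < l → ∀ h, X.d true i c (τ h) =
      τ (X.cE (cR i) c h) + (-X.cE (cR i) c) (τ h) := by
    intro i c hc h
    rw [hX, hτ.cE (by rw [hpc _ hc, hpc _ (hlt i)]), sum_diagShift_row i (cR i) (hlt i) rfl,
      LinearMap.neg_apply]
    abel
  refine hτ.inj _ (eq_zero_of_rowComp_zero (pc := pc) {v | ∃ h, v = τ h ∧ (∀ i j, X.rc i j h = 0) ∧
    (∑ i, X.eop false false i i) h = (r : k) • h ∧ ∀ β i (c : Fin F), l ≤ c.val → X.d β i c h = 0}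
    ?_ ?_ ⟨f, rfl, hf.rc, hr, hs⟩)
  · rintro _ ⟨h, rfl, h1, h2, h3⟩ i c
    by_cases hc : c.val < l
    · refine ⟨τ (X.cE (cR i) c h), ⟨_, rfl, fun i' j' => ?_, ?_, fun β i' c' hc' => ?_⟩,
        -X.cE (cR i) c, fun s => ?_, hcE i c hc h⟩
      · rw [← Module.End.mul_apply, X.rc_cE]
        exact Fock.sgm_apply_eq_zero _ _ (by rw [Module.End.mul_apply, h1, map_zero])
      · rw [← Module.End.mul_apply, X.sum_eop_cE, Module.End.mul_apply, h2, map_smul]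
      · exact X.d_cE_eq_zero (h3 _ _ _ hc') (fun h => absurd (hlt i) (by rw [← h]; omega))
      · refine LinearMap.ext fun v => ?_
        have h4 := LinearMap.congr_fun (rowComp_cE (k := k) (n := n) (pc := pc) s (cR i) c) v
        rw [Module.End.mul_apply, Module.End.mul_apply] at h4 ⊢
        rw [LinearMap.neg_apply, LinearMap.neg_apply, map_neg, ← h4]
    · refine ⟨0, ⟨0, (map_zero τ).symm, fun _ _ => map_zero _, by simp, fun _ _ _ _ => map_zero _⟩, 0,
        fun s => by rw [mul_zero, zero_mul], ?_⟩
      rw [← hτ.d, ← hX, h3 _ _ _ (not_lt.1 hc), map_zero]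
      simp
  · rintro _ ⟨h, rfl, h1, h2, h3⟩
    refine eq_zero_of_symm_derivative (pc := pc) hF hn hpc cR (fun _ => rfl) (fun β i c hc => ?_)
      (fun i j => ?_) ?_ hrl (r := r)
    · cases β
      · rw [← rowComp_d_false_apply, ← hτ.d, ← hX, h3 _ _ _ hc, map_zero, map_zero]
      · exact d_true_rowComp_zero _ _ _
    · have h4 := congrArg (rowComp k pc 0) (hτ.rc i j h)
      rw [← hX, h1, map_zero, sum_diagShift_col i (cR i) (hlt i) rfl,
        sum_diagShift_col j (cR j) (hlt j) rfl, map_zero, map_sub, map_add, hX, rowComp_zero_rc,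
        zero_add, rowComp_d_false_apply, rowComp_d_false_apply, eq_comm, sub_eq_zero] at h4
      exact h4.symm
    · have h4 : rowComp k pc 0 * (∑ i, X.eop false false i i) =
          (∑ i, X.eop false false i i) * rowComp k pc 0 := by
        rw [Finset.mul_sum, Finset.sum_mul]
        exact Finset.sum_congr rfl fun i _ => rowComp_eop _ _ _ _
      rw [← hX, ← Module.End.mul_apply, ← h4, Module.End.mul_apply, LinearMap.sum_apply]
      simp only [hX, ← hτ.eop_false]
      rw [← map_sum, ← LinearMap.sum_apply, ← hX, h2, map_smul, map_smul]

/-- The first fundamental theorem for the rows. -/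
theorem inv_mem_qSub {N : ℕ} (hN : N ≤ F) (hpc : ∀ c : Fin F, pc c = decide (c.val < N))
    (lam : Fin F → ℕ) (hlam : ∑ c, lam c < N) {f : SM k F n} (hf : (polyFock k pc).IsInv f)
    (hw : (polyFock k pc).IsWt (fun c => lam c) f) : f ∈ (polyFock k pc).qSub (vac k F n) := by
  obtain rfl : pc = fun c : Fin F => decide (c.val < N) := funext hpc
  refine inv_mem_qSub_of_staircase hN (fun l f hl1 hlN hf hw => ?_) _ hlam _ lam f rfl rfl hf hw
  have hlF : l ≤ N := by nlinarith
  have hs : ∀ β i (c : Fin F), l ≤ c.val →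
      (polyFock k (fun c : Fin F => decide (c.val < N))).d β i c f = 0 := by
    intro β i c hc
    refine polyFock_d_eq_zero ?_ β i
    rw [hw c]
    simp [not_lt.2 hc]
  obtain ⟨r, hr⟩ : ∃ r, l * (l + 1) = 2 * r := (Nat.even_mul_succ_self l).two_dvd
  have h1 := LinearMap.congr_fun (Fock.sum_cE_self (polyFock k (n := n) fun c : Fin F =>
    decide (c.val < N))) f
  rw [LinearMap.sum_apply, Finset.sum_congr rfl fun c _ => hw c, ← Finset.sum_smul,
    LinearMap.add_apply] at h1
  have h2 : ∑ c : Fin F, (((if c.val < l then (l : ℤ) + 1 else 0 : ℤ)) : k) = 2 * r := by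
    rw [← Int.cast_sum, ← Finset.sum_filter, Finset.sum_const, Fin.card_filter_val_lt,
      min_eq_right (hlF.trans hN)]
    have : ((l * (l + 1) : ℕ) : k) = ((2 * r : ℕ) : k) := by rw [hr]
    push_cast at this
    simpa using this
  have h3 : (∑ i, (polyFock k (n := n) fun c : Fin F => decide (c.val < N)).eop true true i i) f =
      (∑ i, (polyFock k (n := n) fun c : Fin F => decide (c.val < N)).eop false false i i) f := by
    rw [LinearMap.sum_apply, LinearMap.sum_apply]
    refine Finset.sum_congr rfl fun i _ => ?_
    have h4 := hf.ra i i
    rw [Fock.ra, LinearMap.sub_apply, sub_eq_zero] at h4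
    exact h4.symm
  have h4 : (∑ i, (polyFock k (n := n) fun c : Fin F => decide (c.val < N)).eop false false i i) f =
      (r : k) • f := by
    rw [h2, h3, mul_smul, ← two_smul k] at h1
    exact (smul_right_injective _ (two_ne_zero (α := k)) h1).symm
  have hpc' : ∀ c : Fin F, c.val < l → decide (c.val < N) = true := fun c hc => by
    simp only [decide_eq_true_eq]; omega
  by_cases hln : l ≤ n
  · exact inv_mem_qSub_of_le (hlF.trans hN) hln hpc' hf h4 hs
  · rw [inv_eq_zero_of_lt (hlF.trans hN) (not_le.1 hln) hpc' hr.symm hf h4 hs]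
    exact Submodule.zero_mem _

end Staircase

section AbstractFock

variable {k : Type} [Field k]

namespace Fock

section ZSub

variable {M : Type*} [AddCommGroup M] [Module k M] {C R : Type*} [DecidableEq C] [DecidableEq R]
  {pc : C → Bool} (X : Fock (Module.End k M) pc R)

/-- The subspace generated from `v` by creation operators. -/
def zSub (v : M) : Submodule k M :=
  sInf {K | v ∈ K ∧ ∀ β i c, ∀ u ∈ K, X.z β i c u ∈ K}

variable {X}

theorem mem_zSub_self (v : M) : v ∈ X.zSub v := Submodule.mem_sInf.2 fun _ hK => hK.1

theorem z_mem_zSub {v u : M} (hu : u ∈ X.zSub v) (β : Bool) (i : R) (c : C) :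
    X.z β i c u ∈ X.zSub v :=
  Submodule.mem_sInf.2 fun K hK => hK.2 β i c u (Submodule.mem_sInf.1 hu K hK)

theorem zSub_le {v : M} {K : Submodule k M} (hv : v ∈ K)
    (hK : ∀ β i c, ∀ u ∈ K, X.z β i c u ∈ K) : X.zSub v ≤ K := sInf_le ⟨hv, hK⟩

theorem d_zd_eq_zero {β γ γ' : Bool} {i j j' : R} {c e e' : C} {u : M}
    (h : ∀ β i, X.d β i c u = 0) (he : e = e' ∨ c ≠ e) :
    X.d β i c (X.z γ j e (X.d γ' j' e' u)) = 0 := by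
  by_cases hc : c = e
  · obtain rfl | h' := he
    · rw [← hc, h, map_zero, map_zero]
    · exact absurd hc h'
  · exact X.d_z_eq_zero (X.d_d_eq_zero (h β i)) (fun h => hc h.2.2)

theorem d_eop_eq_zero [Fintype C] {β γ γ' : Bool} {i j j' : R} {c : C} {u : M}
    (h : ∀ β i, X.d β i c u = 0) : X.d β i c (X.eop γ γ' j j' u) = 0 := by
  rw [eop, LinearMap.sum_apply, map_sum]
  exact Finset.sum_eq_zero fun e _ => X.d_zd_eq_zero h (Or.inl rfl)

theorem d_cE_self_eq_zero [Fintype R] {β : Bool} {i : R} {c e : C} {u : M}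
    (h : ∀ β i, X.d β i c u = 0) : X.d β i c (X.cE e e u) = 0 := by
  simp only [cE, Bool.xor_self, sgm_false_right, LinearMap.sum_apply, map_sum]
  exact Finset.sum_eq_zero fun p _ => X.d_zd_eq_zero h (Or.inl rfl)

end ZSub

section Transfer

variable [CharZero k] {K : Type*} [AddCommGroup K] [Module k K] {C : Type*} [DecidableEq C]
  {n F : ℕ} {pc : C → Bool} (Y : Fock (Module.End k K) pc (Fin n))

/-- Evaluation of polynomials on a cyclic module. -/
structure IsEval (pF : Fin F → Bool) (ι : C → Fin F) (v0 : K) (Θ : SM k F n →ₗ[k] K) : Prop where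
  vac : Θ (vac k F n) = v0
  z : ∀ β i c u, Θ ((polyFock k pF).z β i (ι c) u) = Y.z β i c (Θ u)
  z_none : ∀ β i e u, (∀ c, ι c ≠ e) → Θ ((polyFock k pF).z β i e u) = 0
  d : ∀ β i c u, Θ ((polyFock k pF).d β i (ι c) u) = Y.d β i c (Θ u)

theorem exists_eval {pF : Fin F → Bool} {ι : C → Fin F} (hι : Function.Injective ι)
    (hp : ∀ c, pF (ι c) = pc c) {v0 : K} (hd : ∀ β i c, Y.d β i c v0 = 0) :
    ∃ Θ : SM k F n →ₗ[k] K, Y.IsEval pF ι v0 Θ := by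
  classical
  set Z : Bool → Fin F → Fin n → Module.End k K := fun p e i =>
    if h : ∃ c, ι c = e then Y.z (xor p (pF e)) i h.choose else 0 with hZ
  have hZι : ∀ p c i, Z p (ι c) i = Y.z (xor p (pc c)) i c := by
    intro p c i
    have h : ∃ c', ι c' = ι c := ⟨c, rfl⟩
    rw [hZ]
    dsimp only
    rw [dif_pos h, hι h.choose_spec, hp]
  have hZ0 : ∀ p e i, (∀ c, ι c ≠ e) → Z p e i = 0 := by
    intro p e i h
    rw [hZ]
    exact dif_neg (fun ⟨c, hc⟩ => h c hc)
  obtain ⟨Θ, h0, hz⟩ := exists_sm_lift (k := k) (F := F) (L := n) (M := K) Z (by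
    intro p q e j e' j'
    by_cases h : ∃ c, ι c = e
    · obtain ⟨c, rfl⟩ := h
      by_cases h' : ∃ c, ι c = e'
      · obtain ⟨c', rfl⟩ := h'
        rw [hZι, hZι, Y.zz]
        simp
      · rw [hZ0 q e' _ (fun c hc => h' ⟨c, hc⟩), mul_zero, zero_mul, sgm_zero]
    · rw [hZ0 p e _ (fun c hc => h ⟨c, hc⟩), mul_zero, zero_mul, sgm_zero]) v0
  refine ⟨Θ, h0, fun β i c u => ?_, fun β i e u he => ?_, fun β i c u => ?_⟩
  · exact (hz _ _ _ _).trans (by rw [hZι, hp]; simp)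
  · exact (hz _ _ _ _).trans (by rw [hZ0 _ _ _ he]; rfl)
  · refine lift_dv hz _ _ _ (Y.d β i c) (by rw [h0, hd]) (fun q e j => ?_) u
    by_cases h : ∃ c, ι c = e
    · obtain ⟨c', rfl⟩ := h
      rw [hZι, Y.dz, hp]
      congr 1
      · simp
      · have : (β = xor q (pc c') ∧ i = j ∧ c = c') ↔ (xor β (pc c) = q ∧ ι c = ι c' ∧ i = j) := by
          rw [hι.eq_iff]
          constructor
          · rintro ⟨rfl, rfl, rfl⟩; simp
          · rintro ⟨rfl, rfl, rfl⟩; simp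
        simp only [this]
    · rw [hZ0 q e _ (fun c hc => h ⟨c, hc⟩), mul_zero, zero_mul, sgm_zero, if_neg, add_zero]
      rintro ⟨-, rfl, -⟩
      exact h ⟨c, rfl⟩

namespace IsEval

variable {Y} {pF : Fin F → Bool} {ι : C → Fin F} {v0 : K} {Θ : SM k F n →ₗ[k] K}

theorem inj (h : Y.IsEval pF ι v0 Θ) (hv : v0 ≠ 0) {u : SM k F n}
    (hu : ∀ e, (∀ c, ι c ≠ e) → ∀ β i, (polyFock k pF).d β i e u = 0) (h0 : Θ u = 0) : u = 0 := by
  refine eq_zero_of_dv_stable (k := k) (u := u)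
    { carrier := {u | (∀ e, (∀ c, ι c ≠ e) → ∀ β i, (polyFock k pF).d β i e u = 0) ∧ Θ u = 0}
      add_mem' := fun {a b} ha hb => ⟨fun e he β i => by rw [map_add, ha.1 e he, hb.1 e he, add_zero],
        by rw [map_add, ha.2, hb.2, add_zero]⟩
      zero_mem' := ⟨fun _ _ _ _ => map_zero _, map_zero _⟩
      smul_mem' := fun x a ha => ⟨fun e he β i => by rw [map_smul, ha.1 e he, smul_zero],
        by rw [map_smul, ha.2, smul_zero]⟩ } ?_ ?_ ⟨hu, h0⟩
  · rintro p e i u ⟨h1, h2⟩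
    have h3 : dv k p e i = (polyFock k (n := n) pF).d (xor p (pF e)) i e := by simp [polyFock]
    rw [h3]
    by_cases he : ∃ c, ι c = e
    · obtain ⟨c, rfl⟩ := he
      exact ⟨fun e he β i => d_d_eq_zero _ (h1 e he β i), by rw [h.d, h2, map_zero]⟩
    · rw [h1 e (fun c hc => he ⟨c, hc⟩)]
      exact ⟨fun _ _ _ _ => map_zero _, map_zero _⟩
  · rintro c ⟨-, h1⟩
    rw [map_smul, h.vac] at h1
    rw [(smul_eq_zero.1 h1).resolve_right hv, zero_smul]

variable [Fintype C]

theorem eop (h : Y.IsEval pF ι v0 Θ) (hι : Function.Injective ι) (β β' : Bool) (i j : Fin n)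
    (u : SM k F n) : Θ ((polyFock k pF).eop β β' i j u) = Y.eop β β' i j (Θ u) := by
  classical
  rw [Fock.eop, Fock.eop, LinearMap.sum_apply, LinearMap.sum_apply, map_sum]
  refine (Finset.sum_of_injOn ι hι.injOn (fun _ _ => Finset.mem_coe.2 (Finset.mem_univ _))
    (fun e _ he => ?_) (fun c _ => ?_)).symm
  · exact h.z_none _ _ _ _ fun c hc => he ⟨c, by simp, hc⟩
  · rw [Module.End.mul_apply, Module.End.mul_apply, h.z, h.d]

theorem isInv (h : Y.IsEval pF ι v0 Θ) (hι : Function.Injective ι) (hv : v0 ≠ 0) {u : SM k F n}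
    (hu : ∀ e, (∀ c, ι c ≠ e) → ∀ β i, (polyFock k pF).d β i e u = 0) (hf : Y.IsInv (Θ u)) :
    (polyFock k pF).IsInv u where
  ra i j := by
    refine h.inj hv (fun e he β l => ?_) ?_
    · rw [Fock.ra, LinearMap.sub_apply, map_sub, d_eop_eq_zero (hu e he),
        d_eop_eq_zero (hu e he), sub_zero]
    · rw [Fock.ra, LinearMap.sub_apply, map_sub, h.eop hι, h.eop hι, ← LinearMap.sub_apply]
      exact hf.ra i j
  rb i j := by
    refine h.inj hv (fun e he β l => ?_) ?_
    · rw [Fock.rb, LinearMap.add_apply, map_add, d_eop_eq_zero (hu e he),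
        d_eop_eq_zero (hu e he), add_zero]
    · rw [Fock.rb, LinearMap.add_apply, map_add, h.eop hι, h.eop hι, ← LinearMap.add_apply]
      exact hf.rb i j
  rc i j := by
    refine h.inj hv (fun e he β l => ?_) ?_
    · rw [Fock.rc, LinearMap.sub_apply, map_sub, d_eop_eq_zero (hu e he),
        d_eop_eq_zero (hu e he), sub_zero]
    · rw [Fock.rc, LinearMap.sub_apply, map_sub, h.eop hι, h.eop hι, ← LinearMap.sub_apply]
      exact hf.rc i j

theorem cE_self (h : Y.IsEval pF ι v0 Θ) (c : C) (u : SM k F n) :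
    Θ ((polyFock k pF).cE (ι c) (ι c) u) = Y.cE c c (Θ u) := by
  simp only [Fock.cE, Bool.xor_self, sgm_false_right, LinearMap.sum_apply, map_sum,
    Module.End.mul_apply, h.z, h.d]

theorem cq (h : Y.IsEval pF ι v0 Θ) (hp : ∀ c, pF (ι c) = pc c) (c c' : C) (u : SM k F n) :
    Θ ((polyFock k pF).cq (ι c) (ι c') u) = Y.cq c c' (Θ u) := by
  have hs : ∀ p q (A : Module.End k (SM k F n)) (B : Module.End k K), Θ (A u) = B (Θ u) →
      Θ (sgm p q A u) = sgm p q B (Θ u) := by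
    intro p q A B hAB
    cases p <;> cases q <;> simpa using hAB
  rw [Fock.cq, Fock.cq, LinearMap.sum_apply, LinearMap.sum_apply, map_sum]
  refine Finset.sum_congr rfl fun p _ => ?_
  rw [hp]
  exact hs _ _ _ _ (by rw [Module.End.mul_apply, Module.End.mul_apply, h.z, h.z])

theorem cq_none (h : Y.IsEval pF ι v0 Θ) {e e' : Fin F} (he : ∀ c, ι c ≠ e) (u : SM k F n) :
    Θ ((polyFock k pF).cq e e' u) = 0 := by
  rw [Fock.cq, LinearMap.sum_apply, map_sum]
  refine Finset.sum_eq_zero fun p _ => ?_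
  have h1 : ∀ s t (A : Module.End k (SM k F n)), Θ (A u) = 0 → Θ (sgm s t A u) = 0 := by
    intro s t A hA
    cases s <;> cases t <;> simpa using hA
  exact h1 _ _ _ (h.z_none _ _ _ _ he)

end IsEval

/-- The first fundamental theorem for cyclic Fock modules. -/
theorem mem_qSub_of_isInv [Fintype C] {v0 : K} (hd : ∀ β i c, Y.d β i c v0 = 0) (hv : v0 ≠ 0)
    (lam : C → ℕ) {f : K} (hz : f ∈ Y.zSub v0) (hf : Y.IsInv f) (hw : Y.IsWt (fun c => lam c) f) :
    f ∈ Y.qSub v0 := by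
  classical
  set m := Fintype.card C with hm
  set N := m + (∑ c, lam c) + 1 with hN
  set e := Fintype.equivFin C with he
  have he_lt : ∀ c, (e c).val < m := fun c => (e c).isLt
  obtain ⟨ι, hιv⟩ : ∃ ι : C → Fin (N + m), ∀ c, (ι c).val = if pc c then (e c).val else N + (e c).val :=
    ⟨fun c => ⟨if pc c then (e c).val else N + (e c).val, by have := he_lt c; split_ifs <;> omega⟩,
      fun _ => rfl⟩
  have hι : Function.Injective ι := by
    intro a b hab
    have h1 := congrArg Fin.val hab
    rw [hιv, hιv] at h1
    have ha := he_lt a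
    have hb := he_lt b
    refine e.injective (Fin.ext ?_)
    split_ifs at h1 <;> omega
  have hp : ∀ c, (decide ((ι c).val < N)) = pc c := by
    intro c
    have hc := he_lt c
    rw [hιv]
    cases pc c
    · simp
    · simp; omega
  obtain ⟨Θ, hΘ⟩ := Y.exists_eval (pF := fun e : Fin (N + m) => decide (e.val < N)) hι hp hd
  obtain ⟨u, hu, rfl⟩ : ∃ u : SM k (N + m) n, (∀ e, (∀ c, ι c ≠ e) → ∀ β i,
      (polyFock k (fun e : Fin (N + m) => decide (e.val < N))).d β i e u = 0) ∧ Θ u = f := by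
    let K' : Submodule k K :=
      { carrier := {f | ∃ u : SM k (N + m) n, (∀ e, (∀ c, ι c ≠ e) → ∀ β i,
          (polyFock k (fun e : Fin (N + m) => decide (e.val < N))).d β i e u = 0) ∧ Θ u = f}
        add_mem' := by
          rintro _ _ ⟨u, hu, rfl⟩ ⟨v, hv, rfl⟩
          exact ⟨u + v, fun e he β i => by rw [map_add, hu e he, hv e he, add_zero], map_add _ _ _⟩
        zero_mem' := ⟨0, fun _ _ _ _ => map_zero _, map_zero _⟩
        smul_mem' := by
          rintro x _ ⟨u, hu, rfl⟩
          exact ⟨x • u, fun e he β i => by rw [map_smul, hu e he, smul_zero], map_smul _ _ _⟩ }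
    refine zSub_le (K := K') ?_ ?_ hz
    · exact ⟨_, fun _ _ _ _ => polyFock_d_vac _ _ _, hΘ.vac⟩
    · rintro β i c _ ⟨u, hu, rfl⟩
      refine ⟨_, fun e he γ j => ?_, hΘ.z β i c u⟩
      exact d_z_eq_zero _ (hu e he γ j) (fun h => he c h.2.2.symm)
  set lam' : Fin (N + m) → ℕ := fun e => if h : ∃ c, ι c = e then lam h.choose else 0 with hlam
  have hlamι : ∀ c, lam' (ι c) = lam c := by
    intro c
    have h : ∃ c', ι c' = ι c := ⟨c, rfl⟩
    rw [hlam]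
    dsimp only
    rw [dif_pos h, hι h.choose_spec]
  have hlam0 : ∀ e, (∀ c, ι c ≠ e) → lam' e = 0 := fun e he => dif_neg fun ⟨c, hc⟩ => he c hc
  have hsum : ∑ e, lam' e = ∑ c, lam c := by
    refine (Finset.sum_of_injOn ι hι.injOn (fun _ _ => Finset.mem_coe.2 (Finset.mem_univ _))
      (fun e _ he => ?_) (fun c _ => (hlamι c).symm)).symm
    exact hlam0 e fun c hc => he ⟨c, by simp, hc⟩
  have h1 := inv_mem_qSub (k := k) (f := u) (N := N) (by omega) (fun _ => rfl) lam' (by omega)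
    (hΘ.isInv hι hv hu hf) (fun e => by
      by_cases h : ∃ c, ι c = e
      · obtain ⟨c, rfl⟩ := h
        rw [← sub_eq_zero]
        refine hΘ.inj hv (fun e he β i => ?_) ?_
        · rw [map_sub, d_cE_self_eq_zero (hu e he), map_smul, hu e he, smul_zero, sub_zero]
        · rw [map_sub, hΘ.cE_self, hw c, map_smul]
          dsimp only
          rw [hlamι, sub_self]
      · dsimp only
        rw [hlam0 e (fun c hc => h ⟨c, hc⟩), Fock.cE, LinearMap.sum_apply]
        rw [Finset.sum_eq_zero fun p _ => Fock.sgm_apply_eq_zero _ _ (by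
          rw [Module.End.mul_apply, hu e (fun c hc => h ⟨c, hc⟩), map_zero])]
        simp)
  refine qSub_le (K := (Y.qSub v0).comap Θ) ?_ ?_ h1
  · rw [Submodule.mem_comap, hΘ.vac]; exact mem_qSub_self _
  · intro e e' u hu _
    rw [Submodule.mem_comap] at hu ⊢
    by_cases h : ∃ c, ι c = e
    · obtain ⟨c, rfl⟩ := h
      by_cases h' : ∃ c, ι c = e'
      · obtain ⟨c', rfl⟩ := h'
        rw [hΘ.cq hp]
        exact cq_mem_qSub hu _ _
      · rw [Fock.cq_symm]
        have h2 : ∀ s t (A : Module.End k (SM k (N + m) n)), Θ (A u) = 0 → Θ (sgm s t A u) = 0 := by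
          intro s t A hA
          cases s <;> cases t <;> simpa using hA
        rw [h2 _ _ _ (hΘ.cq_none (fun c hc => h' ⟨c, hc⟩) u)]
        exact Submodule.zero_mem _
    · rw [hΘ.cq_none (fun c hc => h ⟨c, hc⟩)]
      exact Submodule.zero_mem _

end Transfer

end Fock

end AbstractFock

section HomFock

variable {k : Type} [Field k] {A : Type*} [Ring A] [Algebra k A]

/-- Conjugation by `s` when the parity is odd. -/
def twist (k : Type) [Field k] {A : Type*} [Ring A] [Algebra k A] (s : A) (p : Bool) : A →ₗ[k] A :=
  if p then LinearMap.mulLeft k s ∘ₗ LinearMap.mulRight k s else LinearMap.id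

/-- Right multiplication by an element of the given parity, with signs. -/
def rightMul (k : Type) [Field k] {A : Type*} [Ring A] [Algebra k A] (s : A) (p : Bool) (y : A) :
    A →ₗ[k] A := LinearMap.mulRight k y ∘ₗ twist k s p

@[simp] theorem twist_false (s f : A) : twist k s false f = f := rfl
@[simp] theorem twist_true (s f : A) : twist k s true f = s * (f * s) := rfl
theorem rightMul_apply (s : A) (p : Bool) (y f : A) : rightMul k s p y f = twist k s p f * y := rfl

theorem sgm_apply (p q : Bool) (T : Module.End k A) (f : A) : sgm p q T f = sgm p q (T f) := by
  cases p <;> cases q <;> simp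

theorem twist_twist {s : A} (hs : s * s = 1) (p q : Bool) (f : A) :
    twist k s p (twist k s q f) = twist k s (xor p q) f := by
  cases p <;> cases q <;> simp only [twist_false, twist_true, Bool.xor_true, Bool.xor_false,
    Bool.not_true, Bool.not_false]
  rw [mul_assoc, mul_assoc, hs, mul_one, ← mul_assoc, hs, one_mul]

theorem twist_mul {s : A} (hs : s * s = 1) (p : Bool) (f g : A) :
    twist k s p (f * g) = twist k s p f * twist k s p g := by
  cases p
  · simp
  · simp only [twist_true]
    rw [show s * (f * s) * (s * (g * s)) = s * f * (s * s) * g * s by simp only [mul_assoc], hs]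
    simp only [mul_assoc, mul_one]

theorem twist_sgm (s : A) (p q r : Bool) (f : A) :
    twist k s p (sgm q r f) = sgm q r (twist k s p f) := by
  cases q <;> cases r <;> simp

theorem twist_one {s : A} (hs : s * s = 1) (p : Bool) : twist k s p 1 = 1 := by
  cases p <;> simp [hs]

/-- Conjugation by `s` acts by the parity. -/
def HasParity (k : Type) [Field k] {A : Type*} [Ring A] [Algebra k A] (s : A) (p : Bool) (x : A) :
    Prop := twist k s true x = sgm p true x

theorem HasParity.twist {s : A} {p : Bool} {x : A} (h : HasParity k s p x) (q : Bool) :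
    twist k s q x = sgm q p x := by
  cases q
  · simp
  · rw [h, sgm_swap]

theorem rightMul_mul {s : A} (hs : s * s = 1) {p : Bool} {x : A} (h : HasParity k s p x) (q : Bool)
    (y f : A) : rightMul k s q y (x * f) = sgm p q (x * rightMul k s q y f) := by
  rw [rightMul_apply, rightMul_apply, twist_mul hs, h.twist, sgm_mul, sgm_mul, sgm_swap, mul_assoc]

theorem rightMul_rightMul {s : A} (hs : s * s = 1) {q : Bool} {y : A} (h : HasParity k s q y)
    (p : Bool) (x f : A) :
    rightMul k s p x (rightMul k s q y f) = sgm p q (twist k s (xor p q) f * (y * x)) := by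
  rw [rightMul_apply, rightMul_apply, twist_mul hs, h.twist, twist_twist hs, mul_sgm, sgm_mul,
    mul_assoc]

namespace Fock

variable {C R : Type*} [DecidableEq C] [DecidableEq R] {π : Bool}

/-- The operators have the expected parity with respect to the grading involution `s`. -/
structure IsGraded (k : Type) [Field k] [Algebra k A] (X : Fock A (fun _ : C => π) R) (s : A) :
    Prop where
  ss : s * s = 1
  z : ∀ β i c, HasParity k s (xor β π) (X.z β i c)
  d : ∀ β i c, HasParity k s (xor β π) (X.d β i c)

/-- The parity of the columns of `homFock`. -/
def homParity (C : Type*) (π : Bool) : C ⊕ C → Bool := Sum.elim (fun _ => π) (fun _ => !π)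

@[simp] theorem homParity_inl (c : C) : homParity C π (Sum.inl c) = π := rfl
@[simp] theorem homParity_inr (c : C) : homParity C π (Sum.inr c) = !π := rfl

variable {X : Fock A (fun _ : C => π) R} {s : A}

theorem IsGraded.d_not (hX : X.IsGraded k s) (β : Bool) (i : R) (c : C) :
    HasParity k s (xor β !π) (X.d (!β) i c) := by
  have := hX.d (!β) i c
  cases β <;> simpa using this

theorem IsGraded.z_not (hX : X.IsGraded k s) (β : Bool) (i : R) (c : C) :
    HasParity k s (xor β !π) (X.z (!β) i c) := by
  have := hX.z (!β) i c
  cases β <;> simpa using this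

theorem rightMul_comm {s : A} (hs : s * s = 1) {p q : Bool} {x y : A} (hx : HasParity k s p x)
    (hy : HasParity k s q y) {e : A} (h : y * x = sgm p q (x * y) + e) (f : A) :
    rightMul k s p x (rightMul k s q y f) =
      sgm p q (rightMul k s q y (rightMul k s p x f)) + sgm p q (twist k s (xor p q) f * e) := by
  rw [rightMul_rightMul hs hy, rightMul_rightMul hs hx, h, mul_add, sgm_add, mul_sgm, Bool.xor_comm,
    sgm_swap q p]

theorem mul_rightMul {s : A} (hs : s * s = 1) {p : Bool} {x : A} (h : HasParity k s p x) (q : Bool)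
    (y f : A) : x * rightMul k s q y f = sgm p q (rightMul k s q y (x * f)) := by
  rw [rightMul_mul hs h, sgm_sgm_self]

/-- The left and right multiplications on the endomorphisms of a Fock module. -/
def homFock (hX : X.IsGraded k s) : Fock (Module.End k A) (homParity C π) R where
  z β i := Sum.elim (fun c => LinearMap.mulLeft k (X.z β i c))
    (fun c => sgm β (!π) (rightMul k s (xor β !π) (X.d (!β) i c)))
  d β i := Sum.elim (fun c => LinearMap.mulLeft k (X.d β i c))
    (fun c => sgm (!π) (!π) (sgm β π (rightMul k s (xor β !π) (X.z (!β) i c))))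
  zz := by
    rintro β γ i j (c | c) (c' | c') <;> refine LinearMap.ext fun f => ?_ <;>
      simp only [Sum.elim_inl, Sum.elim_inr, Module.End.mul_apply, LinearMap.mulLeft_apply,
        homParity_inl, homParity_inr, sgm_apply]
    · rw [← mul_assoc, X.zz, sgm_mul, mul_assoc]
    · rw [mul_sgm, mul_rightMul hX.ss (hX.z _ _ _)]
      cases β <;> cases γ <;> cases π <;> simp
    · rw [mul_sgm, mul_rightMul hX.ss (hX.z _ _ _)]
      cases β <;> cases γ <;> cases π <;> simp
    · have h := rightMul_comm hX.ss (hX.d_not β i c) (hX.d_not γ j c') (e := 0) (by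
        rw [X.dd, add_zero, sgm_swap]
        cases β <;> cases γ <;> cases π <;> rfl) f
      cases β <;> cases γ <;> cases π <;> simpa using h
  dd := by
    rintro β γ i j (c | c) (c' | c') <;> refine LinearMap.ext fun f => ?_ <;>
      simp only [Sum.elim_inl, Sum.elim_inr, Module.End.mul_apply, LinearMap.mulLeft_apply,
        homParity_inl, homParity_inr, sgm_apply]
    · rw [← mul_assoc, X.dd, sgm_mul, mul_assoc]
    · rw [mul_sgm, mul_sgm, mul_rightMul hX.ss (hX.d _ _ _)]
      cases β <;> cases γ <;> cases π <;> simp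
    · rw [mul_sgm, mul_sgm, mul_rightMul hX.ss (hX.d _ _ _)]
      cases β <;> cases γ <;> cases π <;> simp
    · have h := rightMul_comm hX.ss (hX.z_not β i c) (hX.z_not γ j c') (e := 0) (by
        rw [X.zz, add_zero, sgm_swap]
        cases β <;> cases γ <;> cases π <;> rfl) f
      cases β <;> cases γ <;> cases π <;> simpa using h
  dz := by
    rintro β γ i j (c | c) (c' | c') <;> refine LinearMap.ext fun f => ?_ <;>
      simp only [Sum.elim_inl, Sum.elim_inr, Module.End.mul_apply, LinearMap.mulLeft_apply,
        homParity_inl, homParity_inr, sgm_apply, LinearMap.add_apply, reduceCtorEq, and_false,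
        if_false, LinearMap.zero_apply, add_zero, Sum.inl.injEq, Sum.inr.injEq]
    · rw [← mul_assoc, X.dz, add_mul, sgm_mul, mul_assoc]
      split_ifs <;> simp
    · rw [mul_sgm, mul_rightMul hX.ss (hX.d _ _ _)]
      cases β <;> cases γ <;> cases π <;> simp
    · rw [mul_sgm, mul_sgm, mul_rightMul hX.ss (hX.z _ _ _)]
      cases β <;> cases γ <;> cases π <;> simp
    · have h := rightMul_comm hX.ss (hX.z_not β i c) (hX.d_not γ j c') (f := f)
        (e := if β = γ ∧ i = j ∧ c = c' then 1 else 0) (by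
        rw [X.dz, sgm_swap]
        congr 1
        · cases β <;> cases γ <;> cases π <;> rfl
        · have h : ((!γ) = (!β) ∧ j = i ∧ c' = c) ↔ (β = γ ∧ i = j ∧ c = c') := by
            cases β <;> cases γ <;> simp [eq_comm]
          simp only [h])
      by_cases hc : β = γ ∧ i = j ∧ c = c'
      · rw [if_pos hc] at h ⊢
        obtain ⟨rfl, rfl, rfl⟩ := hc
        cases β <;> cases π <;> simp at h ⊢ <;> rw [h] <;> abel
      · rw [if_neg hc] at h ⊢
        cases β <;> cases γ <;> cases π <;> simp at h ⊢ <;> simp [h]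

variable (hX : X.IsGraded k s)

theorem homFock_z_inl (β : Bool) (i : R) (c : C) (f : A) :
    (homFock hX).z β i (Sum.inl c) f = X.z β i c * f := rfl
theorem homFock_d_inl (β : Bool) (i : R) (c : C) (f : A) :
    (homFock hX).d β i (Sum.inl c) f = X.d β i c * f := rfl
theorem homFock_z_inr (β : Bool) (i : R) (c : C) (f : A) : (homFock hX).z β i (Sum.inr c) f =
    sgm β (!π) (twist k s (xor β !π) f * X.d (!β) i c) := sgm_apply _ _ _ _
theorem homFock_d_inr (β : Bool) (i : R) (c : C) (f : A) : (homFock hX).d β i (Sum.inr c) f =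
    sgm (!π) (!π) (sgm β π (twist k s (xor β !π) f * X.z (!β) i c)) := by
  rw [← rightMul_apply, ← sgm_apply, ← sgm_apply]
  rfl

theorem homFock_zd_inr (β γ : Bool) (i j : R) (c : C) (f : A) :
    (homFock hX).z β i (Sum.inr c) ((homFock hX).d γ j (Sum.inr c) f) =
      sgm (!β) γ (twist k s (xor β γ) f * (X.z (!γ) j c * X.d (!β) i c)) := by
  rw [homFock_z_inr, homFock_d_inr, twist_sgm, twist_sgm, twist_mul hX.ss, twist_twist hX.ss,
    (hX.z_not γ j c).twist]
  cases β <;> cases γ <;> cases π <;> simp [mul_assoc]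

theorem homFock_eop [Fintype C] (β γ : Bool) (i j : R) (f : A) : (homFock hX).eop β γ i j f =
    X.eop β γ i j * f + sgm (!β) γ (twist k s (xor β γ) f * X.eop (!γ) (!β) j i) := by
  rw [eop, LinearMap.sum_apply, Fintype.sum_sum_type, eop, eop, Finset.sum_mul, Finset.mul_sum,
    sgm_sum]
  congr 1
  · exact Finset.sum_congr rfl fun c _ => (mul_assoc _ _ _).symm
  · exact Finset.sum_congr rfl fun c _ => homFock_zd_inr hX β γ i j c f

theorem homFock_ra [Fintype C] (i j : R) (f : A) :
    (homFock hX).ra i j f = X.ra i j * f - f * X.ra i j := by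
  rw [ra, LinearMap.sub_apply, homFock_eop, homFock_eop, ra]
  simp only [Bool.xor_self, twist_false, Bool.not_false, Bool.not_true, sgm_false_left,
    sgm_false_right, sub_mul, mul_sub]
  abel

theorem homFock_rb [Fintype C] (i j : R) (f : A) :
    (homFock hX).rb i j f = X.rb i j * f - twist k s true f * X.rb i j := by
  rw [rb, LinearMap.add_apply, homFock_eop, homFock_eop, rb]
  simp only [Bool.false_xor, Bool.not_false, Bool.not_true, sgm_true_true, add_mul, mul_add]
  abel

theorem homFock_rc [Fintype C] (i j : R) (f : A) :
    (homFock hX).rc i j f = X.rc i j * f - twist k s true f * X.rc i j := by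
  rw [rc, LinearMap.sub_apply, homFock_eop, homFock_eop, rc]
  simp only [Bool.xor_false, Bool.not_false, Bool.not_true, sgm_false_left, sub_mul, mul_sub]
  abel

variable [Fintype R]

theorem homFock_cE_inl (a b : C) (f : A) :
    (homFock hX).cE (Sum.inl a) (Sum.inl b) f = X.cE a b * f := by
  rw [cE, cE, LinearMap.sum_apply, Finset.sum_mul]
  refine Finset.sum_congr rfl fun p _ => ?_
  rw [sgm_apply, sgm_mul, mul_assoc]
  rfl

theorem homFock_cq_inl (a b : C) (f : A) :
    (homFock hX).cq (Sum.inl a) (Sum.inl b) f = X.cq a b * f := by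
  rw [cq, cq, LinearMap.sum_apply, Finset.sum_mul]
  refine Finset.sum_congr rfl fun p _ => ?_
  rw [sgm_apply, sgm_mul, mul_assoc]
  rfl

theorem homFock_cE_inr (c : C) (f : A) :
    (homFock hX).cE (Sum.inr c) (Sum.inr c) f = f * X.cE c c := by
  rw [cE, cE, LinearMap.sum_apply, Finset.mul_sum, Fintype.sum_prod_type, Fintype.sum_prod_type,
    Fintype.sum_bool, Fintype.sum_bool, add_comm]
  congr 1 <;> refine Finset.sum_congr rfl fun i _ => ?_ <;>
    simp [homFock_zd_inr]

theorem homFock_cq_inr (a b : C) (f : A) : (homFock hX).cq (Sum.inr a) (Sum.inr b) f =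
    sgm (!π) (!π) (twist k s true f * X.ck b a) := by
  rw [cq, ck, LinearMap.sum_apply, Finset.mul_sum, sgm_sum]
  refine Finset.sum_congr rfl fun p _ => ?_
  rw [sgm_apply, Module.End.mul_apply, homFock_z_inr, homFock_z_inr, twist_sgm, twist_mul hX.ss,
    twist_twist hX.ss, (hX.d_not _ _ _).twist]
  obtain ⟨β, i⟩ := p
  cases β <;> cases π <;> simp [mul_assoc]

theorem homFock_cq_inl_inr (a b : C) {f g : A} (hf : ∀ p, twist k s p f = f)
    (hg : ∀ β i, f * X.d β i b = X.d β i b * g) : (homFock hX).cq (Sum.inl a) (Sum.inr b) f =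
      sgm (!π) (!π) (X.cE a b * g) := by
  rw [cq, cE, LinearMap.sum_apply, Finset.sum_mul, sgm_sum]
  refine Finset.sum_congr rfl fun p _ => ?_
  rw [sgm_apply, Module.End.mul_apply, homFock_z_inl, homFock_z_inr, hf, hg]
  obtain ⟨β, i⟩ := p
  cases β <;> cases π <;> simp [mul_assoc]

end Fock

end HomFock

section HomTheorem

variable {k : Type} [Field k]

namespace Fock

variable {M : Type*} [AddCommGroup M] [Module k M] {C R : Type*} [DecidableEq C] [DecidableEq R]
  {π : Bool} {X : Fock (Module.End k M) (fun _ : C => π) R} {s : Module.End k M}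
  {P : (C → ℤ) → Module.End k M} {v0 : M}

/-- A cyclic Fock module with its decomposition into column weight spaces. -/
structure IsWeighted [Fintype R] (X : Fock (Module.End k M) (fun _ : C => π) R) (s : Module.End k M)
    (P : (C → ℤ) → Module.End k M) (v0 : M) : Prop where
  gr : X.IsGraded k s
  zP : ∀ β i c l, X.z β i c * P l = P (l + Pi.single c 1) * X.z β i c
  dP : ∀ β i c l, X.d β i c * P l = P (l - Pi.single c 1) * X.d β i c
  neg : ∀ l c, l c < 0 → P l = 0
  sP : ∀ l p, twist k s p (P l) = P l
  cEP : ∀ c l, X.cE c c * P l = (l c : k) • P l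
  vac : ∃ φ : M →ₗ[k] k, ∀ x, P 0 x = φ x • v0
  P_vac : P 0 v0 = v0
  vac_ne : v0 ≠ 0
  cyclic : X.zSub v0 = ⊤

variable [Fintype R] [Fintype C] [CharZero k]

theorem IsWeighted.mul_P_mem_zSub (h : X.IsWeighted s P v0) (N : ℕ) : ∀ l : C → ℤ,
    (∀ c, 0 ≤ l c) → ∑ c, l c = N → ∀ f, f * P l ∈ (homFock h.gr).zSub (P 0) := by
  induction N with
  | zero =>
    intro l hl hs f
    obtain rfl : l = 0 := by
      funext c
      exact (Finset.sum_eq_zero_iff_of_nonneg fun c _ => hl c).1 (by exact_mod_cast hs) c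
        (Finset.mem_univ c)
    obtain ⟨φ, hφ⟩ := h.vac
    have key : ∀ v, (LinearMap.smulRightₗ φ v : Module.End k M) ∈ (homFock h.gr).zSub (P 0) := by
      intro v
      have : v ∈ X.zSub v0 := h.cyclic ▸ Submodule.mem_top
      have h1 := zSub_le (X := X) (v := v0)
        (K := ((homFock h.gr).zSub (P 0)).comap (LinearMap.smulRightₗ φ)) ?_ ?_ this
      · exact h1
      · have : (LinearMap.smulRightₗ φ v0 : Module.End k M) = P 0 :=
          LinearMap.ext fun x => (hφ x).symm
        rw [Submodule.mem_comap, this]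
        exact mem_zSub_self _
      · intro β i c u hu
        have := z_mem_zSub hu β i (Sum.inl c)
        rw [homFock_z_inl] at this
        rw [Submodule.mem_comap]
        convert this using 1
        exact LinearMap.ext fun x => by simp
    have : f * P 0 = (LinearMap.smulRightₗ φ (f v0) : Module.End k M) :=
      LinearMap.ext fun x => by simp [hφ]
    rw [this]
    exact key _
  | succ N ih =>
    intro l hl hs f
    obtain ⟨c, hc⟩ : ∃ c, 0 < l c := by
      by_contra hcon
      push Not at hcon
      have := Finset.sum_nonpos fun c (_ : c ∈ Finset.univ) => hcon c
      omega
    have hlc : (l c : k) ≠ 0 := by exact_mod_cast hc.ne'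
    have h1 : (l c : k) • (f * P l) ∈ (homFock h.gr).zSub (P 0) := by
      rw [← mul_smul_comm, ← h.cEP, cE, Finset.sum_mul, Finset.mul_sum]
      refine Submodule.sum_mem _ fun p _ => ?_
      have h2 := ih (l - Pi.single c 1) (fun e => by
          by_cases he : e = c
          · subst he; simp; omega
          · simpa [he] using hl e)
        (by
          simp only [Pi.sub_apply, Finset.sum_sub_distrib, hs, Finset.sum_pi_single', Finset.mem_univ,
            if_true]
          push_cast; ring)
        (twist k s (xor (!p.1) !π) (f * X.z p.1 p.2 c))
      have h3 := z_mem_zSub h2 (!p.1) p.2 (Sum.inr c)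
      rw [homFock_z_inr, twist_mul h.gr.ss, twist_twist h.gr.ss, Bool.xor_self, h.sP, mul_assoc,
        Bool.not_not, twist_false, ← h.dP] at h3
      have h4 : ∀ a b (g : Module.End k M), sgm a b g ∈ (homFock h.gr).zSub (P 0) →
          g ∈ (homFock h.gr).zSub (P 0) := by
        intro a b g
        cases a <;> cases b <;> simp
      have := h4 _ _ _ h3
      simpa [mul_assoc] using this
    have := Submodule.smul_mem _ (l c : k)⁻¹ h1
    rwa [smul_smul, inv_mul_cancel₀ hlc, one_smul] at this

/-- The endomorphisms obtained from the weight projections by quadratic operators. -/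
structure IsClosed (X : Fock (Module.End k M) (fun _ : C => π) R) (s : Module.End k M)
    (P : (C → ℤ) → Module.End k M) (S : Submodule k (Module.End k M)) : Prop where
  P : ∀ l, P l ∈ S
  cE : ∀ a b, ∀ f ∈ S, X.cE a b * f ∈ S
  cq : ∀ a b, ∀ f ∈ S, X.cq a b * f ∈ S
  ck : ∀ a b, ∀ f ∈ S, twist k s true f * X.ck a b ∈ S

omit [Fintype C] [CharZero k] in
theorem IsClosed.sInf {X : Fock (Module.End k M) (fun _ : C => π) R} :
    X.IsClosed s P (sInf {S | X.IsClosed s P S}) where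
  P l := Submodule.mem_sInf.2 fun _ hS => hS.P l
  cE a b f hf := Submodule.mem_sInf.2 fun S hS => hS.cE a b f (Submodule.mem_sInf.1 hf S hS)
  cq a b f hf := Submodule.mem_sInf.2 fun S hS => hS.cq a b f (Submodule.mem_sInf.1 hf S hS)
  ck a b f hf := Submodule.mem_sInf.2 fun S hS => hS.ck a b f (Submodule.mem_sInf.1 hf S hS)

omit [CharZero k] in
theorem sgm_mem {K : Type*} [AddCommGroup K] [Module k K] {S : Submodule k K} {u : K} (p q : Bool)
    (h : u ∈ S) : sgm p q u ∈ S := by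
  cases p <;> cases q <;> simpa using h

omit [Fintype C] in
theorem cq_cq {A : Type*} [Ring A] {pc : C → Bool} (X : Fock A pc R) (a b c d : C) :
    X.cq a b * X.cq c d =
      sgm (!xor (pc a) (pc b)) (!xor (pc c) (pc d)) (X.cq c d * X.cq a b) := by
  conv_lhs => rw [cq.eq_def X c d]
  conv_rhs => rw [cq.eq_def X c d]
  rw [Finset.mul_sum, Finset.sum_mul, sgm_sum]
  refine Finset.sum_congr rfl fun p _ => ?_
  rw [mul_sgm, ← mul_assoc, cq_z, sgm_mul, mul_assoc, cq_z, sgm_mul, mul_sgm]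
  cases p.1 <;> cases pc a <;> cases pc b <;> cases pc c <;> cases pc d <;> simp [mul_assoc]

omit [Fintype C] [CharZero k] in
theorem IsWeighted.cq_inl_inr_mem (h : X.IsWeighted s P v0) {f : Module.End k M}
    (hf : f ∈ sInf {S | X.IsClosed s P S}) (a b : C) :
    (homFock h.gr).cq (Sum.inl a) (Sum.inr b) f ∈ sInf {S | X.IsClosed s P S} := by
  set T := sInf {S | X.IsClosed s P S} with hT
  have hTc : X.IsClosed s P T := IsClosed.sInf
  have hcE : ∀ a b, ∀ f ∈ T, (homFock h.gr).cE (Sum.inl a) (Sum.inl b) f ∈ T := fun a b f hf => by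
    rw [homFock_cE_inl]; exact hTc.cE a b f hf
  have hcq : ∀ a b, ∀ f ∈ T, (homFock h.gr).cq (Sum.inl a) (Sum.inl b) f ∈ T := fun a b f hf => by
    rw [homFock_cq_inl]; exact hTc.cq a b f hf
  have hck : ∀ a b, ∀ f ∈ T, (homFock h.gr).cq (Sum.inr a) (Sum.inr b) f ∈ T := fun a b f hf => by
    rw [homFock_cq_inr]; exact sgm_mem _ _ (hTc.ck b a f hf)
  let T' : Submodule k (Module.End k M) :=
    T ⊓ ⨅ a, ⨅ b, T.comap ((homFock h.gr).cq (Sum.inl a) (Sum.inr b))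
  have hT' : ∀ f, f ∈ T' ↔ f ∈ T ∧ ∀ a b, (homFock h.gr).cq (Sum.inl a) (Sum.inr b) f ∈ T := by
    intro f
    simp only [T', Submodule.mem_inf, Submodule.mem_iInf, Submodule.mem_comap]
  have hcl : X.IsClosed s P T' := by
    refine ⟨fun l => (hT' _).2 ⟨hTc.P l, fun a b => ?_⟩, fun c d f hf => ?_, fun c d f hf => ?_,
      fun c d f hf => ?_⟩
    · rw [homFock_cq_inl_inr h.gr a b (g := P (l + Pi.single b 1)) (fun p => h.sP l p)]
      · exact sgm_mem _ _ (hTc.cE _ _ _ (hTc.P _))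
      · intro β i
        rw [h.dP, add_sub_cancel_right]
    · obtain ⟨h1, h2⟩ := (hT' f).1 hf
      refine (hT' _).2 ⟨hTc.cE c d f h1, fun a b => ?_⟩
      have h3 := LinearMap.congr_fun ((homFock h.gr).cE_cq (Sum.inl c) (Sum.inl d) (Sum.inl a)
        (Sum.inr b)) f
      simp only [homParity_inl, homParity_inr, Bool.xor_self, sgm_false_left, LinearMap.add_apply,
        reduceCtorEq, if_false, add_zero, Module.End.mul_apply] at h3
      rw [← homFock_cE_inl h.gr, ← sub_eq_iff_eq_add.2 h3]
      refine Submodule.sub_mem _ (hcE _ _ _ (h2 a b)) ?_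
      split_ifs
      · exact h2 _ _
      · exact Submodule.zero_mem _
    · obtain ⟨h1, h2⟩ := (hT' f).1 hf
      refine (hT' _).2 ⟨hTc.cq c d f h1, fun a b => ?_⟩
      rw [← homFock_cq_inl h.gr, ← Module.End.mul_apply, cq_cq, sgm_apply]
      exact sgm_mem _ _ (hcq _ _ _ (h2 a b))
    · obtain ⟨h1, h2⟩ := (hT' f).1 hf
      have h3 : (homFock h.gr).cq (Sum.inr d) (Sum.inr c) f ∈ T' := by
        refine (hT' _).2 ⟨hck _ _ _ h1, fun a b => ?_⟩
        rw [← Module.End.mul_apply, cq_cq, sgm_apply]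
        exact sgm_mem _ _ (hck _ _ _ (h2 a b))
      rw [homFock_cq_inr] at h3
      have := sgm_mem (!π) (!π) h3
      rwa [sgm_sgm_self] at this
  exact ((hT' f).1 (Submodule.mem_sInf.1 hf T' hcl)).2 a b

/-- Endomorphisms supercommuting with the row operators are generated by column operators. -/
theorem IsWeighted.mem_of_comm {n : ℕ} {X : Fock (Module.End k M) (fun _ : C => π) (Fin n)}
    (h : X.IsWeighted s P v0) {S : Submodule k (Module.End k M)} (hS : X.IsClosed s P S)
    {f : Module.End k M} {l l' : C → ℤ} (hf : P l * f = f) (hf' : f * P l' = f)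
    (ha : ∀ i j, X.ra i j * f = f * X.ra i j)
    (hb : ∀ i j, X.rb i j * f = twist k s true f * X.rb i j)
    (hc : ∀ i j, X.rc i j * f = twist k s true f * X.rc i j) : f ∈ S := by
  by_cases hl : ∃ c, l c < 0
  · obtain ⟨c, hc⟩ := hl
    rw [← hf, h.neg l c hc, zero_mul]; exact Submodule.zero_mem _
  by_cases hl' : ∃ c, l' c < 0
  · obtain ⟨c, hc⟩ := hl'
    rw [← hf', h.neg l' c hc, mul_zero]; exact Submodule.zero_mem _
  push Not at hl hl'
  have hP0 : P 0 ≠ 0 := fun h0 => h.vac_ne (by rw [← h.P_vac, h0, LinearMap.zero_apply])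
  have h1 := (homFock h.gr).mem_qSub_of_isInv (v0 := P 0) (f := f) (by
      rintro β i (c | c)
      · rw [homFock_d_inl, h.dP, h.neg _ c (by simp), zero_mul]
      · have := h.zP (!β) i c (0 - Pi.single c 1)
        rw [sub_add_cancel, h.neg (0 - Pi.single c 1) c (by simp), mul_zero] at this
        rw [homFock_d_inr, h.sP, ← this, sgm_zero, sgm_zero]) hP0
    (Sum.elim (fun c => (l c).toNat) (fun c => (l' c).toNat)) (by
      have := h.mul_P_mem_zSub (∑ c, l' c).toNat l' hl'
        (by rw [Int.toNat_of_nonneg (Finset.sum_nonneg fun c _ => hl' c)]) f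
      rwa [hf'] at this)
    { ra := fun i j => by rw [homFock_ra, ha, sub_self]
      rb := fun i j => by rw [homFock_rb, hb, sub_self]
      rc := fun i j => by rw [homFock_rc, hc, sub_self] }
    (by
      rintro (c | c)
      · rw [homFock_cE_inl]
        dsimp only [Sum.elim_inl]
        rw [Int.toNat_of_nonneg (hl c)]
        conv_lhs => rw [← hf]
        rw [← mul_assoc, h.cEP, smul_mul_assoc, hf]
      · rw [homFock_cE_inr]
        dsimp only [Sum.elim_inr]
        rw [Int.toNat_of_nonneg (hl' c)]
        have h2 : P l' * X.cE c c = X.cE c c * P l' := by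
          simp only [cE, Finset.mul_sum, Finset.sum_mul, mul_sgm, sgm_mul]
          refine Finset.sum_congr rfl fun p _ => ?_
          congr 1
          rw [mul_assoc, h.dP, ← mul_assoc, ← mul_assoc, h.zP, sub_add_cancel]
        conv_lhs => rw [← hf']
        rw [mul_assoc, h2, h.cEP, mul_smul_comm, hf'])
  refine qSub_le (K := sInf {S | X.IsClosed s P S}) ?_ ?_ h1 |> fun h2 =>
    Submodule.mem_sInf.1 h2 S hS
  · exact (IsClosed.sInf (X := X) (s := s) (P := P)).P 0
  · have hT := IsClosed.sInf (X := X) (s := s) (P := P)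
    rintro (c | c) (c' | c') u hu -
    · rw [homFock_cq_inl]; exact hT.cq _ _ _ hu
    · exact h.cq_inl_inr_mem hu _ _
    · rw [cq_symm, sgm_apply]
      exact sgm_mem _ _ (h.cq_inl_inr_mem hu _ _)
    · rw [homFock_cq_inr]; exact sgm_mem _ _ (hT.ck _ _ _ hu)

end Fock

end HomTheorem

section Presentation

variable {k : Type} [Field k] {A : Type*} [Ring A] [Algebra k A] {n : ℕ}

/-- Operators attached to the Chevalley generators and weight idempotents. -/
structure GenOps (A : Type*) (n : ℕ) where
  Q : (Fin n → ℤ) → A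
  E : ℕ → A
  F : ℕ → A
  B11 : A
  B : ℕ → A
  C : ℕ → A

namespace GenOps

/-- The images of the generators. -/
def gen (G : GenOps A n) : DGen n → A
  | .idem l => G.Q l
  | .ge i l => G.E i * G.Q l
  | .gf i l => G.F i * G.Q l
  | .gb11 l => G.B11 * G.Q l
  | .gb i l => G.B i * G.Q l
  | .gc i l => G.C i * G.Q l

variable (k) in
/-- The induced homomorphism on the free algebra. -/
def hom (G : GenOps A n) : FreeAlgebra k (DGen n) →ₐ[k] A := FreeAlgebra.lift k G.gen

@[simp] theorem hom_ι (G : GenOps A n) (x : DGen n) : G.hom k (FreeAlgebra.ι k x) = G.gen x :=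
  FreeAlgebra.lift_ι_apply _ _

@[simp] theorem hom_iId (G : GenOps A n) (l : Fin n → ℤ) : G.hom k (iId k n l) = G.Q l :=
  G.hom_ι _

/-- The weighted operator `x` is represented by `a`. -/
structure Rep (G : GenOps A n) (x : WOp k n) (a : A) : Prop where
  op : ∀ l, G.hom k (x.op l) = a * G.Q l
  wt : ∀ l, a * G.Q l = G.Q (l + x.wt) * a

/-- The weight idempotents are orthogonal. -/
def Ortho (G : GenOps A n) : Prop := ∀ l l', G.Q l * G.Q l' = if l = l' then G.Q l else 0

variable {G : GenOps A n} {x y : WOp k n} {a b : A}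

namespace Rep

theorem comp (hG : G.Ortho) (hx : G.Rep x a) (hy : G.Rep y b) : G.Rep (x.comp y) (a * b) where
  op l := by
    rw [WOp.comp, map_mul, hx.op, hy.op, mul_assoc, ← mul_assoc _ b, ← hy.wt, mul_assoc b, hG,
      if_pos rfl, mul_assoc]
  wt l := by
    rw [WOp.comp, mul_assoc, hy.wt, ← mul_assoc, hx.wt, mul_assoc, add_assoc, add_comm y.wt]

theorem cmm (hG : G.Ortho) (hx : G.Rep x a) (hy : G.Rep y b) :
    G.Rep (x.cmm y) ⁅a, b⁆ where
  op l := by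
    rw [WOp.cmm, Ring.lie_def, map_sub, (hx.comp hG hy).op, (hy.comp hG hx).op, sub_mul]
  wt l := by
    have h := (hy.comp hG hx).wt l
    rw [WOp.comp, add_comm y.wt] at h
    rw [Ring.lie_def, sub_mul, mul_sub, (hx.comp hG hy).wt, h]
    rfl

theorem acm (hG : G.Ortho) (hx : G.Rep x a) (hy : G.Rep y b) :
    G.Rep (x.acm y) (a * b + b * a) where
  op l := by
    rw [WOp.acm, map_add, (hx.comp hG hy).op, (hy.comp hG hx).op, add_mul]
  wt l := by
    have h := (hy.comp hG hx).wt l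
    rw [WOp.comp, add_comm y.wt] at h
    rw [add_mul, mul_add, (hx.comp hG hy).wt, h]
    rfl

theorem src (hG : G.Ortho) (hx : G.Rep x a) (l l' : Fin n → ℤ) :
    G.hom k (x.op l * iId k n l') = G.hom k (if l' = l then x.op l else 0) := by
  rw [map_mul, hx.op, hom_iId, mul_assoc, hG]
  by_cases h : l' = l
  · rw [if_pos h, if_pos h.symm, hx.op]
  · rw [if_neg h, if_neg (Ne.symm h), mul_zero, map_zero]

theorem tgt (hG : G.Ortho) (hx : G.Rep x a) (l l' : Fin n → ℤ) :
    G.hom k (iId k n l' * x.op l) = G.hom k (if l' = l + x.wt then x.op l else 0) := by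
  rw [map_mul, hx.op, hom_iId, hx.wt, ← mul_assoc, hG]
  by_cases h : l' = l + x.wt
  · rw [if_pos h, if_pos h, hx.op, hx.wt, h]
  · rw [if_neg h, if_neg h, zero_mul, map_zero]

theorem op_eq_zero (hx : G.Rep x a) (h : a = 0) (l : Fin n → ℤ) :
    G.hom k (x.op l) = G.hom k 0 := by rw [hx.op, h, zero_mul, map_zero]

theorem op_eq_op (hx : G.Rep x a) (hy : G.Rep y b) (h : a = b) (l : Fin n → ℤ) :
    G.hom k (x.op l) = G.hom k (y.op l) := by rw [hx.op, hy.op, h]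

end Rep

end GenOps

theorem epsw_eq_single {t : ℕ} (h : t < n) : epsw n (t + 1) = Pi.single ⟨t, h⟩ 1 := by
  funext s
  by_cases hs : s.val = t
  · rw [show s = ⟨t, h⟩ from Fin.ext hs]
    simp [epsw]
  · rw [Pi.single_eq_of_ne (fun h' => hs (by rw [h']))]
    simp [epsw, hs]

theorem okEd_iff {i : ℕ} : okEd n i ↔ ∃ t, i = t + 1 ∧ t + 1 < n :=
  ⟨fun h => ⟨i - 1, by have := h.1; omega, by have := h.1; have := h.2; omega⟩,
    fun ⟨t, ht, h⟩ => by subst ht; exact ⟨by omega, by omega⟩⟩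

namespace Fock

variable {C : Type*} [DecidableEq C] [Fintype C] {pc : C → Bool}

/-- Weight idempotents for the row operators. -/
structure IsTorus (X : Fock A pc (Fin n)) (Q : (Fin n → ℤ) → A) (r : k) : Prop where
  QQ : ∀ l l', Q l * Q l' = if l = l' then Q l else 0
  ra : ∀ i j l, X.ra i j * Q l = Q (l + (Pi.single i 1 - Pi.single j 1)) * X.ra i j
  rb : ∀ i j l, X.rb i j * Q l = Q (l + (Pi.single i 1 + Pi.single j 1)) * X.rb i j
  rc : ∀ i j l, X.rc i j * Q l = Q (l - (Pi.single i 1 + Pi.single j 1)) * X.rc i j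
  diag : ∀ i l, X.ra i i * Q l = ((l i : k) + r) • Q l

/-- Extend an operator indexed by neighbouring rows by zero. -/
def nbr (f : Fin n → Fin n → A) (i : ℕ) : A :=
  if h : 1 ≤ i ∧ i + 1 ≤ n then f ⟨i - 1, by omega⟩ ⟨i, by omega⟩ else 0

theorem nbr_succ (f : Fin n → Fin n → A) {t : ℕ} (h : t + 1 < n) :
    nbr f (t + 1) = f ⟨t, by omega⟩ ⟨t + 1, h⟩ := dif_pos ⟨by omega, by omega⟩

theorem nbr_of_not (f : Fin n → Fin n → A) {i : ℕ} (h : ¬ okEd n i) : nbr f i = 0 := dif_neg h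

variable (k) in
/-- The operators giving the action of the idempotented periplectic algebra. -/
noncomputable def opsU (X : Fock A pc (Fin n)) (Q : (Fin n → ℤ) → A) : GenOps A n where
  Q := Q
  E := nbr X.ra
  F := nbr fun i j => X.ra j i
  B11 := if h : 0 < n then (2⁻¹ : k) • X.rb ⟨0, h⟩ ⟨0, h⟩ else 0
  B := nbr X.rb
  C := nbr X.rc

variable (k) in
/-- The operators giving the action of the opposite idempotented periplectic algebra. -/
noncomputable def opsT (X : Fock A pc (Fin n)) (Q : (Fin n → ℤ) → A) : GenOps A n where
  Q l := Q (-l)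
  E i := -nbr (fun i j => X.ra j i) i
  F i := -nbr X.ra i
  B11 := if h : 0 < n then (2⁻¹ : k) • X.rb ⟨0, h⟩ ⟨0, h⟩ else 0
  B := nbr X.rb
  C := nbr X.rc

variable {X : Fock A pc (Fin n)} {Q : (Fin n → ℤ) → A} {r : k}

theorem nbr_wt {f : Fin n → Fin n → A} {Q : (Fin n → ℤ) → A} {w : Fin n → Fin n → Fin n → ℤ}
    {w' : Fin n → ℤ} {i : ℕ} (h : ∀ i j l, f i j * Q l = Q (l + w i j) * f i j)
    (hw : ∀ t (ht : t + 1 < n), i = t + 1 → w' = w ⟨t, by omega⟩ ⟨t + 1, ht⟩) (l : Fin n → ℤ) :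
    nbr f i * Q l = Q (l + w') * nbr f i := by
  by_cases hi : okEd n i
  · obtain ⟨t, rfl, ht⟩ := okEd_iff.1 hi
    rw [nbr_succ _ ht, h, hw t ht rfl]
  · rw [nbr_of_not _ hi, zero_mul, mul_zero]

namespace IsTorus

variable (hX : X.IsTorus Q r)
include hX

theorem ortho_opsU : (opsU k X Q).Ortho := hX.QQ

theorem wE_opsU (i : ℕ) : (opsU k X Q).Rep (wE k n i) (nbr X.ra i) where
  op l := GenOps.hom_ι _ _
  wt := nbr_wt hX.ra fun t ht hi => by
    rw [hi, wE, alw, epsw_eq_single (by omega), epsw_eq_single ht]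

theorem wF_opsU (i : ℕ) : (opsU k X Q).Rep (wF k n i) (nbr (fun i j => X.ra j i) i) where
  op l := GenOps.hom_ι _ _
  wt := nbr_wt (fun i j => hX.ra j i) fun t ht hi => by
    rw [hi, wF, alw, epsw_eq_single (by omega), epsw_eq_single ht, neg_sub]

theorem wB_opsU (i : ℕ) : (opsU k X Q).Rep (wB k n i) (nbr X.rb i) where
  op l := GenOps.hom_ι _ _
  wt := nbr_wt hX.rb fun t ht hi => by
    subst hi
    change epsw n (t + 1) + epsw n (t + 1 + 1) = _
    rw [epsw_eq_single (by omega), epsw_eq_single ht]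

theorem wC_opsU (i : ℕ) : (opsU k X Q).Rep (wC k n i) (nbr X.rc i) where
  op l := GenOps.hom_ι _ _
  wt := nbr_wt (w := fun i j => -(Pi.single i 1 + Pi.single j 1)) (fun i j l =>
    (hX.rc i j l).trans (by rw [sub_eq_add_neg]; rfl)) fun t ht hi => by
    subst hi
    change -(epsw n (t + 1) + epsw n (t + 1 + 1)) = _
    rw [epsw_eq_single (by omega), epsw_eq_single ht]

theorem wB11_opsU : (opsU k X Q).Rep (wB11 k n) (opsU k X Q).B11 where
  op l := GenOps.hom_ι _ _
  wt l := by
    by_cases h : 0 < n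
    · dsimp only [opsU]
      rw [dif_pos h, smul_mul_assoc, hX.rb, mul_smul_comm, wB11, b11w, epsw_eq_single h, two_smul]
    · dsimp only [opsU]
      rw [dif_neg h, zero_mul, mul_zero]

theorem ortho_opsT : (opsT k X Q).Ortho := fun l l' => by
  dsimp only [opsT]
  rw [hX.QQ]
  simp only [neg_inj]

omit [Field k] [Algebra k A] [DecidableEq C] [Fintype C] hX in
theorem neg_wt {a : A} {w : Fin n → ℤ} (h : ∀ l, a * Q l = Q (l + w) * a) (l : Fin n → ℤ) :
    a * Q (-l) = Q (-(l + -w)) * a := by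
  rw [h, neg_add, neg_neg]

theorem wE_opsT (i : ℕ) :
    (opsT k X Q).Rep (wE k n i) (-nbr (fun i j => X.ra j i) i) where
  op l := GenOps.hom_ι _ _
  wt l := by
    have := neg_wt ((hX.wF_opsU i).wt) l
    rw [wF, neg_neg] at this
    rw [neg_mul, mul_neg]
    exact congrArg Neg.neg this

theorem wF_opsT (i : ℕ) : (opsT k X Q).Rep (wF k n i) (-nbr X.ra i) where
  op l := GenOps.hom_ι _ _
  wt l := by
    rw [neg_mul, mul_neg]
    exact congrArg Neg.neg (neg_wt ((hX.wE_opsU i).wt) l)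

theorem wB_opsT (i : ℕ) : (opsT k X Q).Rep (wBt k n i) (nbr X.rb i) where
  op l := GenOps.hom_ι _ _
  wt := neg_wt ((hX.wB_opsU i).wt)

theorem wC_opsT (i : ℕ) : (opsT k X Q).Rep (wCt k n i) (nbr X.rc i) where
  op l := GenOps.hom_ι _ _
  wt l := by
    have := neg_wt ((hX.wC_opsU i).wt) l
    rwa [wC, neg_neg] at this

theorem wB11_opsT : (opsT k X Q).Rep (wB11t k n) (opsT k X Q).B11 where
  op l := GenOps.hom_ι _ _
  wt := neg_wt (hX.wB11_opsU.wt)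

end IsTorus

end Fock

end Presentation

section Relations

variable {k : Type} [Field k] {A : Type*} [Ring A] [Algebra k A] {n : ℕ}

theorem cf_succ (l : Fin n → ℤ) {t : ℕ} (h : t < n) : cf n l (t + 1) = l ⟨t, h⟩ :=
  dif_pos ⟨by omega, h⟩

section RingBracket

variable {S : Type*} [Ring S] (a b : S)

theorem bracket_swap : -⁅a, b⁆ = ⁅b, a⁆ := by
  rw [Ring.lie_def, Ring.lie_def, neg_sub]

theorem bracket_neg : ⁅a, -b⁆ = -⁅a, b⁆ := by
  rw [Ring.lie_def, Ring.lie_def, mul_neg, neg_mul, neg_sub_neg, neg_sub]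

theorem neg_bracket : ⁅-a, b⁆ = -⁅a, b⁆ := by
  rw [Ring.lie_def, Ring.lie_def, mul_neg, neg_mul, neg_sub_neg, neg_sub]

theorem bracket_zero : ⁅a, (0 : S)⁆ = 0 := by
  rw [Ring.lie_def, mul_zero, zero_mul, sub_zero]

theorem zero_bracket : ⁅(0 : S), a⁆ = 0 := by
  rw [Ring.lie_def, mul_zero, zero_mul, sub_zero]

end RingBracket

theorem ne_succ_succ (t : ℕ) : t ≠ t + 1 + 1 := by omega

namespace Fock

variable {C : Type*} [DecidableEq C] [Fintype C] {pc : C → Bool}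

section Brackets

variable {R : Type*} [DecidableEq R] (X : Fock A pc R)

theorem rc_self (i : R) : X.rc i i = 0 := sub_self _

theorem lie_ra_ra (i j l m : R) : ⁅X.ra i j, X.ra l m⁆ =
    (if j = l then X.ra i m else 0) - (if i = m then X.ra l j else 0) := by
  rw [Ring.lie_def, X.ra_ra]; abel

theorem lie_ra_rb (i j l m : R) : ⁅X.ra i j, X.rb l m⁆ =
    (if j = l then X.rb i m else 0) + (if j = m then X.rb i l else 0) := by
  rw [Ring.lie_def, X.ra_rb]; abel

theorem lie_ra_rc (i j l m : R) : ⁅X.ra i j, X.rc l m⁆ =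
    -(if i = l then X.rc j m else 0) - (if i = m then X.rc l j else 0) := by
  rw [Ring.lie_def, X.ra_rc]; abel

theorem lie_rb_ra (i j l m : R) : ⁅X.rb l m, X.ra i j⁆ =
    -(if j = l then X.rb i m else 0) - (if j = m then X.rb i l else 0) := by
  rw [← bracket_swap, lie_ra_rb]; abel

theorem lie_rc_ra (i j l m : R) : ⁅X.rc l m, X.ra i j⁆ =
    (if i = l then X.rc j m else 0) + (if i = m then X.rc l j else 0) := by
  rw [← bracket_swap, lie_ra_rc]; abel

theorem acm_rb_rb (i j l m : R) : X.rb i j * X.rb l m + X.rb l m * X.rb i j = 0 := by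
  rw [X.rb_rb]; abel

theorem acm_rc_rc (i j l m : R) : X.rc i j * X.rc l m + X.rc l m * X.rc i j = 0 := by
  rw [X.rc_rc]; abel

theorem acm_rb_rc (i j l m : R) : X.rb i j * X.rc l m + X.rc l m * X.rb i j =
    (if j = l then X.ra i m else 0) - (if j = m then X.ra i l else 0) +
      (if i = l then X.ra j m else 0) - (if i = m then X.ra j l else 0) := by
  rw [X.rb_rc]; abel

theorem rb_sq_eq_zero (h2 : (2 : k) ≠ 0) (i j : R) : X.rb i j * X.rb i j = 0 := by
  have h : (2 : k) • (X.rb i j * X.rb i j) = 0 := by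
    rw [two_smul]
    exact X.acm_rb_rb i j i j
  rw [← one_smul k (X.rb i j * X.rb i j), ← inv_mul_cancel₀ h2, mul_smul, h, smul_zero]

end Brackets

variable {X : Fock A pc (Fin n)} {Q : (Fin n → ℤ) → A} {r : k}

theorem IsTorus.alpair (hX : X.IsTorus Q r) {t : ℕ} (ht : t + 1 < n) (l : Fin n → ℤ) :
    (X.ra ⟨t, by omega⟩ ⟨t, by omega⟩ - X.ra ⟨t + 1, ht⟩ ⟨t + 1, ht⟩) * Q l =
      ((alpair n l (t + 1) : ℤ) : k) • Q l := by
  rw [_root_.alpair, cf_succ _ (by omega), cf_succ _ ht, sub_mul, hX.diag, hX.diag, ← sub_smul]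
  push_cast
  congr 1
  ring

theorem IsTorus.opsU_rel (hX : X.IsTorus Q r) (h2 : (2 : k) ≠ 0)
    {x y : FreeAlgebra k (DGen n)} (h : DRelU k n x y) :
    (opsU k X Q).hom k x = (opsU k X Q).hom k y := by
  have hO := hX.ortho_opsU
  have hE := hX.wE_opsU
  have hF := hX.wF_opsU
  have hB := hX.wB_opsU
  have hC := hX.wC_opsU
  have h11 := hX.wB11_opsU
  cases h with
  | idem2 l l' =>
    rw [map_mul, GenOps.hom_iId, GenOps.hom_iId, hO]
    split_ifs
    · rw [GenOps.hom_iId]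
    · rw [map_zero]
  | srcE i l l' => exact (hE i).src hO l l'
  | tgtE i l l' => exact (hE i).tgt hO l l'
  | srcF i l l' => exact (hF i).src hO l l'
  | tgtF i l l' => exact (hF i).tgt hO l l'
  | srcB i l l' => exact (hB i).src hO l l'
  | tgtB i l l' => exact (hB i).tgt hO l l'
  | srcC i l l' => exact (hC i).src hO l l'
  | tgtC i l l' => exact (hC i).tgt hO l l'
  | srcB11 l l' => exact h11.src hO l l'
  | tgtB11 l l' => exact h11.tgt hO l l'
  | killE i l h => exact (hE i).op_eq_zero (nbr_of_not _ h) l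
  | killF i l h => exact (hF i).op_eq_zero (nbr_of_not _ h) l
  | killB i l h => exact (hB i).op_eq_zero (nbr_of_not _ h) l
  | killC i l h => exact (hC i).op_eq_zero (nbr_of_not _ h) l
  | u1 i j l hi hj =>
    obtain ⟨t, rfl, ht⟩ := okEd_iff.1 hi
    obtain ⟨s, rfl, hs⟩ := okEd_iff.1 hj
    rw [((hE _).cmm hO (hF _)).op, nbr_succ _ ht, nbr_succ _ hs, lie_ra_ra]
    by_cases h : t = s
    · subst h
      rw [if_pos rfl, if_pos rfl, if_pos rfl, map_smul, GenOps.hom_iId]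
      exact hX.alpair ht l
    · simp [h]
  | u2a i j l hi hj h =>
    obtain ⟨t, rfl, ht⟩ := okEd_iff.1 hi
    obtain ⟨s, rfl, hs⟩ := okEd_iff.1 hj
    refine ((hE _).cmm hO (hE _)).op_eq_zero ?_ l
    rw [nbr_succ _ ht, nbr_succ _ hs, lie_ra_ra, if_neg, if_neg, sub_zero] <;>
      simp only [Fin.mk.injEq] <;> omega
  | u2b i j l hi hj h =>
    obtain ⟨t, rfl, ht⟩ := okEd_iff.1 hi
    obtain ⟨s, rfl, hs⟩ := okEd_iff.1 hj
    refine ((hE _).cmm hO ((hE _).cmm hO (hE _))).op_eq_zero ?_ l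
    rw [nbr_succ _ ht, nbr_succ _ hs, lie_ra_ra]
    rcases h with h | h
    · obtain rfl : s = t + 1 := by omega
      simp [lie_ra_ra, bracket_neg, neg_bracket, bracket_zero, zero_bracket, ne_succ_succ, (ne_succ_succ _).symm]
    · obtain rfl : t = s + 1 := by omega
      simp [lie_ra_ra, bracket_neg, neg_bracket, bracket_zero, zero_bracket, ne_succ_succ, (ne_succ_succ _).symm]
  | u3a i j l hi hj h =>
    obtain ⟨t, rfl, ht⟩ := okEd_iff.1 hi
    obtain ⟨s, rfl, hs⟩ := okEd_iff.1 hj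
    refine ((hF _).cmm hO (hF _)).op_eq_zero ?_ l
    rw [nbr_succ _ ht, nbr_succ _ hs, lie_ra_ra, if_neg, if_neg, sub_zero] <;>
      simp only [Fin.mk.injEq] <;> omega
  | u3b i j l hi hj h =>
    obtain ⟨t, rfl, ht⟩ := okEd_iff.1 hi
    obtain ⟨s, rfl, hs⟩ := okEd_iff.1 hj
    refine ((hF _).cmm hO ((hF _).cmm hO (hF _))).op_eq_zero ?_ l
    rw [nbr_succ _ ht, nbr_succ _ hs, lie_ra_ra]
    rcases h with h | h
    · obtain rfl : s = t + 1 := by omega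
      simp [lie_ra_ra, bracket_neg, neg_bracket, bracket_zero, zero_bracket, ne_succ_succ, (ne_succ_succ _).symm]
    · obtain rfl : t = s + 1 := by omega
      simp [lie_ra_ra, bracket_neg, neg_bracket, bracket_zero, zero_bracket, ne_succ_succ, (ne_succ_succ _).symm]
  | u4b i j l hi hj =>
    obtain ⟨t, rfl, ht⟩ := okEd_iff.1 hi
    obtain ⟨s, rfl, hs⟩ := okEd_iff.1 hj
    refine ((hB _).acm hO (hB _)).op_eq_zero ?_ l
    rw [nbr_succ _ ht, nbr_succ _ hs, acm_rb_rb]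
  | u4c i j l hi hj =>
    obtain ⟨t, rfl, ht⟩ := okEd_iff.1 hi
    obtain ⟨s, rfl, hs⟩ := okEd_iff.1 hj
    refine ((hC _).acm hO (hC _)).op_eq_zero ?_ l
    rw [nbr_succ _ ht, nbr_succ _ hs, acm_rc_rc]
  | u5i i l hi =>
    obtain ⟨t, rfl, ht⟩ := okEd_iff.1 hi
    rw [((hB _).acm hO (hC _)).op, nbr_succ _ ht, nbr_succ _ ht, acm_rb_rc, map_smul,
      GenOps.hom_iId, neg_smul]
    refine Eq.trans ?_ (congrArg Neg.neg (hX.alpair ht l))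
    rw [← neg_mul]
    simp only [Fin.mk.injEq, Nat.succ_ne_self, Nat.left_eq_add, if_true, if_false]
    simp [← sub_eq_neg_add]
    rfl
  | u5m i l hi hi1 =>
    obtain ⟨t, rfl, ht⟩ := okEd_iff.1 hi
    obtain ⟨s, hs, hs'⟩ := okEd_iff.1 hi1
    obtain rfl : s = t + 1 := by omega
    refine ((hB _).acm hO (hC _)).op_eq_op ((hF _).cmm hO (hF _)) ?_ l
    rw [nbr_succ _ ht, nbr_succ _ hs', nbr_succ _ ht, nbr_succ _ hs', acm_rb_rc, lie_ra_ra]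
    simp [ne_succ_succ, (ne_succ_succ _).symm]
  | u5p i l hi hi1 =>
    obtain ⟨t, rfl, ht⟩ := okEd_iff.1 hi
    obtain ⟨s, hs, hs'⟩ := okEd_iff.1 hi1
    obtain rfl : s = t + 1 := by omega
    refine ((hB _).acm hO (hC _)).op_eq_op ((hE _).cmm hO (hE _)) ?_ l
    rw [nbr_succ _ ht, nbr_succ _ hs', nbr_succ _ ht, nbr_succ _ hs', acm_rb_rc, lie_ra_ra]
    simp [ne_succ_succ, (ne_succ_succ _).symm]
  | u5z i j l hi hj h =>
    obtain ⟨t, rfl, ht⟩ := okEd_iff.1 hi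
    obtain ⟨s, rfl, hs⟩ := okEd_iff.1 hj
    refine ((hB _).acm hO (hC _)).op_eq_zero ?_ l
    rw [nbr_succ _ ht, nbr_succ _ hs, acm_rb_rc, if_neg, if_neg, if_neg, if_neg]
    · simp
    all_goals simp only [Fin.mk.injEq]; omega
  | u6f i j l hi hj h =>
    obtain ⟨t, rfl, ht⟩ := okEd_iff.1 hi
    obtain ⟨s, rfl, hs⟩ := okEd_iff.1 hj
    refine ((hB _).cmm hO (hF _)).op_eq_zero ?_ l
    rw [nbr_succ _ ht, nbr_succ _ hs, lie_rb_ra, if_neg, if_neg, neg_zero, sub_zero] <;>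
      simp only [Fin.mk.injEq] <;> omega
  | u6e i j l hi hj h =>
    obtain ⟨t, rfl, ht⟩ := okEd_iff.1 hi
    obtain ⟨s, rfl, hs⟩ := okEd_iff.1 hj
    refine ((hB _).cmm hO (hE _)).op_eq_zero ?_ l
    rw [nbr_succ _ ht, nbr_succ _ hs, lie_rb_ra, if_neg, if_neg, neg_zero, sub_zero] <;>
      simp only [Fin.mk.injEq] <;> omega
  | u6c1 i l hi hi1 =>
    obtain ⟨t, rfl, ht⟩ := okEd_iff.1 hi
    obtain ⟨s, hs, hs'⟩ := okEd_iff.1 hi1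
    obtain rfl : s = t + 1 := by omega
    refine ((hB _).cmm hO (hF _)).op_eq_op ((hB _).cmm hO (hE _)) ?_ l
    rw [nbr_succ _ ht, nbr_succ _ ht, nbr_succ _ hs', nbr_succ _ hs', lie_rb_ra, lie_rb_ra]
    simp
  | u6c2 i l hi hi1 =>
    obtain ⟨t, rfl, ht⟩ := okEd_iff.1 hi
    obtain ⟨s, hs, hs'⟩ := okEd_iff.1 hi1
    obtain rfl : s = t + 1 := by omega
    refine ((hB _).cmm hO (hF _)).op_eq_op ((hB _).cmm hO (hE _)) ?_ l
    rw [nbr_succ _ ht, nbr_succ _ ht, nbr_succ _ hs', nbr_succ _ hs', lie_rb_ra, lie_rb_ra]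
    simp [X.rb_symm]
  | u7f i j l hi hj h =>
    obtain ⟨t, rfl, ht⟩ := okEd_iff.1 hi
    obtain ⟨s, rfl, hs⟩ := okEd_iff.1 hj
    refine ((hF _).cmm hO (hC _)).op_eq_zero ?_ l
    rw [nbr_succ _ ht, nbr_succ _ hs, lie_ra_rc, if_neg (by simp only [Fin.mk.injEq]; omega)]
    split_ifs with h'
    · obtain rfl : s = t := by simpa using h'
      simp [rc_self]
    · simp
  | u7e i j l hi hj h =>
    obtain ⟨t, rfl, ht⟩ := okEd_iff.1 hi
    obtain ⟨s, rfl, hs⟩ := okEd_iff.1 hj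
    refine ((hE _).cmm hO (hC _)).op_eq_zero ?_ l
    rw [nbr_succ _ ht, nbr_succ _ hs, lie_ra_rc,
      if_neg (c := _ = (⟨t + 1, ht⟩ : Fin n)) (by simp only [Fin.mk.injEq]; omega)]
    split_ifs with h'
    · obtain rfl : s = t := by simpa using h'
      simp [rc_self]
    · simp
  | u7x i l hi hi1 =>
    obtain ⟨t, rfl, ht⟩ := okEd_iff.1 hi
    obtain ⟨s, hs, hs'⟩ := okEd_iff.1 hi1
    obtain rfl : s = t + 1 := by omega
    refine ((hF _).cmm hO (hC _)).op_eq_op ((hE _).cmm hO (hC _)) ?_ l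
    rw [nbr_succ _ ht, nbr_succ _ ht, nbr_succ _ hs', nbr_succ _ hs', lie_ra_rc, lie_ra_rc]
    simp
  | u8a i l hi hi1 =>
    obtain ⟨t, rfl, ht⟩ := okEd_iff.1 hi
    obtain ⟨s, hs, hs'⟩ := okEd_iff.1 hi1
    obtain rfl : s = t + 1 := by omega
    rw [map_smul, (((hB _).cmm hO (hF _)).cmm hO (hF _)).op]
    refine Eq.trans ?_ (congrArg ((2 : k) • ·) ((hB _).op l).symm)
    rw [nbr_succ _ ht, nbr_succ _ ht, nbr_succ _ hs', nbr_succ _ hs', lie_rb_ra]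
    simp [lie_rb_ra, bracket_neg, neg_bracket, bracket_zero, zero_bracket, ne_succ_succ, (ne_succ_succ _).symm, X.rb_symm ⟨t + 1 + 1, hs'⟩ ⟨t + 1, ht⟩, two_smul, add_mul]
  | u8z i j l hi hj h =>
    obtain ⟨t, rfl, ht⟩ := okEd_iff.1 hi
    obtain ⟨s, rfl, hs⟩ := okEd_iff.1 hj
    refine (((hB _).cmm hO (hF _)).cmm hO (hF _)).op_eq_zero ?_ l
    have : ¬ s = t + 1 := by omega
    rw [nbr_succ _ ht, nbr_succ _ ht, nbr_succ _ hs, lie_rb_ra]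
    simp [lie_rb_ra, bracket_neg, neg_bracket, bracket_zero, zero_bracket, ne_succ_succ, (ne_succ_succ _).symm, this]
  | u8e l h1 =>
    obtain ⟨t, ht, ht'⟩ := okEd_iff.1 h1
    obtain rfl : t = 0 := by omega
    rw [map_smul, (((hB _).cmm hO (hF _)).cmm hO (hE _)).op]
    refine Eq.trans ?_ (congrArg ((2 : k) • ·) ((hB _).op l).symm)
    rw [nbr_succ _ ht', nbr_succ _ ht', nbr_succ _ ht', lie_rb_ra]
    simp [lie_rb_ra, bracket_neg, neg_bracket, bracket_zero, zero_bracket, ne_succ_succ, (ne_succ_succ _).symm, two_smul, add_mul]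
  | u8be j l h1 hj =>
    obtain ⟨t, ht, ht'⟩ := okEd_iff.1 h1
    obtain rfl : t = 0 := by omega
    obtain ⟨s, rfl, hs⟩ := okEd_iff.1 hj
    refine (((hB _).cmm hO (hE _)).cmm hO (hE _)).op_eq_zero ?_ l
    rw [nbr_succ _ ht', nbr_succ _ ht', nbr_succ _ hs, lie_rb_ra]
    simp [lie_rb_ra, bracket_neg, neg_bracket, bracket_zero, zero_bracket, ne_succ_succ, (ne_succ_succ _).symm]
  | u9a i l hi hi1 =>
    obtain ⟨t, rfl, ht⟩ := okEd_iff.1 hi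
    obtain ⟨s, hs, hs'⟩ := okEd_iff.1 hi1
    obtain rfl : s = t + 1 := by omega
    refine (((hC _).cmm hO (hF _)).cmm hO (hF _)).op_eq_op (hC _) ?_ l
    rw [nbr_succ _ ht, nbr_succ _ ht, nbr_succ _ hs', nbr_succ _ hs', lie_rc_ra]
    simp [lie_rc_ra, bracket_neg, neg_bracket, bracket_zero, zero_bracket, ne_succ_succ, (ne_succ_succ _).symm]
  | u9z i j l hi hi1 hj h =>
    obtain ⟨t, rfl, ht⟩ := okEd_iff.1 hi
    obtain ⟨s, hs, hs'⟩ := okEd_iff.1 hi1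
    obtain rfl : s = t + 1 := by omega
    obtain ⟨s, rfl, hs⟩ := okEd_iff.1 hj
    refine (((hC _).cmm hO (hF _)).cmm hO (hF _)).op_eq_zero ?_ l
    have h1 : ¬ s = t + 1 := by omega
    have h3 : ¬ s + 1 = t := by omega
    rw [nbr_succ _ ht, nbr_succ _ hs', nbr_succ _ hs, lie_rc_ra]
    simp [lie_rc_ra, bracket_neg, neg_bracket, bracket_zero, zero_bracket, ne_succ_succ, (ne_succ_succ _).symm, h1, h3]
  | u10 l h1 =>
    obtain ⟨t, ht, ht'⟩ := okEd_iff.1 h1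
    obtain rfl : t = 0 := by omega
    rw [map_smul, ((hE _).cmm hO (hB _)).op]
    refine Eq.trans (congrArg ((2 : k) • ·) (h11.op l)) ?_
    have h0 : 0 < n := by omega
    rw [nbr_succ _ ht', nbr_succ _ ht', lie_ra_rb]
    dsimp only [opsU]
    rw [dif_pos h0, smul_mul_assoc, smul_smul, mul_inv_cancel₀ h2]
    simp
  | u11 l =>
    refine (h11.comp hO h11).op_eq_zero ?_ l
    dsimp only [opsU]
    split_ifs with h0
    · rw [smul_mul_smul_comm, X.rb_sq_eq_zero h2, smul_zero]
    · rw [zero_mul]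

end Fock

end Relations

section OppositeRelations

variable {k : Type} [Field k] {A : Type*} [Ring A] [Algebra k A] {n : ℕ}

theorem alpair_neg (l : Fin n → ℤ) (i : ℕ) : alpair n (-l) i = -alpair n l i := by
  have h : ∀ j, cf n (-l) j = -cf n l j := fun j => by
    unfold cf
    split_ifs <;> simp
  rw [alpair, alpair, h, h]
  ring

namespace GenOps

variable {G T : GenOps A n} {x y x' y' : WOp k n} {a b : A}

namespace Rep

theorem cmm_neg_neg (hG : G.Ortho) (hx : G.Rep x (-a)) (hy : G.Rep y (-b)) :
    G.Rep (x.cmm y) ⁅a, b⁆ := by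
  have := hx.cmm hG hy
  rwa [neg_bracket, bracket_neg, neg_neg] at this

theorem cmm_neg_left (hG : G.Ortho) (hx : G.Rep x (-a)) (hy : G.Rep y b) :
    G.Rep (x.cmm y) (-⁅a, b⁆) := by
  have := hx.cmm hG hy
  rwa [neg_bracket] at this

theorem cmm_neg_right (hG : G.Ortho) (hx : G.Rep x a) (hy : G.Rep y (-b)) :
    G.Rep (x.cmm y) (-⁅a, b⁆) := by
  have := hx.cmm hG hy
  rwa [bracket_neg] at this

variable (hQ : ∀ l, T.Q l = G.Q (-l))
include hQ

theorem flip (hT : T.Rep x a) (hG : G.Rep y a) (l : Fin n → ℤ) :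
    T.hom k (x.op l) = G.hom k (y.op (-l)) := by
  rw [hT.op, hG.op, hQ]

theorem flip_neg (hT : T.Rep x (-a)) (hG : G.Rep y a) (l : Fin n → ℤ) :
    T.hom k (x.op l) = -G.hom k (y.op (-l)) := by
  rw [hT.op, hG.op, hQ, neg_mul]

theorem flip_zero (hT : T.Rep x a) (hG : G.Rep y a) {l : Fin n → ℤ}
    (h : G.hom k (y.op (-l)) = G.hom k 0) : T.hom k (x.op l) = T.hom k 0 := by
  rw [hT.flip hQ hG, h, map_zero, map_zero]

theorem flip_zero_neg (hT : T.Rep x (-a)) (hG : G.Rep y a) {l : Fin n → ℤ}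
    (h : G.hom k (y.op (-l)) = G.hom k 0) : T.hom k (x.op l) = T.hom k 0 := by
  rw [hT.flip_neg hQ hG, h, map_zero, map_zero, neg_zero]

theorem flip_op (hT : T.Rep x a) (hG : G.Rep y a) (hT' : T.Rep x' b) (hG' : G.Rep y' b)
    {l : Fin n → ℤ} (h : G.hom k (y.op (-l)) = G.hom k (y'.op (-l))) :
    T.hom k (x.op l) = T.hom k (x'.op l) := by
  rw [hT.flip hQ hG, hT'.flip hQ hG', h]

theorem flip_op_neg (hT : T.Rep x (-a)) (hG : G.Rep y a) (hT' : T.Rep x' (-b))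
    (hG' : G.Rep y' b) {l : Fin n → ℤ} (h : G.hom k (y.op (-l)) = G.hom k (y'.op (-l))) :
    T.hom k (x.op l) = T.hom k (x'.op l) := by
  rw [hT.flip_neg hQ hG, hT'.flip_neg hQ hG', h]

theorem flip_smul (hT : T.Rep x a) (hG : G.Rep y a) (hT' : T.Rep x' b) (hG' : G.Rep y' b)
    {l : Fin n → ℤ} {c : k} (h : G.hom k (y.op (-l)) = G.hom k (c • y'.op (-l))) :
    T.hom k (x.op l) = T.hom k (c • x'.op l) := by
  rw [hT.flip hQ hG, h, map_smul, map_smul, hT'.flip hQ hG']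

end Rep

end GenOps

namespace Fock

variable {C : Type*} [DecidableEq C] [Fintype C] {pc : C → Bool}
  {X : Fock A pc (Fin n)} {Q : (Fin n → ℤ) → A} {r : k}

theorem IsTorus.opsT_rel (hX : X.IsTorus Q r) (h2 : (2 : k) ≠ 0)
    {x y : FreeAlgebra k (DGen n)} (h : DRelT k n x y) :
    (opsT k X Q).hom k x = (opsT k X Q).hom k y := by
  have hq : ∀ l, (opsT k X Q).Q l = (opsU k X Q).Q (-l) := fun _ => rfl
  have hU {x y : FreeAlgebra k (DGen n)} : DRelU k n x y → _ := hX.opsU_rel h2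
  have hO := hX.ortho_opsT
  have hE := hX.wE_opsT
  have hF := hX.wF_opsT
  have hB := hX.wB_opsT
  have hC := hX.wC_opsT
  have h11 := hX.wB11_opsT
  have uO := hX.ortho_opsU
  have uE := hX.wE_opsU
  have uF := hX.wF_opsU
  have uB := hX.wB_opsU
  have uC := hX.wC_opsU
  have u11 := hX.wB11_opsU
  cases h with
  | idem2 l l' =>
    rw [map_mul, GenOps.hom_iId, GenOps.hom_iId, hO]
    split_ifs
    · rw [GenOps.hom_iId]
    · rw [map_zero]
  | srcE i l l' => exact (hE i).src hO l l'
  | tgtE i l l' => exact (hE i).tgt hO l l'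
  | srcF i l l' => exact (hF i).src hO l l'
  | tgtF i l l' => exact (hF i).tgt hO l l'
  | srcB i l l' => exact (hB i).src hO l l'
  | tgtB i l l' => exact (hB i).tgt hO l l'
  | srcC i l l' => exact (hC i).src hO l l'
  | tgtC i l l' => exact (hC i).tgt hO l l'
  | srcB11 l l' => exact h11.src hO l l'
  | tgtB11 l l' => exact h11.tgt hO l l'
  | killE i l h => exact (hE i).flip_zero_neg hq (uF i) (hU (.killF i _ h))
  | killF i l h => exact (hF i).flip_zero_neg hq (uE i) (hU (.killE i _ h))
  | killB i l h => exact (hB i).flip_zero hq (uB i) (hU (.killB i _ h))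
  | killC i l h => exact (hC i).flip_zero hq (uC i) (hU (.killC i _ h))
  | u1 i j l hi hj =>
    have := hU (.u1 j i (-l) hj hi)
    rw [((uE j).cmm uO (uF i)).op] at this
    rw [((hE i).cmm_neg_neg hO (hF j)).op, hq, ← bracket_swap, neg_mul, this]
    by_cases hij : i = j
    · subst hij
      rw [if_pos rfl, if_pos rfl, map_smul, map_smul, GenOps.hom_iId, GenOps.hom_iId, alpair_neg,
        hq, Int.cast_neg, neg_smul, neg_neg]
    · rw [if_neg hij, if_neg (Ne.symm hij), map_zero, map_zero, neg_zero]
  | u2a i j l hi hj h =>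
    exact ((hE i).cmm_neg_neg hO (hE j)).flip_zero hq ((uF i).cmm uO (uF j))
      (hU (.u3a i j _ hi hj h))
  | u2b i j l hi hj h =>
    exact ((hE i).cmm_neg_left hO ((hE i).cmm_neg_neg hO (hE j))).flip_zero_neg hq
      ((uF i).cmm uO ((uF i).cmm uO (uF j))) (hU (.u3b i j _ hi hj h))
  | u3a i j l hi hj h =>
    exact ((hF i).cmm_neg_neg hO (hF j)).flip_zero hq ((uE i).cmm uO (uE j))
      (hU (.u2a i j _ hi hj h))
  | u3b i j l hi hj h =>
    exact ((hF i).cmm_neg_left hO ((hF i).cmm_neg_neg hO (hF j))).flip_zero_neg hq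
      ((uE i).cmm uO ((uE i).cmm uO (uE j))) (hU (.u2b i j _ hi hj h))
  | u4b i j l hi hj =>
    exact ((hB i).acm hO (hB j)).flip_zero hq ((uB i).acm uO (uB j)) (hU (.u4b i j _ hi hj))
  | u4c i j l hi hj =>
    exact ((hC i).acm hO (hC j)).flip_zero hq ((uC i).acm uO (uC j)) (hU (.u4c i j _ hi hj))
  | u5i i l hi =>
    rw [((hB i).acm hO (hC i)).flip hq ((uB i).acm uO (uC i)), hU (.u5i i _ hi), map_smul,
      map_smul, GenOps.hom_iId, GenOps.hom_iId, alpair_neg, hq, Int.cast_neg, neg_neg]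
  | u5m i l hi hi1 =>
    exact ((hB _).acm hO (hC _)).flip_op hq ((uB _).acm uO (uC _))
      ((hE _).cmm_neg_neg hO (hE _)) ((uF _).cmm uO (uF _)) (hU (.u5m i _ hi hi1))
  | u5p i l hi hi1 =>
    exact ((hB _).acm hO (hC _)).flip_op hq ((uB _).acm uO (uC _))
      ((hF _).cmm_neg_neg hO (hF _)) ((uE _).cmm uO (uE _)) (hU (.u5p i _ hi hi1))
  | u5z i j l hi hj h =>
    exact ((hB i).acm hO (hC j)).flip_zero hq ((uB i).acm uO (uC j)) (hU (.u5z i j _ hi hj h))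
  | u6e i j l hi hj h =>
    exact ((hB i).cmm_neg_right hO (hE j)).flip_zero_neg hq ((uB i).cmm uO (uF j))
      (hU (.u6f i j _ hi hj h))
  | u6f i j l hi hj h =>
    exact ((hB i).cmm_neg_right hO (hF j)).flip_zero_neg hq ((uB i).cmm uO (uE j))
      (hU (.u6e i j _ hi hj h))
  | u6c1 i l hi hi1 =>
    exact ((hB _).cmm_neg_right hO (hE _)).flip_op_neg hq ((uB _).cmm uO (uF _))
      ((hB _).cmm_neg_right hO (hF _)) ((uB _).cmm uO (uE _)) (hU (.u6c1 i _ hi hi1))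
  | u6c2 i l hi hi1 =>
    exact ((hB _).cmm_neg_right hO (hE _)).flip_op_neg hq ((uB _).cmm uO (uF _))
      ((hB _).cmm_neg_right hO (hF _)) ((uB _).cmm uO (uE _)) (hU (.u6c2 i _ hi hi1))
  | u7e i j l hi hj h =>
    exact ((hE j).cmm_neg_left hO (hC i)).flip_zero_neg hq ((uF j).cmm uO (uC i))
      (hU (.u7f i j _ hi hj h))
  | u7f i j l hi hj h =>
    exact ((hF j).cmm_neg_left hO (hC i)).flip_zero_neg hq ((uE j).cmm uO (uC i))
      (hU (.u7e i j _ hi hj h))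
  | u7x i l hi hi1 =>
    exact ((hE _).cmm_neg_left hO (hC _)).flip_op_neg hq ((uF _).cmm uO (uC _))
      ((hF _).cmm_neg_left hO (hC _)) ((uE _).cmm uO (uC _)) (hU (.u7x i _ hi hi1))
  | u8a i l hi hi1 =>
    exact (((hB i).cmm_neg_right hO (hE i)).cmm_neg_neg hO (hE (i + 1))).flip_smul hq
      (((uB i).cmm uO (uF i)).cmm uO (uF (i + 1))) (hB (i + 1)) (uB (i + 1))
      (hU (.u8a i _ hi hi1))
  | u8z i j l hi hj h =>
    exact (((hB i).cmm_neg_right hO (hE i)).cmm_neg_neg hO (hE j)).flip_zero hq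
      (((uB i).cmm uO (uF i)).cmm uO (uF j)) (hU (.u8z i j _ hi hj h))
  | u8e l h1 =>
    exact (((hB 1).cmm_neg_right hO (hE 1)).cmm_neg_neg hO (hF 1)).flip_smul hq
      (((uB 1).cmm uO (uF 1)).cmm uO (uE 1)) (hB 1) (uB 1) (hU (.u8e _ h1))
  | u8bf j l h1 hj =>
    exact (((hB 1).cmm_neg_right hO (hF 1)).cmm_neg_neg hO (hF j)).flip_zero hq
      (((uB 1).cmm uO (uE 1)).cmm uO (uE j)) (hU (.u8be j _ h1 hj))
  | u9a i l hi hi1 =>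
    exact (((hC (i + 1)).cmm_neg_right hO (hE i)).cmm_neg_neg hO (hE (i + 1))).flip_op hq
      (((uC (i + 1)).cmm uO (uF i)).cmm uO (uF (i + 1))) (hC i) (uC i) (hU (.u9a i _ hi hi1))
  | u9z i j l hi hi1 hj h =>
    exact (((hC (i + 1)).cmm_neg_right hO (hE i)).cmm_neg_neg hO (hE j)).flip_zero hq
      (((uC (i + 1)).cmm uO (uF i)).cmm uO (uF j)) (hU (.u9z i j _ hi hi1 hj h))
  | u10 l h1 =>
    have h : (opsT k X Q).Rep ((wBt k n 1).cmm (wF k n 1)) ⁅nbr X.ra 1, nbr X.rb 1⁆ := by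
      have := (hB 1).cmm_neg_right hO (hF 1)
      rwa [bracket_swap] at this
    exact (h.flip_smul hq ((uE 1).cmm uO (uB 1)) h11 u11 (hU (.u10 _ h1)).symm).symm
  | u11 l => exact (h11.comp hO h11).flip_zero hq (u11.comp uO u11) (hU (.u11 _))

variable (hX : X.IsTorus Q r) (h2 : (2 : k) ≠ 0)

/-- The action of the idempotented periplectic algebra. -/
noncomputable def IsTorus.actU : Udu k n →ₐ[k] A :=
  RingQuot.liftAlgHom k ⟨(opsU k X Q).hom k, fun _ _ h => hX.opsU_rel h2 h⟩

/-- The action of the opposite idempotented periplectic algebra. -/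
noncomputable def IsTorus.actT : Udt k n →ₐ[k] A :=
  RingQuot.liftAlgHom k ⟨(opsT k X Q).hom k, fun _ _ h => hX.opsT_rel h2 h⟩

@[simp] theorem IsTorus.actU_mk (x : FreeAlgebra k (DGen n)) :
    hX.actU h2 (mkDu k n x) = (opsU k X Q).hom k x :=
  RingQuot.liftAlgHom_mkAlgHom_apply k _ _ x

@[simp] theorem IsTorus.actT_mk (x : FreeAlgebra k (DGen n)) :
    hX.actT h2 (mkDt k n x) = (opsT k X Q).hom k x :=
  RingQuot.liftAlgHom_mkAlgHom_apply k _ _ x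

end Fock

end OppositeRelations

section TorusGeneration

variable {k : Type} [Field k] {A : Type*} [Ring A] [Algebra k A] {n : ℕ}

namespace Fock

variable {C : Type*} [DecidableEq C] [Fintype C] {pc : C → Bool}
  {X : Fock A pc (Fin n)} {Q : (Fin n → ℤ) → A} {r : k} {S : Submodule k A}

section

variable {a b : A}

theorem mul_torus_mem (hX : X.IsTorus Q r) (hS : ∀ x ∈ S, ∀ y ∈ S, x * y ∈ S)
    (ha : ∀ l, a * Q l ∈ S) (hb : ∀ l, b * Q l ∈ S) (hw : ∀ l, ∃ l', b * Q l = Q l' * b)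
    (l : Fin n → ℤ) : a * b * Q l ∈ S := by
  obtain ⟨l', h⟩ := hw l
  have : a * b * Q l = a * Q l' * (b * Q l) := by
    rw [h, mul_assoc, h, mul_assoc a, ← mul_assoc (Q l'), hX.QQ, if_pos rfl]
  rw [this]
  exact hS _ (ha l') _ (hb l)

theorem lie_torus_mem (hX : X.IsTorus Q r) (hS : ∀ x ∈ S, ∀ y ∈ S, x * y ∈ S)
    (ha : ∀ l, a * Q l ∈ S) (hb : ∀ l, b * Q l ∈ S) (hwa : ∀ l, ∃ l', a * Q l = Q l' * a)
    (hwb : ∀ l, ∃ l', b * Q l = Q l' * b) (l : Fin n → ℤ) : ⁅a, b⁆ * Q l ∈ S := by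
  rw [Ring.lie_def, sub_mul]
  exact S.sub_mem (mul_torus_mem hX hS ha hb hwb l) (mul_torus_mem hX hS hb ha hwa l)

end

/-- A subspace closed under multiplication, containing the weight idempotents and the Chevalley
generators. -/
structure IsGenerated (X : Fock A pc (Fin n)) (Q : (Fin n → ℤ) → A) (S : Submodule k A) :
    Prop where
  mul : ∀ x ∈ S, ∀ y ∈ S, x * y ∈ S
  idem : ∀ l, Q l ∈ S
  up : ∀ t (h : t + 1 < n) l, X.ra ⟨t, by omega⟩ ⟨t + 1, h⟩ * Q l ∈ S
  down : ∀ t (h : t + 1 < n) l, X.ra ⟨t + 1, h⟩ ⟨t, by omega⟩ * Q l ∈ S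
  b : ∀ (h : 0 < n) l, X.rb ⟨0, h⟩ ⟨0, h⟩ * Q l ∈ S
  c : ∀ (h : 1 < n) l, X.rc ⟨0, by omega⟩ ⟨1, h⟩ * Q l ∈ S

namespace IsGenerated

variable (hS : X.IsGenerated Q S) (hX : X.IsTorus Q r)
include hS hX

theorem ra_up_mem (d : ℕ) : ∀ (i : ℕ) (h : i + d + 1 < n) (l : Fin n → ℤ),
    X.ra ⟨i, by omega⟩ ⟨i + d + 1, h⟩ * Q l ∈ S := by
  induction d with
  | zero => exact hS.up
  | succ d ih =>
    intro i h l
    have := lie_torus_mem hX hS.mul (ih i (by omega)) (hS.up (i + d + 1) h)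
      (fun l => ⟨_, hX.ra _ _ l⟩) (fun l => ⟨_, hX.ra _ _ l⟩) l
    rwa [lie_ra_ra, if_pos rfl, if_neg (by simp only [Fin.mk.injEq]; omega), sub_zero] at this

theorem ra_down_mem (d : ℕ) : ∀ (i : ℕ) (h : i + d + 1 < n) (l : Fin n → ℤ),
    X.ra ⟨i + d + 1, h⟩ ⟨i, by omega⟩ * Q l ∈ S := by
  induction d with
  | zero => exact hS.down
  | succ d ih =>
    intro i h l
    have := lie_torus_mem hX hS.mul (hS.down (i + d + 1) h) (ih i (by omega))
      (fun l => ⟨_, hX.ra _ _ l⟩) (fun l => ⟨_, hX.ra _ _ l⟩) l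
    rwa [lie_ra_ra, if_pos rfl, if_neg (by simp only [Fin.mk.injEq]; omega), sub_zero] at this

theorem ra_mem (i j : Fin n) (l : Fin n → ℤ) : X.ra i j * Q l ∈ S := by
  rcases lt_trichotomy i j with h | rfl | h
  · have := hS.ra_up_mem hX (j - i - 1) i (by omega) l
    convert this using 3
    ext
    change j.1 = i.1 + (j.1 - i.1 - 1) + 1
    omega
  · rw [hX.diag]
    exact S.smul_mem _ (hS.idem l)
  · have := hS.ra_down_mem hX (i - j - 1) j (by omega) l
    convert this using 3
    ext
    change i.1 = j.1 + (i.1 - j.1 - 1) + 1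
    omega

theorem rb_mem (h2 : (2 : k) ≠ 0) (i j : Fin n) (l : Fin n → ℤ) : X.rb i j * Q l ∈ S := by
  have hn : 0 < n := i.pos
  have h0 : ∀ (i : Fin n) (l : Fin n → ℤ), X.rb ⟨0, hn⟩ i * Q l ∈ S := fun i l => by
    have := lie_torus_mem hX hS.mul (hS.ra_mem hX i ⟨0, hn⟩) (hS.b hn)
      (fun l => ⟨_, hX.ra _ _ l⟩) (fun l => ⟨_, hX.rb _ _ l⟩) l
    rw [lie_ra_rb, if_pos rfl, ← two_smul k, smul_mul_assoc] at this
    have := S.smul_mem 2⁻¹ this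
    rwa [smul_smul, inv_mul_cancel₀ h2, one_smul, rb_symm] at this
  by_cases hi : i = ⟨0, hn⟩
  · rw [hi]
    exact h0 j l
  · have := lie_torus_mem hX hS.mul (hS.ra_mem hX j ⟨0, hn⟩) (h0 i)
      (fun l => ⟨_, hX.ra _ _ l⟩) (fun l => ⟨_, hX.rb _ _ l⟩) l
    rwa [lie_ra_rb, if_pos rfl, if_neg (Ne.symm hi), add_zero, rb_symm] at this

theorem rc_mem (i j : Fin n) (l : Fin n → ℤ) : X.rc i j * Q l ∈ S := by
  by_cases hij : i = j
  · rw [hij, rc_self, zero_mul]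
    exact S.zero_mem
  have hn : 1 < n := by
    have := i.2
    have := j.2
    have : i.1 ≠ j.1 := fun h => hij (Fin.ext h)
    omega
  have h1 : ∀ (i : Fin n) (l : Fin n → ℤ), X.rc i ⟨1, hn⟩ * Q l ∈ S := fun i l => by
    have := lie_torus_mem hX hS.mul (hS.ra_mem hX ⟨0, by omega⟩ i) (hS.c hn)
      (fun l => ⟨_, hX.ra _ _ l⟩)
      (fun l => ⟨l - (Pi.single ⟨0, by omega⟩ 1 + Pi.single ⟨1, hn⟩ 1), hX.rc _ _ l⟩) l
    rw [lie_ra_rc, if_pos rfl, if_neg (by simp), sub_zero, neg_mul] at this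
    exact neg_mem_iff.1 this
  have key : ∀ i j : Fin n, j ≠ ⟨1, hn⟩ → X.rc j i * Q l ∈ S := fun i j hj => by
    have := lie_torus_mem hX hS.mul (hS.ra_mem hX ⟨1, hn⟩ i) (h1 j)
      (fun l => ⟨_, hX.ra _ _ l⟩)
      (fun l => ⟨l - (Pi.single j 1 + Pi.single ⟨1, hn⟩ 1), hX.rc _ _ l⟩) l
    rw [lie_ra_rc, if_neg (Ne.symm hj), if_pos rfl, neg_zero, zero_sub, neg_mul] at this
    exact neg_mem_iff.1 this
  by_cases hi : i = ⟨1, hn⟩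
  · rw [rc_symm, neg_mul]
    exact S.neg_mem (key _ _ fun h => hij (hi.trans h.symm))
  · exact key _ _ hi

end IsGenerated

end Fock

end TorusGeneration

section Supercommutation

variable {k : Type} [Field k] {A : Type*} [Ring A] [Algebra k A]

namespace HasParity

variable {s : A} {p q : Bool} {x y : A}

theorem add (hx : HasParity k s p x) (hy : HasParity k s p y) : HasParity k s p (x + y) := by
  rw [HasParity, map_add, hx, hy, sgm_add]

theorem neg (hx : HasParity k s p x) : HasParity k s p (-x) := by
  rw [HasParity, map_neg, hx, sgm_neg]

theorem sub (hx : HasParity k s p x) (hy : HasParity k s p y) : HasParity k s p (x - y) := by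
  rw [HasParity, map_sub, hx, hy, sgm_sub]

theorem zero : HasParity k s p (0 : A) := by
  rw [HasParity, map_zero, sgm_zero]

theorem smul (c : k) (hx : HasParity k s p x) : HasParity k s p (c • x) := by
  rw [HasParity, map_smul, hx]
  cases p <;> simp

theorem sum {ι : Type*} {t : Finset ι} {f : ι → A} (h : ∀ i ∈ t, HasParity k s p (f i)) :
    HasParity k s p (∑ i ∈ t, f i) := by
  rw [HasParity, map_sum, sgm_sum]
  exact Finset.sum_congr rfl h

theorem mul (hs : s * s = 1) (hx : HasParity k s p x) (hy : HasParity k s q y) :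
    HasParity k s (xor p q) (x * y) := by
  rw [HasParity, twist_mul hs, hx, hy, sgm_mul, mul_sgm, sgm_sgm_left]

theorem algebraMap (hs : s * s = 1) (c : k) : HasParity k s false (algebraMap k A c) := by
  rw [Algebra.algebraMap_eq_smul_one]
  refine smul c ?_
  rw [HasParity, twist_one hs, sgm_false_left]

end HasParity

/-- The homogeneous components of `h` supercommute with `g`. -/
def SuperComm (k : Type) [Field k] {A : Type*} [Ring A] [Algebra k A] (s g h : A) : Prop :=
  ∃ h0 h1, HasParity k s false h0 ∧ HasParity k s true h1 ∧ h = h0 + h1 ∧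
    g * h0 = h0 * g ∧ g * h1 = h1 * twist k s true g

/-- The elements `g` and `h` are homogeneous and supercommute. -/
def HomogComm (k : Type) [Field k] {A : Type*} [Ring A] [Algebra k A] (s g h : A) : Prop :=
  ∃ p q, HasParity k s p g ∧ HasParity k s q h ∧ g * h = sgm p q (h * g)

variable {s : A} {G H : Set A}

theorem HomogComm.symm {g h : A} : HomogComm k s g h → HomogComm k s h g
  | ⟨p, q, hg, hh, e⟩ => ⟨q, p, hh, hg, by rw [e, sgm_swap, sgm_sgm_self]⟩

theorem adjoin_twist (hs : s * s = 1) (hG : ∀ g ∈ G, ∃ p, HasParity k s p g) (q : Bool) {g : A}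
    (hg : g ∈ Algebra.adjoin k G) : twist k s q g ∈ Algebra.adjoin k G := by
  induction hg using Algebra.adjoin_induction with
  | mem g hg =>
    obtain ⟨p, hp⟩ := hG g hg
    rw [hp.twist]
    have := Algebra.subset_adjoin (R := k) hg
    cases q <;> cases p <;> simpa
  | algebraMap c =>
    rw [(HasParity.algebraMap hs c).twist, sgm_false_right]
    exact Subalgebra.algebraMap_mem _ _
  | add x y _ _ hx hy => rw [map_add]; exact add_mem hx hy
  | mul x y _ _ hx hy => rw [twist_mul hs]; exact mul_mem hx hy

theorem adjoin_mul_homog (hs : s * s = 1) {q : Bool} {h : A}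
    (hG : ∀ g ∈ G, g * h = h * twist k s q g) {g : A} (hg : g ∈ Algebra.adjoin k G) :
    g * h = h * twist k s q g := by
  induction hg using Algebra.adjoin_induction with
  | mem g hg => exact hG g hg
  | algebraMap c =>
    rw [(HasParity.algebraMap hs c).twist, sgm_false_right, Algebra.commutes]
  | add x y _ _ hx hy => rw [map_add, add_mul, mul_add, hx, hy]
  | mul x y _ _ hx hy => rw [twist_mul hs, mul_assoc, hy, ← mul_assoc, hx, mul_assoc]

theorem adjoin_superComm (hs : s * s = 1) (hGH : ∀ g ∈ G, ∀ h ∈ H, HomogComm k s g h)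
    (hG : ∀ g ∈ G, ∃ p, HasParity k s p g) (hH : ∀ h ∈ H, ∃ p, HasParity k s p h)
    {g h : A} (hg : g ∈ Algebra.adjoin k G) (hh : h ∈ Algebra.adjoin k H) : SuperComm k s g h := by
  suffices key : ∃ h0 h1, HasParity k s false h0 ∧ HasParity k s true h1 ∧ h = h0 + h1 ∧
      ∀ g ∈ Algebra.adjoin k G, g * h0 = h0 * g ∧ g * h1 = h1 * twist k s true g by
    obtain ⟨h0, h1, h2, h3, h4, h5⟩ := key
    exact ⟨h0, h1, h2, h3, h4, h5 g hg⟩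
  clear hg
  induction hh using Algebra.adjoin_induction with
  | mem h hh =>
    obtain ⟨p, hp⟩ := hH h hh
    have hc := fun g hg => adjoin_mul_homog (k := k) (G := G) (q := p) (h := h) hs (fun g hg => by
      obtain ⟨p', q', h1, h2, h3⟩ := hGH g hg h hh
      rw [h3, h1.twist, mul_sgm]
      cases p' with
      | false => rw [sgm_false_left, sgm_false_right]
      | true => rw [sgm_swap, ← sgm_mul, ← sgm_mul, ← h2, hp]) (g := g) hg
    cases p with
    | false =>
      exact ⟨h, 0, hp, HasParity.zero, (add_zero h).symm, fun g hg =>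
        ⟨hc g hg, by rw [mul_zero, zero_mul]⟩⟩
    | true =>
      exact ⟨0, h, HasParity.zero, hp, (zero_add h).symm, fun g hg =>
        ⟨by rw [mul_zero, zero_mul], hc g hg⟩⟩
  | algebraMap c =>
    exact ⟨_, 0, HasParity.algebraMap hs c, HasParity.zero, (add_zero _).symm, fun g hg =>
      ⟨(Algebra.commutes c g).symm, by rw [mul_zero, zero_mul]⟩⟩
  | add x y _ _ hx hy =>
    obtain ⟨x0, x1, hx0, hx1, rfl, hxg⟩ := hx
    obtain ⟨y0, y1, hy0, hy1, rfl, hyg⟩ := hy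
    refine ⟨x0 + y0, x1 + y1, hx0.add hy0, hx1.add hy1, by abel, fun g hg => ⟨?_, ?_⟩⟩
    · rw [mul_add, add_mul, (hxg g hg).1, (hyg g hg).1]
    · rw [mul_add, add_mul, (hxg g hg).2, (hyg g hg).2]
  | mul x y _ _ hx hy =>
    obtain ⟨x0, x1, hx0, hx1, rfl, hxg⟩ := hx
    obtain ⟨y0, y1, hy0, hy1, rfl, hyg⟩ := hy
    have h00 := hx0.mul hs hy0
    have h11 := hx1.mul hs hy1
    have h01 := hx0.mul hs hy1
    have h10 := hx1.mul hs hy0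
    rw [Bool.xor_self] at h00 h11
    rw [Bool.false_xor] at h01
    rw [Bool.xor_false] at h10
    refine ⟨x0 * y0 + x1 * y1, x0 * y1 + x1 * y0, h00.add h11, h01.add h10,
      by noncomm_ring, fun g hg => ?_⟩
    have ht := adjoin_twist hs hG true hg
    have htt : twist k s true (twist k s true g) = g := by
      rw [twist_twist hs, Bool.xor_self, twist_false]
    have e0 := hxg g hg
    have e1 := hyg g hg
    have e2 := hyg _ ht
    rw [htt] at e2
    constructor
    · rw [mul_add, add_mul, ← mul_assoc, e0.1, mul_assoc, e1.1, ← mul_assoc g, e0.2, mul_assoc x1,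
        e2.2, mul_assoc, mul_assoc]
    · rw [mul_add, add_mul, ← mul_assoc, e0.1, mul_assoc, e1.2, ← mul_assoc g, e0.2, mul_assoc x1,
        e2.1, mul_assoc, mul_assoc]

end Supercommutation

section ParityOperator

variable (k : Type) [Field k] (F L : ℕ)

/-- The parity operator. -/
noncomputable def parityOp : Module.End k (SM k F L) := Pe k F L - Po k F L

variable {k F L}

theorem Pe_bvec (b : MonB F L) : Pe k F L (bvec k F L b) = if evenMon b then bvec k F L b else 0 :=
  opOf_bvec _ _

theorem Po_bvec (b : MonB F L) : Po k F L (bvec k F L b) = if evenMon b then 0 else bvec k F L b :=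
  opOf_bvec _ _

theorem parityOp_bvec (b : MonB F L) :
    parityOp k F L (bvec k F L b) = if evenMon b then bvec k F L b else -bvec k F L b := by
  rw [parityOp, LinearMap.sub_apply, Pe_bvec, Po_bvec]
  split_ifs <;> simp

theorem parityOp_mul_self : parityOp k F L * parityOp k F L = 1 := by
  refine end_ext_bvec fun b => ?_
  rw [Module.End.mul_apply, parityOp_bvec]
  split_ifs with h <;> simp [parityOp_bvec, h]

theorem two_smul_odPart (f : Module.End k (SM k F L)) :
    (2 : k) • odPart k F L f = f - twist k (parityOp k F L) true f := by
  have hadd : Pe k F L + Po k F L = 1 := by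
    refine end_ext_bvec fun b => ?_
    rw [LinearMap.add_apply, Pe_bvec, Po_bvec]
    split_ifs <;> simp
  have : ∀ {B : Type} [Ring B] (e o f : B), e + o = 1 →
      e * f * o + o * f * e + (e * f * o + o * f * e) = f - (e - o) * (f * (e - o)) := by
    intro B _ e o f h
    have h1 : f = (e + o) * f * (e + o) := by rw [h, one_mul, mul_one]
    conv_rhs => enter [1]; rw [h1]
    noncomm_ring
  rw [two_smul, odPart, twist_true, parityOp]
  exact this (B := Module.End k (SM k F L)) _ _ _ hadd

theorem odPart_eq [CharZero k] {f f0 f1 : Module.End k (SM k F L)} (h : f = f0 + f1)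
    (h0 : HasParity k (parityOp k F L) false f0) (h1 : HasParity k (parityOp k F L) true f1) :
    odPart k F L f = f1 := by
  have h2 := two_smul_odPart f
  rw [h, map_add, h0, h1, sgm_false_left, sgm_true_true] at h2
  have h3 : (2 : k) • odPart k F L (f0 + f1) = (2 : k) • f1 := by
    rw [h2, two_smul]; abel
  rw [h]
  exact smul_right_injective _ (two_ne_zero' k) h3

theorem sbrk_eq (g f : Module.End k (SM k F L)) :
    sbrk k F L g f = g * f - f * g + (f - twist k (parityOp k F L) true f) * odPart k F L g := by
  rw [sbrk, ← two_smul_odPart, smul_mul_assoc]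

theorem SuperComm.sbrk [CharZero k] {g f : Module.End k (SM k F L)}
    (h : SuperComm k (parityOp k F L) g f) : sbrk k F L g f = 0 := by
  obtain ⟨f0, f1, h0, h1, hf, hg0, hg1⟩ := h
  rw [_root_.sbrk, odPart_eq hf h0 h1, ← mul_smul_comm, two_smul_odPart, hf]
  have : ∀ {B : Type} [Ring B] (g g' f0 f1 : B), g * f0 = f0 * g → g * f1 = f1 * g' →
      g * (f0 + f1) - (f0 + f1) * g + f1 * (g - g') = 0 := by
    intro B _ g g' f0 f1 h0 h1
    rw [mul_add, h0, h1]
    noncomm_ring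
  exact this _ _ _ _ hg0 hg1

theorem mul_eq_of_sbrk [CharZero k] {p : Bool} {g f : Module.End k (SM k F L)}
    (hg : HasParity k (parityOp k F L) p g) (h : sbrk k F L g f = 0) :
    g * f = twist k (parityOp k F L) p f * g := by
  rw [sbrk_eq] at h
  have : ∀ {B : Type} [Ring B] (g f f' : B), g * f - f * g + (f - f') * g = 0 →
      g * f = f' * g := by
    intro B _ g f f' h
    rw [sub_mul, sub_add_sub_cancel] at h
    exact sub_eq_zero.1 h
  cases p with
  | false =>
    rw [odPart_eq (add_zero g).symm hg HasParity.zero] at h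
    have h' : ∀ {B : Type} [Ring B] (g f f' : B), g * f - f * g + (f - f') * 0 = 0 →
        g * f = f * g := by
      intro B _ g f f' h
      rw [mul_zero, add_zero] at h
      exact sub_eq_zero.1 h
    exact h' (B := Module.End k (SM k F L)) _ _ _ h
  | true =>
    rw [odPart_eq (zero_add g).symm HasParity.zero hg] at h
    exact this (B := Module.End k (SM k F L)) _ _ _ h

end ParityOperator

section WeightProjections

variable {k : Type} [Field k] {F L : ℕ} {I : Type*} [DecidableEq I]

/-- The projection onto the span of the monomials of a given weight. -/
noncomputable def weightProj (k : Type) [Field k] {F L : ℕ} {I : Type*} [DecidableEq I]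
    (w : MonB F L → I) (l : I) : Module.End k (SM k F L) :=
  diagOp fun b => if w b = l then 1 else 0

variable (w : MonB F L → I)

theorem weightProj_bvec (l : I) (b : MonB F L) :
    weightProj k w l (bvec k F L b) = if w b = l then bvec k F L b else 0 := by
  rw [weightProj, diagOp_bvec, ite_smul, one_smul, zero_smul]

theorem weightProj_apply (l : I) (u : SM k F L) (b : MonB F L) :
    weightProj k w l u b = if w b = l then u b else 0 := by
  rw [weightProj, diagOp_apply, ite_mul, one_mul, zero_mul]

theorem weightProj_mul (l l' : I) :
    weightProj k w l * weightProj k w l' = if l = l' then weightProj k w l else 0 := by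
  refine end_ext_bvec fun b => ?_
  rw [Module.End.mul_apply, weightProj_bvec]
  by_cases h : w b = l'
  · subst h
    rw [if_pos rfl]
    by_cases h' : l = w b
    · rw [if_pos h']
    · rw [if_neg h', weightProj_bvec, if_neg (Ne.symm h'), LinearMap.zero_apply]
  · rw [if_neg h, map_zero]
    split_ifs with h'
    · subst h'
      rw [weightProj_bvec, if_neg h]
    · rfl

theorem twist_weightProj (p : Bool) (l : I) :
    twist k (parityOp k F L) p (weightProj k w l) = weightProj k w l := by
  cases p with
  | false => rfl
  | true =>
    refine end_ext_bvec fun b => ?_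
    rw [twist_true, Module.End.mul_apply, Module.End.mul_apply, parityOp_bvec]
    by_cases he : evenMon b
    · rw [if_pos he, weightProj_bvec]
      split_ifs
      · rw [parityOp_bvec, if_pos he]
      · rw [map_zero]
    · rw [if_neg he, map_neg, weightProj_bvec]
      split_ifs
      · rw [map_neg, parityOp_bvec, if_neg he, neg_neg]
      · rw [neg_zero, map_zero]

theorem weightProj_comm {J : Type*} [DecidableEq J] (w' : MonB F L → J) (l : I) (l' : J) :
    weightProj k w l * weightProj k w' l' = weightProj k w' l' * weightProj k w l := by
  refine LinearMap.ext fun u => Finsupp.ext fun b => ?_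
  simp only [Module.End.mul_apply, weightProj_apply]
  split_ifs <;> rfl

theorem finite_range_weightProj {l : I} (h : {b | w b = l}.Finite) :
    Module.Finite k (LinearMap.range (weightProj k w l)) := by
  have hle : LinearMap.range (weightProj k w l) ≤
      Submodule.span k (bvec k F L '' {b | w b = l}) := by
    rintro _ ⟨u, rfl⟩
    induction u using Finsupp.induction_linear with
    | zero => rw [map_zero]; exact Submodule.zero_mem _
    | add f g hf hg => rw [map_add]; exact Submodule.add_mem _ hf hg
    | single a c =>
      have h1 : (Finsupp.single a c : SM k F L) = c • bvec k F L a := by simp [bvec]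
      rw [h1, map_smul, weightProj_bvec]
      split_ifs with h
      · exact Submodule.smul_mem _ _ (Submodule.subset_span ⟨a, h, rfl⟩)
      · rw [smul_zero]; exact Submodule.zero_mem _
  have : FiniteDimensional k (Submodule.span k (bvec k F L '' {b | w b = l})) :=
    FiniteDimensional.span_of_finite k (h.image _)
  exact Submodule.finiteDimensional_of_le hle

theorem sum_weightProj_mul {T : Finset I} {f : Module.End k (SM k F L)}
    (h : ∀ u b, f u b ≠ 0 → w b ∈ T) : ∑ l ∈ T, weightProj k w l * f = f := by
  refine LinearMap.ext fun u => Finsupp.ext fun b => ?_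
  rw [LinearMap.sum_apply, Finsupp.finsetSum_apply]
  simp only [Module.End.mul_apply, weightProj_apply, Finset.sum_ite_eq]
  by_cases hb : f u b = 0
  · rw [hb, ite_self]
  · rw [if_pos (h u b hb)]

theorem sum_mul_weightProj {T : Finset I} {f : Module.End k (SM k F L)}
    (h : ∀ b, f (bvec k F L b) ≠ 0 → w b ∈ T) : ∑ l ∈ T, f * weightProj k w l = f := by
  refine end_ext_bvec fun b => ?_
  rw [LinearMap.sum_apply]
  simp only [Module.End.mul_apply, weightProj_bvec, apply_ite f, map_zero, Finset.sum_ite_eq]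
  by_cases hb : f (bvec k F L b) = 0
  · rw [hb, ite_self]
  · rw [if_pos (h b hb)]

theorem eq_of_mul_weightProj {f g : Module.End k (SM k F L)}
    (h : ∀ l, f * weightProj k w l = g * weightProj k w l) : f = g := by
  refine end_ext_bvec fun b => ?_
  have := LinearMap.congr_fun (h (w b)) (bvec k F L b)
  rwa [Module.End.mul_apply, Module.End.mul_apply, weightProj_bvec, if_pos rfl] at this

theorem exists_finite_support {f : Module.End k (SM k F L)}
    (hf : Module.Finite k (LinearMap.range f)) :
    ∃ T : Finset (MonB F L), ∀ u b, f u b ≠ 0 → b ∈ T := by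
  classical
  obtain ⟨G, hG⟩ := Module.Finite.iff_fg.1 hf
  refine ⟨G.biUnion Finsupp.support, fun u b hb => ?_⟩
  have hle : LinearMap.range f ≤ Finsupp.supported k k (G.biUnion Finsupp.support : Set (MonB F L)) := by
    rw [← hG, Submodule.span_le]
    intro v hv
    rw [SetLike.mem_coe, Finsupp.mem_supported]
    intro b hb
    exact Finset.mem_coe.2 (Finset.mem_biUnion.2 ⟨v, hv, hb⟩)
  exact Finset.mem_coe.1 ((Finsupp.mem_supported _ _).1 (hle ⟨u, rfl⟩) (Finsupp.mem_support_iff.2 hb))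

/-- A finite rank operator preserving finite dimensional weight spaces is supported on finitely
many of them. -/
theorem exists_finite_source {f : Module.End k (SM k F L)}
    (hf : Module.Finite k (LinearMap.range f)) (hw : ∀ l, {b | w b = l}.Finite)
    (hc : ∀ l, weightProj k w l * f = f * weightProj k w l) :
    ∃ T : Finset (MonB F L), ∀ b, f (bvec k F L b) ≠ 0 → b ∈ T := by
  classical
  obtain ⟨T, hT⟩ := exists_finite_support hf
  refine ⟨T.biUnion fun b => (hw (w b)).toFinset, fun b hb => ?_⟩
  obtain ⟨b', hb'⟩ := Finsupp.ne_iff.1 hb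
  have h := DFunLike.congr_fun (LinearMap.congr_fun (hc (w b)) (bvec k F L b)) b'
  rw [Module.End.mul_apply, Module.End.mul_apply, weightProj_apply, weightProj_bvec, if_pos rfl] at h
  have hww : w b' = w b := by
    by_contra hne
    rw [if_neg hne] at h
    exact hb' h.symm
  exact Finset.mem_biUnion.2 ⟨b', hT _ _ hb', by simp [hww]⟩

section Shifts

variable [AddCommGroup I]

/-- The operator `x` maps monomials to multiples of monomials, changing the weight by `δ`. -/
def Shifts (w : MonB F L → I) (x : Module.End k (SM k F L)) (δ : I) : Prop :=
  ∀ b, ∃ (c : k) (b' : MonB F L), x (bvec k F L b) = c • bvec k F L b' ∧ (c ≠ 0 → w b' = w b + δ)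

variable {w}

theorem Shifts.mul_weightProj {x : Module.End k (SM k F L)} {δ : I} (h : Shifts w x δ) (l : I) :
    x * weightProj k w l = weightProj k w (l + δ) * x := by
  refine end_ext_bvec fun b => ?_
  obtain ⟨c, b', hx, hw⟩ := h b
  rw [Module.End.mul_apply, Module.End.mul_apply, weightProj_bvec, hx, map_smul, weightProj_bvec]
  by_cases hc : c = 0
  · rw [hc, zero_smul]
    split_ifs
    · rw [hx, hc, zero_smul]
    · rw [map_zero]
  · rw [hw hc]
    by_cases hl : w b = l
    · rw [if_pos hl, if_pos (by rw [hl]), hx]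
    · rw [if_neg hl, if_neg (fun h => hl (add_right_cancel h)), map_zero, smul_zero]

omit [DecidableEq I] in
theorem Shifts.comp {J : Type*} [AddCommGroup J] {x : Module.End k (SM k F L)} {δ : I}
    (h : Shifts w x δ) (T : I →+ J) (j : J) : Shifts (fun b => T (w b) + j) x (T δ) := fun b => by
  obtain ⟨c, b', hx, hw⟩ := h b
  refine ⟨c, b', hx, fun hc => ?_⟩
  change T (w b') + j = T (w b) + j + T δ
  rw [hw hc, map_add]
  abel

end Shifts

/-- The exponents of a monomial, the odd ones being weighted by `ε`. -/
def expo (ε : ℤ) (b : MonB F L) (p : Fin F × Fin L) : ℤ := (b.1 p : ℤ) + if b.2 p then ε else 0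

/-- The weight of a variable of given parity. -/
def varWt (ε : ℤ) (p : Bool) : ℤ := if p then ε else 1

theorem shifts_zv (ε : ℤ) (p : Bool) (i : Fin F) (j : Fin L) :
    Shifts (expo ε) (zv k p i j) (Pi.single (i, j) (varWt ε p)) := by
  intro b
  cases p with
  | false =>
    refine ⟨1, _, (zE_bvec i j b).trans (one_smul _ _).symm, fun _ => ?_⟩
    funext q
    by_cases hq : q = (i, j)
    · subst hq; simp [expo, varWt]; ring
    · simp [expo, hq]
  | true =>
    by_cases hb : b.2 (i, j) = true
    · exact ⟨0, b, by simp [zO_bvec, hb], fun h => absurd rfl h⟩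
    · refine ⟨_, _, (zO_bvec i j b).trans (if_neg hb), fun _ => ?_⟩
      funext q
      by_cases hq : q = (i, j)
      · subst hq; simp [expo, varWt, hb]
      · simp [expo, hq]

theorem shifts_dv (ε : ℤ) (p : Bool) (i : Fin F) (j : Fin L) :
    Shifts (expo ε) (dv k p i j) (-Pi.single (i, j) (varWt ε p)) := by
  intro b
  cases p with
  | false =>
    refine ⟨_, _, dE_bvec i j b, fun h => ?_⟩
    have hb : b.1 (i, j) ≠ 0 := fun h0 => h (by rw [h0, Nat.cast_zero])
    funext q
    by_cases hq : q = (i, j)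
    · subst hq
      simp only [expo, varWt, Function.update_self, Pi.add_apply, Pi.neg_apply, Pi.single_eq_same]
      rw [Nat.cast_sub (by omega)]
      push_cast
      ring
    · simp [expo, hq]
  | true =>
    by_cases hb : b.2 (i, j) = true
    · refine ⟨_, _, (dO_bvec i j b).trans (if_pos hb), fun _ => ?_⟩
      funext q
      by_cases hq : q = (i, j)
      · subst hq; simp [expo, varWt, hb]
      · simp [expo, hq]
    · exact ⟨0, b, by simp [dO_bvec, hb], fun h => absurd rfl h⟩

/-- Row sums. -/
def rowSum (F L : ℕ) : (Fin F × Fin L → ℤ) →+ (Fin F → ℤ) where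
  toFun g i := ∑ l, g (i, l)
  map_zero' := by funext i; simp
  map_add' g h := by funext i; simp [Finset.sum_add_distrib]

/-- Column sums. -/
def colSum (F L : ℕ) : (Fin F × Fin L → ℤ) →+ (Fin L → ℤ) where
  toFun g l := ∑ i, g (i, l)
  map_zero' := by funext i; simp
  map_add' g h := by funext i; simp [Finset.sum_add_distrib]

theorem rowSum_apply (g : Fin F × Fin L → ℤ) (i : Fin F) : rowSum F L g i = ∑ l, g (i, l) := rfl
theorem colSum_apply (g : Fin F × Fin L → ℤ) (l : Fin L) : colSum F L g l = ∑ i, g (i, l) := rfl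

theorem rowSum_single (i : Fin F) (j : Fin L) (x : ℤ) :
    rowSum F L (Pi.single (i, j) x) = Pi.single i x := by
  funext i'
  rw [rowSum_apply]
  by_cases h : i' = i
  · subst h
    rw [Finset.sum_eq_single j (fun l _ hl => by simp [hl]) (by simp)]
    simp
  · rw [Pi.single_eq_of_ne h]
    exact Finset.sum_eq_zero fun l _ => by simp [h]

theorem colSum_single (i : Fin F) (j : Fin L) (x : ℤ) :
    colSum F L (Pi.single (i, j) x) = Pi.single j x := by
  funext j'
  rw [colSum_apply]
  by_cases h : j' = j
  · subst h
    rw [Finset.sum_eq_single i (fun l _ hl => by simp [hl]) (by simp)]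
    simp
  · rw [Pi.single_eq_of_ne h]
    exact Finset.sum_eq_zero fun l _ => by simp [h]

theorem prof_eq (b : MonB F L) : prof b = rowSum F L (expo 1 b) := by
  funext i
  rw [prof, rowSum_apply, Finset.card_filter]
  simp only [expo, Finset.sum_add_distrib]
  push_cast
  rfl

theorem pwt_eq (b : MonB F L) : pwt b = colSum F L (expo (-1) b) := by
  funext l
  rw [pwt, colSum_apply, Finset.card_filter, sub_eq_add_neg]
  simp only [expo, Finset.sum_add_distrib]
  push_cast
  rw [← Finset.sum_neg_distrib]
  congr 1
  exact Finset.sum_congr rfl fun i _ => by split_ifs <;> rfl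

theorem finite_of_bounded {S : Set (MonB F L)} {N : ℕ} (h : ∀ b ∈ S, ∀ p, b.1 p ≤ N) : S.Finite :=
  ((Set.finite_Iic fun _ => N).prod Set.finite_univ).subset fun b hb => ⟨fun p => h b hb p, trivial⟩

theorem finite_prof (l : Fin F → ℤ) : {b : MonB F L | prof b = l}.Finite := by
  refine finite_of_bounded (N := ∑ i, (l i).toNat) fun b hb p => ?_
  have h1 : (b.1 p : ℤ) ≤ l p.1 := by
    rw [← hb, prof]
    have := Finset.single_le_sum (f := fun l => (b.1 (p.1, l) : ℤ)) (fun _ _ => by positivity)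
      (Finset.mem_univ p.2)
    have h0 : (0 : ℤ) ≤ ((Finset.univ.filter fun l : Fin L => b.2 (p.1, l) = true).card : ℤ) := by
      positivity
    linarith
  have h2 := Finset.single_le_sum (f := fun i => (l i).toNat) (fun _ _ => Nat.zero_le _)
    (Finset.mem_univ p.1)
  omega

theorem finite_pwt (l : Fin L → ℤ) : {b : MonB F L | pwt b = l}.Finite := by
  refine finite_of_bounded (N := ∑ j, (l j).toNat + F) fun b hb p => ?_
  have h1 : (b.1 p : ℤ) ≤ l p.2 + F := by
    rw [← hb, pwt]
    have := Finset.single_le_sum (f := fun i => (b.1 (i, p.2) : ℤ)) (fun _ _ => by positivity)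
      (Finset.mem_univ p.1)
    have h0 : (Finset.univ.filter fun i : Fin F => b.2 (i, p.2) = true).card ≤ F :=
      (Finset.card_filter_le _ _).trans (by simp)
    have h0' : ((Finset.univ.filter fun i : Fin F => b.2 (i, p.2) = true).card : ℤ) ≤ F := by
      exact_mod_cast h0
    linarith
  have h2 := Finset.single_le_sum (f := fun i => (l i).toNat) (fun _ _ => Nat.zero_le _)
    (Finset.mem_univ p.2)
  omega

/-- Parity of the creation operators. -/
theorem hasParity_of_evenMon {p : Bool} {x : Module.End k (SM k F L)}
    (h : ∀ b, ∃ (c : k) (b' : MonB F L), x (bvec k F L b) = c • bvec k F L b' ∧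
      (c ≠ 0 → (evenMon b' ↔ (evenMon b ↔ p = false)))) : HasParity k (parityOp k F L) p x := by
  refine end_ext_bvec fun b => ?_
  obtain ⟨c, b', hx, he⟩ := h b
  rw [twist_true, Module.End.mul_apply, Module.End.mul_apply, parityOp_bvec]
  by_cases hc : c = 0
  · rw [hc, zero_smul] at hx
    cases p <;> split_ifs <;> simp [hx]
  · have he := he hc
    cases p <;> by_cases h1 : evenMon b <;> simp [hx, h1, parityOp_bvec] at he ⊢ <;> simp [he]

theorem evenMon_update {e : Fin F × Fin L → ℕ} {o : Fin F × Fin L → Bool} {p : Fin F × Fin L}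
    {v : Bool} (hv : o p = !v) {e' : Fin F × Fin L → ℕ} :
    evenMon ((e', Function.update o p v) : MonB F L) ↔ ¬ evenMon ((e, o) : MonB F L) := by
  have key : ∀ o : Fin F × Fin L → Bool, o p = false →
      (Finset.univ.filter fun q => Function.update o p true q = true) =
        insert p (Finset.univ.filter fun q => o q = true) := by
    intro o _
    ext q
    by_cases hq : q = p <;> simp [hq]
  cases v with
  | true =>
    have hv' : o p = false := hv
    simp only [evenMon]
    rw [key o hv', Finset.card_insert_of_notMem (by simp [hv'])]
    omega
  | false =>
    have hv' : o p = true := hv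
    have h1 := key (Function.update o p false) (by simp)
    rw [Function.update_idem, Function.update_eq_self_iff.2 hv'.symm] at h1
    simp only [evenMon]
    rw [h1, Finset.card_insert_of_notMem (by simp)]
    omega

theorem hasParity_zv (p : Bool) (i : Fin F) (j : Fin L) :
    HasParity k (parityOp k F L) p (zv k p i j) := by
  refine hasParity_of_evenMon fun b => ?_
  cases p with
  | false => exact ⟨1, _, (zE_bvec i j b).trans (one_smul _ _).symm, fun _ => by simp [evenMon]⟩
  | true =>
    by_cases hb : b.2 (i, j) = true
    · exact ⟨0, b, by simp [zO_bvec, hb], fun h => absurd rfl h⟩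
    · refine ⟨_, _, (zO_bvec i j b).trans (if_neg hb), fun _ => ?_⟩
      rw [evenMon_update (e := b.1) (by simpa using hb)]
      simp

theorem hasParity_dv (p : Bool) (i : Fin F) (j : Fin L) :
    HasParity k (parityOp k F L) p (dv k p i j) := by
  refine hasParity_of_evenMon fun b => ?_
  cases p with
  | false => exact ⟨_, _, dE_bvec i j b, fun _ => by simp [evenMon]⟩
  | true =>
    by_cases hb : b.2 (i, j) = true
    · refine ⟨_, _, (dO_bvec i j b).trans (if_pos hb), fun _ => ?_⟩
      rw [evenMon_update (e := b.1) (by simpa using hb)]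
      simp
    · exact ⟨0, b, by simp [dO_bvec, hb], fun h => absurd rfl h⟩

end WeightProjections

section LocallyUnital

variable {k : Type} [Field k] {A : Type*} [Ring A] [Algebra k A]

/-- The span of the products of elements of `R` factoring through some `P l`. -/
def locSpan {I : Type*} (R : Subalgebra k A) (P : I → A) : Submodule k A :=
  Submodule.span k {x | ∃ l, ∃ a ∈ R, ∃ b ∈ R, x = a * P l * b}

section

variable {I : Type*} {R : Subalgebra k A} {P : I → A}

theorem mem_locSpan {a b : A} (ha : a ∈ R) (l : I) (hb : b ∈ R) : a * P l * b ∈ locSpan R P :=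
  Submodule.subset_span ⟨l, a, ha, b, hb, rfl⟩

theorem mul_mem_locSpan_left {a : A} (ha : a ∈ R) (l : I) : a * P l ∈ locSpan R P := by
  simpa using mem_locSpan (P := P) ha l R.one_mem

theorem idem_mem_locSpan (l : I) : P l ∈ locSpan R P := by
  simpa using mul_mem_locSpan_left (P := P) R.one_mem l

theorem locSpan_le (hP : ∀ l, P l ∈ R) : locSpan R P ≤ R.toSubmodule := by
  refine Submodule.span_le.2 ?_
  rintro _ ⟨l, a, ha, b, hb, rfl⟩
  exact R.mul_mem (R.mul_mem ha (hP l)) hb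

theorem mul_mem_locSpan {x y : A} (hx : x ∈ R) (hy : y ∈ locSpan R P) : x * y ∈ locSpan R P := by
  refine Submodule.span_induction ?_ (by simp) (fun y z _ _ hy hz => ?_) (fun c y _ hy => ?_) hy
  · rintro _ ⟨l, a, ha, b, hb, rfl⟩
    rw [← mul_assoc, ← mul_assoc]
    exact mem_locSpan (R.mul_mem hx ha) l hb
  · rw [mul_add]; exact Submodule.add_mem _ hy hz
  · rw [mul_smul_comm]; exact Submodule.smul_mem _ c hy

theorem twist_mem_locSpan {s : A} (hs : s * s = 1) (hR : ∀ x ∈ R, twist k s true x ∈ R)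
    (hP : ∀ l, twist k s true (P l) = P l) {x : A} (hx : x ∈ locSpan R P) :
    twist k s true x ∈ locSpan R P := by
  refine Submodule.span_induction ?_ ?_ (fun y z _ _ hy hz => ?_) (fun c y _ hy => ?_) hx
  · rintro _ ⟨l, a, ha, b, hb, rfl⟩
    rw [twist_mul hs, twist_mul hs, hP]
    exact mem_locSpan (hR a ha) l (hR b hb)
  · rw [map_zero]; exact Submodule.zero_mem _
  · rw [map_add]; exact Submodule.add_mem _ hy hz
  · rw [map_smul]; exact Submodule.smul_mem _ c hy

theorem map_locSpan {B : Type*} [Ring B] [Algebra k B] (Ψ : B →ₐ[k] A) (P : I → B) :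
    (Submodule.span k {x | ∃ l a b, x = a * P l * b}).map Ψ.toLinearMap =
      locSpan Ψ.range fun l => Ψ (P l) := by
  rw [Submodule.map_span, locSpan]
  congr 1
  ext x
  constructor
  · rintro ⟨_, ⟨l, a, b, rfl⟩, rfl⟩
    exact ⟨l, _, ⟨a, rfl⟩, _, ⟨b, rfl⟩, by simp⟩
  · rintro ⟨l, _, ⟨a, rfl⟩, _, ⟨b, rfl⟩, rfl⟩
    exact ⟨_, ⟨l, a, b, rfl⟩, by simp⟩

theorem locSpan_comp {J : Type*} (e : J ≃ I) : locSpan R (fun l => P (e l)) = locSpan R P := by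
  rw [locSpan, locSpan]
  congr 1
  ext x
  constructor
  · rintro ⟨l, h⟩
    exact ⟨e l, h⟩
  · rintro ⟨l, h⟩
    exact ⟨e.symm l, by simpa using h⟩

end

/-- Operators of finite rank are stable under composition with arbitrary operators. -/
theorem finite_range_locSpan {M I : Type*} [AddCommGroup M] [Module k M]
    {R : Subalgebra k (Module.End k M)} {P : I → Module.End k M}
    (hP : ∀ l, Module.Finite k (LinearMap.range (P l))) {f : Module.End k M}
    (hf : f ∈ locSpan R P) : Module.Finite k (LinearMap.range f) := by
  refine Submodule.span_induction ?_ ?_ (fun y z _ _ hy hz => ?_) (fun c y _ hy => ?_) hf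
  · rintro _ ⟨l, a, -, b, -, rfl⟩
    have := hP l
    have hle : LinearMap.range (a * P l * b) ≤ (LinearMap.range (P l)).map a := by
      rintro _ ⟨u, rfl⟩
      exact ⟨_, ⟨b u, rfl⟩, rfl⟩
    exact Submodule.finiteDimensional_of_le hle
  · rw [LinearMap.range_zero]; infer_instance
  · have := hy
    have := hz
    have hle : LinearMap.range (y + z) ≤ LinearMap.range y ⊔ LinearMap.range z := by
      rintro _ ⟨u, rfl⟩
      exact Submodule.add_mem_sup ⟨u, rfl⟩ ⟨u, rfl⟩
    exact Submodule.finiteDimensional_of_le hle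
  · have := hy
    have hle : LinearMap.range (c • y) ≤ LinearMap.range y := by
      rintro _ ⟨u, rfl⟩
      exact ⟨c • u, map_smul _ _ _⟩
    exact Submodule.finiteDimensional_of_le hle

end LocallyUnital

section Chevalley

variable {k : Type} [Field k] {A : Type*} [Ring A] [Algebra k A] {n : ℕ}

theorem GenOps.range_hom (G : GenOps A n) : (G.hom k).range = Algebra.adjoin k (Set.range G.gen) := by
  rw [← Algebra.map_top, ← FreeAlgebra.adjoin_range_ι, AlgHom.map_adjoin, ← Set.range_comp]
  congr 2
  funext x
  exact G.hom_ι x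

theorem range_of_comp_mkAlgHom {X : Type*} {r : FreeAlgebra k X → FreeAlgebra k X → Prop}
    (Ψ : RingQuot r →ₐ[k] A) (φ : FreeAlgebra k X →ₐ[k] A)
    (h : ∀ x, Ψ (RingQuot.mkAlgHom k r x) = φ x) : Ψ.range = φ.range := by
  ext y
  constructor
  · rintro ⟨x, rfl⟩
    obtain ⟨x, rfl⟩ := RingQuot.mkAlgHom_surjective k r x
    exact ⟨x, (h x).symm⟩
  · rintro ⟨x, rfl⟩
    exact ⟨_, h x⟩

namespace Fock

variable {C : Type*} [DecidableEq C] [Fintype C] {pc : C → Bool}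
  {X : Fock A pc (Fin n)} {Q : (Fin n → ℤ) → A} {r : k}

variable (k X Q) in
/-- The subalgebra generated by the Chevalley generators and the weight idempotents. -/
noncomputable def chev : Subalgebra k A := Algebra.adjoin k (Set.range (opsU k X Q).gen)

theorem gen_mem_chev (x : DGen n) : (opsU k X Q).gen x ∈ chev k X Q :=
  Algebra.subset_adjoin ⟨x, rfl⟩

theorem adjoin_opsT : Algebra.adjoin k (Set.range (opsT k X Q).gen) = chev k X Q := by
  refine le_antisymm (Algebra.adjoin_le ?_) (Algebra.adjoin_le ?_)
  · rintro _ ⟨x, rfl⟩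
    cases x with
    | idem l => exact gen_mem_chev (.idem (-l))
    | ge i l =>
      change -_ * _ ∈ _
      rw [neg_mul]
      exact neg_mem (gen_mem_chev (.gf i (-l)))
    | gf i l =>
      change -_ * _ ∈ _
      rw [neg_mul]
      exact neg_mem (gen_mem_chev (.ge i (-l)))
    | gb11 l => exact gen_mem_chev (.gb11 (-l))
    | gb i l => exact gen_mem_chev (.gb i (-l))
    | gc i l => exact gen_mem_chev (.gc i (-l))
  · have hT : ∀ x, (opsT k X Q).gen x ∈ Algebra.adjoin k (Set.range (opsT k X Q).gen) :=
      fun x => Algebra.subset_adjoin ⟨x, rfl⟩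
    rintro _ ⟨x, rfl⟩
    cases x with
    | idem l => simpa [GenOps.gen, opsT, opsU] using hT (.idem (-l))
    | ge i l => simpa [GenOps.gen, opsT, opsU] using hT (.gf i (-l))
    | gf i l => simpa [GenOps.gen, opsT, opsU] using hT (.ge i (-l))
    | gb11 l => simpa [GenOps.gen, opsT, opsU] using hT (.gb11 (-l))
    | gb i l => simpa [GenOps.gen, opsT, opsU] using hT (.gb i (-l))
    | gc i l => simpa [GenOps.gen, opsT, opsU] using hT (.gc i (-l))

theorem IsTorus.range_actU (hX : X.IsTorus Q r) (h2 : (2 : k) ≠ 0) :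
    (hX.actU h2).range = chev k X Q :=
  (range_of_comp_mkAlgHom _ _ fun x => hX.actU_mk h2 x).trans (GenOps.range_hom _)

theorem IsTorus.range_actT (hX : X.IsTorus Q r) (h2 : (2 : k) ≠ 0) :
    (hX.actT h2).range = chev k X Q :=
  (range_of_comp_mkAlgHom _ _ fun x => hX.actT_mk h2 x).trans
    ((GenOps.range_hom _).trans adjoin_opsT)

theorem IsTorus.map_locU (hX : X.IsTorus Q r) (h2 : (2 : k) ≠ 0) :
    (locU k n).map (hX.actU h2).toLinearMap = locSpan (chev k X Q) Q := by
  have h : ∀ l, hX.actU h2 (mkDu k n (iId k n l)) = Q l := fun l => by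
    rw [hX.actU_mk, GenOps.hom_iId]; rfl
  rw [locU, map_locSpan (hX.actU h2) (fun l => mkDu k n (iId k n l)), hX.range_actU]
  simp only [h]

theorem IsTorus.map_locT (hX : X.IsTorus Q r) (h2 : (2 : k) ≠ 0) :
    (locT k n).map (hX.actT h2).toLinearMap = locSpan (chev k X Q) Q := by
  have h : ∀ l, hX.actT h2 (mkDt k n (iId k n l)) = Q (-l) := fun l => by
    rw [hX.actT_mk, GenOps.hom_iId]; rfl
  rw [locT, map_locSpan (hX.actT h2) (fun l => mkDt k n (iId k n l)), hX.range_actT]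
  simp only [h]
  exact locSpan_comp (Equiv.neg _)

theorem IsTorus.isGenerated_chev (hX : X.IsTorus Q r) (h2 : (2 : k) ≠ 0) :
    X.IsGenerated Q (locSpan (chev k X Q) Q) := by
  have key : ∀ {x : A} {l : Fin n → ℤ}, x * Q l ∈ chev k X Q →
      x * Q l ∈ locSpan (chev k X Q) Q := fun {x l} hx => by
    have := mul_mem_locSpan_left (P := Q) hx l
    rwa [mul_assoc, hX.QQ, if_pos rfl] at this
  refine ⟨fun x hx y hy => mul_mem_locSpan (locSpan_le (fun l => gen_mem_chev (.idem l)) hx) hy,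
    fun l => idem_mem_locSpan l, fun t h l => key ?_, fun t h l => key ?_, fun h l => key ?_,
    fun h l => key ?_⟩
  · have := gen_mem_chev (k := k) (X := X) (Q := Q) (.ge (t + 1) l)
    change nbr _ (_ + 1) * Q l ∈ chev k X Q at this
    rwa [nbr_succ _ h] at this
  · have := gen_mem_chev (k := k) (X := X) (Q := Q) (.gf (t + 1) l)
    change nbr (fun i j => X.ra j i) (t + 1) * Q l ∈ chev k X Q at this
    rwa [nbr_succ _ h] at this
  · have := gen_mem_chev (k := k) (X := X) (Q := Q) (.gb11 l)
    rw [GenOps.gen, opsU, dif_pos h] at this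
    have := (chev k X Q).smul_mem this 2
    rwa [smul_mul_assoc, smul_smul, mul_inv_cancel₀ h2, one_smul] at this
  · have := gen_mem_chev (k := k) (X := X) (Q := Q) (.gc 1 l)
    change nbr _ (_ + 1) * Q l ∈ chev k X Q at this
    rwa [nbr_succ _ h] at this

end Fock

end Chevalley

section Homogeneity

variable {k : Type} [Field k] {A : Type*} [Ring A] [Algebra k A] {n : ℕ}

namespace Fock

variable {C R : Type*} [DecidableEq C] [DecidableEq R] [Fintype C] {π : Bool}
  {X : Fock A (fun _ : C => π) R} {s : A}

theorem IsGraded.eop (hX : X.IsGraded k s) (β β' : Bool) (i j : R) :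
    HasParity k s (xor β β') (X.eop β β' i j) :=
  HasParity.sum fun c _ => by
    have := (hX.z β i c).mul hX.ss (hX.d β' j c)
    rwa [show xor (xor β π) (xor β' π) = xor β β' by cases β <;> cases β' <;> cases π <;> rfl] at this

theorem IsGraded.ra (hX : X.IsGraded k s) (i j : R) : HasParity k s false (X.ra i j) :=
  (hX.eop false false i j).sub (hX.eop true true j i)

theorem IsGraded.rb (hX : X.IsGraded k s) (i j : R) : HasParity k s true (X.rb i j) :=
  (hX.eop false true i j).add (hX.eop false true j i)

theorem IsGraded.rc (hX : X.IsGraded k s) (i j : R) : HasParity k s true (X.rc i j) :=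
  (hX.eop true false i j).sub (hX.eop true false j i)

end Fock

namespace Fock

variable {C : Type*} [DecidableEq C] [Fintype C] {pc : C → Bool} {X : Fock A pc (Fin n)}

/-- The operators occurring in the Chevalley generators. -/
inductive IsChev (X : Fock A pc (Fin n)) : A → Prop
  | one : IsChev X 1
  | zero : IsChev X 0
  | ra (i j : Fin n) : IsChev X (X.ra i j)
  | rb (c : k) (i j : Fin n) : IsChev X (c • X.rb i j)
  | rc (i j : Fin n) : IsChev X (X.rc i j)

theorem isChev_gen (Q : (Fin n → ℤ) → A) (x : DGen n) :
    ∃ y l, IsChev (k := k) X y ∧ (opsU k X Q).gen x = y * Q l := by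
  have hn : ∀ {f : Fin n → Fin n → A} (i : ℕ), (∀ i j, IsChev (k := k) X (f i j)) →
      IsChev (k := k) X (nbr f i) := fun {f} i hf => by
    rw [nbr]
    split_ifs
    · exact hf _ _
    · exact .zero
  cases x with
  | idem l => exact ⟨1, l, .one, (one_mul _).symm⟩
  | ge i l => exact ⟨_, l, hn i fun i j => .ra i j, rfl⟩
  | gf i l => exact ⟨_, l, hn i fun i j => .ra j i, rfl⟩
  | gb11 l =>
    refine ⟨_, l, ?_, rfl⟩
    dsimp only [opsU]
    split_ifs
    · exact .rb _ _ _
    · exact .zero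
  | gb i l => exact ⟨_, l, hn i fun i j => one_smul k (X.rb i j) ▸ .rb 1 i j, rfl⟩
  | gc i l => exact ⟨_, l, hn i fun i j => .rc i j, rfl⟩

end Fock

end Homogeneity

section Centralizer

variable {k : Type} [Field k] [CharZero k] {F L : ℕ} {c r : ℕ} {π : Bool}

namespace Fock

theorem IsWeighted.ck_mul {M C R : Type*} [AddCommGroup M] [Module k M] [DecidableEq C]
    [DecidableEq R] [Fintype R] {X : Fock (Module.End k M) (fun _ : C => π) R}
    {s : Module.End k M} {P : (C → ℤ) → Module.End k M} {v0 : M} (h : X.IsWeighted s P v0)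
    (a b : C) (l : C → ℤ) :
    X.ck a b * P l = P (l - Pi.single b 1 - Pi.single a 1) * X.ck a b := by
  rw [ck, Finset.sum_mul, Finset.mul_sum]
  refine Finset.sum_congr rfl fun p _ => ?_
  rw [sgm_mul, mul_sgm, mul_assoc, h.dP, ← mul_assoc, h.dP, mul_assoc]

theorem IsWeighted.eop_comm {M C R : Type*} [AddCommGroup M] [Module k M] [DecidableEq C]
    [DecidableEq R] [Fintype R] [Fintype C] {X : Fock (Module.End k M) (fun _ : C => π) R}
    {s : Module.End k M} {P : (C → ℤ) → Module.End k M} {v0 : M} (h : X.IsWeighted s P v0)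
    (β β' : Bool) (i j : R) (l : C → ℤ) : Commute (X.eop β β' i j) (P l) := by
  rw [Commute, SemiconjBy, eop, Finset.sum_mul, Finset.mul_sum]
  refine Finset.sum_congr rfl fun p _ => ?_
  rw [mul_assoc, h.dP, ← mul_assoc, h.zP, sub_add_cancel, mul_assoc]

theorem commute_rows {A C R : Type*} [Ring A] [DecidableEq C] [DecidableEq R] [Fintype C]
    {pc : C → Bool} {X : Fock A pc R} {y : A} (h : ∀ β β' i j, Commute (X.eop β β' i j) y)
    (i j : R) : Commute (X.ra i j) y ∧ Commute (X.rb i j) y ∧ Commute (X.rc i j) y :=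
  ⟨(h _ _ _ _).sub_left (h _ _ _ _), (h _ _ _ _).add_left (h _ _ _ _),
    (h _ _ _ _).sub_left (h _ _ _ _)⟩

/-- Sufficient conditions for a space of operators to be closed under the column operators. -/
structure IsColumnClosed (X : Fock (Module.End k (SM k F L)) (fun _ : Fin c => π) (Fin r))
    (P : (Fin c → ℤ) → Module.End k (SM k F L)) (S : Submodule k (Module.End k (SM k F L))) :
    Prop where
  mul : ∀ x ∈ S, ∀ y ∈ S, x * y ∈ S
  twist : ∀ x ∈ S, twist k (parityOp k F L) true x ∈ S
  idem : ∀ l, P l ∈ S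
  cE : ∀ a b l, X.cE a b * P l ∈ S
  cq : ∀ a b l, X.cq a b * P l ∈ S
  ck : ∀ a b l, X.ck a b * P l ∈ S

/-- A space of operators containing the row operators on every weight space. -/
structure HasRows (X : Fock (Module.End k (SM k F L)) (fun _ : Fin c => π) (Fin r))
    (Q : (Fin r → ℤ) → Module.End k (SM k F L)) (S : Submodule k (Module.End k (SM k F L))) :
    Prop where
  idem : ∀ l, Q l ∈ S
  ra : ∀ i j l, X.ra i j * Q l ∈ S
  rb : ∀ i j l, X.rb i j * Q l ∈ S
  rc : ∀ i j l, X.rc i j * Q l ∈ S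

variable {X : Fock (Module.End k (SM k F L)) (fun _ : Fin c => π) (Fin r)}
  {w1 : MonB F L → Fin r → ℤ} {w2 : MonB F L → Fin c → ℤ}
  {S T : Submodule k (Module.End k (SM k F L))} {v0 : SM k F L}

theorem commute_of_sbrk {w : MonB F L → Fin r → ℤ} {f : Module.End k (SM k F L)} {l : Fin r → ℤ}
    (h : sbrk k F L (weightProj k w l) f = 0) :
    weightProj k w l * f = f * weightProj k w l :=
  mul_eq_of_sbrk (p := false) (twist_weightProj w true l) h

theorem mul_eq_of_sbrk_mul_weightProj {x f : Module.End k (SM k F L)} {p : Bool}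
    (hx : HasParity k (parityOp k F L) p x)
    (hQ : ∀ l, sbrk k F L (weightProj k w1 l) f = 0)
    (h : ∀ l, sbrk k F L (x * weightProj k w1 l) f = 0) :
    x * f = twist k (parityOp k F L) p f * x := by
  refine eq_of_mul_weightProj w1 fun l => ?_
  have hp := hx.mul parityOp_mul_self
    (show HasParity k (parityOp k F L) false (weightProj k w1 l) from twist_weightProj w1 true l)
  rw [Bool.xor_false] at hp
  have := mul_eq_of_sbrk hp (h l)
  rwa [mul_assoc, commute_of_sbrk (hQ l), ← mul_assoc, ← mul_assoc] at this

theorem IsWeighted.centralizer_eq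
    (hX : X.IsWeighted (parityOp k F L) (weightProj k w2) v0) (hw : ∀ l, {b | w1 b = l}.Finite)
    (hS : X.IsColumnClosed (weightProj k w2) S) (hT : X.HasRows (weightProj k w1) T)
    (hfin : ∀ f ∈ S, f ∈ EndFin k F L) (hST : ∀ g ∈ T, ∀ f ∈ S, sbrk k F L g f = 0) :
    (S : Set (Module.End k (SM k F L))) =
      {f | f ∈ EndFin k F L ∧ ∀ g ∈ T, sbrk k F L g f = 0} := by
  have hsrc : ∀ f ∈ EndFin k F L, (∀ g ∈ T, sbrk k F L g f = 0) →
      ∃ Z : Finset (Fin c → ℤ), ∑ l ∈ Z, f * weightProj k w2 l = f := fun f hf hc => by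
    obtain ⟨Z, hZ⟩ := exists_finite_source w1 hf hw fun l => commute_of_sbrk (hc _ (hT.idem l))
    exact ⟨Z.image w2, sum_mul_weightProj w2 fun b hb => Finset.mem_image_of_mem _ (hZ b hb)⟩
  have htgt : ∀ f ∈ EndFin k F L,
      ∃ Z : Finset (Fin c → ℤ), ∑ l ∈ Z, weightProj k w2 l * f = f := fun f hf => by
    obtain ⟨Z, hZ⟩ := exists_finite_support hf
    exact ⟨Z.image w2, sum_weightProj_mul w2 fun u b hb => Finset.mem_image_of_mem _ (hZ u b hb)⟩
  have hcl : X.IsClosed (parityOp k F L) (weightProj k w2) S := by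
    have hl : ∀ x, (∀ l, x * weightProj k w2 l ∈ S) → ∀ f ∈ S, x * f ∈ S := fun x hx f hf => by
      obtain ⟨Z, hZ⟩ := htgt f (hfin f hf)
      rw [← hZ, Finset.mul_sum]
      refine S.sum_mem fun l _ => ?_
      rw [← mul_assoc]
      exact hS.mul _ (hx l) _ hf
    refine ⟨hS.idem, fun a b => hl _ (hS.cE a b), fun a b => hl _ (hS.cq a b),
      fun a b f hf => ?_⟩
    have hf' := hS.twist f hf
    obtain ⟨Z, hZ⟩ := hsrc _ (hfin _ hf') fun g hg => hST g hg _ hf'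
    rw [← hZ, Finset.sum_mul]
    refine S.sum_mem fun l _ => ?_
    have h := hX.ck_mul a b (l + Pi.single a 1 + Pi.single b 1)
    rw [add_sub_cancel_right, add_sub_cancel_right] at h
    rw [mul_assoc, ← h]
    exact hS.mul _ hf' _ (hS.ck a b _)
  refine Set.Subset.antisymm (fun f hf => ⟨hfin f hf, fun g hg => hST g hg f hf⟩) ?_
  rintro f ⟨hf, hc⟩
  have hQ := fun l => hc _ (hT.idem l)
  obtain ⟨Z, hZ⟩ := htgt f hf
  obtain ⟨Z', hZ'⟩ := hsrc f hf hc
  rw [SetLike.mem_coe, ← hZ]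
  refine S.sum_mem fun l _ => ?_
  rw [← hZ', Finset.mul_sum]
  refine S.sum_mem fun l' _ => ?_
  have key : ∀ {p : Bool} {x : Module.End k (SM k F L)}, HasParity k (parityOp k F L) p x →
      (∀ l, x * weightProj k w1 l ∈ T) → (∀ l, Commute x (weightProj k w2 l)) →
      x * (weightProj k w2 l * (f * weightProj k w2 l')) =
        twist k (parityOp k F L) p (weightProj k w2 l * (f * weightProj k w2 l')) * x :=
    fun {p x} hp hx hcm => by
      have h := mul_eq_of_sbrk_mul_weightProj hp hQ fun l => hc _ (hx l)
      rw [twist_mul parityOp_mul_self, twist_mul parityOp_mul_self, twist_weightProj,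
        twist_weightProj, ← mul_assoc, (hcm l).eq, mul_assoc, ← mul_assoc x, h, mul_assoc,
        (hcm l').eq]
      simp only [mul_assoc]
  have hrow := fun l => commute_rows (X := X) fun β β' i j => hX.eop_comm β β' i j l
  refine hX.mem_of_comm hcl (l := l) (l' := l') ?_ ?_
    (fun i j => key (hX.gr.ra i j) (hT.ra i j) fun l => (hrow l i j).1)
    (fun i j => key (hX.gr.rb i j) (hT.rb i j) fun l => (hrow l i j).2.1)
    (fun i j => key (hX.gr.rc i j) (hT.rc i j) fun l => (hrow l i j).2.2)
  · rw [← mul_assoc, weightProj_mul, if_pos rfl]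
  · rw [mul_assoc, mul_assoc, weightProj_mul, if_pos rfl]

end Fock

end Centralizer

section Duality

variable {k : Type} [Field k] {A : Type*} [Ring A] [Algebra k A]

namespace Fock

variable {C R : Type*} [DecidableEq C] [DecidableEq R]

/-- Exchange rows and columns, and the odd creation and annihilation operators. -/
def dual (X : Fock A (fun _ : C => false) R) : Fock A (fun _ : R => true) C where
  z β c r := bif β then X.z false r c else X.d true r c
  d β c r := bif β then X.d false r c else X.z true r c
  zz β γ c c' r r' := by
    cases β <;> cases γ
    · exact X.dd _ _ _ _ _ _
    · exact (X.dz _ _ _ _ _ _).trans (by simp)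
    · change _ = X.d _ _ _ * X.z _ _ _
      rw [X.dz]
      simp
    · exact X.zz _ _ _ _ _ _
  dd β γ c c' r r' := by
    cases β <;> cases γ
    · exact X.zz _ _ _ _ _ _
    · change _ = X.d _ _ _ * X.z _ _ _
      rw [X.dz]
      simp
    · exact (X.dz _ _ _ _ _ _).trans (by simp)
    · exact X.dd _ _ _ _ _ _
  dz β γ c c' r r' := by
    cases β <;> cases γ
    · change _ = -(X.d _ _ _ * X.z _ _ _) + _
      rw [X.dz]
      have : (true = true ∧ r' = r ∧ c' = c) ↔ (false = false ∧ c = c' ∧ r = r') := by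
        rw [eq_comm (a := r), eq_comm (a := c)]; tauto
      rw [if_congr this rfl rfl]
      simp
    · exact (X.zz _ _ _ _ _ _).trans (by simp)
    · exact (X.dd _ _ _ _ _ _).trans (by simp)
    · refine (X.dz _ _ _ _ _ _).trans ?_
      have : (false = false ∧ r = r' ∧ c = c') ↔ (true = true ∧ c = c' ∧ r = r') := by tauto
      rw [if_congr this rfl rfl]
      rfl

variable (X : Fock A (fun _ : C => false) R)

theorem d_mul_z_true (r r' : R) (c c' : C) : X.d true r c * X.z true r' c' =
    (if r = r' ∧ c = c' then 1 else 0) - X.z true r' c' * X.d true r c := by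
  rw [X.dz]
  simp [neg_add_eq_sub]

theorem dual_ra [Fintype R] (c c' : C) :
    X.dual.ra c c' = (if c = c' then (Fintype.card R : A) else 0) - X.cE c' c := by
  simp only [ra, eop, cE, dual, cond_true, cond_false, Fintype.sum_prod_type, Fintype.sum_bool,
    d_mul_z_true, Finset.sum_sub_distrib, true_and, Bool.xor_self, sgm_false_right]
  rw [Finset.sum_const, Finset.card_univ, nsmul_eq_mul, mul_ite, mul_one, mul_zero]
  abel

theorem dual_rb [Fintype R] (c c' : C) : X.dual.rb c c' = X.ck c c' := by
  have h : ∀ r, X.d false r c * X.d true r c' = X.d true r c' * X.d false r c := fun r => by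
    rw [X.dd]; simp
  simp only [rb, eop, ck, dual, cond_true, cond_false, Fintype.sum_prod_type, Fintype.sum_bool,
    sgm_false_right, Bool.not_true, Bool.not_false, h]

theorem dual_rc [Fintype R] (c c' : C) : X.dual.rc c c' = X.cq c c' := by
  have h : ∀ r, X.z true r c * X.z false r c' = X.z false r c' * X.z true r c := fun r => by
    rw [X.zz]; simp
  simp only [rc, eop, cq, dual, cond_true, cond_false, Fintype.sum_prod_type, Fintype.sum_bool,
    sgm_false_left, sgm_true_true, Bool.not_true, Bool.not_false, h, Finset.sum_neg_distrib]
  abel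

theorem dual_cE [Fintype C] (r r' : R) :
    X.dual.cE r r' = X.ra r r' + if r = r' then (Fintype.card C : A) else 0 := by
  simp only [ra, eop, cE, dual, cond_true, cond_false, Fintype.sum_prod_type, Fintype.sum_bool,
    d_mul_z_true, Finset.sum_sub_distrib, and_true, Bool.xor_self, sgm_false_right]
  rw [Finset.sum_const, Finset.card_univ, nsmul_eq_mul, mul_ite, mul_one, mul_zero]
  abel

theorem dual_cq [Fintype C] (r r' : R) : X.dual.cq r r' = X.rb r r' := by
  have h : ∀ c, X.d true r c * X.z false r' c = X.z false r' c * X.d true r c := fun c => by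
    rw [X.dz]; simp
  simp only [rb, eop, cq, dual, cond_true, cond_false, Fintype.sum_prod_type, Fintype.sum_bool,
    sgm_false_right, Bool.not_true, Bool.not_false, h]

theorem dual_ck [Fintype C] (r r' : R) : X.dual.ck r r' = X.rc r r' := by
  have h : ∀ c, X.d false r c * X.z true r' c = X.z true r' c * X.d false r c := fun c => by
    rw [X.dz]; simp
  simp only [rc, eop, ck, dual, cond_true, cond_false, Fintype.sum_prod_type, Fintype.sum_bool,
    sgm_false_left, sgm_true_true, Bool.not_true, Bool.not_false, h, Finset.sum_neg_distrib]
  abel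

variable {X} {s : A}

theorem IsGraded.dual (hX : X.IsGraded k s) : X.dual.IsGraded k s where
  ss := hX.ss
  z β c r := by
    cases β
    · exact hX.d true r c
    · exact hX.z false r c
  d β c r := by
    cases β
    · exact hX.z true r c
    · exact hX.d false r c

end Fock

namespace Fock

variable {c r : ℕ} {X : Fock A (fun _ : Fin c => false) (Fin r)} {s : A}

theorem IsGraded.homogComm (hX : X.IsGraded k s) {x y : A} (hx : IsChev (k := k) X x)
    (hy : IsChev (k := k) X.dual y) : HomogComm k s x y := by
  have h1 : HasParity k s false (1 : A) := by
    rw [HasParity, twist_one hX.ss, sgm_false_left]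
  have h0 : HasParity k s false (0 : A) := HasParity.zero
  have hc : ∀ (P : Prop) [Decidable P] (x : A), x * (if P then (r : A) else 0) =
      (if P then (r : A) else 0) * x := fun P _ x => by
    split_ifs
    · exact (Nat.cast_commute r x).eq.symm
    · rw [mul_zero, zero_mul]
  have ha := hX.ra
  have hb := hX.rb
  have hcc := hX.rc
  have ha' := hX.dual.ra
  have hb' := hX.dual.rb
  have hc' := hX.dual.rc
  cases hx with
  | one =>
    cases hy with
    | one => exact ⟨_, _, h1, h1, rfl⟩
    | zero => exact ⟨_, _, h1, h0, by simp⟩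
    | ra i j => exact ⟨_, _, h1, ha' i j, by simp⟩
    | rb a i j => exact ⟨_, _, h1, (hb' i j).smul a, by simp⟩
    | rc i j => exact ⟨_, _, h1, hc' i j, by simp⟩
  | zero =>
    cases hy with
    | one => exact ⟨_, _, h0, h1, by simp⟩
    | zero => exact ⟨_, _, h0, h0, by simp⟩
    | ra i j => exact ⟨_, _, h0, ha' i j, by simp⟩
    | rb a i j => exact ⟨_, _, h0, (hb' i j).smul a, by simp⟩
    | rc i j => exact ⟨_, _, h0, hc' i j, by simp⟩
  | ra i j =>
    cases hy with
    | one => exact ⟨_, _, ha i j, h1, by simp⟩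
    | zero => exact ⟨_, _, ha i j, h0, by simp⟩
    | ra i' j' =>
      refine ⟨_, _, ha i j, ha' i' j', ?_⟩
      rw [sgm_false_left, dual_ra, mul_sub, sub_mul, ra_cE, Fintype.card_fin, hc]
    | rb a i' j' =>
      refine ⟨_, _, ha i j, (hb' i' j').smul a, ?_⟩
      rw [sgm_false_left, dual_rb, mul_smul_comm, smul_mul_assoc, ra_ck]
    | rc i' j' =>
      refine ⟨_, _, ha i j, hc' i' j', ?_⟩
      rw [sgm_false_left, dual_rc, ra_cq]
  | rb b i j =>
    cases hy with
    | one => exact ⟨_, _, (hb i j).smul b, h1, by simp⟩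
    | zero => exact ⟨_, _, (hb i j).smul b, h0, by simp⟩
    | ra i' j' =>
      refine ⟨_, _, (hb i j).smul b, ha' i' j', ?_⟩
      rw [sgm_false_right, dual_ra, mul_sub, sub_mul, smul_mul_assoc, smul_mul_assoc, rb_cE,
        Fintype.card_fin, hc, mul_smul_comm, mul_smul_comm]
      simp
    | rb a i' j' =>
      refine ⟨_, _, (hb i j).smul b, (hb' i' j').smul a, ?_⟩
      rw [dual_rb, smul_mul_smul_comm, smul_mul_smul_comm, rb_ck, mul_comm b]
      simp
    | rc i' j' =>
      refine ⟨_, _, (hb i j).smul b, hc' i' j', ?_⟩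
      rw [dual_rc, smul_mul_assoc, mul_smul_comm, rb_cq]
      simp
  | rc i j =>
    cases hy with
    | one => exact ⟨_, _, hcc i j, h1, by simp⟩
    | zero => exact ⟨_, _, hcc i j, h0, by simp⟩
    | ra i' j' =>
      refine ⟨_, _, hcc i j, ha' i' j', ?_⟩
      rw [sgm_false_right, dual_ra, mul_sub, sub_mul, rc_cE, Fintype.card_fin, hc]
      simp
    | rb a i' j' =>
      refine ⟨_, _, hcc i j, (hb' i' j').smul a, ?_⟩
      rw [dual_rb, mul_smul_comm, smul_mul_assoc, rc_ck]
      simp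
    | rc i' j' =>
      refine ⟨_, _, hcc i j, hc' i' j', ?_⟩
      rw [dual_rc, rc_cq]
      simp

end Fock

end Duality

section ChevalleySupercommutation

variable {k : Type} [Field k] {A : Type*} [Ring A] [Algebra k A]

namespace Fock

/-- Compatibility of idempotents with the row weights of the creation and annihilation
operators. -/
structure IsRowGraded {C R : Type*} [DecidableEq C] [DecidableEq R] {pc : C → Bool}
    (X : Fock A pc R) (Q : (R → ℤ) → A) : Prop where
  z : ∀ β i c l, X.z β i c * Q l = Q (l + Pi.single i (varWt (-1) β)) * X.z β i c
  d : ∀ β i c l, X.d β i c * Q l = Q (l - Pi.single i (varWt (-1) β)) * X.d β i c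

section

variable {C R : Type*} [DecidableEq C] [DecidableEq R] [Fintype C] {pc : C → Bool}
  {X : Fock A pc R} {Q : (R → ℤ) → A}

theorem IsRowGraded.eop (h : X.IsRowGraded Q) (β β' : Bool) (i j : R) (l : R → ℤ) :
    X.eop β β' i j * Q l =
      Q (l - Pi.single j (varWt (-1) β') + Pi.single i (varWt (-1) β)) * X.eop β β' i j := by
  rw [Fock.eop, Finset.sum_mul, Finset.mul_sum]
  refine Finset.sum_congr rfl fun c _ => ?_
  rw [mul_assoc, h.d, ← mul_assoc, h.z, mul_assoc]

end

section

variable {C : Type*} [DecidableEq C] [Fintype C] {pc : C → Bool} {n : ℕ}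
  {X : Fock A pc (Fin n)} {Q : (Fin n → ℤ) → A}

theorem IsRowGraded.isTorus (h : X.IsRowGraded Q) {r : k}
    (hQ : ∀ l l', Q l * Q l' = if l = l' then Q l else 0)
    (hd : ∀ i l, X.ra i i * Q l = ((l i : k) + r) • Q l) : X.IsTorus Q r where
  QQ := hQ
  ra i j l := by
    rw [Fock.ra, sub_mul, mul_sub, h.eop, h.eop]
    simp only [varWt, Bool.false_eq_true, if_true, if_false, Pi.single_neg]
    congr 3 <;> abel
  rb i j l := by
    rw [Fock.rb, add_mul, mul_add, h.eop, h.eop]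
    simp only [varWt, Bool.false_eq_true, if_true, if_false, Pi.single_neg]
    congr 3 <;> abel
  rc i j l := by
    rw [Fock.rc, sub_mul, mul_sub, h.eop, h.eop]
    simp only [varWt, Bool.false_eq_true, if_true, if_false, Pi.single_neg]
    congr 3 <;> abel
  diag := hd

theorem IsChev.commute {x y : A} (h : ∀ β β' i j, Commute (X.eop β β' i j) y)
    (hx : IsChev (k := k) X x) : Commute x y := by
  have := commute_rows h
  cases hx with
  | one => exact Commute.one_left _
  | zero => exact Commute.zero_left _
  | ra i j => exact (this i j).1
  | rb a i j => exact (this i j).2.1.smul_left a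
  | rc i j => exact (this i j).2.2

end

variable {c r : ℕ} {X : Fock A (fun _ : Fin c => false) (Fin r)} {s : A}
  {Q : (Fin r → ℤ) → A} {Q' : (Fin c → ℤ) → A}

/-- Even idempotents for the rows and the columns which are compatible with the operators
of the dual pair. -/
structure IsDualPair (k : Type) [Field k] [Algebra k A]
    (X : Fock A (fun _ : Fin c => false) (Fin r)) (s : A)
    (Q : (Fin r → ℤ) → A) (Q' : (Fin c → ℤ) → A) : Prop where
  gr : X.IsGraded k s
  even : ∀ l, HasParity k s false (Q l)
  even' : ∀ l, HasParity k s false (Q' l)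
  comm : ∀ l l', Commute (Q l) (Q' l')
  eop : ∀ β β' (i j : Fin r) l, Commute (X.eop β β' i j) (Q' l)
  eop' : ∀ β β' (i j : Fin c) l, Commute (X.dual.eop β β' i j) (Q l)

namespace IsDualPair

theorem homogComm_gen (h : IsDualPair k X s Q Q') (u : DGen r) (v : DGen c) :
    HomogComm k s ((opsU k X Q).gen u) ((opsU k X.dual Q').gen v) := by
  obtain ⟨x, l, hx, hu⟩ := isChev_gen (k := k) (X := X) Q u
  obtain ⟨y, l', hy, hv⟩ := isChev_gen (k := k) (X := X.dual) Q' v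
  rw [hu, hv]
  obtain ⟨p, q, hp, hq, e⟩ := h.gr.homogComm hx hy
  have hxq := hx.commute fun β β' i j => h.eop β β' i j l'
  have hyq := hy.commute fun β β' i j => h.eop' β β' i j l
  have hp' := hp.mul h.gr.ss (h.even l)
  have hq' := hq.mul h.gr.ss (h.even' l')
  rw [Bool.xor_false] at hp' hq'
  refine ⟨p, q, hp', hq', ?_⟩
  rw [mul_assoc, ← mul_assoc (Q l), ← hyq.eq, mul_assoc, ← mul_assoc x, e, sgm_mul, (h.comm l l').eq,
    mul_assoc, ← mul_assoc x, hxq.eq]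
  simp only [mul_assoc]

theorem superComm (h : IsDualPair k X s Q Q') {g f : A} (hg : g ∈ chev k X Q)
    (hf : f ∈ chev k X.dual Q') : SuperComm k s g f ∧ SuperComm k s f g := by
  have h1 : ∀ x ∈ Set.range (opsU k X Q).gen, ∀ y ∈ Set.range (opsU k X.dual Q').gen,
      HomogComm k s x y := by
    rintro _ ⟨u, rfl⟩ _ ⟨v, rfl⟩
    exact h.homogComm_gen u v
  have h2 : ∀ x ∈ Set.range (opsU k X Q).gen, ∃ p, HasParity k s p x := by
    rintro _ ⟨u, rfl⟩
    obtain ⟨p, _, hp, _⟩ := h.homogComm_gen u (.idem 0)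
    exact ⟨p, hp⟩
  have h3 : ∀ x ∈ Set.range (opsU k X.dual Q').gen, ∃ p, HasParity k s p x := by
    rintro _ ⟨u, rfl⟩
    obtain ⟨_, p, _, hp, _⟩ := h.homogComm_gen (.idem 0) u
    exact ⟨p, hp⟩
  exact ⟨adjoin_superComm h.gr.ss h1 h2 h3 hg hf,
    adjoin_superComm h.gr.ss (fun y hy x hx => (h1 x hx y hy).symm) h3 h2 hf hg⟩

theorem twist_mem_chev (h : IsDualPair k X s Q Q') : ∀ g ∈ chev k X Q, twist k s true g ∈ chev k X Q :=
  fun _ => adjoin_twist h.gr.ss (by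
    rintro _ ⟨u, rfl⟩
    obtain ⟨p, _, hp, _⟩ := h.homogComm_gen u (.idem 0)
    exact ⟨p, hp⟩) true

theorem twist_mem_chev_dual (h : IsDualPair k X s Q Q') :
    ∀ g ∈ chev k X.dual Q', twist k s true g ∈ chev k X.dual Q' :=
  fun _ => adjoin_twist h.gr.ss (by
    rintro _ ⟨u, rfl⟩
    obtain ⟨_, p, _, hp, _⟩ := h.homogComm_gen (.idem 0) u
    exact ⟨p, hp⟩) true

end IsDualPair

end Fock

end ChevalleySupercommutation

section PolynomialDuality

variable {k : Type} [Field k] {F L : ℕ}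

theorem sm_submodule_eq_top_of_full (K : Submodule k (SM k F L))
    (h0 : bvec k F L (fun _ => 0, fun _ => true) ∈ K)
    (hz : ∀ i j, ∀ u ∈ K, zv k false i j u ∈ K) (hd : ∀ i j, ∀ u ∈ K, dv k true i j u ∈ K) :
    K = ⊤ := by
  have key : ∀ N : ℕ, ∀ b : MonB F L,
      (∑ p, b.1 p) + (∑ p, if b.2 p then 0 else 1) = N → bvec k F L b ∈ K := by
    intro N
    induction N with
    | zero =>
      intro b hb
      have h1 : b = (fun _ => 0, fun _ => true) := by
        simp only [Nat.add_eq_zero_iff, Finset.sum_eq_zero_iff, Finset.mem_univ,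
          true_implies] at hb
        refine Prod.ext (funext hb.1) (funext fun p => ?_)
        have := hb.2 p
        simpa using this
      rw [h1]; exact h0
    | succ N ih =>
      intro b hb
      by_cases h : ∃ p, b.1 p ≠ 0
      · obtain ⟨⟨i, j⟩, hp⟩ := h
        have h2 : bvec k F L b = zE k F L i j
            (bvec k F L (Function.update b.1 (i, j) (b.1 (i, j) - 1), b.2)) := by
          rw [zE_bvec]
          simp [Nat.sub_add_cancel (Nat.one_le_iff_ne_zero.2 hp)]
        rw [h2]
        refine hz i j _ (ih _ ?_)
        rw [Finset.sum_update_of_mem (Finset.mem_univ _)]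
        rw [← Finset.add_sum_erase Finset.univ b.1 (Finset.mem_univ (i, j))] at hb
        simp only [Finset.sdiff_singleton_eq_erase]
        omega
      · by_cases h' : ∃ p, b.2 p = false
        · obtain ⟨⟨i, j⟩, hp⟩ := h'
          have h2 : bvec k F L b = osgn k b.2 (i, j) • dO k F L i j
              (bvec k F L (b.1, Function.update b.2 (i, j) true)) := by
            have : Function.update b.2 (i, j) false = b.2 := by
              rw [← hp, Function.update_eq_self]
            simp [dO_bvec, osgn_update, smul_smul, osgn_mul_self, this]
          rw [h2]
          refine K.smul_mem _ (hd i j _ (ih _ ?_))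
          rw [← Finset.add_sum_erase Finset.univ (fun p => if b.2 p then 0 else 1)
            (Finset.mem_univ (i, j))] at hb
          have h3 : ∑ x ∈ Finset.univ.erase (i, j),
              (if Function.update b.2 (i, j) true x then 0 else 1) =
              ∑ x ∈ Finset.univ.erase (i, j), if b.2 x then 0 else 1 :=
            Finset.sum_congr rfl fun x hx => by
              rw [Function.update_of_ne (Finset.ne_of_mem_erase hx)]
          have h4 := Finset.add_sum_erase Finset.univ
            (fun p => if Function.update b.2 (i, j) true p = true then 0 else 1)
            (Finset.mem_univ (i, j))
          rw [h3] at h4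
          simp only [Function.update_self, hp, if_true, Bool.false_eq_true, if_false] at hb h4
          dsimp only
          omega
        · push Not at h h'
          simp [h, h'] at hb
  refine eq_top_iff.2 fun u _ => ?_
  induction u using Finsupp.induction_linear with
  | zero => exact K.zero_mem
  | add f g hf hg => exact K.add_mem (hf trivial) (hg trivial)
  | single b c =>
    have h1 : (Finsupp.single b c : SM k F L) = c • bvec k F L b := by simp [bvec]
    rw [h1]
    exact K.smul_mem _ (key _ b rfl)

section Shifts

variable (p : Bool) (i : Fin F) (j : Fin L)

theorem zv_mul_prof (l : Fin F → ℤ) : zv k p i j * weightProj k prof l =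
    weightProj k prof (l + Pi.single i 1) * zv k p i j := by
  have h := ((shifts_zv (k := k) 1 p i j).comp (rowSum F L) 0).mul_weightProj l
  simp only [add_zero, ← prof_eq, rowSum_single] at h
  rwa [show varWt 1 p = 1 by cases p <;> rfl] at h

theorem dv_mul_prof (l : Fin F → ℤ) : dv k p i j * weightProj k prof l =
    weightProj k prof (l - Pi.single i 1) * dv k p i j := by
  have h := ((shifts_dv (k := k) 1 p i j).comp (rowSum F L) 0).mul_weightProj l
  simp only [add_zero, ← prof_eq, map_neg, rowSum_single, ← sub_eq_add_neg] at h
  rwa [show varWt 1 p = 1 by cases p <;> rfl] at h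

theorem zv_mul_pwt (l : Fin L → ℤ) : zv k p i j * weightProj k pwt l =
    weightProj k pwt (l + Pi.single j (varWt (-1) p)) * zv k p i j := by
  have h := ((shifts_zv (k := k) (-1) p i j).comp (colSum F L) 0).mul_weightProj l
  simpa only [add_zero, ← pwt_eq, colSum_single] using h

theorem dv_mul_pwt (l : Fin L → ℤ) : dv k p i j * weightProj k pwt l =
    weightProj k pwt (l - Pi.single j (varWt (-1) p)) * dv k p i j := by
  have h := ((shifts_dv (k := k) (-1) p i j).comp (colSum F L) 0).mul_weightProj l
  simpa only [add_zero, ← pwt_eq, map_neg, colSum_single, ← sub_eq_add_neg] using h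

end Shifts

theorem weightProj_neg_prof (l : Fin F → ℤ) :
    weightProj k (fun b : MonB F L => -prof b) l = weightProj k prof (-l) := by
  rw [weightProj, weightProj]
  simp only [neg_eq_iff_eq_neg]

theorem weightProj_pwt_add (l a : Fin L → ℤ) :
    weightProj k (fun b : MonB F L => pwt b + a) l = weightProj k pwt (l - a) := by
  rw [weightProj, weightProj]
  simp only [eq_sub_iff_add_eq]

theorem mul_weightProj_of_bvec {I : Type*} [DecidableEq I] {w : MonB F L → I} {x : Module.End k (SM k F L)}
    {c : I → k} (h : ∀ b, x (bvec k F L b) = c (w b) • bvec k F L b) (l : I) :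
    x * weightProj k w l = c l • weightProj k w l := by
  refine end_ext_bvec fun b => ?_
  rw [Module.End.mul_apply, LinearMap.smul_apply, weightProj_bvec]
  split_ifs with hb
  · rw [h, hb]
  · rw [map_zero, smul_zero]

theorem weightProj_apply_of_unique {I : Type*} [DecidableEq I] {w : MonB F L → I} {l : I} {b0 : MonB F L}
    (h : ∀ b, w b = l ↔ b = b0) (u : SM k F L) :
    weightProj k w l u = u b0 • bvec k F L b0 := by
  ext b
  rw [weightProj_apply, Finsupp.smul_apply, bvec, Finsupp.single_apply]
  simp only [h, eq_comm (a := b0)]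
  split_ifs with hb
  · rw [hb, smul_eq_mul, mul_one]
  · rw [smul_zero]

theorem weightProj_eq_zero {I : Type*} [DecidableEq I] {w : MonB F L → I} {l : I}
    (h : ∀ b, w b ≠ l) : weightProj k w l = 0 := by
  refine end_ext_bvec fun b => ?_
  rw [weightProj_bvec, if_neg (h b), LinearMap.zero_apply]

theorem prof_apply (b : MonB F L) (i : Fin F) :
    prof b i = ((∑ j, (b.1 (i, j) + if b.2 (i, j) then 1 else 0) : ℕ) : ℤ) := by
  rw [prof, Finset.card_filter, Finset.sum_add_distrib]
  push_cast
  rfl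

theorem pwt_add_apply (b : MonB F L) (j : Fin L) :
    pwt b j + F = ((∑ i, (b.1 (i, j) + if b.2 (i, j) then 0 else 1) : ℕ) : ℤ) := by
  have h : (∑ i : Fin F, (if b.2 (i, j) = true then 0 else 1)) +
      (∑ i : Fin F, if b.2 (i, j) = true then 1 else 0) = F := by
    rw [← Finset.sum_add_distrib]
    refine (Finset.sum_congr rfl fun i _ => show _ = 1 by split_ifs <;> rfl).trans ?_
    simp
  rw [pwt, Finset.card_filter, Finset.sum_add_distrib, Nat.cast_add, ← Nat.cast_sum]
  omega

theorem prof_eq_zero_iff (b : MonB F L) :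
    prof b = 0 ↔ b = (fun _ => 0, fun _ => false) := by
  constructor
  · intro h
    have : ∀ i j, b.1 (i, j) + (if b.2 (i, j) then 1 else 0) = 0 := fun i j => by
      have := congrFun h i
      rw [prof_apply, Pi.zero_apply, Nat.cast_eq_zero, Finset.sum_eq_zero_iff] at this
      exact this j (Finset.mem_univ _)
    refine Prod.ext (funext fun p => ?_) (funext fun p => ?_)
    · exact (Nat.add_eq_zero_iff.1 (this p.1 p.2)).1
    · simpa using (Nat.add_eq_zero_iff.1 (this p.1 p.2)).2
  · rintro rfl
    funext i
    simp [prof_apply]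

theorem pwt_add_eq_zero_iff (b : MonB F L) :
    (pwt b + fun _ => (F : ℤ)) = 0 ↔ b = (fun _ => 0, fun _ => true) := by
  constructor
  · intro h
    have : ∀ i j, b.1 (i, j) + (if b.2 (i, j) then 0 else 1) = 0 := fun i j => by
      have := congrFun h j
      rw [Pi.add_apply, pwt_add_apply, Pi.zero_apply, Nat.cast_eq_zero,
        Finset.sum_eq_zero_iff] at this
      exact this i (Finset.mem_univ _)
    refine Prod.ext (funext fun p => ?_) (funext fun p => ?_)
    · exact (Nat.add_eq_zero_iff.1 (this p.1 p.2)).1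
    · simpa using (Nat.add_eq_zero_iff.1 (this p.1 p.2)).2
  · rintro rfl
    funext i
    rw [Pi.add_apply, pwt_add_apply]
    simp

end PolynomialDuality

section HoweDuality

variable {k : Type} [Field k] {m n : ℕ}

/-- The Fock structure on the polynomial superalgebra with columns indexed by the tensor
factors. -/
noncomputable abbrev stdFock (k : Type) [Field k] (m n : ℕ) :
    Fock (Module.End k (SM k m n)) (fun _ : Fin m => false) (Fin n) :=
  polyFock k fun _ => false

theorem stdFock_z (β : Bool) (j : Fin n) (i : Fin m) : (stdFock k m n).z β j i = zv k β i j := by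
  cases β <;> rfl

theorem stdFock_d (β : Bool) (j : Fin n) (i : Fin m) : (stdFock k m n).d β j i = dv k β i j := by
  cases β <;> rfl

theorem stdFock_isGraded : (stdFock k m n).IsGraded k (parityOp k m n) where
  ss := parityOp_mul_self
  z β j i := by rw [stdFock_z, Bool.xor_false]; exact hasParity_zv β i j
  d β j i := by rw [stdFock_d, Bool.xor_false]; exact hasParity_dv β i j

theorem stdFock_ra_bvec (j : Fin n) (b : MonB m n) :
    (stdFock k m n).ra j j (bvec k m n b) = (pwt b j : k) • bvec k m n b := by
  simp only [Fock.ra, Fock.eop, stdFock_z, stdFock_d]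
  rw [LinearMap.sub_apply, LinearMap.sum_apply, LinearMap.sum_apply, pwt, Finset.card_filter]
  push_cast
  rw [sub_smul, Finset.sum_smul, Finset.sum_smul]
  congr 1
  · exact Finset.sum_congr rfl fun i _ => zE_dE_bvec i j b
  · exact Finset.sum_congr rfl fun i _ => zO_dO_bvec i j b

theorem stdFock_ra_weightProj (j : Fin n) (l : Fin n → ℤ) :
    (stdFock k m n).ra j j * weightProj k pwt l = (l j : k) • weightProj k pwt l :=
  mul_weightProj_of_bvec (c := fun l => (l j : k)) (stdFock_ra_bvec j) l

theorem stdFock_cE_bvec (i : Fin m) (b : MonB m n) :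
    (stdFock k m n).cE i i (bvec k m n b) = (prof b i : k) • bvec k m n b := by
  rw [polyFock_cE_self, diagOp_bvec, prof_apply, Int.cast_natCast]

theorem bvec_ne_zero (b : MonB m n) : bvec k m n b ≠ 0 :=
  Finsupp.single_ne_zero.2 one_ne_zero

theorem exists_weightProj_eq {I : Type*} [DecidableEq I] {w : MonB m n → I} {l : I}
    {b0 : MonB m n} (h : ∀ b, w b = l ↔ b = b0) :
    ∃ φ : SM k m n →ₗ[k] k, ∀ u, weightProj k w l u = φ u • bvec k m n b0 :=
  ⟨Finsupp.lapply b0, weightProj_apply_of_unique h⟩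

theorem stdFock_isWeighted :
    (stdFock k m n).IsWeighted (parityOp k m n) (weightProj k prof) (vac k m n) where
  gr := stdFock_isGraded
  zP β j i l := by rw [stdFock_z, zv_mul_prof]
  dP β j i l := by rw [stdFock_d, dv_mul_prof]
  neg l i hl := weightProj_eq_zero fun b hb => by
    have := congrFun hb i
    rw [prof_apply] at this
    omega
  sP l p := twist_weightProj prof p l
  cEP i l := mul_weightProj_of_bvec (c := fun l => (l i : k)) (stdFock_cE_bvec i) l
  vac := exists_weightProj_eq prof_eq_zero_iff
  P_vac := by
    rw [vac, weightProj_bvec, if_pos ((prof_eq_zero_iff _).2 rfl)]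
  vac_ne := bvec_ne_zero _
  cyclic := sm_submodule_eq_top _ (Fock.mem_zSub_self _) fun p i j u hu => by
    rw [← stdFock_z]
    exact Fock.z_mem_zSub hu p j i

theorem stdFock_dual_isWeighted :
    (stdFock k m n).dual.IsWeighted (parityOp k m n)
      (weightProj k fun b => pwt b + fun _ => (m : ℤ)) (bvec k m n (fun _ => 0, fun _ => true)) where
  gr := stdFock_isGraded.dual
  zP β i j l := by
    rw [weightProj_pwt_add, weightProj_pwt_add, add_sub_right_comm]
    cases β
    · exact (dv_mul_pwt true i j _).trans (by simp [varWt, Pi.single_neg]; rfl)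
    · exact zv_mul_pwt false i j _
  dP β i j l := by
    rw [weightProj_pwt_add, weightProj_pwt_add, sub_right_comm]
    cases β
    · exact (zv_mul_pwt true i j _).trans (by simp [varWt, Pi.single_neg, sub_eq_add_neg]; rfl)
    · exact dv_mul_pwt false i j _
  neg l j hl := weightProj_eq_zero fun b hb => by
    have := congrFun hb j
    rw [Pi.add_apply, pwt_add_apply] at this
    omega
  sP l p := twist_weightProj _ p l
  cEP j l := mul_weightProj_of_bvec (c := fun l => (l j : k)) (fun b => by
    rw [Fock.dual_cE, if_pos rfl, Fintype.card_fin, LinearMap.add_apply, stdFock_ra_bvec,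
      Module.End.natCast_apply, Pi.add_apply, Int.cast_add, add_smul, Int.cast_natCast,
      Nat.cast_smul_eq_nsmul]) l
  vac := exists_weightProj_eq pwt_add_eq_zero_iff
  P_vac := by rw [weightProj_bvec, if_pos ((pwt_add_eq_zero_iff _).2 rfl)]
  vac_ne := bvec_ne_zero _
  cyclic := sm_submodule_eq_top_of_full _ (Fock.mem_zSub_self _)
    (fun i j u hu => Fock.z_mem_zSub hu true i j) (fun i j u hu => Fock.z_mem_zSub hu false i j)

theorem stdFock_isTorus : (stdFock k m n).IsTorus (weightProj k pwt) (0 : k) :=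
  Fock.IsRowGraded.isTorus
    { z := fun β j i l => by rw [stdFock_z, zv_mul_pwt]
      d := fun β j i l => by rw [stdFock_d, dv_mul_pwt] }
    (weightProj_mul pwt) fun j l => by rw [add_zero, stdFock_ra_weightProj]

theorem stdFock_dual_isTorus :
    (stdFock k m n).dual.IsTorus (weightProj k fun b => -prof b) (n : k) :=
  Fock.IsRowGraded.isTorus
    { z := fun β i j l => by
        rw [weightProj_neg_prof, weightProj_neg_prof, neg_add']
        cases β
        · exact dv_mul_prof true i j _
        · exact (zv_mul_prof false i j _).trans (by simp [varWt, Pi.single_neg]; rfl)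
      d := fun β i j l => by
        rw [weightProj_neg_prof, weightProj_neg_prof, neg_sub', sub_neg_eq_add]
        cases β
        · exact zv_mul_prof true i j _
        · exact (dv_mul_prof false i j _).trans (by simp [varWt, Pi.single_neg, sub_eq_add_neg]; rfl) }
    (weightProj_mul _) fun i l => mul_weightProj_of_bvec (c := fun l => (l i : k) + n) (fun b => by
      rw [Fock.dual_ra, if_pos rfl, Fintype.card_fin, LinearMap.sub_apply, stdFock_cE_bvec,
        Module.End.natCast_apply, Pi.neg_apply, Int.cast_neg, add_smul, Nat.cast_smul_eq_nsmul,
        neg_smul, neg_add_eq_sub]) l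

theorem stdFock_isDualPair [CharZero k] : (stdFock k m n).IsDualPair k (parityOp k m n) (weightProj k pwt)
    (weightProj k fun b => -prof b) where
  gr := stdFock_isGraded
  even l := twist_weightProj pwt true l
  even' l := twist_weightProj _ true l
  comm l l' := weightProj_comm _ _ l l'
  eop β β' i j l := by
    rw [weightProj_neg_prof]
    exact stdFock_isWeighted.eop_comm β β' i j _
  eop' β β' i j l := by
    have := (stdFock_dual_isWeighted (k := k) (m := m) (n := n)).eop_comm β β' i j (l + fun _ => (m : ℤ))
    rwa [weightProj_pwt_add, add_sub_cancel_right] at this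

end HoweDuality

section HoweDuality

variable {k : Type} [Field k] {m n : ℕ}


/-- The image of the locally unital algebra attached to the rows. -/
noncomputable abbrev rowImage (k : Type) [Field k] (m n : ℕ) : Submodule k (Module.End k (SM k m n)) :=
  locSpan (Fock.chev k (stdFock k m n) (weightProj k pwt)) (weightProj k pwt)

/-- The image of the locally unital algebra attached to the columns. -/
noncomputable abbrev colImage (k : Type) [Field k] (m n : ℕ) : Submodule k (Module.End k (SM k m n)) :=
  locSpan (Fock.chev k (stdFock k m n).dual (weightProj k fun b => -prof b))
    (weightProj k fun b => -prof b)

theorem rowImage_le : rowImage k m n ≤ (Fock.chev k (stdFock k m n) (weightProj k pwt)).toSubmodule :=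
  locSpan_le fun l => Fock.gen_mem_chev (.idem l)

theorem colImage_le : colImage k m n ≤
    (Fock.chev k (stdFock k m n).dual (weightProj k fun b => -prof b)).toSubmodule :=
  locSpan_le fun l => Fock.gen_mem_chev (.idem l)

theorem finite_neg_prof (l : Fin m → ℤ) : {b : MonB m n | -prof b = l}.Finite := by
  simpa only [neg_eq_iff_eq_neg] using finite_prof (-l)

theorem finite_range_of_mem_colImage {f : Module.End k (SM k m n)} (hf : f ∈ colImage k m n) :
    Module.Finite k (LinearMap.range f) := by
  have h := fun l => finite_range_weightProj (k := k) (fun b : MonB m n => -prof b) (finite_neg_prof l)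
  exact finite_range_locSpan (M := SM k m n) h hf

theorem finite_range_of_mem_rowImage {f : Module.End k (SM k m n)} (hf : f ∈ rowImage k m n) :
    Module.Finite k (LinearMap.range f) := by
  have h := fun l => finite_range_weightProj (k := k) (pwt (m := m) (n := n)) (finite_pwt l)
  exact finite_range_locSpan (M := SM k m n) h hf

theorem projW_eq_weightProj (l : Fin n → ℤ) : projW k m n l = weightProj k pwt l :=
  end_ext_bvec fun b => by rw [projW, opOf_bvec, weightProj_bvec]

theorem projP_eq_weightProj (l : Fin m → ℤ) : projP k m n l = weightProj k prof l :=
  end_ext_bvec fun b => by rw [projP, opOf_bvec, weightProj_bvec]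

theorem opB_eq_rb {i j : Fin n} (h : i ≠ j) : opB k m n i j = (stdFock k m n).rb i j := by
  rw [opB, if_neg h]; rfl

theorem mem_of_ite_sub_mul {B : Type*} [Ring B] [Algebra k B] {S : Submodule k B} {p : Prop}
    [Decidable p] {N : ℕ} {x y : B} (hy : y ∈ S) (h : ((if p then (N : B) else 0) - x) * y ∈ S) :
    x * y ∈ S := by
  have h' : (if p then (N : B) else 0) * y ∈ S := by
    split_ifs
    · rw [← nsmul_eq_mul]; exact S.nsmul_mem hy N
    · rw [zero_mul]; exact S.zero_mem
  have := S.sub_mem h' h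
  rwa [← sub_mul, sub_sub_cancel] at this

theorem add_ite_mul_mem {B : Type*} [Ring B] [Algebra k B] {S : Submodule k B} {p : Prop}
    [Decidable p] {N : ℕ} {x y : B} (hy : y ∈ S) (h : x * y ∈ S) :
    (x + if p then (N : B) else 0) * y ∈ S := by
  rw [add_mul]
  refine S.add_mem h ?_
  split_ifs
  · rw [← nsmul_eq_mul]; exact S.nsmul_mem hy N
  · rw [zero_mul]; exact S.zero_mem

variable [CharZero k]

theorem rowImage_isGenerated :
    (stdFock k m n).IsGenerated (weightProj k pwt) (rowImage k m n) :=
  stdFock_isTorus.isGenerated_chev two_ne_zero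

theorem colImage_isGenerated :
    (stdFock k m n).dual.IsGenerated (weightProj k fun b => -prof b) (colImage k m n) :=
  stdFock_dual_isTorus.isGenerated_chev two_ne_zero

theorem rowImage_hasRows : (stdFock k m n).HasRows (weightProj k pwt) (rowImage k m n) where
  idem := rowImage_isGenerated.idem
  ra := rowImage_isGenerated.ra_mem stdFock_isTorus
  rb := rowImage_isGenerated.rb_mem stdFock_isTorus two_ne_zero
  rc := rowImage_isGenerated.rc_mem stdFock_isTorus

theorem colImage_hasRows :
    (stdFock k m n).dual.HasRows (weightProj k fun b => -prof b) (colImage k m n) where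
  idem := colImage_isGenerated.idem
  ra := colImage_isGenerated.ra_mem stdFock_dual_isTorus
  rb := colImage_isGenerated.rb_mem stdFock_dual_isTorus two_ne_zero
  rc := colImage_isGenerated.rc_mem stdFock_dual_isTorus

theorem colImage_isColumnClosed :
    (stdFock k m n).IsColumnClosed (weightProj k prof) (colImage k m n) := by
  have hw : ∀ l : Fin m → ℤ, weightProj k (prof (n := n)) l = weightProj k (fun b => -prof b) (-l) :=
    fun l => by rw [weightProj_neg_prof, neg_neg]
  have h := colImage_hasRows (k := k) (m := m) (n := n)
  refine ⟨colImage_isGenerated.mul, fun x hx => twist_mem_locSpan (parityOp_mul_self (k := k) (F := m) (L := n))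
    (stdFock_isDualPair (k := k) (m := m) (n := n)).twist_mem_chev_dual (twist_weightProj _ true) hx, fun l => ?_,
    fun a b l => ?_, fun a b l => ?_, fun a b l => ?_⟩
  · rw [hw]; exact h.idem _
  · rw [hw]
    refine mem_of_ite_sub_mul (p := b = a) (N := Fintype.card (Fin n)) (h.idem _) ?_
    rw [← Fock.dual_ra]
    exact h.ra b a _
  · rw [hw, ← Fock.dual_rc]; exact h.rc a b _
  · rw [hw, ← Fock.dual_rb]; exact h.rb a b _

theorem rowImage_isColumnClosed :
    (stdFock k m n).dual.IsColumnClosed (weightProj k fun b => pwt b + fun _ => (m : ℤ))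
      (rowImage k m n) := by
  have h := rowImage_hasRows (k := k) (m := m) (n := n)
  refine ⟨rowImage_isGenerated.mul, fun x hx => twist_mem_locSpan (parityOp_mul_self (k := k) (F := m) (L := n))
    (stdFock_isDualPair (k := k) (m := m) (n := n)).twist_mem_chev (twist_weightProj _ true) hx, fun l => ?_,
    fun a b l => ?_, fun a b l => ?_, fun a b l => ?_⟩ <;> rw [weightProj_pwt_add]
  · exact h.idem _
  · rw [Fock.dual_cE]
    exact add_ite_mul_mem (h.idem _) (h.ra a b _)
  · rw [Fock.dual_cq]; exact h.rb a b _
  · rw [Fock.dual_ck]; exact h.rc a b _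

theorem colImage_eq_centralizer : (colImage k m n : Set (Module.End k (SM k m n))) =
    {f | f ∈ EndFin k m n ∧ ∀ g ∈ rowImage k m n, sbrk k m n g f = 0} := by
  have hfin : ∀ f ∈ colImage k m n, f ∈ EndFin k m n := fun f hf =>
    finite_range_of_mem_colImage hf
  have hcomm : ∀ g ∈ rowImage k m n, ∀ f ∈ colImage k m n, sbrk k m n g f = 0 := fun g hg f hf =>
    (stdFock_isDualPair.superComm (rowImage_le hg) (colImage_le hf)).1.sbrk
  exact Fock.IsWeighted.centralizer_eq stdFock_isWeighted finite_pwt colImage_isColumnClosed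
    rowImage_hasRows hfin hcomm

theorem rowImage_eq_centralizer : (rowImage k m n : Set (Module.End k (SM k m n))) =
    {f | f ∈ EndFin k m n ∧ ∀ g ∈ colImage k m n, sbrk k m n g f = 0} := by
  have hfin : ∀ f ∈ rowImage k m n, f ∈ EndFin k m n := fun f hf =>
    finite_range_of_mem_rowImage hf
  have hcomm : ∀ g ∈ colImage k m n, ∀ f ∈ rowImage k m n, sbrk k m n g f = 0 := fun g hg f hf =>
    (stdFock_isDualPair.superComm (rowImage_le hf) (colImage_le hg)).2.sbrk
  exact Fock.IsWeighted.centralizer_eq stdFock_dual_isWeighted finite_neg_prof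
    rowImage_isColumnClosed colImage_hasRows hfin hcomm

theorem opB_self (i : Fin n) : opB k m n i i = (2⁻¹ : k) • (stdFock k m n).rb i i := by
  have h : (stdFock k m n).rb i i = (2 : k) • EEop k m n (Sum.inl i) (Sum.inr i) := by
    rw [two_smul]; rfl
  rw [opB, if_pos rfl, h, smul_smul, inv_mul_cancel₀ two_ne_zero, one_smul]

theorem natPnAction_actU : NatPnAction k m n (stdFock_isTorus.actU two_ne_zero) := by
  have hB : ∀ i, pnB k m n i = Fock.nbr (stdFock k m n).rb i := fun i => by
    rw [pnB, Fock.nbr]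
    refine dite_congr rfl (fun h => opB_eq_rb ?_) fun _ => rfl
    rw [Ne, Fin.mk.injEq]
    omega
  have hB11 : pnB11 k m n = (Fock.opsU k (stdFock k m n) (weightProj k pwt)).B11 :=
    dite_congr rfl (fun h => opB_self _) fun _ => rfl
  refine ⟨fun l => ?_, fun i l => ?_, fun i l => ?_, fun l => ?_, fun i l => ?_, fun i l => ?_⟩ <;>
    rw [Fock.IsTorus.actU_mk, projW_eq_weightProj]
  · exact GenOps.hom_iId _ _
  · exact GenOps.hom_ι _ _
  · exact GenOps.hom_ι _ _
  · rw [hB11]; exact GenOps.hom_ι _ _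
  · rw [hB]; exact GenOps.hom_ι _ _
  · exact GenOps.hom_ι _ _

end HoweDuality

/-- for every `m, n ≥ 1` there are commuting actions of the
locally unital superalgebras `U̇(p̃(m))` and `U̇(p(n))` on `A = S(V_n)^{⊗m}`,
where `U̇(p(n))` acts through the natural `p(n)`-action; the induced
homomorphisms `ρ̃ : U̇(p̃(m)) → End^fin_k(A)` and `ρ : U̇(p(n)) → End^fin_k(A)`
have mutually centralizing images: the image of each equals the graded
centralizer of the image of the other inside `End^fin_k(A)`. -/
theorem statement12 (k : Type) [Field k] [CharZero k] [IsAlgClosed k]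
    (m n : ℕ) (hm : 1 ≤ m) (hn : 1 ≤ n) :
    ∃ (Ψm : Udt k m →ₐ[k] Module.End k (SM k m n))
      (Ψn : Udu k n →ₐ[k] Module.End k (SM k m n)),
      -- U̇(p(n)) acts naturally
      NatPnAction k m n Ψn ∧
      -- the weight idempotents of U̇(p̃(m)) act by the S^λ-projections
      (∀ l : Fin m → ℤ, Ψm (mkDt k m (iId k m l)) = projP k m n l) ∧
      -- the two actions commute in the graded sense
      (∀ (u : Udt k m) (v : Udu k n), sbrk k m n (Ψm u) (Ψn v) = 0) ∧
      -- the images are mutually centralizing inside End^fin(A)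
      ((Submodule.map Ψm.toLinearMap (locT k m) : Set (Module.End k (SM k m n)))
        = {f | f ∈ EndFin k m n ∧
            ∀ g ∈ Submodule.map Ψn.toLinearMap (locU k n), sbrk k m n g f = 0}) ∧
      ((Submodule.map Ψn.toLinearMap (locU k n) : Set (Module.End k (SM k m n)))
        = {f | f ∈ EndFin k m n ∧
            ∀ g ∈ Submodule.map Ψm.toLinearMap (locT k m), sbrk k m n g f = 0}) := by
  have h2 : (2 : k) ≠ 0 := two_ne_zero
  have hT : Submodule.map (stdFock_dual_isTorus.actT h2).toLinearMap (locT k m) = colImage k m n :=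
    stdFock_dual_isTorus.map_locT h2
  have hU : Submodule.map (stdFock_isTorus.actU h2).toLinearMap (locU k n) = rowImage k m n :=
    stdFock_isTorus.map_locU h2
  refine ⟨stdFock_dual_isTorus.actT h2, stdFock_isTorus.actU h2, natPnAction_actU, fun l => ?_,
    fun u v => ?_, ?_, ?_⟩
  · rw [Fock.IsTorus.actT_mk, GenOps.hom_iId, projP_eq_weightProj]
    exact (weightProj_neg_prof (-l)).trans (by rw [neg_neg])
  · have hu : stdFock_dual_isTorus.actT h2 u ∈ _ :=
      (stdFock_dual_isTorus (k := k) (m := m) (n := n)).range_actT h2 ▸ AlgHom.mem_range_self _ u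
    have hv : stdFock_isTorus.actU h2 v ∈ _ :=
      (stdFock_isTorus (k := k) (m := m) (n := n)).range_actU h2 ▸ AlgHom.mem_range_self _ v
    exact (stdFock_isDualPair.superComm hv hu).2.sbrk
  · rw [hT, hU]
    exact colImage_eq_centralizer
  · rw [hT, hU]
    exact rowImage_eq_centralizer
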